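/- Let n and m be integers with n > 2m+1 ≥ 3. Let U ∈ W^{m+1,2}(ℝ^{n+1}_+) be smooth up to the boundary, set f(x) = U(x,0), and suppose U satisfies: Δ^k U(x,0) = [Γ(m+1)Γ(m+1/2−k)/(Γ(m−k+1)Γ(m+1/2))] Δ_x^k f(x) for all x ∈ ℝⁿ and 0 ≤ k ≤ ⌊m/2⌋, and ∂_y Δ^k U(x,0) = 0 for all x ∈ ℝⁿ and 0 ≤ k ≤ ⌊(m−1)/2⌋. Then [Γ(m+1)Γ(1/2)/Γ(m+1/2)] · [Γ((n+2m+1)/2)/Γ((n−2m−1)/2)] · ω_n^{(2m+1)/n} · (∫_{ℝⁿ} |U(x,0)|^{2n/(n−2m−1)} dx)^{(n−2m−1)/n} ≤ ∫_{ℝ^{n+1}_+} |∇^{m+1} U|² dx dy. Moreover, equality holds if and only if U(x,y) = c ∫_{ℝⁿ} y^{1+2m} (|x−ξ|² + y²)^{−((n+1)/2+m)} (λ² + |ξ−ξ₀|²)^{−(n−2m−1)/2} dξ for some λ > 0, some constant c, and some point ξ₀ ∈ ℝⁿ. -/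

import Mathlib

open MeasureTheory Real Filter
open scoped Real BigOperators Nat Topology

noncomputable section

abbrev Euc (d : ℕ) := EuclideanSpace ℝ (Fin d)

/-- Euclidean Laplacian of a scalar function on `ℝ^d`. -/
def lap {d : ℕ} (f : Euc d → ℝ) (x : Euc d) : ℝ :=
  ∑ i : Fin d, iteratedFDeriv ℝ 2 f x (fun _ => EuclideanSpace.single i 1)

/-- Iterated Laplacian `Δ^k` on `ℝ^d`. -/
def lapIter {d : ℕ} (k : ℕ) (f : Euc d → ℝ) : Euc d → ℝ := lap^[k] f

/-- Laplacian in the `x`-variable of a function on `ℝⁿ × ℝ`. -/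
def lapX {n : ℕ} (U : Euc n → ℝ → ℝ) : Euc n → ℝ → ℝ :=
  fun x y => lap (fun x' => U x' y) x

/-- Iterated Laplacian `Δ_x^k` in the `x`-variable. -/
def lapXIter {n : ℕ} (k : ℕ) (U : Euc n → ℝ → ℝ) : Euc n → ℝ → ℝ := lapX^[k] U

/-- Full Laplacian `Δ = Δ_x + ∂_y²` on the half-space `ℝⁿ × ℝ₊`. -/
def lapH {n : ℕ} (U : Euc n → ℝ → ℝ) : Euc n → ℝ → ℝ :=
  fun x y => lapX U x y + iteratedDeriv 2 (fun t => U x t) y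

/-- Iterated full Laplacian `Δ^k` on the half-space. -/
def lapHIter {n : ℕ} (k : ℕ) (U : Euc n → ℝ → ℝ) : Euc n → ℝ → ℝ := lapH^[k] U

/-- `|∇^{m+1} U|²` on the half-space: the square of `Δ^{(m+1)/2} U` if `m` is odd,
and `|∇_x Δ^{m/2} U|² + |∂_y Δ^{m/2} U|²` if `m` is even. -/
def gradPowH {n : ℕ} (m : ℕ) (U : Euc n → ℝ → ℝ) (x : Euc n) (y : ℝ) : ℝ :=
  if Odd m then (lapHIter ((m + 1) / 2) U x y) ^ 2
  else ‖gradient (fun x' => lapHIter (m / 2) U x' y) x‖ ^ 2 +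
    (deriv (fun t => lapHIter (m / 2) U x t) y) ^ 2

/-- Volume of the unit sphere `𝕊ⁿ ⊆ ℝ^{n+1}`. -/
def omegaN (n : ℕ) : ℝ := 2 * π ^ (((n : ℝ) + 1) / 2) / Gamma (((n : ℝ) + 1) / 2)

/-- The open upper half-space `ℝ^{n+1}_+`. -/
def upperHS (n : ℕ) : Set (Euc n × ℝ) := {p | 0 < p.2}

/-! ### Radial integrals and the non-sharp HLS inequality -/

section Radial
variable {E : Type*} [NormedAddCommGroup E] [NormedSpace ℝ E] [FiniteDimensional ℝ E]
  [MeasurableSpace E] [BorelSpace E] (μ : Measure E) [μ.IsAddHaarMeasure]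

lemma lintegral_comp_smul_pos (f : E → ENNReal) {R : ℝ} (hR : 0 < R) :
    ∫⁻ x, f x ∂μ = ENNReal.ofReal (R ^ (Module.finrank ℝ E : ℝ)) * ∫⁻ x, f (R • x) ∂μ := by
  let e : E ≃ᵐ E := (Homeomorph.smul (Units.mk0 R hR.ne')).toMeasurableEquiv
  have h1 : ∫⁻ x, f (R • x) ∂μ = ∫⁻ x, f x ∂(Measure.map (R • ·) μ) :=
    (lintegral_map_equiv f e).symm
  have hp : 0 < R ^ Module.finrank ℝ E := pow_pos hR _
  rw [h1, Measure.map_addHaar_smul μ hR.ne', lintegral_smul_measure, smul_eq_mul, ← mul_assoc,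
    rpow_natCast, abs_of_pos (inv_pos.2 hp), ← ENNReal.ofReal_mul hp.le, mul_inv_cancel₀ hp.ne']
  simp

lemma radial_near (hd : 1 ≤ Module.finrank ℝ E) {s : ℝ} (hs : s < Module.finrank ℝ E) :
    ∃ c : ℝ, 0 ≤ c ∧ ∀ R : ℝ, 0 < R →
      ∫⁻ z in Metric.ball (0 : E) R, ENNReal.ofReal (‖z‖ ^ (-s)) ∂μ
        ≤ ENNReal.ofReal (c * R ^ ((Module.finrank ℝ E : ℝ) - s)) := by
  have hint : IntegrableOn (fun z : E => ‖z‖ ^ (-s)) (Metric.ball 0 1) μ := by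
    refine integrableOn_ball_of_norm_le_rpow (C := 1) hd hs (Eventually.of_forall fun x => ?_)
      (Measurable.aestronglyMeasurable (by fun_prop))
    rw [one_mul, norm_of_nonneg (by positivity)]
  have hfin : ∫⁻ z in Metric.ball (0 : E) 1, ENNReal.ofReal (‖z‖ ^ (-s)) ∂μ ≠ ⊤ :=
    hint.lintegral_lt_top.ne
  refine ⟨(∫⁻ z in Metric.ball (0 : E) 1, ENNReal.ofReal (‖z‖ ^ (-s)) ∂μ).toReal,
    ENNReal.toReal_nonneg, fun R hR => ?_⟩
  rw [ENNReal.ofReal_mul ENNReal.toReal_nonneg, ENNReal.ofReal_toReal hfin]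
  rw [← lintegral_indicator Metric.isOpen_ball.measurableSet,
    ← lintegral_indicator Metric.isOpen_ball.measurableSet, lintegral_comp_smul_pos μ _ hR]
  have : ∀ z : E, (Metric.ball (0 : E) R).indicator (fun z => ENNReal.ofReal (‖z‖ ^ (-s))) (R • z)
      = ENNReal.ofReal (R ^ (-s)) *
        (Metric.ball (0 : E) 1).indicator (fun z => ENNReal.ofReal (‖z‖ ^ (-s))) z := by
    intro z
    have hz : R • z ∈ Metric.ball (0 : E) R ↔ z ∈ Metric.ball (0 : E) 1 := by
      simp [norm_smul, abs_of_pos hR, hR]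
    by_cases h : z ∈ Metric.ball (0 : E) 1
    · rw [Set.indicator_of_mem h, Set.indicator_of_mem (hz.2 h), ← ENNReal.ofReal_mul (by positivity),
        norm_smul, norm_of_nonneg hR.le, mul_rpow hR.le (norm_nonneg _)]
    · rw [Set.indicator_of_notMem h, Set.indicator_of_notMem (fun h' => h (hz.1 h')), mul_zero]
  simp only [this]
  rw [lintegral_const_mul' _ _ ENNReal.ofReal_ne_top, ← mul_assoc,
    ← ENNReal.ofReal_mul (by positivity), ← rpow_add hR, mul_comm, sub_eq_add_neg]

lemma radial_far {s : ℝ} (hs : (Module.finrank ℝ E : ℝ) < s) :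
    ∃ c : ℝ, 0 ≤ c ∧ ∀ R : ℝ, 0 < R →
      ∫⁻ z in (Metric.ball (0 : E) R)ᶜ, ENNReal.ofReal (‖z‖ ^ (-s)) ∂μ
        ≤ ENNReal.ofReal (c * R ^ ((Module.finrank ℝ E : ℝ) - s)) := by
  have hs0 : 0 < s := lt_of_le_of_lt (by positivity) hs
  have hint : IntegrableOn (fun z : E => ‖z‖ ^ (-s)) (Metric.ball 0 1)ᶜ μ := by
    refine Integrable.mono' (((integrable_one_add_norm (μ := μ) hs).const_mul (2 ^ s)).integrableOn)
      (Measurable.aestronglyMeasurable (by fun_prop)) ?_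
    refine (ae_restrict_iff' Metric.isOpen_ball.measurableSet.compl).2 (Eventually.of_forall fun z hz => ?_)
    have h1 : 1 ≤ ‖z‖ := by simpa using hz
    rw [norm_of_nonneg (by positivity)]
    have h2 : (1 + ‖z‖) / 2 ≤ ‖z‖ := by linarith
    refine (rpow_le_rpow_of_nonpos (by positivity) h2 (by linarith)).trans (le_of_eq ?_)
    rw [div_rpow (by positivity) (by norm_num), rpow_neg (by norm_num : (0:ℝ) ≤ 2)]
    field_simp
  have hfin : ∫⁻ z in (Metric.ball (0 : E) 1)ᶜ, ENNReal.ofReal (‖z‖ ^ (-s)) ∂μ ≠ ⊤ :=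
    hint.lintegral_lt_top.ne
  refine ⟨(∫⁻ z in (Metric.ball (0 : E) 1)ᶜ, ENNReal.ofReal (‖z‖ ^ (-s)) ∂μ).toReal,
    ENNReal.toReal_nonneg, fun R hR => ?_⟩
  rw [ENNReal.ofReal_mul ENNReal.toReal_nonneg, ENNReal.ofReal_toReal hfin]
  rw [← lintegral_indicator Metric.isOpen_ball.measurableSet.compl,
    ← lintegral_indicator Metric.isOpen_ball.measurableSet.compl, lintegral_comp_smul_pos μ _ hR]
  have : ∀ z : E, (Metric.ball (0 : E) R)ᶜ.indicator (fun z => ENNReal.ofReal (‖z‖ ^ (-s))) (R • z)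
      = ENNReal.ofReal (R ^ (-s)) *
        (Metric.ball (0 : E) 1)ᶜ.indicator (fun z => ENNReal.ofReal (‖z‖ ^ (-s))) z := by
    intro z
    have hz : R • z ∈ (Metric.ball (0 : E) R)ᶜ ↔ z ∈ (Metric.ball (0 : E) 1)ᶜ := by
      simp [norm_smul, abs_of_pos hR, hR]
    by_cases h : z ∈ (Metric.ball (0 : E) 1)ᶜ
    · rw [Set.indicator_of_mem h, Set.indicator_of_mem (hz.2 h), ← ENNReal.ofReal_mul (by positivity),
        norm_smul, norm_of_nonneg hR.le, mul_rpow hR.le (norm_nonneg _)]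
    · rw [Set.indicator_of_notMem h, Set.indicator_of_notMem (fun h' => h (hz.1 h')), mul_zero]
  simp only [this]
  rw [lintegral_const_mul' _ _ ENNReal.ofReal_ne_top, ← mul_assoc,
    ← ENNReal.ofReal_mul (by positivity), ← rpow_add hR, mul_comm, sub_eq_add_neg]

theorem hls_nonsharp (hd : 1 ≤ Module.finrank ℝ E) {lam q : ℝ} (hlam : 0 < lam)
    (hlam' : lam < Module.finrank ℝ E)
    (hq : q = 2 * (Module.finrank ℝ E : ℝ) / (2 * (Module.finrank ℝ E : ℝ) - lam)) :
    ∃ C : ℝ, 0 ≤ C ∧ ∀ F : E → ℝ, Measurable F → (∀ x, 0 ≤ F x) →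
      ∫⁻ x, ENNReal.ofReal (F x ^ q) ∂μ ≤ 1 →
      ∫⁻ x, ∫⁻ y, ENNReal.ofReal (F x * F y * ‖x - y‖ ^ (-lam)) ∂μ ∂μ ≤ ENNReal.ofReal C := by
  set n : ℝ := (Module.finrank ℝ E : ℝ) with hn
  have hn0 : 0 < n := by linarith
  have h2n : 0 < 2 * n - lam := by linarith
  have hq1 : 1 < q := by rw [hq, lt_div_iff₀ h2n]; linarith
  have hqm : q - 1 = lam / (2 * n - lam) := by rw [hq]; field_simp; ring
  obtain ⟨c1, hc1, near⟩ := radial_near μ hd hlam'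
  obtain ⟨c2, hc2, far⟩ := radial_far μ (s := 2 * n) (E := E) (by linarith)
  have hpq : q.HolderConjugate (2 * n / lam) := by
    rw [Real.holderConjugate_iff]
    refine ⟨hq1, ?_⟩
    rw [hq]; field_simp; ring
  set C1 : ℝ := c1 + c2 ^ (lam / (2 * n)) with hC1
  have hC10 : 0 ≤ C1 := by positivity
  refine ⟨2 * C1, by positivity, fun F hF hF0 hFq => ?_⟩
  -- inner bound
  have inner : ∀ x, 0 < F x → ∫⁻ y in {y | F y ≤ F x}, ENNReal.ofReal (F y * ‖x - y‖ ^ (-lam)) ∂μ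
      ≤ ENNReal.ofReal (C1 * F x ^ (q - 1)) := by
    intro x hx
    set a := F x
    set R : ℝ := a ^ (-2 / (2 * n - lam)) with hR
    have hR0 : 0 < R := rpow_pos_of_pos hx _
    have split : ∫⁻ y in {y | F y ≤ a}, ENNReal.ofReal (F y * ‖x - y‖ ^ (-lam)) ∂μ
        ≤ ∫⁻ y in Metric.ball x R, ENNReal.ofReal (a * ‖x - y‖ ^ (-lam)) ∂μ
          + ∫⁻ y in (Metric.ball x R)ᶜ, ENNReal.ofReal (F y * ‖x - y‖ ^ (-lam)) ∂μ := by
      have hS : MeasurableSet {y | F y ≤ a} := hF measurableSet_Iic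
      rw [← lintegral_indicator hS, ← lintegral_indicator Metric.isOpen_ball.measurableSet,
        ← lintegral_indicator Metric.isOpen_ball.measurableSet.compl, ← lintegral_add_left]
      · refine lintegral_mono fun y => ?_
        by_cases hy : y ∈ Metric.ball x R
        · by_cases hy2 : y ∈ {y | F y ≤ a}
          · rw [Set.indicator_of_mem hy2, Set.indicator_of_mem hy]
            refine le_add_right (ENNReal.ofReal_le_ofReal ?_)
            exact mul_le_mul_of_nonneg_right hy2 (by positivity)
          · rw [Set.indicator_of_notMem hy2]; exact zero_le
        · rw [Set.indicator_of_mem (show y ∈ (Metric.ball x R)ᶜ from hy)]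
          exact le_add_left (Set.indicator_le_self' (fun _ _ => zero_le) y)
      · refine Measurable.indicator ?_ Metric.isOpen_ball.measurableSet
        fun_prop
    have translate_ball : ∀ (f : E → ENNReal),
        ∫⁻ y in Metric.ball x R, f (x - y) ∂μ = ∫⁻ y in Metric.ball (0 : E) R, f y ∂μ := by
      intro f
      rw [← lintegral_indicator Metric.isOpen_ball.measurableSet,
        ← lintegral_indicator Metric.isOpen_ball.measurableSet,
        ← lintegral_sub_left_eq_self (fun y => (Metric.ball (0 : E) R).indicator f y) x]
      refine lintegral_congr fun y => ?_
      have hm : x - y ∈ Metric.ball (0 : E) R ↔ y ∈ Metric.ball x R := by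
        simp [dist_eq_norm, norm_sub_rev]
      by_cases h : y ∈ Metric.ball x R
      · simp only [Set.indicator_of_mem h, Set.indicator_of_mem (hm.2 h)]
      · simp only [Set.indicator_of_notMem h, Set.indicator_of_notMem (fun h' => h (hm.1 h'))]
    have translate_compl : ∀ (f : E → ENNReal),
        ∫⁻ y in (Metric.ball x R)ᶜ, f (x - y) ∂μ = ∫⁻ y in (Metric.ball (0 : E) R)ᶜ, f y ∂μ := by
      intro f
      rw [← lintegral_indicator Metric.isOpen_ball.measurableSet.compl,
        ← lintegral_indicator Metric.isOpen_ball.measurableSet.compl,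
        ← lintegral_sub_left_eq_self (fun y => (Metric.ball (0 : E) R)ᶜ.indicator f y) x]
      refine lintegral_congr fun y => ?_
      have hm : x - y ∈ (Metric.ball (0 : E) R)ᶜ ↔ y ∈ (Metric.ball x R)ᶜ := by
        simp [dist_eq_norm, norm_sub_rev]
      by_cases h : y ∈ (Metric.ball x R)ᶜ
      · simp only [Set.indicator_of_mem h, Set.indicator_of_mem (hm.2 h)]
      · simp only [Set.indicator_of_notMem h, Set.indicator_of_notMem (fun h' => h (hm.1 h'))]
    have b1 : ∫⁻ y in Metric.ball x R, ENNReal.ofReal (a * ‖x - y‖ ^ (-lam)) ∂μ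
        ≤ ENNReal.ofReal (c1 * a ^ (q - 1)) := by
      rw [translate_ball (fun z => ENNReal.ofReal (a * ‖z‖ ^ (-lam)))]
      simp only [ENNReal.ofReal_mul hx.le]
      rw [lintegral_const_mul' _ _ ENNReal.ofReal_ne_top]
      refine (mul_le_mul_right (near R hR0) _).trans ?_
      rw [← ENNReal.ofReal_mul hx.le]
      refine ENNReal.ofReal_le_ofReal (le_of_eq ?_)
      have : a * R ^ (n - lam) = a ^ (q - 1) := by
        rw [hR, ← rpow_mul hx.le]
        nth_rewrite 1 [← rpow_one a]
        rw [← rpow_add hx, hqm]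
        congr 1
        field_simp
        ring
      rw [← this]; ring
    have b2 : ∫⁻ y in (Metric.ball x R)ᶜ, ENNReal.ofReal (F y * ‖x - y‖ ^ (-lam)) ∂μ
        ≤ ENNReal.ofReal (c2 ^ (lam / (2 * n)) * a ^ (q - 1)) := by
      simp only [ENNReal.ofReal_mul (hF0 _)]
      have hol := ENNReal.lintegral_mul_le_Lp_mul_Lq (μ.restrict (Metric.ball x R)ᶜ) hpq
        (f := fun y => ENNReal.ofReal (F y)) (g := fun y => ENNReal.ofReal (‖x - y‖ ^ (-lam)))
        (by fun_prop) (by fun_prop)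
      refine hol.trans ?_
      have f1 : (∫⁻ y in (Metric.ball x R)ᶜ, ENNReal.ofReal (F y) ^ q ∂μ) ^ (1 / q) ≤ 1 := by
        refine ENNReal.rpow_le_one ?_ (by positivity)
        refine (setLIntegral_le_lintegral _ _).trans (le_trans (le_of_eq ?_) hFq)
        refine lintegral_congr fun y => ?_
        rw [ENNReal.ofReal_rpow_of_nonneg (hF0 y) (by linarith)]
      have f2 : ∫⁻ y in (Metric.ball x R)ᶜ, ENNReal.ofReal (‖x - y‖ ^ (-lam)) ^ (2 * n / lam) ∂μ
          ≤ ENNReal.ofReal (c2 * R ^ (-n)) := by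
        rw [translate_compl (fun z => ENNReal.ofReal (‖z‖ ^ (-lam)) ^ (2 * n / lam))]
        refine le_trans (le_of_eq ?_) ((far R hR0).trans (le_of_eq ?_))
        · refine lintegral_congr fun z => ?_
          rw [ENNReal.ofReal_rpow_of_nonneg (by positivity) (by positivity), ← rpow_mul (norm_nonneg _)]
          congr 2
          field_simp
        · congr 2; congr 1; ring
      calc _ ≤ 1 * (ENNReal.ofReal (c2 * R ^ (-n))) ^ (1 / (2 * n / lam)) := by
            refine mul_le_mul' f1 (ENNReal.rpow_le_rpow f2 (by positivity))
        _ = _ := by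
            rw [one_mul, ENNReal.ofReal_rpow_of_nonneg (by positivity) (by positivity), one_div_div,
              mul_rpow hc2 (by positivity), ← rpow_mul hR0.le, hR, ← rpow_mul hx.le, hqm]
            congr 3
            field_simp
    calc _ ≤ _ := split
      _ ≤ _ := add_le_add b1 b2
      _ = _ := by
        rw [← ENNReal.ofReal_add (by positivity) (by positivity)]
        congr 1
        rw [hC1]; ring
  -- the main estimate
  have hmeas : Measurable fun p : E × E => ENNReal.ofReal (F p.1 * F p.2 * ‖p.1 - p.2‖ ^ (-lam)) := by
    fun_prop
  let H : E → E → ENNReal := fun x y =>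
    {p : E × E | F p.2 ≤ F p.1}.indicator
      (fun p : E × E => ENNReal.ofReal (F p.1 * F p.2 * ‖p.1 - p.2‖ ^ (-lam))) (x, y)
  have hHm : Measurable (Function.uncurry H) := by
    have : Function.uncurry H = {p : E × E | F p.2 ≤ F p.1}.indicator
      (fun p : E × E => ENNReal.ofReal (F p.1 * F p.2 * ‖p.1 - p.2‖ ^ (-lam))) := by
      ext ⟨x, y⟩; rfl
    rw [this]
    exact hmeas.indicator (measurableSet_le (by fun_prop) (by fun_prop))
  have hle : ∀ x y, ENNReal.ofReal (F x * F y * ‖x - y‖ ^ (-lam)) ≤ H x y + H y x := by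
    intro x y
    rcases le_total (F y) (F x) with h | h
    · refine le_add_right (le_of_eq ?_)
      simp only [H]
      rw [Set.indicator_of_mem (show (x, y) ∈ {p : E × E | F p.2 ≤ F p.1} from h)]
    · refine le_add_left (le_of_eq ?_)
      simp only [H]
      rw [Set.indicator_of_mem (show (y, x) ∈ {p : E × E | F p.2 ≤ F p.1} from h), norm_sub_rev,
        mul_comm (F x)]
  have hHbound : ∫⁻ x, ∫⁻ y, H x y ∂μ ∂μ ≤ ENNReal.ofReal C1 := by
    calc ∫⁻ x, ∫⁻ y, H x y ∂μ ∂μ ≤ ∫⁻ x, ENNReal.ofReal C1 * ENNReal.ofReal (F x ^ q) ∂μ := by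
          refine lintegral_mono fun x => ?_
          have e : ∀ y, H x y = ENNReal.ofReal (F x) * {y | F y ≤ F x}.indicator
              (fun y => ENNReal.ofReal (F y * ‖x - y‖ ^ (-lam))) y := by
            intro y
            simp only [H, Set.indicator_apply, Set.mem_ofPred_eq]
            split_ifs
            · rw [← ENNReal.ofReal_mul (hF0 x), mul_assoc]
            · simp
          simp only [e]
          have hS : MeasurableSet {y | F y ≤ F x} := hF measurableSet_Iic
          rw [lintegral_const_mul' _ _ ENNReal.ofReal_ne_top, lintegral_indicator hS]
          rcases (hF0 x).eq_or_lt with h0 | h0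
          · rw [← h0]; simp
          · refine (mul_le_mul_right (inner x h0) _).trans (le_of_eq ?_)
            rw [← ENNReal.ofReal_mul (hF0 x), ← ENNReal.ofReal_mul hC10]
            congr 1
            have : F x ^ q = F x * F x ^ (q - 1) := by
              nth_rewrite 2 [← rpow_one (F x)]
              rw [← rpow_add h0]; congr 1; ring
            rw [this]; ring
      _ = ENNReal.ofReal C1 * ∫⁻ x, ENNReal.ofReal (F x ^ q) ∂μ := by
          rw [lintegral_const_mul' _ _ ENNReal.ofReal_ne_top]
      _ ≤ ENNReal.ofReal C1 * 1 := mul_le_mul_right hFq _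
      _ = _ := mul_one _
  calc _ ≤ ∫⁻ x, ∫⁻ y, (H x y + H y x) ∂μ ∂μ :=
        lintegral_mono fun x => lintegral_mono fun y => hle x y
    _ = ∫⁻ x, ∫⁻ y, H x y ∂μ ∂μ + ∫⁻ x, ∫⁻ y, H y x ∂μ ∂μ := by
        have hm1 : Measurable (fun x => ∫⁻ y, H x y ∂μ) := hHm.lintegral_prod_right'
        rw [← lintegral_add_left hm1]
        refine lintegral_congr fun x => ?_
        rw [lintegral_add_left]
        exact hHm.of_uncurry_left
    _ = ∫⁻ x, ∫⁻ y, H x y ∂μ ∂μ + ∫⁻ x, ∫⁻ y, H x y ∂μ ∂μ := by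
        congr 1
        rw [lintegral_lintegral_swap hHm.aemeasurable]
    _ ≤ ENNReal.ofReal C1 + ENNReal.ofReal C1 := add_le_add hHbound hHbound
    _ = _ := by rw [← ENNReal.ofReal_add hC10 hC10, two_mul]
end Radial

/-! ### Positive definite kernels on the sphere -/

/-- Dot product used for the kernels. -/
def dotp {d : ℕ} (w z : Fin d → ℝ) : ℝ := ∑ i, w i * z i

lemma gramJ {d : ℕ} (J : (Fin d → ℝ) → (Fin d → ℝ)) (hJ : Continuous J) (k : ℕ) :
    ∃ (I : Type) (_ : Fintype I) (M Φ : I → (Fin d → ℝ) → ℝ),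
      (∀ s, Continuous (M s)) ∧ (∀ s, Continuous (Φ s)) ∧ ∀ w z : Fin d → ℝ,
        (∑ s, M s w * M s z = dotp w z ^ k) ∧
        (∑ s, Φ s w * M s z = k * dotp w z ^ (k - 1) * dotp (J w) z) ∧
        (∑ s, M s w * Φ s z = k * dotp w z ^ (k - 1) * dotp w (J z)) ∧
        (∑ s, Φ s w * Φ s z = k * dotp w z ^ (k - 1) * dotp (J w) (J z)
          + k * ((k : ℝ) - 1) * dotp w z ^ (k - 2) * (dotp (J w) z * dotp w (J z))) := by
  induction k with
  | zero =>
    refine ⟨Unit, inferInstance, fun _ _ => 1, fun _ _ => 0, fun _ => continuous_const,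
      fun _ => continuous_const, fun w z => ?_⟩
    simp
  | succ k ih =>
    obtain ⟨I, hI, M, Φ, hM, hΦ, h⟩ := ih
    refine ⟨I × Fin d, inferInstance, fun s w => M s.1 w * w s.2,
      fun s w => Φ s.1 w * w s.2 + M s.1 w * J w s.2, ?_, ?_, ?_⟩
    · intro s
      exact (hM s.1).mul (continuous_apply s.2)
    · intro s
      exact ((hΦ s.1).mul (continuous_apply s.2)).add
        ((hM s.1).mul ((continuous_apply s.2).comp hJ))
    · intro w z
      obtain ⟨h1, h2, h3, h4⟩ := h w z
      have key : ∀ (f g : I → ℝ) (u v : Fin d → ℝ),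
          ∑ s : I × Fin d, (f s.1 * u s.2) * (g s.1 * v s.2) = (∑ s, f s * g s) * dotp u v := by
        intro f g u v
        rw [Fintype.sum_prod_type, dotp, Finset.sum_mul_sum]
        refine Finset.sum_congr rfl fun s _ => Finset.sum_congr rfl fun i _ => by ring
      have e1 : (k : ℝ) * dotp w z ^ (k - 1) * dotp w z = k * dotp w z ^ k := by
        rcases k with _ | k
        · simp
        · simp [pow_succ]; ring
      have e2 : (k : ℝ) * ((k : ℝ) - 1) * dotp w z ^ (k - 2) * dotp w z
          = k * ((k : ℝ) - 1) * dotp w z ^ (k - 1) := by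
        rcases k with _ | _ | k
        · simp
        · simp
        · simp [pow_succ]; ring
      refine ⟨?_, ?_, ?_, ?_⟩
      · rw [key (fun s => M s w) (fun s => M s z) w z, h1, pow_succ]
      · simp only [add_mul, Finset.sum_add_distrib]
        rw [key (fun s => Φ s w) (fun s => M s z) w z, key (fun s => M s w) (fun s => M s z) (J w) z,
          h1, h2]
        simp only [Nat.add_sub_cancel]
        push_cast
        linear_combination (dotp (J w) z) * e1
      · simp only [mul_add, Finset.sum_add_distrib]
        rw [key (fun s => M s w) (fun s => Φ s z) w z, key (fun s => M s w) (fun s => M s z) w (J z),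
          h1, h3]
        simp only [Nat.add_sub_cancel]
        push_cast
        linear_combination (dotp w (J z)) * e1
      · simp only [mul_add, add_mul, Finset.sum_add_distrib]
        rw [key (fun s => Φ s w) (fun s => Φ s z) w z, key (fun s => M s w) (fun s => Φ s z) (J w) z,
          key (fun s => Φ s w) (fun s => M s z) w (J z),
          key (fun s => M s w) (fun s => M s z) (J w) (J z), h1, h2, h3, h4]
        have : k + 1 - 2 = k - 1 := by omega
        simp only [Nat.add_sub_cancel, this]
        push_cast
        linear_combination (dotp (J w) (J z)) * e1 + (dotp (J w) z * dotp w (J z)) * e2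

/-- rotation generator -/
def Jrot {d : ℕ} (i j : Fin d) (w : Fin d → ℝ) : Fin d → ℝ :=
  fun l => (if l = j then w i else 0) - (if l = i then w j else 0)

lemma continuous_Jrot {d : ℕ} (i j : Fin d) : Continuous (Jrot (d := d) i j) := by
  unfold Jrot
  refine continuous_pi fun l => ?_
  refine Continuous.sub ?_ ?_
  · split_ifs <;> fun_prop
  · split_ifs <;> fun_prop

lemma dotp_comm {d : ℕ} (w z : Fin d → ℝ) : dotp w z = dotp z w := by
  unfold dotp; exact Finset.sum_congr rfl fun i _ => mul_comm _ _

lemma dotp_Jrot_left {d : ℕ} (i j : Fin d) (w z : Fin d → ℝ) :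
    dotp (Jrot i j w) z = w i * z j - w j * z i := by
  simp [dotp, Jrot, sub_mul, Finset.sum_sub_distrib, ite_mul]

lemma sum_Jrot_Jrot {d : ℕ} (w z : Fin d → ℝ) :
    ∑ i, ∑ j, dotp (Jrot i j w) (Jrot i j z) = 2 * ((d : ℝ) - 1) * dotp w z := by
  have : ∀ i j : Fin d, dotp (Jrot i j w) (Jrot i j z)
      = w i * z i + w j * z j - 2 * (if i = j then w i * z i else 0) := by
    intro i j
    rw [dotp_Jrot_left]
    simp only [Jrot]
    by_cases h : i = j
    · subst h; simp; ring
    · simp [h, Ne.symm h]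
  simp only [this, Finset.sum_sub_distrib, Finset.sum_add_distrib, ← Finset.mul_sum]
  simp only [Finset.sum_const, Finset.card_univ, Fintype.card_fin, nsmul_eq_mul,
    Finset.sum_ite_eq, Finset.mem_univ, if_true, dotp]
  have h6 : ∑ x, w x * ((d : ℝ) * z x) = d * ∑ x, w x * z x := by
    rw [Finset.mul_sum]; exact Finset.sum_congr rfl fun i _ => by ring
  rw [h6]
  ring

lemma sum_Jrot_sq {d : ℕ} (w z : Fin d → ℝ) (hw : dotp w w = 1) (hz : dotp z z = 1) :
    ∑ i, ∑ j, dotp (Jrot i j w) z * dotp w (Jrot i j z) = - 2 * (1 - dotp w z ^ 2) := by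
  have : ∀ i j : Fin d, dotp (Jrot i j w) z * dotp w (Jrot i j z)
      = 2 * ((w i * z i) * (w j * z j)) - (w i * w i) * (z j * z j) - (z i * z i) * (w j * w j) := by
    intro i j
    rw [dotp_comm w, dotp_Jrot_left, dotp_Jrot_left]
    ring
  simp only [this, Finset.sum_sub_distrib, ← Finset.mul_sum]
  have h1 : ∀ u v : Fin d → ℝ, ∑ i, ∑ j, u i * v j = (∑ i, u i) * ∑ j, v j := by
    intro u v; rw [Finset.sum_mul_sum]
  have h2 : ∑ i, ∑ j, w i * z i * (w j * z j) = dotp w z * dotp w z :=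
    h1 (fun i => w i * z i) (fun i => w i * z i)
  have h3 : ∑ i, ∑ j, w i * w i * (z j * z j) = dotp w w * dotp z z :=
    h1 (fun i => w i * w i) (fun i => z i * z i)
  have h4 : ∑ i, ∑ j, z i * z i * (w j * w j) = dotp z z * dotp w w :=
    h1 (fun i => z i * z i) (fun i => w i * w i)
  have h5 : ∑ i, ∑ j, 2 * (w i * z i * (w j * z j)) = 2 * (dotp w z * dotp w z) := by
    rw [← h2]; simp only [Finset.mul_sum]
  simp only [Finset.mul_sum] at h3 h4 h5 ⊢
  rw [h5, h3, h4, hw, hz]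
  ring

/-- The basic positive definite kernel. -/
lemma gramD {d : ℕ} (k : ℕ) :
    ∃ (I : Type) (_ : Fintype I) (Φ : I → (Fin d → ℝ) → ℝ),
      (∀ s, Continuous (Φ s)) ∧ ∀ w z : Fin d → ℝ, dotp w w = 1 → dotp z z = 1 →
        ∑ s, Φ s w * Φ s z = 2 * k * (((d : ℝ) + k - 2) * dotp w z ^ k
          - ((k : ℝ) - 1) * dotp w z ^ (k - 2)) := by
  choose I hI M Φ hM hΦ h using fun ij : Fin d × Fin d =>
    gramJ (Jrot (d := d) ij.1 ij.2) (continuous_Jrot ij.1 ij.2) k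
  refine ⟨Σ ij : Fin d × Fin d, I ij, inferInstance, fun s => Φ s.1 s.2, fun s => hΦ _ _, ?_⟩
  intro w z hw hz
  rw [Fintype.sum_sigma]
  have : ∀ ij : Fin d × Fin d, ∑ s, Φ ij s w * Φ ij s z = k * dotp w z ^ (k - 1) * dotp (Jrot ij.1 ij.2 w) (Jrot ij.1 ij.2 z)
          + k * ((k : ℝ) - 1) * dotp w z ^ (k - 2) * (dotp (Jrot ij.1 ij.2 w) z * dotp w (Jrot ij.1 ij.2 z)) :=
    fun ij => (h ij w z).2.2.2
  simp only [this]
  rw [Finset.sum_add_distrib, ← Finset.mul_sum, ← Finset.mul_sum, Fintype.sum_prod_type,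
    Fintype.sum_prod_type]
  rw [sum_Jrot_Jrot, sum_Jrot_sq w z hw hz]
  rcases k with _ | _ | k
  · simp
  · simp; ring
  · simp [pow_succ]; ring

lemma dotp_le_one {d : ℕ} (w z : Fin d → ℝ) (hw : dotp w w = 1) (hz : dotp z z = 1) :
    dotp w z ≤ 1 := by
  have h : 0 ≤ ∑ i, (w i - z i) ^ 2 := Finset.sum_nonneg fun i _ => sq_nonneg _
  have : ∑ i, (w i - z i) ^ 2 = dotp w w + dotp z z - 2 * dotp w z := by
    simp only [dotp, Finset.mul_sum, ← Finset.sum_add_distrib, ← Finset.sum_sub_distrib]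
    exact Finset.sum_congr rfl fun i _ => by ring
  linarith

lemma neg_one_le_dotp {d : ℕ} (w z : Fin d → ℝ) (hw : dotp w w = 1) (hz : dotp z z = 1) :
    -1 ≤ dotp w z := by
  have h : 0 ≤ ∑ i, (w i + z i) ^ 2 := Finset.sum_nonneg fun i _ => sq_nonneg _
  have : ∑ i, (w i + z i) ^ 2 = dotp w w + dotp z z + 2 * dotp w z := by
    simp only [dotp, Finset.mul_sum, ← Finset.sum_add_distrib]
    exact Finset.sum_congr rfl fun i _ => by ring
  linarith

lemma abs_coord_le_one {d : ℕ} (w : Fin d → ℝ) (hw : dotp w w = 1) (i : Fin d) : |w i| ≤ 1 := by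
  have : w i * w i ≤ dotp w w :=
    Finset.single_le_sum (f := fun i => w i * w i) (fun j _ => mul_self_nonneg _) (Finset.mem_univ i)
  rw [hw] at this
  exact abs_le_one_iff_mul_self_le_one.2 this

lemma continuous_dotp {d : ℕ} : Continuous fun p : (Fin d → ℝ) × (Fin d → ℝ) => dotp p.1 p.2 := by
  unfold dotp; fun_prop

/-! ### Binomial coefficients and the sequence argument -/

/-- coefficients of `(1-s)^{-α}` -/
def bco (α : ℝ) (k : ℕ) : ℝ := (ascPochhammer ℝ k).eval α / (k ! : ℝ)

lemma bco_zero (α : ℝ) : bco α 0 = 1 := by simp [bco]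

lemma bco_pos {α : ℝ} (hα : 0 < α) (k : ℕ) : 0 < bco α k :=
  div_pos (ascPochhammer_pos k α hα) (by positivity)

lemma bco_succ (α : ℝ) (k : ℕ) : ((k : ℝ) + 1) * bco α (k + 1) = (α + k) * bco α k := by
  have h : (k ! : ℝ) ≠ 0 := by positivity
  have h' : ((k : ℝ) + 1) ≠ 0 := by positivity
  simp only [bco, ascPochhammer_succ_eval, Nat.factorial_succ]
  push_cast
  field_simp

lemma bco_shift (α : ℝ) (k : ℕ) : ((k : ℝ) + 1) * bco α (k + 1) = α * bco (α + 1) k := by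
  have h : (k ! : ℝ) ≠ 0 := by positivity
  have h' : ((k : ℝ) + 1) ≠ 0 := by positivity
  simp only [bco, ascPochhammer_succ_left, Nat.factorial_succ]
  simp
  field_simp

lemma bco_eq_choose (α : ℝ) (k : ℕ) : Ring.choose (α + k - 1) k = bco α k := by
  have h := Ring.factorial_nsmul_multichoose_eq_ascPochhammer α k
  rw [Ring.choose]
  have e : α + k - 1 - k + 1 = α := by ring
  rw [e, bco, eq_div_iff (by positivity), mul_comm]
  rw [nsmul_eq_mul] at h
  rw [h, Polynomial.ascPochhammer_smeval_eq_eval]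

lemma binom_hasSum (α : ℝ) {s : ℝ} (hs : |s| < 1) :
    HasSum (fun k => bco α k * s ^ k) ((1 - s) ^ (-α)) := by
  have h := (Real.one_div_one_sub_rpow_hasFPowerSeriesOnBall_zero α).hasSum (y := s)
    (by simpa [Metric.mem_eball, edist_dist] using hs)
  simp only [zero_add, FormalMultilinearSeries.ofScalars_apply_eq, bco_eq_choose, smul_eq_mul] at h
  rw [rpow_neg (by linarith [le_abs_self s]), ← one_div]
  exact h

lemma binom_hasSum' (α : ℝ) {r t : ℝ} (hs : |r * t| < 1) :
    HasSum (fun k : ℕ => (k : ℝ) * bco α k * r ^ k * t ^ (k - 1))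
      (α * r * (1 - r * t) ^ (-(α + 1))) := by
  rw [← hasSum_nat_add_iff' 1]
  have := (binom_hasSum (α + 1) hs).mul_left (α * r)
  have e : α * r * (1 - r * t) ^ (-(α + 1)) -
      ∑ i ∈ Finset.range 1, (i : ℝ) * bco α i * r ^ i * t ^ (i - 1)
      = α * r * (1 - r * t) ^ (-(α + 1)) := by simp
  rw [e]
  have e2 : (fun k : ℕ => α * r * (bco (α + 1) k * (r * t) ^ k)) =
      fun k : ℕ => ((k + 1 : ℕ) : ℝ) * bco α (k + 1) * r ^ (k + 1) * t ^ (k + 1 - 1) := by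
    refine funext fun k => ?_
    have := bco_shift α k
    push_cast
    rw [this, mul_pow, pow_succ]
    ring
  rw [e2] at this
  exact this

/-- recursion for the moments of the uniform measure -/
def cmom (n : ℝ) : ℕ → ℝ
  | 0 => 1
  | 1 => 0
  | (k + 2) => ((k : ℝ) + 1) / (n + k + 1) * cmom n k

theorem seq_argument (n α : ℝ) (hα : 0 < α) (hn : 2 * α < n) :
    ∃ C : ℝ, 0 ≤ C ∧ ∀ (A : ℕ → ℝ) (P : ℝ),
      (∀ j : ℕ, 0 ≤ (n + j) * A (j + 1) - j * A (j - 1)) →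
      (∀ N, ∑ j ∈ Finset.range N, bco α j * ((n + j) * A (j + 1) - j * A (j - 1)) ≤ P) →
      (∀ k, 0 ≤ A k - cmom n k * A 0) ∧
      (∀ N, ∑ k ∈ Finset.range N, bco α k * (A k - cmom n k * A 0) ≤ C * P) := by
  have hn0 : 0 < n := by linarith
  -- bounds for individual terms
  have key1 : ∀ k, ∃ C : ℝ, 0 ≤ C ∧ ∀ (A : ℕ → ℝ) (P : ℝ),
      (∀ j : ℕ, 0 ≤ (n + j) * A (j + 1) - j * A (j - 1)) →
      (∀ N, ∑ j ∈ Finset.range N, bco α j * ((n + j) * A (j + 1) - j * A (j - 1)) ≤ P) →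
      0 ≤ A k - cmom n k * A 0 ∧ A k - cmom n k * A 0 ≤ C * P := by
    have term : ∀ (A : ℕ → ℝ) (P : ℝ),
      (∀ j : ℕ, 0 ≤ (n + j) * A (j + 1) - j * A (j - 1)) →
      (∀ N, ∑ j ∈ Finset.range N, bco α j * ((n + j) * A (j + 1) - j * A (j - 1)) ≤ P) →
      ∀ j : ℕ, (n + j) * A (j + 1) - j * A (j - 1) ≤ 1 / bco α j * P := by
      intro A P hD hP j
      have h := hP (j + 1)
      rw [Finset.sum_range_succ] at h
      have h0 : 0 ≤ ∑ j ∈ Finset.range j, bco α j * ((n + j) * A (j + 1) - j * A (j - 1)) :=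
        Finset.sum_nonneg fun i _ => mul_nonneg (bco_pos hα i).le (hD i)
      have hb := bco_pos hα j
      rw [one_div, inv_mul_eq_div, le_div_iff₀ hb]
      linarith
    intro k
    induction k using Nat.strong_induction_on with
    | _ k ih =>
      rcases k with _ | _ | k
      · refine ⟨0, le_rfl, fun A P _ _ => ?_⟩
        simp [cmom]
      · refine ⟨1 / n, by positivity, fun A P hD hP => ?_⟩
        have h1 := term A P hD hP 0
        have h2 := hD 0
        simp [bco_zero] at h1 h2
        simp only [cmom, zero_add, zero_mul, sub_zero]
        refine ⟨by rw [mul_comm] at h2; exact nonneg_of_mul_nonneg_left h2 hn0, ?_⟩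
        rw [one_div, inv_mul_eq_div, le_div_iff₀ hn0]
        linarith
      · obtain ⟨C, hC, h⟩ := ih k (by omega)
        have hb := bco_pos hα (k + 1)
        have hnk : 0 < n + k + 1 := by positivity
        refine ⟨(1 / bco α (k + 1) + (k + 1) * C) / (n + k + 1), by positivity, fun A P hD hP => ?_⟩
        obtain ⟨h1, h2⟩ := h A P hD hP
        have h3 := term A P hD hP (k + 1)
        have h4 := hD (k + 1)
        push_cast at h3 h4
        have e : A (k + 1 + 1) - cmom n (k + 1 + 1) * A 0
          = (((n + (k + 1)) * A (k + 1 + 1) - (k + 1) * A k) + (k + 1) * (A k - cmom n k * A 0))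
            / (n + k + 1) := by
          rw [eq_div_iff hnk.ne']
          simp only [cmom]
          field_simp
          ring
        rw [e]
        have hk1 : (0 : ℝ) ≤ (k : ℝ) + 1 := by positivity
        refine ⟨div_nonneg (add_nonneg h4 (mul_nonneg hk1 h1)) hnk.le, ?_⟩
        rw [div_mul_eq_mul_div]
        refine div_le_div_of_nonneg_right ?_ hnk.le
        have := mul_le_mul_of_nonneg_left h2 hk1
        linarith
  choose Cc hCc key using key1
  set κ : ℝ := (n - 2 * α) / 2 with hκ
  have hκ0 : 0 < κ := by rw [hκ]; linarith
  let γ : ℕ → ℝ := fun i => bco α i * (n + i) - bco α (i + 2) * (i + 2)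
  -- lower bound for γ
  obtain ⟨i0, hi0⟩ : ∃ i0 : ℕ, ∀ i : ℕ, i0 ≤ i → κ * bco α (i + 1) ≤ γ i := by
    obtain ⟨i0, hi0⟩ := exists_nat_ge ((α * (α - 1) + κ * α) / κ)
    refine ⟨i0, fun i hi => ?_⟩
    have hi' : (α * (α - 1) + κ * α) ≤ κ * i := by
      rw [div_le_iff₀ hκ0] at hi0
      have : (i0 : ℝ) ≤ i := by exact_mod_cast hi
      nlinarith
    have s1 := bco_succ α i
    have s2 := bco_succ α (i + 1)
    push_cast at s2
    have hb := bco_pos hα (i + 1)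
    have hαi : 0 < α + i := by positivity
    have e : γ i = bco α (i + 1) * (((i : ℝ) + 1) * (n + i) / (α + i) - (α + (i + 1))) := by
      simp only [γ]
      have : bco α i = ((i : ℝ) + 1) * bco α (i + 1) / (α + i) := by
        rw [s1]; field_simp
      rw [this]
      have : bco α (i + 2) * ((i : ℝ) + 2) = (α + (i + 1)) * bco α (i + 1) := by
        rw [← s2]; ring
      rw [this]
      ring
    rw [e, mul_comm]
    refine mul_le_mul_of_nonneg_left ?_ hb.le
    rw [le_sub_iff_add_le, le_div_iff₀ hαi]
    have hnn : n = 2 * κ + 2 * α := by rw [hκ]; ring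
    rw [hnn]
    nlinarith
  let R : ℕ → ℝ := fun i => (κ * bco α (i + 1) + |γ i|) * Cc (i + 1)
  have hR : ∀ i, 0 ≤ R i := fun i =>
    mul_nonneg (add_nonneg (mul_nonneg hκ0.le (bco_pos hα _).le) (abs_nonneg _)) (hCc _)
  have hRs : 0 ≤ ∑ i ∈ Finset.range i0, R i := Finset.sum_nonneg fun i _ => hR i
  refine ⟨(1 + ∑ i ∈ Finset.range i0, R i) / κ, by positivity, fun A P hD hP => ?_⟩
  have hE0 : ∀ k, 0 ≤ A k - cmom n k * A 0 := fun k => (key k A P hD hP).1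
  refine ⟨hE0, ?_⟩
  have hP0 : 0 ≤ P := by simpa using hP 0
  set E : ℕ → ℝ := fun k => A k - cmom n k * A 0 with hE
  have hDE : ∀ j : ℕ, (n + (j + 1)) * A (j + 2) - (j + 1) * A j
      = (n + (j + 1)) * E (j + 2) - (j + 1) * E j := by
    intro j
    have hnk : 0 < n + j + 1 := by positivity
    simp only [hE, cmom]
    field_simp
    ring
  have hsum : ∀ M : ℕ, ∑ j ∈ Finset.range (M + 2), bco α j * ((n + j) * A (j + 1) - j * A (j - 1))
      = ∑ i ∈ Finset.range M, γ i * E (i + 1) + bco α M * (n + M) * E (M + 1)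
        + bco α (M + 1) * (n + (M + 1)) * E (M + 2) := by
    intro M
    induction M with
    | zero =>
      have := hDE 0
      simp [Finset.sum_range_succ, hE, cmom] at this ⊢
      linear_combination (bco α 1) * this
    | succ M ih =>
      rw [Finset.sum_range_succ, ih, Finset.sum_range_succ]
      have := hDE (M + 1)
      push_cast at this ⊢
      simp only [γ]
      linear_combination (bco α (M + 2)) * this
  have hmain : ∀ M : ℕ, ∑ i ∈ Finset.range M, γ i * E (i + 1) ≤ P := by
    intro M
    have h := hP (M + 2)
    rw [hsum] at h
    have h1 : 0 ≤ bco α M * (n + M) * E (M + 1) :=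
      mul_nonneg (mul_nonneg (bco_pos hα _).le (by positivity)) (hE0 _)
    have h2 : 0 ≤ bco α (M + 1) * (n + (M + 1)) * E (M + 2) :=
      mul_nonneg (mul_nonneg (bco_pos hα _).le (by positivity)) (hE0 _)
    linarith
  have hterm : ∀ i, κ * (bco α (i + 1) * E (i + 1)) ≤ γ i * E (i + 1)
      + (if i < i0 then R i else 0) * P := by
    intro i
    split_ifs with h
    · have h1 : E (i + 1) ≤ Cc (i + 1) * P := (key (i + 1) A P hD hP).2
      have h2 : 0 ≤ κ * bco α (i + 1) + |γ i| :=
        add_nonneg (mul_nonneg hκ0.le (bco_pos hα _).le) (abs_nonneg _)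
      have h3 := mul_le_mul_of_nonneg_left h1 h2
      have h4 := mul_le_mul_of_nonneg_right (neg_abs_le (γ i)) (hE0 (i + 1))
      simp only [R]
      change _ ≤ γ i * E (i + 1) at h4
      change (κ * bco α (i + 1) + |γ i|) * E (i + 1) ≤ _ at h3
      change -|γ i| * E (i + 1) ≤ _ at h4
      linarith
    · have := mul_le_mul_of_nonneg_right (hi0 i (not_lt.1 h)) (hE0 (i + 1))
      change _ ≤ γ i * E (i + 1) at this
      change (κ * bco α (i + 1)) * E (i + 1) ≤ _ at this
      linarith
  intro N
  rw [div_mul_eq_mul_div, le_div_iff₀ hκ0]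
  rcases N with _ | M
  · simp; positivity
  · rw [Finset.sum_range_succ']
    have z : A 0 - cmom n 0 * A 0 = 0 := by simp [cmom]
    rw [z, mul_zero, add_zero, mul_comm, Finset.mul_sum]
    calc _ ≤ ∑ i ∈ Finset.range M, (γ i * E (i + 1) + (if i < i0 then R i else 0) * P) :=
          Finset.sum_le_sum fun i _ => hterm i
      _ = ∑ i ∈ Finset.range M, γ i * E (i + 1)
          + (∑ i ∈ Finset.range M, (if i < i0 then R i else 0)) * P := by
          rw [Finset.sum_add_distrib, Finset.sum_mul]
      _ ≤ P + (∑ i ∈ Finset.range i0, R i) * P := by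
          refine add_le_add (hmain M) (mul_le_mul_of_nonneg_right ?_ hP0)
          rw [← Finset.sum_filter]
          refine Finset.sum_le_sum_of_subset_of_nonneg ?_ (fun i _ _ => hR i)
          intro i hi
          simp at hi ⊢
          exact hi.2
      _ = _ := by ring

set_option linter.unusedSectionVars false
/-! ### Spherical moment inequality -/

/-- kernel variable -/
def tk {X : Type*} {d : ℕ} (w : X → Fin d → ℝ) (p : X × X) : ℝ := dotp (w p.1) (w p.2)

/-- moments -/
def Mom {X : Type*} [MeasurableSpace X] {d : ℕ} (μ : Measure X) (w : X → Fin d → ℝ) (G : X → ℝ)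
    (phi : ℝ → ℝ) : ℝ := ∫ p, G p.1 * G p.2 * phi (tk w p) ∂(μ.prod μ)

/-- hypotheses on the map to the sphere -/
structure SphMap {X : Type*} [MeasurableSpace X] {d : ℕ} (μ : Measure X) (w : X → Fin d → ℝ) :
    Prop where
  meas : Measurable w
  unit : ∀ x, dotp (w x) (w x) = 1
  diag : ∀ᵐ p ∂(μ.prod μ), tk w p < 1

section
variable {X : Type*} [MeasurableSpace X] {d : ℕ} {μ : Measure X} [SFinite μ] {w : X → Fin d → ℝ}
  {G : X → ℝ}

lemma SphMap.meas_tk (hw : SphMap μ w) : Measurable (tk w) := by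
  unfold tk
  exact continuous_dotp.measurable.comp
    ((hw.meas.comp measurable_fst).prodMk (hw.meas.comp measurable_snd))

lemma SphMap.tk_mem (hw : SphMap μ w) (p : X × X) : tk w p ∈ Set.Icc (-1 : ℝ) 1 :=
  ⟨neg_one_le_dotp _ _ (hw.unit _) (hw.unit _), dotp_le_one _ _ (hw.unit _) (hw.unit _)⟩

lemma integrable_GG (hG : Integrable G μ) :
    Integrable (fun p : X × X => G p.1 * G p.2) (μ.prod μ) := hG.mul_prod hG

lemma integrable_mom (hw : SphMap μ w) (hG : Integrable G μ) {phi : ℝ → ℝ} (hphi : Measurable phi)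
    {M : ℝ} (hM : ∀ t ∈ Set.Icc (-1 : ℝ) 1, |phi t| ≤ M) :
    Integrable (fun p : X × X => G p.1 * G p.2 * phi (tk w p)) (μ.prod μ) := by
  refine (integrable_GG hG).mul_bdd (c := M) (hphi.comp hw.meas_tk).aestronglyMeasurable ?_
  exact Eventually.of_forall fun p => hM _ (hw.tk_mem p)

lemma hasSum_mom (hw : SphMap μ w) (hG : Integrable G μ) (p : ℕ → ℝ → ℝ) (phi : ℝ → ℝ)
    (hp : ∀ j, Continuous (p j)) (M : ℕ → ℝ) (hM : Summable M)
    (hpM : ∀ j, ∀ t ∈ Set.Icc (-1 : ℝ) 1, |p j t| ≤ M j)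
    (hs : ∀ t ∈ Set.Icc (-1 : ℝ) 1, HasSum (fun j => p j t) (phi t)) :
    HasSum (fun j => Mom μ w G (p j)) (Mom μ w G phi) := by
  have h := hasSum_integral_of_summable_integral_norm (μ := μ.prod μ)
    (F := fun j (q : X × X) => G q.1 * G q.2 * p j (tk w q))
    (fun j => integrable_mom hw hG (hp j).measurable (hpM j)) ?_
  · have e : Mom μ w G phi = ∫ q, ∑' j, G q.1 * G q.2 * p j (tk w q) ∂(μ.prod μ) := by
      unfold Mom
      refine integral_congr_ae (Eventually.of_forall fun q => ?_)
      exact ((hs _ (hw.tk_mem q)).mul_left _).tsum_eq.symm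
    rw [e]
    exact h
  · refine Summable.of_nonneg_of_le (fun j => integral_nonneg fun q => norm_nonneg _) ?_
      (hM.mul_left (∫ q, ‖G q.1 * G q.2‖ ∂(μ.prod μ)))
    intro j
    rw [← integral_mul_const]
    refine integral_mono (integrable_mom hw hG (hp j).measurable (hpM j)).norm
      ((integrable_GG hG).norm.mul_const _) fun q => ?_
    simp only [norm_mul]
    exact mul_le_mul_of_nonneg_left (hpM j _ (hw.tk_mem q)) (by positivity)

lemma abs_pow_le_one_Icc {t : ℝ} (ht : t ∈ Set.Icc (-1 : ℝ) 1) (k : ℕ) : |t ^ k| ≤ 1 := by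
  rw [abs_pow]; exact pow_le_one₀ (abs_nonneg _) (abs_le.2 ht)

lemma integrable_pow_mom (hw : SphMap μ w) (hG : Integrable G μ) (k : ℕ) :
    Integrable (fun p : X × X => G p.1 * G p.2 * (tk w p) ^ k) (μ.prod μ) :=
  integrable_mom (phi := fun t => t ^ k) (M := 1) hw hG (measurable_id.pow_const k)
    fun _ ht => abs_pow_le_one_Icc ht k

lemma mom_D_eq (hw : SphMap μ w) (hG : Integrable G μ) (a b : ℝ) (i j : ℕ) :
    Mom μ w G (fun t => a * t ^ i - b * t ^ j)
      = a * Mom μ w G (fun t => t ^ i) - b * Mom μ w G (fun t => t ^ j) := by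
  unfold Mom
  rw [← integral_const_mul, ← integral_const_mul, ← integral_sub]
  · refine integral_congr_ae (Eventually.of_forall fun q => ?_)
    simp only []
    ring
  · exact (integrable_pow_mom hw hG i).const_mul a
  · exact (integrable_pow_mom hw hG j).const_mul b

lemma mom_D_nonneg (hw : SphMap μ w) (hG : Integrable G μ) (j : ℕ) :
    0 ≤ ((d : ℝ) - 1 + j) * Mom μ w G (fun t => t ^ (j + 1)) - j * Mom μ w G (fun t => t ^ (j - 1)) := by
  rw [← mom_D_eq hw hG]
  obtain ⟨I, hI, Φ, hΦ, h⟩ := gramD (d := d) (j + 1)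
  have hb : ∀ s, ∃ C, ∀ x, ‖Φ s (w x)‖ ≤ C := by
    intro s
    have hc : IsCompact (Set.pi Set.univ fun _ : Fin d => Set.Icc (-1 : ℝ) 1) :=
      isCompact_univ_pi fun _ => isCompact_Icc
    obtain ⟨C, hC⟩ := hc.exists_bound_of_continuousOn (hΦ s).continuousOn
    refine ⟨C, fun x => hC _ ?_⟩
    intro i _
    exact abs_le.1 (abs_coord_le_one _ (hw.unit x) i)
  choose C hC using hb
  have hint : ∀ s, Integrable (fun x => G x * Φ s (w x)) μ := fun s =>
    hG.mul_bdd (c := C s) ((hΦ s).measurable.comp hw.meas).aestronglyMeasurable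
      (Eventually.of_forall (hC s))
  have e : Mom μ w G (fun t => ((d : ℝ) - 1 + j) * t ^ (j + 1) - j * t ^ (j - 1))
      = (1 / (2 * ((j : ℝ) + 1))) * ∑ s, (∫ x, G x * Φ s (w x) ∂μ) ^ 2 := by
    unfold Mom
    have : ∀ s, (∫ x, G x * Φ s (w x) ∂μ) ^ 2
        = ∫ p : X × X, (G p.1 * Φ s (w p.1)) * (G p.2 * Φ s (w p.2)) ∂(μ.prod μ) := by
      intro s
      rw [sq]
      exact (integral_prod_mul (μ := μ) (ν := μ) (fun x => G x * Φ s (w x))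
        (fun x => G x * Φ s (w x))).symm
    simp only [this]
    rw [← integral_finsetSum _ fun s _ => (hint s).mul_prod (hint s), ← integral_const_mul]
    refine integral_congr_ae (Eventually.of_forall fun p => ?_)
    have h1 := h (w p.1) (w p.2) (hw.unit _) (hw.unit _)
    have h2 : ∑ s, (G p.1 * Φ s (w p.1)) * (G p.2 * Φ s (w p.2))
        = G p.1 * G p.2 * ∑ s, Φ s (w p.1) * Φ s (w p.2) := by
      rw [Finset.mul_sum]; exact Finset.sum_congr rfl fun s _ => by ring
    simp only [h2, h1, tk]
    have e1 : j + 1 - 2 = j - 1 := by omega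
    rw [e1]
    push_cast
    have : ((j : ℝ) + 1) ≠ 0 := by positivity
    field_simp
    ring
  rw [e]
  exact mul_nonneg (by positivity) (Finset.sum_nonneg fun s _ => sq_nonneg _)

lemma rt_lt {r t : ℝ} (hr : r ∈ Set.Ico (0 : ℝ) 1) (ht : t ∈ Set.Icc (-1 : ℝ) 1) : |r * t| < 1 := by
  rw [abs_mul, abs_of_nonneg hr.1]
  calc r * |t| ≤ r * 1 := mul_le_mul_of_nonneg_left (abs_le.2 ht) hr.1
    _ < 1 := by linarith [hr.2]

lemma mom_K_hasSum (hw : SphMap μ w) (hG : Integrable G μ) {α : ℝ} (hα : 0 < α) {r : ℝ}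
    (hr : r ∈ Set.Ico (0 : ℝ) 1) :
    HasSum (fun k => bco α k * r ^ k * Mom μ w G (fun t => t ^ k))
      (Mom μ w G (fun t => (1 - r * t) ^ (-α))) := by
  have h := hasSum_mom (G := G) hw hG (fun k t => bco α k * (r * t) ^ k)
    (fun t => (1 - r * t) ^ (-α)) (fun k => by fun_prop) (fun k => bco α k * r ^ k)
    (binom_hasSum α (by rw [abs_of_nonneg hr.1]; exact hr.2)).summable ?_ ?_
  · convert h using 1
    refine funext fun k => ?_
    unfold Mom
    rw [← integral_const_mul]
    refine integral_congr_ae (Eventually.of_forall fun p => ?_)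
    simp only [mul_pow]
    ring
  · intro k t ht
    rw [mul_pow, abs_mul, abs_mul, abs_of_pos (bco_pos hα k), abs_of_nonneg (pow_nonneg hr.1 k)]
    have := abs_pow_le_one_Icc ht k
    have hb := bco_pos hα k
    have := mul_le_mul_of_nonneg_left this (mul_nonneg hb.le (pow_nonneg hr.1 k))
    linarith
  · intro t ht
    exact binom_hasSum α (rt_lt hr ht)

lemma mom_P_hasSum (hw : SphMap μ w) (hG : Integrable G μ) {α : ℝ} (hα : 0 < α) {r : ℝ}
    (hr : r ∈ Set.Ico (0 : ℝ) 1) (n : ℝ) (hn : 0 ≤ n) :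
    HasSum (fun j : ℕ => bco α j * r ^ j *
        ((n + j) * Mom μ w G (fun t => t ^ (j + 1)) - j * Mom μ w G (fun t => t ^ (j - 1))))
      (Mom μ w G (fun t => n * t * (1 - r * t) ^ (-α)
        + (t ^ 2 - 1) * (α * r * (1 - r * t) ^ (-(α + 1))))) := by
  have hr1 : |r| < 1 := by rw [abs_of_nonneg hr.1]; exact hr.2
  have h := hasSum_mom (G := G) hw hG
    (fun j t => bco α j * r ^ j * ((n + j) * t ^ (j + 1) - j * t ^ (j - 1)))
    (fun t => n * t * (1 - r * t) ^ (-α)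
        + (t ^ 2 - 1) * (α * r * (1 - r * t) ^ (-(α + 1))))
    (fun j => by fun_prop) (fun j => bco α j * r ^ j * (n + j + j)) ?_ ?_ ?_
  · convert h using 1
    refine funext fun k => ?_
    rw [← mom_D_eq hw hG]
    unfold Mom
    rw [← integral_const_mul]
    refine integral_congr_ae (Eventually.of_forall fun p => ?_)
    simp only []
    ring
  · have h1 := ((binom_hasSum α hr1).summable.mul_left n).add
      ((binom_hasSum' α (r := r) (t := 1) (by simpa using hr1)).summable.mul_left 2)
    refine h1.congr fun j => ?_
    simp
    ring
  · intro k t ht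
    have hb : 0 ≤ bco α k * r ^ k := mul_nonneg (bco_pos hα k).le (pow_nonneg hr.1 k)
    rw [abs_mul, abs_of_nonneg hb]
    refine mul_le_mul_of_nonneg_left ?_ hb
    have h1 := abs_le.1 (abs_pow_le_one_Icc ht (k + 1))
    have h2 := abs_le.1 (abs_pow_le_one_Icc ht (k - 1))
    have h3 : 0 ≤ n + k := by positivity
    have h4 : (0 : ℝ) ≤ k := by positivity
    rw [abs_le]
    constructor <;> nlinarith
  · intro t ht
    have h1 := (binom_hasSum α (rt_lt hr ht)).mul_left (n * t)
    have h2 := (binom_hasSum' α (rt_lt hr ht)).mul_left (t ^ 2 - 1)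
    have h3 := h1.add h2
    have e : (fun j : ℕ => bco α j * r ^ j * ((n + j) * t ^ (j + 1) - j * t ^ (j - 1)))
        = fun j : ℕ => n * t * (bco α j * (r * t) ^ j)
          + (t ^ 2 - 1) * ((j : ℝ) * bco α j * r ^ j * t ^ (j - 1)) := by
      refine funext fun j => ?_
      rcases j with _ | j
      · simp; ring
      · simp only [Nat.add_sub_cancel, mul_pow]; ring
    rw [e]
    exact h3

lemma kernel_bound {α r t : ℝ} (hα : 0 < α) (hr : r ∈ Set.Ico (0 : ℝ) 1)
    (ht : t ∈ Set.Icc (-1 : ℝ) 1) (ht1 : t < 1) :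
    (1 - r * t) ^ (-α) ≤ 2 ^ α * (1 - t) ^ (-α) := by
  have h1 : (1 - t) / 2 ≤ 1 - r * t := by
    rcases le_total 0 t with h | h
    · nlinarith [hr.2]
    · nlinarith [hr.1, ht.1]
  have h0 : 0 < (1 - t) / 2 := by linarith
  refine (rpow_le_rpow_of_nonpos h0 h1 (by linarith)).trans (le_of_eq ?_)
  rw [div_rpow (by linarith) (by norm_num), rpow_neg (by norm_num : (0:ℝ) ≤ 2)]
  field_simp

/-- the sequence tending to one -/
def rseq (i : ℕ) : ℝ := 1 - 1 / ((i : ℝ) + 1)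

lemma rseq_mem (i : ℕ) : rseq i ∈ Set.Ico (0 : ℝ) 1 := by
  unfold rseq
  have : (0 : ℝ) < (i : ℝ) + 1 := by positivity
  have h1 : 1 / ((i : ℝ) + 1) ≤ 1 := by rw [div_le_one this]; linarith [(Nat.cast_nonneg i : (0:ℝ) ≤ i)]
  have h2 : 0 < 1 / ((i : ℝ) + 1) := by positivity
  constructor <;> linarith

lemma rseq_tendsto : Tendsto rseq atTop (𝓝 1) := by
  have := (tendsto_one_div_add_atTop_nhds_zero_nat (𝕜 := ℝ)).const_sub 1
  simp only [sub_zero] at this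
  exact this

lemma mom_K_tendsto (hw : SphMap μ w) (hG : Integrable G μ) {α : ℝ} (hα : 0 < α)
    (hK : Integrable (fun p => G p.1 * G p.2 * (1 - tk w p) ^ (-α)) (μ.prod μ)) :
    Tendsto (fun i => Mom μ w G (fun t => (1 - rseq i * t) ^ (-α))) atTop
      (𝓝 (Mom μ w G (fun t => (1 - t) ^ (-α)))) := by
  unfold Mom
  refine tendsto_integral_of_dominated_convergence
    (fun p => 2 ^ α * ‖G p.1 * G p.2 * (1 - tk w p) ^ (-α)‖) ?_ (hK.norm.const_mul _) ?_ ?_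
  · intro i
    exact (integrable_GG hG).aestronglyMeasurable.mul
      ((measurable_const.sub (measurable_const.mul hw.meas_tk)).pow_const _).aestronglyMeasurable
  · intro i
    filter_upwards [hw.diag] with p hp
    have ht := hw.tk_mem p
    have h1 := kernel_bound hα (rseq_mem i) ht hp
    have h2 := (abs_lt.1 (rt_lt (rseq_mem i) ht)).2
    have h3 : 0 ≤ (1 - rseq i * tk w p) ^ (-α) := rpow_nonneg (by linarith) _
    have h4 : 0 ≤ (1 - tk w p) ^ (-α) := rpow_nonneg (by linarith) _
    rw [norm_mul, norm_mul (G p.1 * G p.2), norm_of_nonneg h3, norm_of_nonneg h4]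
    have := mul_le_mul_of_nonneg_left h1 (norm_nonneg (G p.1 * G p.2))
    linarith
  · filter_upwards [hw.diag] with p hp
    refine Tendsto.const_mul _ ?_
    refine Tendsto.rpow_const ?_ (Or.inl (by linarith))
    have := (rseq_tendsto.mul_const (tk w p)).const_sub 1
    simpa using this

lemma mom_P_tendsto (hw : SphMap μ w) (hG : Integrable G μ) {α : ℝ} (hα : 0 < α) (n : ℝ)
    (hn : 0 ≤ n)
    (hK : Integrable (fun p => G p.1 * G p.2 * (1 - tk w p) ^ (-α)) (μ.prod μ)) :
    Tendsto (fun i => Mom μ w G (fun t => n * t * (1 - rseq i * t) ^ (-α)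
        + (t ^ 2 - 1) * (α * rseq i * (1 - rseq i * t) ^ (-(α + 1))))) atTop
      (𝓝 (Mom μ w G (fun t => (1 - t) ^ (-α) * ((n - α) * t - α)))) := by
  unfold Mom
  refine tendsto_integral_of_dominated_convergence
    (fun p => (n * 2 ^ α + 2 * α * 2 ^ (α + 1)) * ‖G p.1 * G p.2 * (1 - tk w p) ^ (-α)‖) ?_
      (hK.norm.const_mul _) ?_ ?_
  · intro i
    refine (integrable_GG hG).aestronglyMeasurable.mul (Measurable.aestronglyMeasurable ?_)
    have := hw.meas_tk
    fun_prop
  · intro i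
    filter_upwards [hw.diag] with p hp
    have ht := hw.tk_mem p
    set t := tk w p
    set r := rseq i
    have hr : r ∈ Set.Ico (0:ℝ) 1 := rseq_mem i
    have h1 := kernel_bound hα hr ht hp
    have h1' := kernel_bound (α := α + 1) (by linarith) hr ht hp
    have h2 := (abs_lt.1 (rt_lt hr ht)).2
    have h3 : 0 ≤ (1 - r * t) ^ (-α) := rpow_nonneg (by linarith) _
    have h3' : 0 ≤ (1 - r * t) ^ (-(α + 1)) := rpow_nonneg (by linarith) _
    have h4 : 0 ≤ (1 - t) ^ (-α) := rpow_nonneg (by linarith) _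
    have h5 : (1 - t) ^ (-(α + 1)) * (1 - t) = (1 - t) ^ (-α) := by
      rw [← rpow_add_one (by linarith)]; congr 1; ring
    rw [norm_mul, norm_mul (G p.1 * G p.2), norm_of_nonneg h4]
    have key : ‖n * t * (1 - r * t) ^ (-α) + (t ^ 2 - 1) * (α * r * (1 - r * t) ^ (-(α + 1)))‖
        ≤ (n * 2 ^ α + 2 * α * 2 ^ (α + 1)) * (1 - t) ^ (-α) := by
      refine (norm_add_le _ _).trans ?_
      have a1 : ‖n * t * (1 - r * t) ^ (-α)‖ ≤ n * (2 ^ α * (1 - t) ^ (-α)) := by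
        rw [norm_mul, norm_mul, norm_of_nonneg hn, norm_of_nonneg h3]
        have : ‖t‖ ≤ 1 := abs_le.2 ht
        calc n * ‖t‖ * (1 - r * t) ^ (-α) ≤ n * 1 * (1 - r * t) ^ (-α) := by gcongr
          _ ≤ _ := by rw [mul_one]; exact mul_le_mul_of_nonneg_left h1 hn
      have a2 : ‖(t ^ 2 - 1) * (α * r * (1 - r * t) ^ (-(α + 1)))‖
          ≤ 2 * α * (2 ^ (α + 1) * (1 - t) ^ (-α)) := by
        rw [norm_mul, norm_mul, norm_mul, norm_of_nonneg hα.le, norm_of_nonneg hr.1,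
          norm_of_nonneg h3', ← h5]
        have b1 : ‖t ^ 2 - 1‖ ≤ 2 * (1 - t) := by
          rw [Real.norm_eq_abs, abs_le]
          constructor <;> nlinarith [ht.1, ht.2]
        have b2 : α * r * (1 - r * t) ^ (-(α + 1)) ≤ α * 1 * (2 ^ (α + 1) * (1 - t) ^ (-(α + 1))) := by
          have := hr.2.le
          gcongr
        calc _ ≤ (2 * (1 - t)) * (α * 1 * (2 ^ (α + 1) * (1 - t) ^ (-(α + 1)))) := by
              refine mul_le_mul b1 b2 (mul_nonneg (mul_nonneg hα.le hr.1) h3') ?_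
              linarith
          _ = _ := by ring
      linarith
    have := mul_le_mul_of_nonneg_left key (norm_nonneg (G p.1 * G p.2))
    linarith
  · filter_upwards [hw.diag] with p hp
    refine Tendsto.const_mul _ ?_
    set t := tk w p
    have h0 : Tendsto (fun i => 1 - rseq i * t) atTop (𝓝 (1 - t)) := by
      have := (rseq_tendsto.mul_const t).const_sub 1
      simpa using this
    have h1 : Tendsto (fun i => (1 - rseq i * t) ^ (-α)) atTop (𝓝 ((1 - t) ^ (-α))) :=
      h0.rpow_const (Or.inl (by linarith))
    have h2 : Tendsto (fun i => (1 - rseq i * t) ^ (-(α + 1))) atTop (𝓝 ((1 - t) ^ (-(α + 1)))) :=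
      h0.rpow_const (Or.inl (by linarith))
    have h5 : (1 - t) ^ (-(α + 1)) * (1 - t) = (1 - t) ^ (-α) := by
      rw [← rpow_add_one (by linarith)]; congr 1; ring
    have h3 := (h1.const_mul (n * t)).add (((rseq_tendsto.const_mul α).mul h2).const_mul (t ^ 2 - 1))
    convert h3 using 2
    rw [← h5]; ring

lemma mom_P_partial (hw : SphMap μ w) (hG : Integrable G μ) {α : ℝ} (hα : 0 < α)
    (hd : 1 ≤ d)
    (hK : Integrable (fun p => G p.1 * G p.2 * (1 - tk w p) ^ (-α)) (μ.prod μ)) (N : ℕ) :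
    ∑ j ∈ Finset.range N, bco α j * (((d : ℝ) - 1 + j) * Mom μ w G (fun t => t ^ (j + 1))
      - j * Mom μ w G (fun t => t ^ (j - 1)))
      ≤ Mom μ w G (fun t => (1 - t) ^ (-α) * (((d : ℝ) - 1 - α) * t - α)) := by
  have hn : (0 : ℝ) ≤ (d : ℝ) - 1 := by
    have : (1 : ℝ) ≤ d := by exact_mod_cast hd
    linarith
  have h1 := mom_P_tendsto hw hG hα ((d : ℝ) - 1) hn hK
  have h2 : Tendsto (fun i => ∑ j ∈ Finset.range N, bco α j * (rseq i) ^ j *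
      (((d : ℝ) - 1 + j) * Mom μ w G (fun t => t ^ (j + 1))
      - j * Mom μ w G (fun t => t ^ (j - 1)))) atTop (𝓝 (∑ j ∈ Finset.range N, bco α j * 1 ^ j *
      (((d : ℝ) - 1 + j) * Mom μ w G (fun t => t ^ (j + 1))
      - j * Mom μ w G (fun t => t ^ (j - 1))))) :=
    tendsto_finsetSum _ fun j _ => ((rseq_tendsto.pow j).const_mul _).mul_const _
  simp only [one_pow, mul_one] at h2
  refine le_of_tendsto_of_tendsto' h2 h1 fun i => ?_
  refine sum_le_hasSum _ (fun j _ => ?_) (mom_P_hasSum hw hG hα (rseq_mem i) _ hn)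
  exact mul_nonneg (mul_nonneg (bco_pos hα j).le (pow_nonneg (rseq_mem i).1 j)) (mom_D_nonneg hw hG j)

end

theorem sphere_ineq (d : ℕ) (hd : 1 ≤ d) (α : ℝ) (hα : 0 < α) (hn : 2 * α < (d : ℝ) - 1) :
    ∃ C : ℝ, 0 ≤ C ∧ ∀ {X : Type} [MeasurableSpace X] (μ : Measure X) [SFinite μ]
      (w : X → Fin d → ℝ) (G σ : X → ℝ), SphMap μ w → Integrable G μ → Integrable σ μ →
      Integrable (fun p => G p.1 * G p.2 * (1 - tk w p) ^ (-α)) (μ.prod μ) →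
      Integrable (fun p => σ p.1 * σ p.2 * (1 - tk w p) ^ (-α)) (μ.prod μ) →
      Mom μ w σ (fun t => (1 - t) ^ (-α) * (((d : ℝ) - 1 - α) * t - α)) = 0 →
      Mom μ w G (fun t => (1 - t) ^ (-α)) * (∫ x, σ x ∂μ) ^ 2 ≤
        Mom μ w σ (fun t => (1 - t) ^ (-α)) * (∫ x, G x ∂μ) ^ 2 +
        C * (∫ x, σ x ∂μ) ^ 2 * Mom μ w G (fun t => (1 - t) ^ (-α) * (((d : ℝ) - 1 - α) * t - α)) := by
  obtain ⟨C, hC, h⟩ := seq_argument ((d : ℝ) - 1) α hα hn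
  refine ⟨C, hC, ?_⟩
  intro X _ μ _ w G σ hw hG hσ hKG hKσ hPσ
  have A0 : ∀ g : X → ℝ, Mom μ w g (fun t => t ^ 0) = (∫ x, g x ∂μ) ^ 2 := by
    intro g
    simp only [Mom, pow_zero, mul_one]
    rw [sq]
    exact integral_prod_mul (μ := μ) (ν := μ) g g
  obtain ⟨hE, hS⟩ := h (fun k => Mom μ w G (fun t => t ^ k)) _ (mom_D_nonneg hw hG)
    (mom_P_partial hw hG hα hd hKG)
  obtain ⟨hEσ, hSσ⟩ := h (fun k => Mom μ w σ (fun t => t ^ k)) _ (mom_D_nonneg hw hσ)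
    (mom_P_partial hw hσ hα hd hKσ)
  rw [hPσ, mul_zero] at hSσ
  simp only [A0] at hE hS hEσ hSσ
  have hz : ∀ k, Mom μ w σ (fun t => t ^ k) = cmom ((d : ℝ) - 1) k * (∫ x, σ x ∂μ) ^ 2 := by
    intro k
    have h1 := hSσ (k + 1)
    rw [Finset.sum_range_succ] at h1
    have h2 : 0 ≤ ∑ k ∈ Finset.range k, bco α k * (Mom μ w σ (fun t => t ^ k)
        - cmom ((d : ℝ) - 1) k * (∫ x, σ x ∂μ) ^ 2) :=
      Finset.sum_nonneg fun i _ => mul_nonneg (bco_pos hα i).le (hEσ i)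
    have h3 : bco α k * (Mom μ w σ (fun t => t ^ k)
        - cmom ((d : ℝ) - 1) k * (∫ x, σ x ∂μ) ^ 2) ≤ 0 := by linarith
    have h4 := nonpos_of_mul_nonpos_right h3 (bco_pos hα k)
    linarith [hEσ k]
  set a := (∫ x, G x ∂μ) ^ 2
  set s := (∫ x, σ x ∂μ) ^ 2
  have hs : 0 ≤ s := sq_nonneg _
  set P := Mom μ w G (fun t => (1 - t) ^ (-α) * (((d : ℝ) - 1 - α) * t - α))
  have h1 := (mom_K_tendsto hw hG hα hKG).mul_const s
  have h2 := ((mom_K_tendsto hw hσ hα hKσ).mul_const a).add_const (C * s * P)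
  refine le_of_tendsto_of_tendsto' h1 h2 fun i => ?_
  have hr := rseq_mem i
  have k1 := (mom_K_hasSum hw hG hα hr).mul_right s
  have k2 := (mom_K_hasSum hw hσ hα hr).mul_right a
  have k3 := k1.sub k2
  have : Mom μ w G (fun t => (1 - rseq i * t) ^ (-α)) * s
      - Mom μ w σ (fun t => (1 - rseq i * t) ^ (-α)) * a ≤ C * s * P := by
    refine le_of_tendsto' k3.tendsto_sum_nat fun N => ?_
    calc _ = s * ∑ k ∈ Finset.range N, (rseq i) ^ k * (bco α k * (Mom μ w G (fun t => t ^ k)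
        - cmom ((d : ℝ) - 1) k * a)) := by
          rw [Finset.mul_sum]
          refine Finset.sum_congr rfl fun k _ => ?_
          rw [hz k]
          ring
      _ ≤ s * ∑ k ∈ Finset.range N, (bco α k * (Mom μ w G (fun t => t ^ k)
        - cmom ((d : ℝ) - 1) k * a)) := by
          refine mul_le_mul_of_nonneg_left (Finset.sum_le_sum fun k _ => ?_) hs
          have b1 : (rseq i) ^ k ≤ 1 := pow_le_one₀ hr.1 hr.2.le
          have b2 := mul_nonneg (bco_pos hα k).le (hE k)
          calc _ ≤ 1 * _ := mul_le_mul_of_nonneg_right b1 b2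
            _ = _ := one_mul _
      _ ≤ s * (C * P) := mul_le_mul_of_nonneg_left (hS N) hs
      _ = _ := by ring
  linarith

/-! ### Inversion and explicit integrals -/

lemma lint_gamma {r b : ℝ} (hr : 0 < r) (hb : 0 < b) :
    ∫⁻ t in Set.Ioi (0:ℝ), ENNReal.ofReal (t ^ (r - 1) * rexp (-(b * t)))
      = ENNReal.ofReal (b ^ (-r) * Gamma r) := by
  have h := integral_rpow_mul_exp_neg_mul_Ioi hr hb
  have hint : IntegrableOn (fun t : ℝ => t ^ (r - 1) * rexp (-(b * t))) (Set.Ioi 0) := by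
    have := integrableOn_rpow_mul_exp_neg_mul_rpow (p := 1) (s := r - 1) (b := b) (by linarith)
      one_pos hb
    simpa [neg_mul] using this
  rw [← ofReal_integral_eq_lintegral_ofReal hint, h]
  · rw [one_div, inv_rpow hb.le, rpow_neg hb.le]
  · refine (ae_restrict_iff' measurableSet_Ioi).2 (Eventually.of_forall fun t ht => ?_)
    have : 0 < t := ht
    show (0:ℝ) ≤ _
    positivity

lemma lint_of_gauss {V : Type*} [MeasurableSpace V] (μ : Measure V) [SFinite μ] (N : V → ℝ)
    (hN : Measurable N) (hN0 : ∀ v, 0 ≤ N v) {k r : ℝ} (hk : 0 ≤ k)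
    (hg : ∀ t : ℝ, 0 < t → ∫⁻ v, ENNReal.ofReal (rexp (-(t * N v))) ∂μ = ENNReal.ofReal ((π / t) ^ k))
    (hr : k < r) :
    ∫⁻ v, ENNReal.ofReal ((1 + N v) ^ (-r)) ∂μ
      = ENNReal.ofReal (π ^ k * Gamma (r - k) / Gamma r) := by
  have hr0 : 0 < r := by linarith
  have hG : 0 < Gamma r := Gamma_pos_of_pos hr0
  have key : ENNReal.ofReal (Gamma r) * ∫⁻ v, ENNReal.ofReal ((1 + N v) ^ (-r)) ∂μ
      = ENNReal.ofReal (π ^ k * Gamma (r - k)) := by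
    rw [← lintegral_const_mul' _ _ ENNReal.ofReal_ne_top]
    have e : ∀ v, ENNReal.ofReal (Gamma r) * ENNReal.ofReal ((1 + N v) ^ (-r))
        = ∫⁻ t in Set.Ioi (0:ℝ), ENNReal.ofReal (t ^ (r - 1) * rexp (-((1 + N v) * t))) := by
      intro v
      rw [lint_gamma hr0 (by linarith [hN0 v]), ← ENNReal.ofReal_mul hG.le, mul_comm]
    simp only [e]
    rw [lintegral_lintegral_swap]
    · have e2 : ∀ t ∈ Set.Ioi (0:ℝ), ∫⁻ v, ENNReal.ofReal (t ^ (r - 1) * rexp (-((1 + N v) * t))) ∂μ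
          = ENNReal.ofReal (π ^ k) * ENNReal.ofReal (t ^ (r - k - 1) * rexp (-(1 * t))) := by
        intro t ht
        have ht0 : 0 < t := ht
        have e3 : ∀ v, ENNReal.ofReal (t ^ (r - 1) * rexp (-((1 + N v) * t)))
            = ENNReal.ofReal (t ^ (r - 1) * rexp (-t)) * ENNReal.ofReal (rexp (-(t * N v))) := by
          intro v
          rw [← ENNReal.ofReal_mul (by positivity), mul_assoc (t ^ (r-1)), ← Real.exp_add]
          congr 3; ring
        simp only [e3]
        rw [lintegral_const_mul' _ _ ENNReal.ofReal_ne_top, hg t ht0,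
          ← ENNReal.ofReal_mul (by positivity), ← ENNReal.ofReal_mul (by positivity)]
        congr 1
        rw [div_rpow pi_pos.le ht0.le, sub_right_comm, rpow_sub ht0 (r - 1) k, one_mul]
        ring
      rw [setLIntegral_congr_fun measurableSet_Ioi e2,
        lintegral_const_mul' _ _ ENNReal.ofReal_ne_top, lint_gamma (by linarith) one_pos,
        one_rpow, one_mul, ← ENNReal.ofReal_mul (by positivity)]
    · apply Measurable.aemeasurable
      fun_prop
  have h0 : ENNReal.ofReal (Gamma r) ≠ 0 := by simpa using hG
  rw [div_eq_mul_inv, mul_comm, ENNReal.ofReal_mul (inv_pos.2 hG).le, ← key, ← mul_assoc,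
    ← ENNReal.ofReal_mul (inv_pos.2 hG).le, inv_mul_cancel₀ hG.ne']
  simp

lemma lint_gauss_euc (n : ℕ) {t : ℝ} (ht : 0 < t) :
    ∫⁻ v : Euc n, ENNReal.ofReal (rexp (-(t * ‖v‖ ^ 2)))
      = ENNReal.ofReal ((π / t) ^ ((n : ℝ) / 2)) := by
  have h := GaussianFourier.integral_rexp_neg_mul_sq_norm (V := Euc n) ht
  rw [finrank_euclideanSpace_fin] at h
  have hpos : 0 < (π / t) ^ ((n : ℝ) / 2) := by positivity
  have hint : Integrable (fun v : Euc n => rexp (-t * ‖v‖ ^ 2)) := by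
    by_contra hc
    rw [integral_undef hc] at h
    linarith
  rw [← h, ofReal_integral_eq_lintegral_ofReal hint (Eventually.of_forall fun v => (exp_pos _).le)]
  simp [neg_mul]

lemma lint_bubble (n : ℕ) {r : ℝ} (hr : (n : ℝ) / 2 < r) :
    ∫⁻ v : Euc n, ENNReal.ofReal ((1 + ‖v‖ ^ 2) ^ (-r))
      = ENNReal.ofReal (π ^ ((n : ℝ) / 2) * Gamma (r - (n : ℝ) / 2) / Gamma r) :=
  lint_of_gauss volume (fun v : Euc n => ‖v‖ ^ 2) (by fun_prop) (fun v => by positivity)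
    (by positivity) (fun t ht => lint_gauss_euc n ht) hr

lemma lint_inversion (n : ℕ) (c : Euc n) {R : ℝ} (hn : 1 ≤ n) (hR : 0 < R) (f : Euc n → ENNReal) :
    ∫⁻ y, f y = ∫⁻ z, ENNReal.ofReal ((R / ‖z - c‖) ^ (2 * n)) * f (EuclideanGeometry.inversion c R z) := by
  have : Nonempty (Fin n) := ⟨⟨0, hn⟩⟩
  have hs : MeasurableSet ({c}ᶜ : Set (Euc n)) := (measurableSet_singleton c).compl
  have himg : EuclideanGeometry.inversion c R '' ({c}ᶜ : Set (Euc n)) = {c}ᶜ := by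
    ext y
    constructor
    · rintro ⟨x, hx, rfl⟩
      simpa [EuclideanGeometry.inversion_eq_center hR.ne'] using hx
    · intro hy
      refine ⟨EuclideanGeometry.inversion c R y, ?_, EuclideanGeometry.inversion_inversion c hR.ne' y⟩
      simpa [EuclideanGeometry.inversion_eq_center hR.ne'] using hy
  have h := lintegral_image_eq_lintegral_abs_det_fderiv_mul volume hs
    (f := EuclideanGeometry.inversion c R)
    (fun x hx => (EuclideanGeometry.hasFDerivAt_inversion (R := R) (by simpa using hx)).hasFDerivWithinAt)
    ((EuclideanGeometry.inversion_injective c hR.ne').injOn) f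
  rw [himg] at h
  have hr : (volume : Measure (Euc n)).restrict ({c}ᶜ) = volume := by
    rw [Measure.restrict_eq_self_of_ae_mem]
    rw [ae_iff]
    have : {a : Euc n | a ∉ ({c}ᶜ : Set (Euc n))} = {c} := by ext; simp
    rw [this]
    exact measure_singleton c
  rw [hr] at h
  rw [h]
  refine lintegral_congr fun z => ?_
  congr 2
  rw [ContinuousLinearMap.det, ContinuousLinearMap.toLinearMap_smul, LinearMap.det_smul,
    finrank_euclideanSpace_fin, abs_mul, dist_eq_norm, ← pow_mul]
  have hd : |LinearMap.det ((((ℝ ∙ (z - c))ᗮ.reflection : Euc n →L[ℝ] Euc n)) : Euc n →ₗ[ℝ] Euc n)| = 1 := by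
    have := Submodule.det_reflection ((ℝ ∙ (z - c))ᗮ)
    erw [this]
    simp [abs_pow]
  rw [hd, mul_one, abs_of_nonneg (by positivity)]

lemma inversion_one_add (n : ℕ) (c z : Euc n) (hz : z ≠ c) {R : ℝ} (hR : R ^ 2 = 1 + ‖c‖ ^ 2) :
    1 + ‖EuclideanGeometry.inversion c R z‖ ^ 2 = R ^ 2 / ‖z - c‖ ^ 2 * (1 + ‖z‖ ^ 2) := by
  have h0 : ‖z - c‖ ≠ 0 := by simpa [sub_eq_zero] using hz
  have e : EuclideanGeometry.inversion c R z = (R / ‖z - c‖) ^ 2 • (z - c) + c := by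
    rw [EuclideanGeometry.inversion_def]; simp only [dist_eq_norm]; rfl
  have hzz : ‖z‖ ^ 2 = ‖z - c‖ ^ 2 + 2 * inner ℝ (z - c) c + ‖c‖ ^ 2 := by
    rw [← norm_add_sq_real, sub_add_cancel]
  rw [e, norm_add_sq_real, norm_smul, inner_smul_left, hzz, norm_of_nonneg (by positivity)]
  simp only [RCLike.conj_to_real, div_pow, mul_pow]
  have hR2 : ‖c‖ ^ 2 = R ^ 2 - 1 := by linarith
  rw [hR2]
  field_simp
  ring

/-- conformal convolution identity -/
lemma lint_conv (n : ℕ) (hn : 1 ≤ n) (l : ℝ) (x : Euc n) :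
    ∫⁻ y : Euc n, ENNReal.ofReal (‖x - y‖ ^ (-l) * (1 + ‖y‖ ^ 2) ^ (-((2 * n - l) / 2)))
      = ENNReal.ofReal ((1 + ‖x‖ ^ 2) ^ (-(l / 2))) *
        ∫⁻ y : Euc n, ENNReal.ofReal ((1 + ‖y‖ ^ 2) ^ (-((2 * n - l) / 2))) := by
  have : Nonempty (Fin n) := ⟨⟨0, hn⟩⟩
  have h1 : 0 < 1 + ‖x‖ ^ 2 := by positivity
  set R := Real.sqrt (1 + ‖x‖ ^ 2) with hRdef
  have hR : 0 < R := Real.sqrt_pos.2 h1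
  have hR2 : R ^ 2 = 1 + ‖x‖ ^ 2 := Real.sq_sqrt h1.le
  rw [lint_inversion n x hn hR, ← lintegral_const_mul' _ _ ENNReal.ofReal_ne_top]
  refine lintegral_congr_ae ?_
  have hae : ∀ᵐ z : Euc n, z ≠ x := by
    rw [ae_iff]; simp
  filter_upwards [hae] with z hz
  have h0 : 0 < ‖z - x‖ := by simpa [sub_eq_zero] using hz
  rw [inversion_one_add n x z hz hR2, ← ENNReal.ofReal_mul (by positivity),
    ← ENNReal.ofReal_mul (by positivity)]
  congr 1
  have hd : ‖x - EuclideanGeometry.inversion x R z‖ = R ^ 2 / ‖z - x‖ := by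
    rw [← dist_eq_norm, EuclideanGeometry.dist_center_inversion, dist_comm, dist_eq_norm]
  have h3 : 0 < 1 + ‖z‖ ^ 2 := by positivity
  rw [hd, ← hR2, mul_rpow (by positivity) h3.le, ← mul_assoc, ← mul_assoc]
  congr 1
  generalize ‖z - x‖ = s at *
  rw [← div_pow, ← rpow_natCast (R / s) (2 * n), ← rpow_natCast (R / s) 2, ← rpow_mul (by positivity),
    div_rpow (by positivity) h0.le, div_rpow (by positivity) h0.le, div_rpow (by positivity) h0.le]
  simp only [← rpow_natCast R 2, ← rpow_mul hR.le]
  rw [div_mul_div_comm, div_mul_div_comm, ← rpow_add hR, ← rpow_add hR, ← rpow_add h0, ← rpow_add h0]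
  have ez : (↑(2 * n) + -l + ↑(2:ℕ) * -((2 * (n:ℝ) - l) / 2)) = 0 := by push_cast; ring
  rw [ez, rpow_zero, div_one]
  congr 1; push_cast; ring

/-! ### Stereographic projection -/

def srho {n : ℕ} (x : Euc n) : ℝ := 2 / (1 + ‖x‖ ^ 2)

def stw {n : ℕ} (x : Euc n) : Fin (n + 1) → ℝ := Fin.cons (1 - srho x) (fun i => srho x * x i)

def Cc (n : ℕ) (r : ℝ) : ℝ := π ^ ((n : ℝ) / 2) * Gamma (r - (n : ℝ) / 2) / Gamma r

def rk {n : ℕ} (α : ℝ) (p : Euc n × Euc n) : ℝ := ‖p.1 - p.2‖ ^ (-(2 * α))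

/-- the HLS double integral -/
def II {n : ℕ} (α : ℝ) (F : Euc n → ℝ) : ℝ := ∫ p : Euc n × Euc n, F p.1 * F p.2 * rk α p

def QQ {n : ℕ} (α : ℝ) (F : Euc n → ℝ) : ℝ :=
  ∫ p : Euc n × Euc n, F p.1 * F p.2 * rk α p * (((n : ℝ) - α) * tk stw p - α)

lemma srho_pos {n : ℕ} (x : Euc n) : 0 < srho x := by unfold srho; positivity

lemma srho_le {n : ℕ} (x : Euc n) : srho x ≤ 2 := by
  unfold srho
  rw [div_le_iff₀ (by positivity)]
  nlinarith [sq_nonneg ‖x‖]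

lemma srho_mul {n : ℕ} (x : Euc n) : srho x * ‖x‖ ^ 2 = 2 - srho x := by
  unfold srho; field_simp; ring

lemma continuous_srho {n : ℕ} : Continuous (srho (n := n)) := by
  unfold srho
  exact continuous_const.div (by fun_prop) (fun x => by positivity)

@[fun_prop]
lemma measurable_srho {n : ℕ} : Measurable (srho (n := n)) := continuous_srho.measurable

lemma continuous_stw {n : ℕ} : Continuous (stw (n := n)) := by
  refine continuous_pi fun j => ?_
  refine Fin.cases ?_ (fun i => ?_) j
  · show Continuous fun a : Euc n => 1 - srho a
    exact continuous_const.sub continuous_srho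
  · have := (continuous_srho (n := n)).mul (EuclideanSpace.proj (𝕜 := ℝ) i).continuous
    exact this

lemma dotp_stw {n : ℕ} (x y : Euc n) :
    dotp (stw x) (stw y) = (1 - srho x) * (1 - srho y) + srho x * srho y * inner ℝ x y := by
  unfold dotp
  rw [Fin.sum_univ_succ]
  simp only [stw, Fin.cons_zero, Fin.cons_succ]
  congr 1
  rw [PiLp.inner_apply, Finset.mul_sum]
  refine Finset.sum_congr rfl fun i _ => ?_
  simp
  ring

lemma one_sub_dotp_stw {n : ℕ} (x y : Euc n) :
    1 - dotp (stw x) (stw y) = srho x * srho y * ‖x - y‖ ^ 2 / 2 := by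
  rw [dotp_stw, norm_sub_sq_real]
  have hx := srho_mul x
  have hy := srho_mul y
  linear_combination (-1/2 * srho y) * hx + (-1/2 * srho x) * hy

lemma measurable_rk {n : ℕ} (α : ℝ) : Measurable (rk (n := n) α) := by
  unfold rk; fun_prop

lemma rk_nonneg {n : ℕ} (α : ℝ) (p : Euc n × Euc n) : 0 ≤ rk α p := by
  unfold rk; positivity

lemma stw_unit {n : ℕ} (x : Euc n) : dotp (stw x) (stw x) = 1 := by
  have := one_sub_dotp_stw x x
  simp at this
  linarith

lemma ae_ne_prod {n : ℕ} (hn : 1 ≤ n) : ∀ᵐ p : Euc n × Euc n, p.1 ≠ p.2 := by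
  have : Nonempty (Fin n) := ⟨⟨0, hn⟩⟩
  have hms : MeasurableSet {p : Euc n × Euc n | p.1 ≠ p.2} :=
    (measurableSet_eq_fun measurable_fst measurable_snd).compl
  rw [Measure.volume_eq_prod, Measure.ae_prod_iff_ae_ae hms]
  refine Eventually.of_forall fun x => ?_
  have hae : ∀ᵐ z : Euc n, z ≠ x := by rw [ae_iff]; simp
  filter_upwards [hae] with z hz using hz.symm

lemma sphMap_stw {n : ℕ} (hn : 1 ≤ n) : SphMap (volume : Measure (Euc n)) stw where
  meas := continuous_stw.measurable
  unit := stw_unit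
  diag := by
    have := ae_ne_prod hn
    rw [Measure.volume_eq_prod] at this
    filter_upwards [this] with p hp
    have h := one_sub_dotp_stw p.1 p.2
    have h0 : 0 < ‖p.1 - p.2‖ := by simpa [sub_eq_zero] using hp
    have := srho_pos p.1
    have := srho_pos p.2
    have : 0 < srho p.1 * srho p.2 * ‖p.1 - p.2‖ ^ 2 / 2 := by positivity
    unfold tk
    linarith

lemma one_sub_tk_rpow {n : ℕ} (β : ℝ) (p : Euc n × Euc n) :
    (1 - tk stw p) ^ (-β) = 2 ^ β * srho p.1 ^ (-β) * srho p.2 ^ (-β) * rk β p := by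
  unfold tk rk
  have h1 := srho_pos p.1
  have h2 := srho_pos p.2
  rw [one_sub_dotp_stw, div_rpow (by positivity) (by norm_num), mul_rpow (by positivity) (by positivity),
    mul_rpow h1.le h2.le, ← rpow_natCast ‖p.1 - p.2‖ 2, ← rpow_mul (norm_nonneg _),
    rpow_neg (by norm_num : (0:ℝ) ≤ 2)]
  rw [div_inv_eq_mul]
  push_cast
  rw [show (2:ℝ) * -β = -(2 * β) by ring]
  ring

lemma stereo_kernel {n : ℕ} (α : ℝ) (F : Euc n → ℝ) (p : Euc n × Euc n) :
    (F p.1 * srho p.1 ^ α) * (F p.2 * srho p.2 ^ α) * (1 - tk stw p) ^ (-α)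
      = 2 ^ α * (F p.1 * F p.2 * rk α p) := by
  rw [one_sub_tk_rpow, rpow_neg (srho_pos p.1).le, rpow_neg (srho_pos p.2).le]
  have h1 := rpow_pos_of_pos (srho_pos p.1) α
  have h2 := rpow_pos_of_pos (srho_pos p.2) α
  field_simp

/-- integrability of the HLS integrand -/
lemma II_integrable {n : ℕ} {α : ℝ} (hα : 0 < α) (hn : 2 * α < n) {F : Euc n → ℝ} (hF : Measurable F)
    (hFq : Integrable (fun x => |F x| ^ ((n : ℝ) / (n - α)))) :
    Integrable (fun p : Euc n × Euc n => F p.1 * F p.2 * rk α p) := by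
  have hn1 : 1 ≤ n := by
    rcases Nat.eq_zero_or_pos n with h | h
    · subst h; simp at hn; linarith
    · exact h
  have hq0 : 0 < (n : ℝ) / (n - α) := div_pos (by linarith) (by linarith)
  set q := (n : ℝ) / (n - α) with hq
  obtain ⟨C, hC, H⟩ := hls_nonsharp (volume : Measure (Euc n)) (by simpa using hn1)
    (lam := 2 * α) (q := q) (by linarith) (by simpa using hn)
    (by simp only [finrank_euclideanSpace_fin]; rw [hq, ← mul_sub, mul_div_mul_left _ _ two_ne_zero])
  set A := ∫ x, |F x| ^ q with hA
  have hA0 : 0 ≤ A := integral_nonneg fun x => by positivity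
  set c : ℝ := (1 + A) ^ (-(1 / q)) with hc
  have hc0 : 0 < c := by positivity
  have h1 := H (fun x => c * |F x|) (by fun_prop) (fun x => by positivity) (by
    have e : ∀ x, (c * |F x|) ^ q = (1 + A)⁻¹ * |F x| ^ q := by
      intro x
      rw [mul_rpow hc0.le (abs_nonneg _), hc, ← rpow_mul (by positivity)]
      congr 1
      rw [show -(1 / q) * q = -1 by field_simp, rpow_neg_one]
    simp only [e]
    rw [← ofReal_integral_eq_lintegral_ofReal (hFq.const_mul _)
      (Eventually.of_forall fun x => by positivity), integral_const_mul, ← hA]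
    rw [ENNReal.ofReal_le_one, inv_mul_le_iff₀ (by positivity)]
    linarith)
  have hm : Measurable (fun p : Euc n × Euc n => (c * |F p.1|) * (c * |F p.2|) * rk α p) := by
    have := measurable_rk (n := n) α
    fun_prop
  have h2 : Integrable (fun p : Euc n × Euc n => (c * |F p.1|) * (c * |F p.2|) * rk α p) := by
    refine ⟨hm.aestronglyMeasurable, ?_⟩
    rw [hasFiniteIntegral_iff_ofReal (Eventually.of_forall fun p =>
      mul_nonneg (by positivity) (rk_nonneg _ _)), Measure.volume_eq_prod,
      lintegral_prod _ hm.ennreal_ofReal.aemeasurable]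
    exact lt_of_le_of_lt h1 ENNReal.ofReal_lt_top
  have h3 := h2.const_mul ((c * c)⁻¹)
  refine h3.mono' ?_ (Eventually.of_forall fun p => le_of_eq ?_)
  · have := measurable_rk (n := n) α
    exact Measurable.aestronglyMeasurable (by fun_prop)
  · rw [norm_mul, norm_mul, norm_of_nonneg (rk_nonneg _ _), Real.norm_eq_abs, Real.norm_eq_abs]
    field_simp

lemma Cc_pos {n : ℕ} {r : ℝ} (hr : (n : ℝ) / 2 < r) : 0 < Cc n r := by
  unfold Cc
  have h1 := Gamma_pos_of_pos (show 0 < r - (n:ℝ)/2 by linarith)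
  have h2 := Gamma_pos_of_pos (show 0 < r by linarith [show (0:ℝ) ≤ n / 2 by positivity])
  positivity

lemma integrable_bubble (n : ℕ) {r : ℝ} (hr : (n : ℝ) / 2 < r) :
    Integrable (fun v : Euc n => (1 + ‖v‖ ^ 2) ^ (-r)) := by
  refine ⟨Measurable.aestronglyMeasurable (by fun_prop), ?_⟩
  rw [hasFiniteIntegral_iff_ofReal (Eventually.of_forall fun p => by positivity), lint_bubble n hr]
  exact ENNReal.ofReal_lt_top

lemma integral_bubble (n : ℕ) {r : ℝ} (hr : (n : ℝ) / 2 < r) :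
    ∫ v : Euc n, (1 + ‖v‖ ^ 2) ^ (-r) = Cc n r := by
  rw [integral_eq_lintegral_of_nonneg_ae (Eventually.of_forall fun p => by positivity)
    (integrable_bubble n hr).1, lint_bubble n hr]
  exact ENNReal.toReal_ofReal (Cc_pos hr).le

lemma srho_rpow {n : ℕ} (x : Euc n) (r : ℝ) : srho x ^ r = 2 ^ r * (1 + ‖x‖ ^ 2) ^ (-r) := by
  unfold srho
  rw [div_rpow (by norm_num) (by positivity), rpow_neg (by positivity)]
  rfl

lemma integrable_srho (n : ℕ) {r : ℝ} (hr : (n : ℝ) / 2 < r) :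
    Integrable (fun v : Euc n => srho v ^ r) := by
  simp only [srho_rpow]
  exact (integrable_bubble n hr).const_mul _

lemma integral_srho (n : ℕ) {r : ℝ} (hr : (n : ℝ) / 2 < r) :
    ∫ v : Euc n, srho v ^ r = 2 ^ r * Cc n r := by
  simp only [srho_rpow]
  rw [integral_const_mul, integral_bubble n hr]

lemma lint_JJ (n : ℕ) (hn : 1 ≤ n) {β : ℝ} (hβ : 2 * β < n) :
    ∫⁻ p : Euc n × Euc n, ENNReal.ofReal (srho p.1 ^ ((n:ℝ) - β) * srho p.2 ^ ((n:ℝ) - β) * rk β p)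
      = ENNReal.ofReal (2 ^ ((n:ℝ) - 2 * β) * Cc n (n - β) * (2 ^ (n:ℝ) * Cc n n)) := by
  have hm : Measurable (fun p : Euc n × Euc n => srho p.1 ^ ((n:ℝ) - β) * srho p.2 ^ ((n:ℝ) - β) * rk β p) := by
    have := measurable_rk (n := n) β
    fun_prop
  have hnr : (1:ℝ) ≤ n := by exact_mod_cast hn
  have hC1 := Cc_pos (n := n) (r := n - β) (by linarith)
  have hC2 := Cc_pos (n := n) (r := n) (by linarith)
  rw [Measure.volume_eq_prod, lintegral_prod _ hm.ennreal_ofReal.aemeasurable]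
  have inner : ∀ x : Euc n, ∫⁻ y : Euc n, ENNReal.ofReal
      (srho x ^ ((n:ℝ) - β) * srho y ^ ((n:ℝ) - β) * rk β (x, y))
      = ENNReal.ofReal (2 ^ ((n:ℝ) - 2 * β) * Cc n (n - β)) * ENNReal.ofReal (srho x ^ (n:ℝ)) := by
    intro x
    have hx := srho_pos x
    have e : ∀ y : Euc n, ENNReal.ofReal (srho x ^ ((n:ℝ) - β) * srho y ^ ((n:ℝ) - β) * rk β (x, y))
        = ENNReal.ofReal (srho x ^ ((n:ℝ) - β) * 2 ^ ((n:ℝ) - β)) *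
          ENNReal.ofReal (‖x - y‖ ^ (-(2 * β)) * (1 + ‖y‖ ^ 2) ^ (-((2 * n - 2 * β) / 2))) := by
      intro y
      rw [← ENNReal.ofReal_mul (by positivity)]
      congr 1
      rw [srho_rpow y, rk, show (2 * (n:ℝ) - 2 * β) / 2 = n - β by ring]
      ring
    simp only [e]
    rw [lintegral_const_mul' _ _ ENNReal.ofReal_ne_top, lint_conv n hn,
      show (2 * (n:ℝ) - 2 * β) / 2 = n - β by ring, lint_bubble n (by linarith), ← Cc,
      ← ENNReal.ofReal_mul (by positivity), ← ENNReal.ofReal_mul (by positivity),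
      ← ENNReal.ofReal_mul (by positivity)]
    congr 1
    have e1 : (1 + ‖x‖ ^ 2) ^ (-(2 * β / 2)) = srho x ^ β * 2 ^ (-β) := by
      rw [srho_rpow, show 2 * β / 2 = β by ring, rpow_neg (by norm_num : (0:ℝ) ≤ 2)]
      field_simp
    have e2 : srho x ^ (n:ℝ) = srho x ^ ((n:ℝ) - β) * srho x ^ β := by
      rw [← rpow_add hx]; congr 1; ring
    have e3 : (2:ℝ) ^ ((n:ℝ) - 2 * β) = 2 ^ ((n:ℝ) - β) * 2 ^ (-β) := by
      rw [← rpow_add (by norm_num)]; congr 1; ring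
    rw [e1, e2, e3]; ring
  simp only [inner]
  rw [lintegral_const_mul' _ _ ENNReal.ofReal_ne_top,
    ← ofReal_integral_eq_lintegral_ofReal (integrable_srho n (by linarith))
      (Eventually.of_forall fun x => (rpow_pos_of_pos (srho_pos x) _).le),
    integral_srho n (by linarith), ← ENNReal.ofReal_mul (by positivity)]

lemma JJ_nonneg {n : ℕ} (β : ℝ) (p : Euc n × Euc n) :
    0 ≤ srho p.1 ^ ((n:ℝ) - β) * srho p.2 ^ ((n:ℝ) - β) * rk β p := by
  have h1 := srho_pos p.1
  have h2 := srho_pos p.2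
  exact mul_nonneg (by positivity) (rk_nonneg _ _)

lemma JJ_integrable (n : ℕ) (hn : 1 ≤ n) {β : ℝ} (hβ : 2 * β < n) :
    Integrable (fun p : Euc n × Euc n => srho p.1 ^ ((n:ℝ) - β) * srho p.2 ^ ((n:ℝ) - β) * rk β p) := by
  have := measurable_rk (n := n) β
  refine ⟨Measurable.aestronglyMeasurable (by fun_prop), ?_⟩
  rw [hasFiniteIntegral_iff_ofReal (Eventually.of_forall fun p => JJ_nonneg β p), lint_JJ n hn hβ]
  exact ENNReal.ofReal_lt_top

lemma JJ_integral (n : ℕ) (hn : 1 ≤ n) {β : ℝ} (hβ : 2 * β < n) :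
    ∫ p : Euc n × Euc n, srho p.1 ^ ((n:ℝ) - β) * srho p.2 ^ ((n:ℝ) - β) * rk β p
      = 2 ^ ((n:ℝ) - 2 * β) * Cc n (n - β) * (2 ^ (n:ℝ) * Cc n n) := by
  have hnr : (1:ℝ) ≤ n := by exact_mod_cast hn
  have hC1 := Cc_pos (n := n) (r := n - β) (by linarith)
  have hC2 := Cc_pos (n := n) (r := n) (by linarith)
  rw [integral_eq_lintegral_of_nonneg_ae (Eventually.of_forall fun p => JJ_nonneg β p)
    (JJ_integrable n hn hβ).1, lint_JJ n hn hβ, ENNReal.toReal_ofReal (by positivity)]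

lemma Cc_shift {n : ℕ} (hn : 1 ≤ n) {α : ℝ} (hα : 2 * α < n) :
    ((n:ℝ) - 2 * α) * Cc n (n - α) = 2 * (n - α) * Cc n (n - (α - 1)) := by
  have hnr : (1:ℝ) ≤ n := by exact_mod_cast hn
  unfold Cc
  have h1 : (n:ℝ) - α ≠ 0 := by linarith
  have h2 : (n:ℝ) - α - n / 2 ≠ 0 := by linarith
  rw [show (n:ℝ) - (α - 1) = (n - α) + 1 by ring, Gamma_add_one h1,
    show (n:ℝ) - α + 1 - n / 2 = (n - α - n / 2) + 1 by ring, Gamma_add_one h2]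
  have h3 : Gamma ((n:ℝ) - α) ≠ 0 := (Gamma_pos_of_pos (by linarith)).ne'
  field_simp
  ring

/-- The sphere inequality transported to Euclidean space. -/
theorem stereo_ineq {n : ℕ} {α : ℝ} (hα : 0 < α) (hn : 2 * α < n) :
    ∃ C : ℝ, 0 ≤ C ∧ ∀ F : Euc n → ℝ, Measurable F → (∀ x, 0 ≤ F x) →
      Integrable (fun x => |F x| ^ ((n : ℝ) / (n - α))) → Integrable (fun x => F x * srho x ^ α) →
      II α F ≤ 2 ^ ((n:ℝ) - 2 * α) * Cc n (n - α) / (2 ^ (n:ℝ) * Cc n n) * (∫ x, F x * srho x ^ α) ^ 2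
        + C * QQ α F := by
  have hn1 : 1 ≤ n := by
    rcases Nat.eq_zero_or_pos n with h | h
    · subst h; simp at hn; linarith
    · exact h
  have hnr : (1:ℝ) ≤ n := by exact_mod_cast hn1
  obtain ⟨C, hC, H⟩ := sphere_ineq (n + 1) (by omega) α hα (by push_cast; linarith)
  refine ⟨C, hC, fun F hF hF0 hFq hint => ?_⟩
  have hC1 := Cc_pos (n := n) (r := n - α) (by linarith)
  have hC2 := Cc_pos (n := n) (r := n) (by linarith)
  set B' := 2 ^ (n:ℝ) * Cc n n with hB'
  have hB : 0 < B' := by positivity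
  set σ : Euc n → ℝ := fun x => srho x ^ ((n:ℝ) - α) * srho x ^ α with hσ
  have hσn : ∀ x, σ x = srho x ^ (n:ℝ) := by
    intro x; rw [hσ]; simp only; rw [← rpow_add (srho_pos x)]; congr 1; ring
  have hσi : Integrable σ := by
    simp only [funext hσn]; exact integrable_srho n (by linarith)
  have hσI : ∫ x, σ x = B' := by
    simp only [hσn]; exact integral_srho n (by linarith)
  have kσ : ∀ p : Euc n × Euc n, σ p.1 * σ p.2 * (1 - tk stw p) ^ (-α)
      = 2 ^ α * (srho p.1 ^ ((n:ℝ) - α) * srho p.2 ^ ((n:ℝ) - α) * rk α p) :=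
    fun p => stereo_kernel α (fun x => srho x ^ ((n:ℝ) - α)) p
  have kσ2 : ∀ p : Euc n × Euc n, σ p.1 * σ p.2 * (1 - tk stw p) ^ (-(α - 1))
      = 2 ^ (α - 1) * (srho p.1 ^ ((n:ℝ) - (α - 1)) * srho p.2 ^ ((n:ℝ) - (α - 1)) * rk (α - 1) p) := by
    intro p
    rw [← stereo_kernel (α - 1) (fun x => srho x ^ ((n:ℝ) - (α - 1))) p, hσn, hσn]
    simp only [← rpow_add (srho_pos _)]
    norm_num
  have hdiag := (sphMap_stw hn1).diag
  have hvol : (volume : Measure (Euc n × Euc n)) = (volume : Measure (Euc n)).prod volume := rfl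
  have hKσ : Mom volume stw σ (fun t => (1 - t) ^ (-α)) = 2 ^ α * (2 ^ ((n:ℝ) - 2 * α) * Cc n (n - α) * B') := by
    unfold Mom
    simp only [kσ]
    rw [integral_const_mul, ← hvol, JJ_integral n hn1 hn]
  have hKG : Mom volume stw (fun x => F x * srho x ^ α) (fun t => (1 - t) ^ (-α)) = 2 ^ α * II α F := by
    unfold Mom II
    simp only [stereo_kernel]
    rw [integral_const_mul, ← hvol]
  have hPG : Mom volume stw (fun x => F x * srho x ^ α)
      (fun t => (1 - t) ^ (-α) * ((((n + 1 : ℕ):ℝ) - 1 - α) * t - α)) = 2 ^ α * QQ α F := by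
    unfold Mom QQ
    rw [← integral_const_mul, ← hvol]
    refine integral_congr_ae (Eventually.of_forall fun p => ?_)
    simp only
    rw [← mul_assoc, stereo_kernel]
    push_cast
    ring
  have hPσ : Mom volume stw σ (fun t => (1 - t) ^ (-α) * ((((n + 1 : ℕ):ℝ) - 1 - α) * t - α)) = 0 := by
    have i1 := (JJ_integrable n hn1 hn).const_mul (((n:ℝ) - 2 * α) * 2 ^ α)
    have i2 := (JJ_integrable n hn1 (β := α - 1) (by linarith)).const_mul (((n:ℝ) - α) * 2 ^ (α - 1))
    have e : Mom volume stw σ (fun t => (1 - t) ^ (-α) * ((((n + 1 : ℕ):ℝ) - 1 - α) * t - α))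
        = ∫ p : Euc n × Euc n,
          ((((n:ℝ) - 2 * α) * 2 ^ α) * (srho p.1 ^ ((n:ℝ) - α) * srho p.2 ^ ((n:ℝ) - α) * rk α p)
          - (((n:ℝ) - α) * 2 ^ (α - 1)) *
            (srho p.1 ^ ((n:ℝ) - (α - 1)) * srho p.2 ^ ((n:ℝ) - (α - 1)) * rk (α - 1) p)) := by
      unfold Mom
      rw [hvol]
      refine integral_congr_ae ?_
      filter_upwards [hdiag] with p hp
      rw [mul_assoc ((n:ℝ) - 2 * α), mul_assoc ((n:ℝ) - α), ← kσ, ← kσ2]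
      have h1 : 0 < 1 - tk stw p := by linarith
      rw [show -(α - 1) = -α + 1 by ring, rpow_add h1, rpow_one]
      push_cast
      ring
    rw [e, integral_sub i1 i2, integral_const_mul, integral_const_mul, JJ_integral n hn1 hn,
      JJ_integral n hn1 (by linarith), ← hB']
    have := Cc_shift hn1 hn
    have h2 : (2:ℝ) ^ ((n:ℝ) - 2 * (α - 1)) = 2 ^ ((n:ℝ) - 2 * α) * 4 := by
      rw [show (n:ℝ) - 2 * (α - 1) = (n - 2 * α) + 2 by ring, rpow_add (by norm_num)]
      norm_num
    have h3 : (2:ℝ) ^ α = 2 ^ (α - 1) * 2 := by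
      rw [← rpow_add_one (by norm_num)]; congr 1; ring
    rw [h2, h3]
    linear_combination (2 ^ (α - 1) * 2 * 2 ^ ((n:ℝ) - 2 * α) * B') * this
  have iG : Integrable (fun p : Euc n × Euc n => (F p.1 * srho p.1 ^ α) * (F p.2 * srho p.2 ^ α) *
      (1 - tk stw p) ^ (-α)) ((volume : Measure (Euc n)).prod volume) := by
    simp only [stereo_kernel]
    exact (II_integrable hα hn hF hFq).const_mul _
  have iσ : Integrable (fun p : Euc n × Euc n => σ p.1 * σ p.2 *
      (1 - tk stw p) ^ (-α)) ((volume : Measure (Euc n)).prod volume) := by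
    simp only [kσ]
    exact (JJ_integrable n hn1 hn).const_mul _
  have main := H volume stw (fun x => F x * srho x ^ α) σ (sphMap_stw hn1) hint hσi iG iσ hPσ
  rw [hKG, hKσ, hPG, hσI] at main
  have h2α : (0:ℝ) < 2 ^ α := by positivity
  have main2 : II α F * B' ^ 2 ≤ 2 ^ ((n:ℝ) - 2 * α) * Cc n (n - α) * B' * (∫ x, F x * srho x ^ α) ^ 2
      + C * B' ^ 2 * QQ α F := by
    refine le_of_mul_le_mul_left ?_ h2α
    linarith [main]
  rw [div_mul_eq_mul_div, ← sub_le_iff_le_add, le_div_iff₀ hB]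
  refine le_of_mul_le_mul_right ?_ hB
  linarith [main2]

/-! ### Centering -/

def cenD {n : ℕ} (θ : ℝ × Euc n) : ℝ := (1 + rexp θ.1 ^ 2 + ‖θ.2‖ ^ 2) / rexp θ.1

def cenR {n : ℕ} (θ : ℝ × Euc n) (x : Euc n) : ℝ :=
  (rexp θ.1 ^ 2 + ‖x - θ.2‖ ^ 2) / (rexp θ.1 * (1 + ‖x‖ ^ 2))

lemma cenD_pos {n : ℕ} (θ : ℝ × Euc n) : 0 < cenD θ := by unfold cenD; positivity
lemma cenR_pos {n : ℕ} (θ : ℝ × Euc n) (x : Euc n) : 0 < cenR θ x := by unfold cenR; positivity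

lemma cenR_le {n : ℕ} (θ : ℝ × Euc n) (x : Euc n) : cenR θ x ≤ 2 * cenD θ := by
  unfold cenR cenD
  have h := exp_pos θ.1
  rw [mul_div_assoc', div_le_div_iff₀ (by positivity) h]
  have h1 : ‖x - θ.2‖ ≤ ‖x‖ + ‖θ.2‖ := norm_sub_le _ _
  have h2 : ‖x - θ.2‖ ^ 2 ≤ 2 * ‖x‖ ^ 2 + 2 * ‖θ.2‖ ^ 2 := by
    nlinarith [norm_nonneg (x - θ.2), sq_nonneg (‖x‖ - ‖θ.2‖)]
  have h3 : rexp θ.1 ^ 2 + ‖x - θ.2‖ ^ 2 ≤ 2 * (1 + rexp θ.1 ^ 2 + ‖θ.2‖ ^ 2) * (1 + ‖x‖ ^ 2) := by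
    nlinarith [sq_nonneg (rexp θ.1), sq_nonneg ‖x‖, sq_nonneg ‖θ.2‖,
      mul_nonneg (sq_nonneg (rexp θ.1)) (sq_nonneg ‖x‖), mul_nonneg (sq_nonneg ‖θ.2‖) (sq_nonneg ‖x‖)]
  nlinarith

lemma le_cenR {n : ℕ} (θ : ℝ × Euc n) (x : Euc n) : (cenD θ)⁻¹ ≤ cenR θ x := by
  unfold cenR cenD
  have h := exp_pos θ.1
  rw [inv_div, div_le_div_iff₀ (by positivity) (by positivity)]
  have h1 : ‖x‖ ≤ ‖x - θ.2‖ + ‖θ.2‖ := by simpa using norm_add_le (x - θ.2) θ.2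
  have h2 : 1 + ‖x‖ ^ 2 ≤ 1 + (‖x - θ.2‖ + ‖θ.2‖) ^ 2 := by
    have := norm_nonneg x
    gcongr
  have h3 : rexp θ.1 ^ 2 * (1 + (‖x - θ.2‖ + ‖θ.2‖) ^ 2) ≤
      (rexp θ.1 ^ 2 + ‖x - θ.2‖ ^ 2) * (1 + rexp θ.1 ^ 2 + ‖θ.2‖ ^ 2) := by
    nlinarith [sq_nonneg (rexp θ.1 ^ 2 - ‖x - θ.2‖ * ‖θ.2‖), sq_nonneg ‖x - θ.2‖]
  calc rexp θ.1 * (rexp θ.1 * (1 + ‖x‖ ^ 2)) = rexp θ.1 ^ 2 * (1 + ‖x‖ ^ 2) := by ring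
    _ ≤ rexp θ.1 ^ 2 * (1 + (‖x - θ.2‖ + ‖θ.2‖) ^ 2) := by gcongr
    _ ≤ _ := h3

lemma norm_le_cenD {n : ℕ} (θ : ℝ × Euc n) : ‖θ‖ ≤ cenD θ := by
  have h := exp_pos θ.1
  have hD : cenD θ = rexp (-θ.1) + rexp θ.1 + ‖θ.2‖ ^ 2 * rexp (-θ.1) := by
    unfold cenD; rw [Real.exp_neg]; field_simp
  have hx : rexp (-θ.1) * rexp θ.1 = 1 := by rw [← Real.exp_add]; simp
  have h' := exp_pos (-θ.1)
  rw [Prod.norm_def]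
  refine max_le ?_ ?_
  · rw [Real.norm_eq_abs, hD]
    have := add_one_le_exp θ.1
    have := add_one_le_exp (-θ.1)
    have : 0 ≤ ‖θ.2‖ ^ 2 * rexp (-θ.1) := by positivity
    rcases abs_cases θ.1 with h | h <;> rw [h.1] <;> linarith
  · rw [hD]
    have h1 : ‖θ.2‖ ≤ rexp θ.1 + ‖θ.2‖ ^ 2 * rexp (-θ.1) := by
      have : 0 ≤ (rexp θ.1 - ‖θ.2‖) ^ 2 * rexp (-θ.1) := by positivity
      have e : (rexp θ.1 - ‖θ.2‖) ^ 2 * rexp (-θ.1) =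
          rexp θ.1 - 2 * ‖θ.2‖ + ‖θ.2‖ ^ 2 * rexp (-θ.1) := by
        linear_combination (rexp θ.1 - 2 * ‖θ.2‖) * hx
      have := norm_nonneg θ.2
      linarith
    linarith

lemma one_le_cenD {n : ℕ} (θ : ℝ × Euc n) : 1 ≤ cenD θ := by
  unfold cenD
  rw [le_div_iff₀ (exp_pos _)]
  nlinarith [sq_nonneg (rexp θ.1 - 1), sq_nonneg ‖θ.2‖]

lemma abs_log_cenR {n : ℕ} (θ : ℝ × Euc n) (x : Euc n) : |log (cenR θ x)| ≤ log (2 * cenD θ) := by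
  have h1 := log_le_log (cenR_pos θ x) (cenR_le θ x)
  have h2 := log_le_log (inv_pos.2 (cenD_pos θ)) (le_cenR θ x)
  rw [log_inv] at h2
  have h3 := log_le_log (cenD_pos θ) (show cenD θ ≤ 2 * cenD θ by linarith [cenD_pos θ])
  rw [abs_le]
  constructor <;> linarith

lemma continuous_cenD {n : ℕ} : Continuous (cenD (n := n)) := by
  unfold cenD
  exact Continuous.div (by fun_prop) (by fun_prop) (fun θ => (exp_pos _).ne')

lemma continuous_cenR {n : ℕ} (x : Euc n) : Continuous (fun θ : ℝ × Euc n => cenR θ x) := by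
  unfold cenR
  exact Continuous.div (by fun_prop) (by fun_prop) (fun θ => by positivity)

lemma continuous_cenR' {n : ℕ} (θ : ℝ × Euc n) : Continuous (cenR θ) := by
  unfold cenR
  exact Continuous.div (by fun_prop) (by fun_prop) (fun θ => by positivity)

def cenH {n : ℕ} (f : Euc n → ℝ) (θ : ℝ × Euc n) : ℝ := ∫ x, f x * log (cenR θ x)

lemma cenH_integrable {n : ℕ} {f : Euc n → ℝ} (hf : Integrable f) (θ : ℝ × Euc n) :
    Integrable (fun x => f x * log (cenR θ x)) := by
  refine hf.mul_bdd (c := log (2 * cenD θ)) ?_ (Eventually.of_forall fun x => abs_log_cenR θ x)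
  exact ((continuous_cenR' θ).log fun x => (cenR_pos θ x).ne').aestronglyMeasurable

lemma cenH_continuous {n : ℕ} {f : Euc n → ℝ} (hf : Integrable f) : Continuous (cenH f) := by
  rw [continuous_iff_continuousAt]
  intro θ0
  refine continuousAt_of_dominated (bound := fun x => ‖f x‖ * (log (2 * cenD θ0) + 1))
    (Eventually.of_forall fun θ => (cenH_integrable hf θ).1) ?_ (hf.norm.mul_const _) ?_
  · have hc : Continuous (fun θ : ℝ × Euc n => log (2 * cenD θ)) :=
      (continuous_const.mul continuous_cenD).log fun θ => by
        have := cenD_pos θ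
        exact (mul_pos two_pos this).ne'
    have := hc.continuousAt.eventually (eventually_lt_nhds (show log (2 * cenD θ0) < log (2 * cenD θ0) + 1 by linarith))
    filter_upwards [this] with θ hθ
    refine Eventually.of_forall fun x => ?_
    rw [norm_mul]
    exact mul_le_mul_of_nonneg_left ((abs_log_cenR θ x).trans hθ.le) (norm_nonneg _)
  · refine Eventually.of_forall fun x => ?_
    exact (continuous_const.mul ((continuous_cenR x).log fun θ => (cenR_pos θ x).ne')).continuousAt

/-- small-ratio sets have small mass -/
lemma cen_bad {n : ℕ} (hn : 1 ≤ n) {f : Euc n → ℝ} (hf : Integrable f) (hf0 : ∀ x, 0 ≤ f x) :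
    ∃ ε : ℝ, 0 < ε ∧ ε ≤ 1 ∧ ∀ θ : ℝ × Euc n, ∫ x in {x | cenR θ x < ε * cenD θ}, f x ≤ 1 / 4 := by
  -- mass outside a large ball
  obtain ⟨M, hM0, hM⟩ : ∃ M : ℝ, 0 ≤ M ∧ ∫ x in (Metric.closedBall (0 : Euc n) M)ᶜ, f x ≤ 1 / 8 := by
    have ht : Tendsto (fun k : ℕ => ∫ x in (Metric.closedBall (0 : Euc n) k)ᶜ, f x) atTop (𝓝 0) := by
      have := tendsto_setIntegral_of_antitone (μ := volume) (f := f)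
        (s := fun k : ℕ => (Metric.closedBall (0 : Euc n) (k : ℝ))ᶜ)
        (fun k => Metric.isClosed_closedBall.measurableSet.compl)
        (fun a b hab => Set.compl_subset_compl.2 (Metric.closedBall_subset_closedBall (by exact_mod_cast hab)))
        ⟨0, hf.integrableOn⟩
      have he : ⋂ k : ℕ, (Metric.closedBall (0 : Euc n) (k : ℝ))ᶜ = ∅ := by
        rw [← Set.compl_iUnion, Metric.iUnion_closedBall_nat, Set.compl_univ]
      rw [he] at this
      simpa using this
    obtain ⟨k, hk⟩ := (ht.eventually (eventually_lt_nhds (show (0:ℝ) < 1/8 by norm_num))).exists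
    exact ⟨k, by positivity, hk.le⟩
  -- absolute continuity
  have hfin : ∫⁻ x, ENNReal.ofReal (f x) ≠ ⊤ := hf.lintegral_lt_top.ne
  obtain ⟨δ, hδ, hδ2⟩ := exists_pos_setLIntegral_lt_of_measure_lt hfin
    (ε := ENNReal.ofReal (1/8)) (by simp)
  -- radius
  obtain ⟨η, hη, hηδ⟩ : ∃ η : ℝ, 0 < η ∧ ∀ x : Euc n, volume (Metric.ball x η) < δ := by
    have ht : Tendsto (fun r : ℝ => ENNReal.ofReal (r ^ n) * volume (Metric.ball (0 : Euc n) 1))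
        (𝓝 0) (𝓝 0) := by
      have h1 : Tendsto (fun r : ℝ => ENNReal.ofReal (r ^ n)) (𝓝 0) (𝓝 0) := by
        have : Continuous fun r : ℝ => ENNReal.ofReal (r ^ n) :=
          ENNReal.continuous_ofReal.comp (by fun_prop)
        have h := this.tendsto 0
        simpa [show n ≠ 0 by omega] using h
      have := ENNReal.Tendsto.mul_const (b := volume (Metric.ball (0 : Euc n) 1)) h1
        (Or.inr (measure_ball_lt_top).ne)
      simpa using this
    have h2 := (ht.mono_left (nhdsWithin_le_nhds (s := Set.Ioi 0))).eventually (eventually_lt_nhds hδ)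
    obtain ⟨η, h3, h4⟩ := (h2.and self_mem_nhdsWithin).exists
    refine ⟨η, h4, fun x => ?_⟩
    have : Nonempty (Fin n) := ⟨⟨0, hn⟩⟩
    rw [Measure.addHaar_ball volume x (le_of_lt h4), finrank_euclideanSpace_fin]
    exact h3
  -- choice of ε
  set A : ℝ := 1 + 2 * M ^ 2 with hA
  have hA1 : 1 ≤ A := by nlinarith [sq_nonneg M]
  set d0 : ℝ := min (1/4) (η ^ 2 / (4 * A)) with hd0
  have hd0p : 0 < d0 := by positivity
  have hd1 : d0 ≤ 1/4 := min_le_left _ _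
  have hd2 : d0 * (4 * A) ≤ η ^ 2 := by
    rw [← le_div_iff₀ (by positivity)]; exact min_le_right _ _
  refine ⟨d0 / (1 + M ^ 2), by positivity, ?_, fun θ => ?_⟩
  · rw [div_le_one (by positivity)]; nlinarith [sq_nonneg M]
  set S := {x | cenR θ x < d0 / (1 + M ^ 2) * cenD θ} with hS
  have hsub : S ⊆ (Metric.closedBall (0 : Euc n) M)ᶜ ∪ Metric.ball θ.2 η := by
    intro x hx
    by_cases hxM : x ∈ Metric.closedBall (0 : Euc n) M
    · right
      have hxM' : ‖x‖ ≤ M := by simpa using hxM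
      have hx' : cenR θ x < d0 / (1 + M ^ 2) * cenD θ := hx
      unfold cenR cenD at hx'
      have hexp := exp_pos θ.1
      rw [div_mul_div_comm, div_lt_div_iff₀ (by positivity) (by positivity)] at hx'
      have hx2 : (rexp θ.1 ^ 2 + ‖x - θ.2‖ ^ 2) * (1 + M ^ 2) <
          d0 * (1 + rexp θ.1 ^ 2 + ‖θ.2‖ ^ 2) * (1 + ‖x‖ ^ 2) := by
        refine lt_of_mul_lt_mul_right ?_ hexp.le
        linarith
      have hx3 : (1 + ‖x‖ ^ 2) ≤ 1 + M ^ 2 := by gcongr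
      have hx4 : rexp θ.1 ^ 2 + ‖x - θ.2‖ ^ 2 < d0 * (1 + rexp θ.1 ^ 2 + ‖θ.2‖ ^ 2) := by
        refine lt_of_mul_lt_mul_right (lt_of_lt_of_le hx2 ?_) (show 0 ≤ 1 + M ^ 2 by positivity)
        gcongr
      have h5 : ‖θ.2‖ ≤ ‖x - θ.2‖ + ‖x‖ := by
        have := norm_sub_le x (x - θ.2); simp at this; linarith
      have h6 : ‖θ.2‖ ^ 2 ≤ 2 * ‖x - θ.2‖ ^ 2 + 2 * M ^ 2 := by
        nlinarith [norm_nonneg θ.2, norm_nonneg x, sq_nonneg (‖x - θ.2‖ - ‖x‖)]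
      have h7 : ‖x - θ.2‖ ^ 2 < η ^ 2 := by
        have : 1 + rexp θ.1 ^ 2 + ‖θ.2‖ ^ 2 ≤ A + 2 * (rexp θ.1 ^ 2 + ‖x - θ.2‖ ^ 2) := by
          nlinarith [sq_nonneg (rexp θ.1)]
        have h8 : rexp θ.1 ^ 2 + ‖x - θ.2‖ ^ 2 < d0 * (A + 2 * (rexp θ.1 ^ 2 + ‖x - θ.2‖ ^ 2)) :=
          lt_of_lt_of_le hx4 (by gcongr)
        have h9 : 0 ≤ rexp θ.1 ^ 2 + ‖x - θ.2‖ ^ 2 := by positivity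
        nlinarith [sq_nonneg (rexp θ.1)]
      rw [Metric.mem_ball, dist_eq_norm]
      exact lt_of_pow_lt_pow_left₀ 2 hη.le h7
    · left; exact hxM
  have hball : ∫ x in Metric.ball θ.2 η, f x ≤ 1 / 8 := by
    rw [integral_eq_lintegral_of_nonneg_ae (Eventually.of_forall hf0) hf.1.restrict]
    have := hδ2 _ (hηδ θ.2)
    exact ENNReal.toReal_le_of_le_ofReal (by norm_num) this.le
  calc ∫ x in S, f x ≤ ∫ x in (Metric.closedBall (0 : Euc n) M)ᶜ ∪ Metric.ball θ.2 η, f x :=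
        setIntegral_mono_set hf.integrableOn (Eventually.of_forall hf0) hsub.eventuallyLE
    _ ≤ (∫ x in (Metric.closedBall (0 : Euc n) M)ᶜ, f x) + ∫ x in Metric.ball θ.2 η, f x := by
        have h1 : (Metric.closedBall (0 : Euc n) M)ᶜ ∪ Metric.ball θ.2 η
          = (Metric.closedBall (0 : Euc n) M)ᶜ ∪ (Metric.ball θ.2 η \ (Metric.closedBall (0 : Euc n) M)ᶜ) := by
          rw [Set.union_sdiff_self]
        rw [h1, setIntegral_union Set.disjoint_sdiff_right
          (Metric.isOpen_ball.measurableSet.diff Metric.isClosed_closedBall.measurableSet.compl)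
          hf.integrableOn hf.integrableOn]
        refine add_le_add le_rfl ?_
        exact setIntegral_mono_set hf.integrableOn (Eventually.of_forall hf0) Set.sdiff_subset.eventuallyLE
    _ ≤ 1 / 4 := by linarith

lemma cenH_lower {n : ℕ} (hn : 1 ≤ n) {f : Euc n → ℝ} (hf : Integrable f) (hf0 : ∀ x, 0 ≤ f x)
    (h1 : ∫ x, f x = 1) : ∃ C : ℝ, ∀ θ : ℝ × Euc n, 1 / 2 * log (cenD θ) - C ≤ cenH f θ := by
  obtain ⟨ε, hε, hε1, H⟩ := cen_bad hn hf hf0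
  refine ⟨-log ε, fun θ => ?_⟩
  set S := {x | cenR θ x < ε * cenD θ} with hS
  have hSm : MeasurableSet S := measurableSet_lt (continuous_cenR' θ).measurable measurable_const
  have hL : 0 ≤ log (cenD θ) := log_nonneg (one_le_cenD θ)
  have hle : log ε ≤ 0 := log_nonpos hε.le hε1
  have pt : ∀ x, f x * (log ε + log (cenD θ)) - 2 * log (cenD θ) * S.indicator f x ≤ f x * log (cenR θ x) := by
    intro x
    by_cases hx : x ∈ S
    · rw [Set.indicator_of_mem hx]
      have h2 := log_le_log (inv_pos.2 (cenD_pos θ)) (le_cenR θ x)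
      rw [log_inv] at h2
      nlinarith [hf0 x, mul_le_mul_of_nonneg_left h2 (hf0 x), mul_nonneg (hf0 x) (neg_nonneg.2 hle)]
    · rw [Set.indicator_of_notMem hx, mul_zero, sub_zero]
      have hx' : ε * cenD θ ≤ cenR θ x := not_lt.1 hx
      have h2 := log_le_log (mul_pos hε (cenD_pos θ)) hx'
      rw [log_mul hε.ne' (cenD_pos θ).ne'] at h2
      exact mul_le_mul_of_nonneg_left h2 (hf0 x)
  have hi := integral_mono ((hf.mul_const (log ε + log (cenD θ))).sub
    ((hf.indicator hSm).const_mul (2 * log (cenD θ)))) (cenH_integrable hf θ) pt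
  have e : ∫ x, (f x * (log ε + log (cenD θ)) - 2 * log (cenD θ) * S.indicator f x)
      = (log ε + log (cenD θ)) - 2 * log (cenD θ) * ∫ x in S, f x := by
    rw [integral_sub (hf.mul_const _) ((hf.indicator hSm).const_mul _), integral_mul_const, h1,
      integral_const_mul, integral_indicator hSm, one_mul]
  have hi' : (log ε + log (cenD θ)) - 2 * log (cenD θ) * ∫ x in S, f x ≤ cenH f θ := e ▸ hi
  have := mul_le_mul_of_nonneg_left (H θ) (show 0 ≤ 2 * log (cenD θ) by linarith)
  linarith

lemma lin_zero_of_quad {a b t0 : ℝ} (ht0 : 0 < t0) (h : ∀ t, |t| < t0 → 0 ≤ a * t + b * t ^ 2) : a = 0 := by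
  by_contra ha
  set t := min (t0 / 2) (|a| / (2 * (|b| + 1))) with ht
  have hap : 0 < |a| := abs_pos.2 ha
  have htp : 0 < t := by positivity
  have ht1 : t < t0 := lt_of_le_of_lt (min_le_left _ _) (by linarith)
  have ht2 : t * (2 * (|b| + 1)) ≤ |a| := by
    rw [← le_div_iff₀ (by positivity)]; exact min_le_right _ _
  have hb := le_abs_self b
  have key : b * t ^ 2 < |a| * t := by
    have : b * t < |a| := by nlinarith [abs_nonneg b]
    nlinarith
  rcases abs_cases a with h' | h'
  · have := h (-t) (by rwa [abs_neg, abs_of_pos htp]); nlinarith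
  · have := h t (by rwa [abs_of_pos htp]); nlinarith

theorem centering {n : ℕ} (hn : 1 ≤ n) {f : Euc n → ℝ} (hf : Integrable f) (hf0 : ∀ x, 0 ≤ f x)
    (h1 : ∫ x, f x = 1) : ∃ (μ : ℝ) (x0 : Euc n), 0 < μ ∧
      (∀ v : Euc n, ∫ x, f x * (inner ℝ (x - x0) v / (μ ^ 2 + ‖x - x0‖ ^ 2)) = 0) ∧
      ∫ x, f x * (μ ^ 2 / (μ ^ 2 + ‖x - x0‖ ^ 2)) = 1 / 2 := by
  obtain ⟨C, hC⟩ := cenH_lower hn hf hf0 h1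
  have hcoer : Tendsto (cenH f) (cocompact (ℝ × Euc n)) atTop := by
    have t1 : Tendsto (fun θ : ℝ × Euc n => log ‖θ‖) (cocompact _) atTop :=
      tendsto_log_atTop.comp (tendsto_norm_cocompact_atTop)
    have t2 : Tendsto (fun θ : ℝ × Euc n => 1 / 2 * log ‖θ‖ + (-C)) (cocompact _) atTop :=
      tendsto_atTop_add_const_right _ _ (t1.const_mul_atTop (by norm_num))
    refine tendsto_atTop_mono' _ ?_ t2
    have := (tendsto_norm_cocompact_atTop (E := ℝ × Euc n)).eventually (eventually_gt_atTop 0)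
    filter_upwards [this] with θ hθ
    have h2 := log_le_log hθ (norm_le_cenD θ)
    linarith [hC θ]
  obtain ⟨θ, hmin⟩ := (cenH_continuous hf).exists_forall_le hcoer
  set μ := rexp θ.1 with hμ
  have hμ0 : 0 < μ := exp_pos _
  set x0 := θ.2 with hx0
  have hs : ∀ x : Euc n, 0 < μ ^ 2 + ‖x - x0‖ ^ 2 := fun x => by positivity
  have ib : ∀ (g : Euc n → ℝ) (c : ℝ), Continuous g → (∀ x, |g x| ≤ c) → Integrable (fun x => f x * g x) :=
    fun g c hg hgc => hf.mul_bdd (c := c) hg.aestronglyMeasurable (Eventually.of_forall hgc)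
  have bd1 : ∀ x : Euc n, 1 / (μ ^ 2 + ‖x - x0‖ ^ 2) ≤ 1 / μ ^ 2 := by
    intro x; apply one_div_le_one_div_of_le (by positivity); nlinarith [sq_nonneg ‖x - x0‖]
  refine ⟨μ, x0, hμ0, fun v => ?_, ?_⟩
  · have c1 : Continuous fun x : Euc n => inner ℝ (x - x0) v / (μ ^ 2 + ‖x - x0‖ ^ 2) :=
      Continuous.div (by fun_prop) (by fun_prop) (fun x => (hs x).ne')
    have c2 : Continuous fun x : Euc n => 1 / (μ ^ 2 + ‖x - x0‖ ^ 2) :=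
      Continuous.div (by fun_prop) (by fun_prop) (fun x => (hs x).ne')
    have i1 := ib _ (‖v‖ / μ) c1 (by
      intro x
      rw [abs_div, abs_of_pos (hs x), div_le_div_iff₀ (hs x) hμ0]
      have := abs_real_inner_le_norm (x - x0) v
      have h3 : ‖x - x0‖ * μ ≤ μ ^ 2 + ‖x - x0‖ ^ 2 := by
        nlinarith [sq_nonneg (‖x - x0‖ - μ), sq_nonneg ‖x - x0‖]
      calc _ ≤ ‖x - x0‖ * ‖v‖ * μ := by gcongr
        _ = ‖v‖ * (‖x - x0‖ * μ) := by ring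
        _ ≤ _ := by gcongr)
    have i2 := ib _ (1 / μ ^ 2) c2 (by
      intro x; rw [abs_of_pos (by positivity)]; exact bd1 x)
    have hq : ∀ t : ℝ, 0 ≤ (-2 * ∫ x, f x * (inner ℝ (x - x0) v / (μ ^ 2 + ‖x - x0‖ ^ 2))) * t
        + (‖v‖ ^ 2 * ∫ x, f x * (1 / (μ ^ 2 + ‖x - x0‖ ^ 2))) * t ^ 2 := by
      intro t
      have hm := hmin (θ.1, x0 + t • v)
      have pt : ∀ x, f x * log (cenR (θ.1, x0 + t • v) x) ≤ f x * log (cenR θ x) +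
          ((-2 * t) * (f x * (inner ℝ (x - x0) v / (μ ^ 2 + ‖x - x0‖ ^ 2)))
            + (‖v‖ ^ 2 * t ^ 2) * (f x * (1 / (μ ^ 2 + ‖x - x0‖ ^ 2)))) := by
        intro x
        have hr := cenR_pos (θ.1, x0 + t • v) x
        have hr0 := cenR_pos θ x
        have hl := log_le_sub_one_of_pos (div_pos hr hr0)
        rw [log_div hr.ne' hr0.ne'] at hl
        have e : cenR (θ.1, x0 + t • v) x / cenR θ x =
            (μ ^ 2 + (‖x - x0‖ ^ 2 - 2 * t * inner ℝ (x - x0) v + t ^ 2 * ‖v‖ ^ 2)) / (μ ^ 2 + ‖x - x0‖ ^ 2) := by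
          unfold cenR
          simp only [← hμ, ← hx0]
          have e2 : ‖x - (x0 + t • v)‖ ^ 2 = ‖x - x0‖ ^ 2 - 2 * t * inner ℝ (x - x0) v + t ^ 2 * ‖v‖ ^ 2 := by
            rw [← sub_sub, norm_sub_sq_real, inner_smul_right, norm_smul, mul_pow, Real.norm_eq_abs, sq_abs]
            ring
          rw [e2]
          have := hs x
          field_simp
        have e3 : cenR (θ.1, x0 + t • v) x / cenR θ x - 1 = (-2 * t) * (inner ℝ (x - x0) v / (μ ^ 2 + ‖x - x0‖ ^ 2))
            + (‖v‖ ^ 2 * t ^ 2) * (1 / (μ ^ 2 + ‖x - x0‖ ^ 2)) := by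
          rw [e]
          have := hs x
          field_simp
          ring
        rw [e3] at hl
        nlinarith [mul_le_mul_of_nonneg_left hl (hf0 x)]
      have hi := integral_mono (cenH_integrable hf _) ((cenH_integrable hf θ).add
        ((i1.const_mul (-2 * t)).add (i2.const_mul (‖v‖ ^ 2 * t ^ 2)))) pt
      simp only [Pi.add_apply] at hi
      have i12 : Integrable (fun x => (-2 * t) * (f x * (inner ℝ (x - x0) v / (μ ^ 2 + ‖x - x0‖ ^ 2)))
            + (‖v‖ ^ 2 * t ^ 2) * (f x * (1 / (μ ^ 2 + ‖x - x0‖ ^ 2)))) :=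
        (i1.const_mul (-2 * t)).add (i2.const_mul (‖v‖ ^ 2 * t ^ 2))
      rw [integral_add (cenH_integrable hf θ) i12,
        integral_add (i1.const_mul (-2 * t)) (i2.const_mul (‖v‖ ^ 2 * t ^ 2)), integral_const_mul,
        integral_const_mul] at hi
      unfold cenH at hm
      linarith
    have := lin_zero_of_quad one_pos (fun t _ => hq t)
    linarith
  · have c2 : Continuous fun x : Euc n => μ ^ 2 / (μ ^ 2 + ‖x - x0‖ ^ 2) :=
      Continuous.div (by fun_prop) (by fun_prop) (fun x => (hs x).ne')
    have i2 := ib _ 1 c2 (by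
      intro x; rw [abs_of_pos (by positivity), div_le_one (hs x)]; nlinarith [sq_nonneg ‖x - x0‖])
    set A := ∫ x, f x * (μ ^ 2 / (μ ^ 2 + ‖x - x0‖ ^ 2)) with hA
    have hq : ∀ t : ℝ, |t| < 1 → 0 ≤ (A - 1 / 2) * t + A * t ^ 2 := by
      intro t ht
      have ht' : 0 < 1 + t := by linarith [(abs_lt.1 ht).1]
      set b := log (1 + t) / 2 with hb
      have hm := hmin (θ.1 + b, x0)
      have hexp : rexp (θ.1 + b) ^ 2 = μ ^ 2 * (1 + t) := by
        rw [Real.exp_add, mul_pow, ← hμ]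
        congr 1
        rw [← Real.exp_nat_mul, hb, show ((2:ℕ):ℝ) * (log (1 + t) / 2) = log (1 + t) by push_cast; ring, Real.exp_log ht']
      have pt : ∀ x, f x * log (cenR (θ.1 + b, x0) x) ≤ f x * log (cenR θ x) +
          (t * (f x * (μ ^ 2 / (μ ^ 2 + ‖x - x0‖ ^ 2))) + (-b) * f x) := by
        intro x
        have hr := cenR_pos (θ.1 + b, x0) x
        have hr0 := cenR_pos θ x
        have e : cenR (θ.1 + b, x0) x = cenR θ x * (1 + t * (μ ^ 2 / (μ ^ 2 + ‖x - x0‖ ^ 2))) * rexp (-b) := by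
          unfold cenR
          simp only [hexp, ← hx0, ← hμ]
          rw [Real.exp_add, ← hμ, Real.exp_neg]
          have := hs x
          have := exp_pos b
          field_simp
          ring
        have hpos : 0 < 1 + t * (μ ^ 2 / (μ ^ 2 + ‖x - x0‖ ^ 2)) := by
          rw [e] at hr
          by_contra hc
          have := mul_nonpos_of_nonneg_of_nonpos hr0.le (not_lt.1 hc)
          have := mul_nonpos_of_nonpos_of_nonneg this (exp_pos (-b)).le
          linarith
        have hl := log_le_sub_one_of_pos hpos
        rw [e, log_mul (by positivity) (exp_pos _).ne', log_mul hr0.ne' hpos.ne', Real.log_exp]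
        nlinarith [mul_le_mul_of_nonneg_left hl (hf0 x)]
      have hi := integral_mono (cenH_integrable hf _) ((cenH_integrable hf θ).add
        ((i2.const_mul t).add (hf.const_mul (-b)))) pt
      simp only [Pi.add_apply] at hi
      have i12 : Integrable (fun x => t * (f x * (μ ^ 2 / (μ ^ 2 + ‖x - x0‖ ^ 2))) + (-b) * f x) :=
        (i2.const_mul t).add (hf.const_mul (-b))
      rw [integral_add (cenH_integrable hf θ) i12,
        integral_add (i2.const_mul t) (hf.const_mul (-b)), integral_const_mul,
        integral_const_mul, h1, ← hA] at hi
      unfold cenH at hm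
      have h5 : b ≤ t * A := by linarith
      have h6 := one_sub_inv_le_log_of_pos ht'
      have h7 : (1 - (1 + t)⁻¹) * (1 + t) = t := by field_simp; ring
      have h8 : (1 - (1 + t)⁻¹) * (1 + t) ≤ 2 * (t * A) * (1 + t) := by
        apply mul_le_mul_of_nonneg_right _ ht'.le
        linarith
      rw [h7] at h8
      linarith
    have := lin_zero_of_quad one_pos hq
    linarith

/-! ### The variational argument -/

lemma taylor_pos {q s : ℝ} (hq1 : 1 ≤ q) (hq2 : q ≤ 2) (hs : 0 ≤ s) :
    (1 + s) ^ q ≤ 1 + q * s + q * (q - 1) / 2 * s ^ 2 := by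
  have hmono : MonotoneOn (fun s : ℝ => 1 + q * s + q * (q - 1) / 2 * s ^ 2 - (1 + s) ^ q) (Set.Ici 0) := by
    have hd : ∀ x : ℝ, 0 ≤ x → HasDerivAt (fun s : ℝ => 1 + q * s + q * (q - 1) / 2 * s ^ 2 - (1 + s) ^ q)
        (q * (1 + (q - 1) * x - (1 + x) ^ (q - 1))) x := by
      intro x hx
      have h1 : HasDerivAt (fun s : ℝ => (1 + s) ^ q) (1 * q * (1 + x) ^ (q - 1)) x :=
        ((hasDerivAt_id x).const_add 1).rpow_const (Or.inr hq1)
      have h2 := ((((hasDerivAt_id x).const_mul q).const_add 1).add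
        (((hasDerivAt_id x).pow 2).const_mul (q * (q - 1) / 2))).sub h1
      refine h2.congr_deriv ?_
      simp
      ring
    refine monotoneOn_of_deriv_nonneg (convex_Ici 0) (fun x hx => (hd x hx).continuousAt.continuousWithinAt)
      (fun x hx => ?_) (fun x hx => ?_)
    · rw [interior_Ici] at hx
      exact (hd x (le_of_lt hx)).differentiableAt.differentiableWithinAt
    · rw [interior_Ici] at hx
      rw [(hd x (le_of_lt hx)).deriv]
      have hx0 : 0 < x := hx
      have := rpow_one_add_le_one_add_mul_self (show -1 ≤ x by linarith) (show 0 ≤ q - 1 by linarith)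
        (show q - 1 ≤ 1 by linarith)
      exact mul_nonneg (by linarith) (by linarith)
  have := hmono (Set.mem_Ici.2 le_rfl) (Set.mem_Ici.2 hs) hs
  simp only [mul_zero, add_zero, one_rpow] at this
  norm_num at this
  linarith

lemma taylor_neg {q u : ℝ} (hq1 : 1 ≤ q) (hq2 : q ≤ 2) (hu : 0 ≤ u) (hu2 : u ≤ 1 / 2) :
    (1 - u) ^ q ≤ 1 - q * u + q * (q - 1) / 2 * u ^ 2 + 2 * q * (q - 1) / 3 * u ^ 3 := by
  have hmono : MonotoneOn (fun u : ℝ => 1 - q * u + q * (q - 1) / 2 * u ^ 2 + 2 * q * (q - 1) / 3 * u ^ 3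
      - (1 - u) ^ q) (Set.Icc 0 (1/2)) := by
    have hd : ∀ x : ℝ, x ≤ 1 / 2 → HasDerivAt (fun u : ℝ => 1 - q * u + q * (q - 1) / 2 * u ^ 2
        + 2 * q * (q - 1) / 3 * u ^ 3 - (1 - u) ^ q)
        (q * ((1 - x) ^ (q - 1) - (1 - (q - 1) * x - 2 * (q - 1) * x ^ 2))) x := by
      intro x hx
      have h1 : HasDerivAt (fun s : ℝ => (1 - s) ^ q) (-1 * q * (1 - x) ^ (q - 1)) x :=
        ((hasDerivAt_id x).const_sub 1).rpow_const (Or.inr hq1)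
      have h2 := (((((hasDerivAt_id x).const_mul q).const_sub 1).add
        (((hasDerivAt_id x).pow 2).const_mul (q * (q - 1) / 2))).add
        (((hasDerivAt_id x).pow 3).const_mul (2 * q * (q - 1) / 3))).sub h1
      refine h2.congr_deriv ?_
      simp
      ring
    refine monotoneOn_of_deriv_nonneg (convex_Icc _ _) (fun x hx => (hd x hx.2).continuousAt.continuousWithinAt)
      (fun x hx => ?_) (fun x hx => ?_)
    · rw [interior_Icc] at hx
      exact (hd x (le_of_lt hx.2)).differentiableAt.differentiableWithinAt
    · rw [interior_Icc] at hx
      rw [(hd x (le_of_lt hx.2)).deriv]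
      have hx0 : 0 < x := hx.1
      have hx1 : x < 1 / 2 := hx.2
      refine mul_nonneg (by linarith) ?_
      have hb := rpow_one_add_le_one_add_mul_self (show -1 ≤ -x by linarith) (show 0 ≤ 2 - q by linarith)
        (show 2 - q ≤ 1 by linarith)
      rw [← sub_eq_add_neg] at hb
      have h1x : 0 < 1 - x := by linarith
      have hp := rpow_pos_of_pos h1x (2 - q)
      have he : (1 - x) ^ (q - 1) * (1 - x) ^ (2 - q) = 1 - x := by
        rw [← rpow_add h1x]; norm_num
      have hA : 0 < (1 - x) ^ (q - 1) := rpow_pos_of_pos h1x _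
      set A := (1 - x) ^ (q - 1)
      have hc : 0 < 1 + (2 - q) * -x := by nlinarith
      have h3 : 1 - x ≤ A * (1 + (2 - q) * -x) := by
        rw [← he]; gcongr
      have h4 : (1 - (q - 1) * x - 2 * (q - 1) * x ^ 2) * (1 + (2 - q) * -x) ≤ 1 - x := by
        have hk : 0 ≤ q - 1 := by linarith
        have : 1 - x - (1 - (q - 1) * x - 2 * (q - 1) * x ^ 2) * (1 + (2 - q) * -x)
          = (q - 1) * x ^ 2 * (2 - (2 - q) - 2 * (2 - q) * x) := by ring
        have h5 : 0 ≤ (q - 1) * x ^ 2 * (2 - (2 - q) - 2 * (2 - q) * x) := by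
          apply mul_nonneg (by positivity)
          nlinarith
        linarith
      have := le_of_mul_le_mul_right (h4.trans h3) hc
      linarith
  have := hmono (show (0:ℝ) ∈ Set.Icc (0:ℝ) (1/2) by norm_num) (Set.mem_Icc.2 ⟨hu, hu2⟩) hu
  simp only [mul_zero, sub_zero, one_rpow] at this
  norm_num at this
  linarith

lemma taylor_q {q s δ : ℝ} (hq1 : 1 ≤ q) (hq2 : q ≤ 2) (hs : |s| ≤ δ) (hδ : δ ≤ 1 / 2) :
    (1 + s) ^ q ≤ 1 + q * s + q * (q - 1) / 2 * s ^ 2 + 2 * δ ^ 3 := by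
  have hδ0 : 0 ≤ δ := (abs_nonneg s).trans hs
  rcases le_total 0 s with h | h
  · have := taylor_pos hq1 hq2 h
    have : 0 ≤ δ ^ 3 := by positivity
    linarith
  · have h1 := taylor_neg (u := -s) hq1 hq2 (by linarith) (by linarith [neg_le_of_abs_le hs])
    rw [sub_neg_eq_add] at h1
    have h2 : (-s) ^ 3 ≤ δ ^ 3 := by
      have : -s ≤ δ := by linarith [neg_le_of_abs_le hs]
      have h0 : 0 ≤ -s := by linarith
      gcongr
    have h3 : 2 * q * (q - 1) / 3 ≤ 2 := by nlinarith
    have h4 : 0 ≤ (-s) ^ 3 := pow_nonneg (by linarith) 3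
    have h5 : 2 * q * (q - 1) / 3 * (-s) ^ 3 ≤ 2 * δ ^ 3 := by
      calc _ ≤ 2 * (-s) ^ 3 := by gcongr
        _ ≤ _ := by gcongr
    have e : (-s)^2 = s ^ 2 := by ring
    rw [e] at h1
    linarith

/-- admissible competitors -/
structure Adm {n : ℕ} (α : ℝ) (F : Euc n → ℝ) : Prop where
  meas : Measurable F
  nonneg : ∀ x, 0 ≤ F x
  int : Integrable (fun x => F x ^ ((n : ℝ) / (n - α)))
  one : ∫ x, F x ^ ((n : ℝ) / (n - α)) = 1

lemma qfacts {n : ℕ} {α : ℝ} (hα : 0 < α) (hn : 2 * α < n) :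
    0 < (n:ℝ) - α ∧ 1 < (n : ℝ) / (n - α) ∧ (n : ℝ) / (n - α) < 2 ∧ (n : ℝ) / (n - α) - 1 = α / (n - α)
      ∧ 1 ≤ n := by
  have h0 : 0 < (n:ℝ) - α := by linarith
  refine ⟨h0, ?_, ?_, ?_, ?_⟩
  · rw [lt_div_iff₀ h0]; linarith
  · rw [div_lt_iff₀ h0]; linarith
  · field_simp; ring
  · rcases Nat.eq_zero_or_pos n with h | h
    · subst h; simp at hn; linarith
    · exact h

lemma II_nonneg {n : ℕ} {α : ℝ} {F : Euc n → ℝ} (hF : ∀ x, 0 ≤ F x) : 0 ≤ II α F :=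
  integral_nonneg fun _ => mul_nonneg (mul_nonneg (hF _) (hF _)) (rk_nonneg _ _)

lemma II_smul {n : ℕ} {α : ℝ} (c : ℝ) (F : Euc n → ℝ) : II α (fun x => c * F x) = c ^ 2 * II α F := by
  unfold II
  rw [← integral_const_mul]
  congr 1; ext p; ring

lemma II_congr_ae {n : ℕ} {α : ℝ} {F G : Euc n → ℝ} (h : F =ᵐ[volume] G) : II α F = II α G := by
  unfold II
  refine integral_congr_ae ?_
  have h1 : ∀ᵐ p : Euc n × Euc n, F p.1 = G p.1 := Measure.quasiMeasurePreserving_fst.ae h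
  have h2 : ∀ᵐ p : Euc n × Euc n, F p.2 = G p.2 := Measure.quasiMeasurePreserving_snd.ae h
  filter_upwards [h1, h2] with p hp1 hp2
  rw [hp1, hp2]

lemma II_hom {n : ℕ} {α S : ℝ} (hα : 0 < α) (hn : 2 * α < n) (hS : ∀ F : Euc n → ℝ, Adm α F → II α F ≤ S)
    {F : Euc n → ℝ} (hF : Measurable F) (hF0 : ∀ x, 0 ≤ F x)
    (hFq : Integrable (fun x => F x ^ ((n : ℝ) / (n - α)))) :
    II α F ≤ S * (∫ x, F x ^ ((n : ℝ) / (n - α))) ^ (2 / ((n : ℝ) / (n - α))) := by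
  obtain ⟨h0, hq1, hq2, -, -⟩ := qfacts hα hn
  set q := (n : ℝ) / (n - α) with hq
  have hq0 : 0 < q := by linarith
  set N := ∫ x, F x ^ q with hN
  have hN0 : 0 ≤ N := integral_nonneg fun x => rpow_nonneg (hF0 x) _
  rcases hN0.eq_or_lt with h | h
  · rw [← h, zero_rpow (by positivity), mul_zero]
    have hz : F =ᵐ[volume] fun _ => 0 := by
      have := (integral_eq_zero_iff_of_nonneg (fun x => rpow_nonneg (hF0 x) q) hFq).1 (hN ▸ h.symm)
      filter_upwards [this] with x hx
      exact (rpow_eq_zero (hF0 x) hq0.ne').1 hx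
    rw [II_congr_ae hz]
    simp [II]
  · have e : ∀ x, (N ^ (-(1 / q)) * F x) ^ q = N⁻¹ * F x ^ q := by
      intro x
      rw [mul_rpow (by positivity) (hF0 x), ← rpow_mul h.le, show -(1 / q) * q = -1 by field_simp, rpow_neg_one]
    have hA : Adm α (fun x => N ^ (-(1 / q)) * F x) := by
      refine ⟨by fun_prop, fun x => mul_nonneg (by positivity) (hF0 x), ?_, ?_⟩
      · simp only [← hq, e]; exact hFq.const_mul _
      · simp only [← hq, e]; rw [integral_const_mul, ← hN, inv_mul_cancel₀ h.ne']
    have := hS _ hA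
    rw [II_smul, ← rpow_natCast, ← rpow_mul h.le] at this
    have e2 : N ^ (-(1 / q) * ((2:ℕ):ℝ)) = (N ^ (2 / q))⁻¹ := by
      rw [← rpow_neg h.le]; congr 1; push_cast; ring
    rw [e2, inv_mul_le_iff₀ (by positivity)] at this
    linarith

lemma stw_abs_le {n : ℕ} (x : Euc n) (j : Fin (n + 1)) : |stw x j| ≤ 1 :=
  abs_coord_le_one (stw x) (stw_unit x) j

lemma measurable_stw {n : ℕ} (j : Fin (n + 1)) : Measurable (fun x : Euc n => stw x j) :=
  ((continuous_apply j).comp continuous_stw).measurable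

lemma bdd_mul_int {X : Type*} [MeasurableSpace X] {μ : Measure X} {f g : X → ℝ} {c : ℝ} (hf : Integrable f μ)
    (hg : Measurable g) (hc : ∀ x, |g x| ≤ c) : Integrable (fun x => f x * g x) μ :=
  hf.mul_bdd (c := c) hg.aestronglyMeasurable (Eventually.of_forall hc)

set_option maxHeartbeats 2000000 in
theorem variation {n : ℕ} {α S ε δ : ℝ} (hα : 0 < α) (hn : 2 * α < n)
    (hS : ∀ F : Euc n → ℝ, Adm α F → II α F ≤ S) {F : Euc n → ℝ} (hF : Adm α F)
    (hc : ∀ j, ∫ x, F x ^ ((n : ℝ) / (n - α)) * stw x j = 0) (hε : S - ε ≤ II α F) (hδ : 0 < δ)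
    (hδ2 : δ ≤ 1 / 2) :
    QQ α F ≤ (n - α) * ((n + 1) * ε / δ ^ 2 + ((n : ℝ) / (n - α) - 1) * ε + 8 * (n + 1) * S * δ) := by
  obtain ⟨h0, hq1, hq2, hqm, hn1⟩ := qfacts hα hn
  set q := (n : ℝ) / (n - α) with hq
  have hq0 : 0 < q := by linarith
  have hS0 : 0 ≤ S := (II_nonneg hF.nonneg).trans (hS F hF)
  have hint := hF.int
  have hone := hF.one
  simp only [← hq] at hint hone
  have hII : Integrable (fun p : Euc n × Euc n => F p.1 * F p.2 * rk α p) := by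
    refine II_integrable hα hn hF.meas ?_
    simpa only [abs_of_nonneg (hF.nonneg _)] using hF.int
  -- second moments
  set m : Fin (n + 1) → ℝ := fun j => ∫ x, F x ^ q * (stw x j) ^ 2 with hm
  have hmint : ∀ j, Integrable (fun x => F x ^ q * (stw x j) ^ 2) := fun j =>
    bdd_mul_int (c := 1) hint ((measurable_stw j).pow_const 2) (fun x => by
      rw [abs_pow]; exact pow_le_one₀ (abs_nonneg _) (stw_abs_le x j))
  have hwint : ∀ j, Integrable (fun x => F x ^ q * stw x j) := fun j =>
    bdd_mul_int (c := 1) hint (measurable_stw j) (fun x => stw_abs_le x j)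
  have hm0 : ∀ j, 0 ≤ m j := fun j => integral_nonneg fun x => by
    have := rpow_nonneg (hF.nonneg x) q; positivity
  have hsum : ∑ j, m j = 1 := by
    rw [hm, ← integral_finsetSum _ (fun j _ => hmint j), ← hone]
    refine integral_congr_ae (Eventually.of_forall fun x => ?_)
    simp only
    rw [← Finset.mul_sum]
    have := stw_unit x
    unfold dotp at this
    simp only [← pow_two] at this
    rw [this, mul_one]
  have hm1 : ∀ j, m j ≤ 1 := fun j => by
    rw [← hsum]; exact Finset.single_le_sum (fun i _ => hm0 i) (Finset.mem_univ j)
  -- bound for perturbed functions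
  have pert : ∀ (j : Fin (n + 1)) (s : ℝ), |s| = δ →
      II α (fun x => F x * (1 + s * stw x j)) ≤ S * (1 + (q - 1) * δ ^ 2 * m j + 8 * δ ^ 3) := by
    intro j s hs
    have hsw : ∀ x, |s * stw x j| ≤ δ := fun x => by
      rw [abs_mul, hs]; exact mul_le_of_le_one_right hδ.le (stw_abs_le x j)
    have hpos : ∀ x, 0 ≤ 1 + s * stw x j := fun x => by linarith [neg_le_of_abs_le (hsw x)]
    have hmeas : Measurable (fun x => F x * (1 + s * stw x j)) :=
      hF.meas.mul (((measurable_stw j).const_mul s).const_add 1)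
    have epow : ∀ x, (F x * (1 + s * stw x j)) ^ q = F x ^ q * (1 + s * stw x j) ^ q := fun x =>
      mul_rpow (hF.nonneg x) (hpos x)
    have hint2 : Integrable (fun x => (F x * (1 + s * stw x j)) ^ q) := by
      simp only [epow]
      refine bdd_mul_int (c := 2 ^ q) hint ((((measurable_stw j).const_mul s).const_add 1).pow_const q) (fun x => ?_)
      rw [abs_of_nonneg (rpow_nonneg (hpos x) q)]
      exact rpow_le_rpow (hpos x) (by linarith [le_of_abs_le (hsw x)]) hq0.le
    have h1 := II_hom hα hn hS hmeas (fun x => mul_nonneg (hF.nonneg x) (hpos x)) hint2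
    rw [← hq] at h1
    set η := q * (q - 1) / 2 * δ ^ 2 * m j + 2 * δ ^ 3 with hη
    have hη0 : 0 ≤ η := by
      have := hm0 j
      have : 0 ≤ q - 1 := by linarith
      positivity
    have hs2 : s ^ 2 = δ ^ 2 := by rw [← hs, sq_abs]
    have hN : ∫ x, (F x * (1 + s * stw x j)) ^ q ≤ 1 + η := by
      have iA : Integrable (fun x => F x ^ q + (q * s) * (F x ^ q * stw x j)) := hint.add ((hwint j).const_mul _)
      have iB : Integrable (fun x => F x ^ q + (q * s) * (F x ^ q * stw x j)
          + (q * (q - 1) / 2 * δ ^ 2) * (F x ^ q * (stw x j) ^ 2)) := iA.add ((hmint j).const_mul _)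
      have iC : Integrable (fun x => F x ^ q + (q * s) * (F x ^ q * stw x j)
          + (q * (q - 1) / 2 * δ ^ 2) * (F x ^ q * (stw x j) ^ 2) + 2 * δ ^ 3 * F x ^ q) :=
        iB.add (hint.const_mul _)
      have hle := integral_mono hint2 iC (fun x => by
        simp only [epow]
        have := mul_le_mul_of_nonneg_left (taylor_q hq1.le hq2.le (hsw x) hδ2) (rpow_nonneg (hF.nonneg x) q)
        rw [mul_pow, hs2] at this
        linarith)
      rw [integral_add iB (hint.const_mul _), integral_add iA ((hmint j).const_mul _),
        integral_add hint ((hwint j).const_mul _), integral_const_mul, integral_const_mul, integral_const_mul,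
        hone, hc j] at hle
      rw [hη]
      linarith
    have hN0 : 0 ≤ ∫ x, (F x * (1 + s * stw x j)) ^ q := integral_nonneg fun x =>
      rpow_nonneg (mul_nonneg (hF.nonneg x) (hpos x)) q
    have hr1 : 1 ≤ 2 / q := by rw [le_div_iff₀ hq0]; linarith
    have hr2 : 2 / q ≤ 2 := by rw [div_le_iff₀ hq0]; linarith
    have hb : (1 + η) ^ (2 / q) ≤ 1 + (2 / q) * η + η ^ 2 := by
      have hb1 := rpow_one_add_le_one_add_mul_self (show -1 ≤ η by linarith) (show 0 ≤ 2 / q - 1 by linarith)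
        (show 2 / q - 1 ≤ 1 by linarith)
      have : (1 + η) ^ (2 / q) = (1 + η) * (1 + η) ^ (2 / q - 1) := by
        nth_rewrite 2 [← rpow_one (1 + η)]
        rw [← rpow_add (by linarith)]; congr 1; ring
      rw [this]
      calc _ ≤ (1 + η) * (1 + (2 / q - 1) * η) := by gcongr
        _ = 1 + 2 / q * η + (2 / q - 1) * η ^ 2 := by ring
        _ ≤ _ := by nlinarith [sq_nonneg η]
    have hη2 : η ≤ 2 * δ ^ 2 := by
      have h1 : q * (q - 1) / 2 * m j ≤ 1 := by
        have := hm1 j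
        have := hm0 j
        have : q * (q - 1) / 2 ≤ 1 := by nlinarith
        have : 0 ≤ q * (q - 1) / 2 := by nlinarith
        nlinarith
      have : δ ^ 3 ≤ δ ^ 2 / 2 := by nlinarith [sq_nonneg δ]
      have : q * (q - 1) / 2 * m j * δ ^ 2 ≤ 1 * δ ^ 2 := by gcongr
      rw [hη]; linarith
    have hη3 : η ^ 2 ≤ 4 * δ ^ 3 := by
      have : η ^ 2 ≤ (2 * δ ^ 2) ^ 2 := by gcongr
      have : δ ^ 4 ≤ δ ^ 3 := by
        apply pow_le_pow_of_le_one hδ.le (by linarith) (by norm_num)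
      nlinarith
    have hfin : 1 + (2 / q) * η + η ^ 2 ≤ 1 + (q - 1) * δ ^ 2 * m j + 8 * δ ^ 3 := by
      have e : (2 / q) * η = (q - 1) * δ ^ 2 * m j + (2 / q) * (2 * δ ^ 3) := by
        rw [hη]; field_simp
      have : (2 / q) * (2 * δ ^ 3) ≤ 2 * (2 * δ ^ 3) := by gcongr
      linarith
    refine h1.trans (mul_le_mul_of_nonneg_left ?_ hS0)
    exact (rpow_le_rpow hN0 hN (by positivity)).trans (hb.trans hfin)
  -- expansion
  have hjint : ∀ j, Integrable (fun p : Euc n × Euc n => F p.1 * F p.2 * rk α p * (stw p.1 j * stw p.2 j)) :=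
    fun j => bdd_mul_int (c := 1) hII
      (((measurable_stw j).comp measurable_fst).mul ((measurable_stw j).comp measurable_snd))
      (fun p => by
        rw [abs_mul]
        exact mul_le_one₀ (stw_abs_le _ j) (abs_nonneg _) (stw_abs_le _ j))
  set T : Fin (n + 1) → ℝ := fun j => ∫ p : Euc n × Euc n, F p.1 * F p.2 * rk α p * (stw p.1 j * stw p.2 j) with hT
  have expand : ∀ j, II α (fun x => F x * (1 + δ * stw x j)) + II α (fun x => F x * (1 + (-δ) * stw x j))
      = 2 * II α F + 2 * δ ^ 2 * T j := by
    intro j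
    have ipm : ∀ s : ℝ, Integrable (fun p : Euc n × Euc n =>
        F p.1 * (1 + s * stw p.1 j) * (F p.2 * (1 + s * stw p.2 j)) * rk α p) := by
      intro s
      have := bdd_mul_int (c := (1 + |s|) * (1 + |s|)) (g := fun p : Euc n × Euc n =>
        (1 + s * stw p.1 j) * (1 + s * stw p.2 j)) hII
        (((((measurable_stw j).const_mul s).const_add 1).comp measurable_fst).mul
          ((((measurable_stw j).const_mul s).const_add 1).comp measurable_snd))
        (fun p => by
          have hb : ∀ x : Euc n, |1 + s * stw x j| ≤ 1 + |s| := fun x => by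
            refine (abs_add_le _ _).trans ?_
            rw [abs_one, abs_mul]
            have := mul_le_of_le_one_right (abs_nonneg s) (stw_abs_le x j)
            linarith
          rw [abs_mul]
          exact mul_le_mul (hb _) (hb _) (abs_nonneg _) (by positivity))
      refine this.congr (Eventually.of_forall fun p => ?_)
      simp only; ring
    unfold II
    rw [← integral_add (ipm δ) (ipm (-δ)), ← integral_const_mul, hT]
    simp only
    rw [← integral_const_mul, ← integral_add (hII.const_mul 2) ((hjint j).const_mul _)]
    refine integral_congr_ae (Eventually.of_forall fun p => ?_)
    simp only; ring
  have step : ∀ j, δ ^ 2 * T j ≤ ε + S * ((q - 1) * δ ^ 2 * m j + 8 * δ ^ 3) := by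
    intro j
    have h1 := pert j δ (abs_of_pos hδ)
    have h2 := pert j (-δ) (by rw [abs_neg, abs_of_pos hδ])
    have h3 := expand j
    linarith
  have hTsum : ∑ j, T j = ∫ p : Euc n × Euc n, F p.1 * F p.2 * rk α p * tk stw p := by
    rw [hT, ← integral_finsetSum _ (fun j _ => hjint j)]
    refine integral_congr_ae (Eventually.of_forall fun p => ?_)
    simp only
    rw [← Finset.mul_sum]
    rfl
  have total : δ ^ 2 * ∑ j, T j ≤ (n + 1) * ε + S * ((q - 1) * δ ^ 2) + (n + 1) * (8 * S * δ ^ 3) := by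
    have := Finset.sum_le_sum (fun j (_ : j ∈ Finset.univ) => step j)
    rw [← Finset.mul_sum, Finset.sum_add_distrib, ← Finset.mul_sum, Finset.sum_add_distrib, ← Finset.mul_sum,
      hsum] at this
    simp only [Finset.sum_const, Finset.card_univ, Fintype.card_fin, nsmul_eq_mul] at this
    push_cast at this
    linarith
  have hQ : QQ α F = (n - α) * ∑ j, T j - α * II α F := by
    rw [hTsum]
    unfold QQ II
    have it : Integrable (fun p : Euc n × Euc n => F p.1 * F p.2 * rk α p * tk stw p) := by
      have := integrable_finsetSum Finset.univ (fun j _ => hjint j)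
      refine this.congr (Eventually.of_forall fun p => ?_)
      simp only
      rw [← Finset.mul_sum]
      rfl
    rw [← integral_const_mul, ← integral_const_mul, ← integral_sub (it.const_mul _) (hII.const_mul _)]
    refine integral_congr_ae (Eventually.of_forall fun p => ?_)
    simp only; ring
  have total2 : ∑ j, T j ≤ (n + 1) * ε / δ ^ 2 + S * (q - 1) + 8 * (n + 1) * S * δ := by
    have : ∑ j, T j ≤ ((n + 1) * ε + S * ((q - 1) * δ ^ 2) + (n + 1) * (8 * S * δ ^ 3)) / δ ^ 2 := by
      rw [le_div_iff₀ (by positivity)]; linarith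
    refine this.trans (le_of_eq ?_)
    field_simp
  have hα2 : α = (n - α) * (q - 1) := by rw [hqm]; field_simp
  have hfin : QQ α F = (n - α) * (∑ j, T j - (q - 1) * II α F) := by
    rw [hQ]; nth_rewrite 2 [hα2]; ring
  rw [hfin]
  refine mul_le_mul_of_nonneg_left ?_ h0.le
  have : (q - 1) * (S - ε) ≤ (q - 1) * II α F := mul_le_mul_of_nonneg_left hε (by linarith)
  linarith

/-! ### The sharp HLS inequality -/

lemma holder_sph {n : ℕ} {α : ℝ} (hα : 0 < α) (hn : 2 * α < n) {F : Euc n → ℝ} (hF : Adm α F) :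
    Integrable (fun x => F x * srho x ^ α) ∧
    (∫ x, F x * srho x ^ α) ≤ (2 ^ (n:ℝ) * Cc n n) ^ (α / n) ∧
    ((2 ^ (n:ℝ) * Cc n n) ^ (α / n) ≤ (∫ x, F x * srho x ^ α) →
      ∀ᵐ x, F x ^ ((n:ℝ) / (n - α)) = srho x ^ (n:ℝ) / (2 ^ (n:ℝ) * Cc n n)) := by
  obtain ⟨h0, hq1, hq2, hqm, hn1⟩ := qfacts hα hn
  have hnr : (1:ℝ) ≤ n := by exact_mod_cast hn1
  have hC2 := Cc_pos (n := n) (r := n) (by linarith)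
  set B' := 2 ^ (n:ℝ) * Cc n n with hB'
  have hB : 0 < B' := by positivity
  set q := (n : ℝ) / (n - α) with hq
  have hpq : q.HolderConjugate (n / α) := by
    rw [Real.holderConjugate_iff]
    refine ⟨hq1, ?_⟩
    rw [hq, inv_div, inv_div]; field_simp; ring
  have hint := hF.int
  have hone := hF.one
  simp only [← hq] at hint hone
  set b : Euc n → ℝ := fun x => srho x ^ α / B' ^ (α / n) with hb
  have hbn : ∀ x, 0 ≤ b x := fun x => div_nonneg (rpow_nonneg (srho_pos x).le _) (by positivity)
  have hbp : ∀ x, b x ^ ((n:ℝ) / α) = srho x ^ (n:ℝ) / B' := by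
    intro x
    rw [hb]; simp only
    rw [div_rpow (rpow_nonneg (srho_pos x).le _) (by positivity), ← rpow_mul (srho_pos x).le, ← rpow_mul hB.le]
    rw [show α * ((n:ℝ) / α) = n by field_simp, show α / n * ((n:ℝ) / α) = 1 by field_simp, rpow_one]
  have hbi : Integrable (fun x => b x ^ ((n:ℝ) / α)) := by
    simp only [hbp]
    exact (integrable_srho n (by linarith)).div_const _
  have hbI : ∫ x, b x ^ ((n:ℝ) / α) = 1 := by
    simp only [hbp]
    rw [integral_div, integral_srho n (by linarith), ← hB', div_self hB.ne']
  have young : ∀ x, F x * b x ≤ F x ^ q / q + b x ^ ((n:ℝ) / α) / (n / α) := fun x =>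
    young_inequality_of_nonneg (hF.nonneg x) (hbn x) hpq
  have iR : Integrable (fun x => F x ^ q / q + b x ^ ((n:ℝ) / α) / (n / α)) :=
    (hint.div_const _).add (hbi.div_const _)
  have IR : ∫ x, (F x ^ q / q + b x ^ ((n:ℝ) / α) / (n / α)) = 1 := by
    rw [integral_add (hint.div_const _) (hbi.div_const _), integral_div, integral_div, hone, hbI, one_div, one_div]
    exact hpq.inv_add_inv_eq_one
  have mb : Measurable b := by
    have := measurable_srho (n := n)
    fun_prop
  have iL : Integrable (fun x => F x * b x) := by
    refine iR.mono' (hF.meas.mul mb).aestronglyMeasurable (Eventually.of_forall fun x => ?_)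
    rw [norm_of_nonneg (mul_nonneg (hF.nonneg x) (hbn x))]
    exact young x
  have eb : ∀ x, F x * srho x ^ α = B' ^ (α / n) * (F x * b x) := by
    intro x; rw [hb]; simp only; field_simp
  simp only [eb]
  rw [integral_const_mul]
  have hBa : 0 < B' ^ (α / n) := by positivity
  refine ⟨iL.const_mul _, ?_, ?_⟩
  · have := integral_mono iL iR young
    rw [IR] at this
    exact mul_le_of_le_one_right hBa.le this
  · intro h
    have h1 : 1 ≤ ∫ x, F x * b x := by
      by_contra hh
      push Not at hh
      have := mul_lt_mul_of_pos_left hh hBa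
      linarith
    have h2 : ∫ x, (F x ^ q / q + b x ^ ((n:ℝ) / α) / (n / α) - F x * b x) = 0 := by
      have h3 := integral_mono iL iR young
      rw [integral_sub iR iL, IR]
      rw [IR] at h3
      linarith
    have h4 := (integral_eq_zero_iff_of_nonneg (fun x => sub_nonneg.2 (young x)) (iR.sub iL)).1 h2
    filter_upwards [h4] with x hx
    have hx' : F x * b x = F x ^ q / q + b x ^ ((n:ℝ) / α) / (n / α) := by
      simp only [Pi.zero_apply] at hx; linarith
    rw [← hbp]
    exact (young_inequality_eq_iff_of_nonneg (hF.nonneg x) (hbn x) hpq).1 hx'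

lemma integral_affine {n : ℕ} {μ : ℝ} (hμ : 0 < μ) (x0 : Euc n) (g : Euc n → ℝ) :
    ∫ z, g (x0 + μ • z) = (μ ^ (n:ℝ))⁻¹ * ∫ x, g x := by
  have h1 := Measure.integral_comp_smul_of_nonneg (volume : Measure (Euc n)) (fun x => g (x0 + x)) μ (hR := hμ.le)
  simp only [finrank_euclideanSpace_fin] at h1
  rw [h1, integral_add_left_eq_self (fun x => g x) x0, rpow_natCast]
  rfl

lemma integral_affine2 {n : ℕ} {μ : ℝ} (hμ : 0 < μ) (x0 : Euc n) (g : Euc n × Euc n → ℝ) :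
    ∫ z : Euc n × Euc n, g (x0 + μ • z.1, x0 + μ • z.2) = (μ ^ (2 * (n:ℝ)))⁻¹ * ∫ x, g x := by
  have hh : (volume : Measure (Euc n × Euc n)).IsAddHaarMeasure := by
    rw [Measure.volume_eq_prod]; infer_instance
  have h1 := Measure.integral_comp_smul_of_nonneg (volume : Measure (Euc n × Euc n))
    (fun x => g ((x0, x0) + x)) μ (hR := hμ.le)
  have h2 : Module.finrank ℝ (Euc n × Euc n) = 2 * n := by
    rw [Module.finrank_prod]; simp; ring
  rw [h2] at h1
  rw [integral_add_left_eq_self (fun x => g x) (x0, x0)] at h1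
  have h3 : μ ^ (2 * (n:ℝ)) = μ ^ (2 * n) := by rw [← rpow_natCast]; push_cast; rfl
  rw [h3]
  exact h1

lemma integrable_affine {n : ℕ} {μ : ℝ} (hμ : 0 < μ) (x0 : Euc n) {g : Euc n → ℝ} (hg : Integrable g) :
    Integrable (fun z => g (x0 + μ • z)) :=
  (hg.comp_add_left x0).comp_smul hμ.ne'

lemma exists_centered {n : ℕ} {α : ℝ} (hα : 0 < α) (hn : 2 * α < n) {F : Euc n → ℝ} (hF : Adm α F) :
    ∃ (μ : ℝ) (x0 : Euc n), 0 < μ ∧ Adm α (fun z => μ ^ ((n:ℝ) - α) * F (x0 + μ • z)) ∧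
      II α (fun z => μ ^ ((n:ℝ) - α) * F (x0 + μ • z)) = II α F ∧
      ∀ j, ∫ z, (μ ^ ((n:ℝ) - α) * F (x0 + μ • z)) ^ ((n : ℝ) / (n - α)) * stw z j = 0 := by
  obtain ⟨h0, hq1, hq2, hqm, hn1⟩ := qfacts hα hn
  set q := (n : ℝ) / (n - α) with hq
  have hint := hF.int
  have hone := hF.one
  simp only [← hq] at hint hone
  obtain ⟨μ, x0, hμ, hc1, hc2⟩ := centering hn1 hint (fun x => rpow_nonneg (hF.nonneg x) q) hone
  have epow : ∀ z, (μ ^ ((n:ℝ) - α) * F (x0 + μ • z)) ^ q = μ ^ (n:ℝ) * F (x0 + μ • z) ^ q := by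
    intro z
    rw [mul_rpow (by positivity) (hF.nonneg _), ← rpow_mul hμ.le,
      show ((n:ℝ) - α) * q = n by rw [hq]; field_simp]
  have hμn : 0 < μ ^ (n:ℝ) := by positivity
  refine ⟨μ, x0, hμ, ⟨?_, ?_, ?_, ?_⟩, ?_, ?_⟩
  · have := hF.meas; fun_prop
  · intro z; exact mul_nonneg (by positivity) (hF.nonneg _)
  · simp only [← hq, epow]
    exact (integrable_affine hμ x0 hint).const_mul _
  · simp only [← hq, epow]
    rw [integral_const_mul, integral_affine hμ x0 (fun x => F x ^ q), hone, mul_one, mul_inv_cancel₀ hμn.ne']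
  · unfold II
    have e : ∀ p : Euc n × Euc n, μ ^ ((n:ℝ) - α) * F (x0 + μ • p.1) * (μ ^ ((n:ℝ) - α) * F (x0 + μ • p.2)) * rk α p
        = μ ^ (2 * (n:ℝ)) * (fun p : Euc n × Euc n => F p.1 * F p.2 * rk α p) (x0 + μ • p.1, x0 + μ • p.2) := by
      intro p
      have : rk α (x0 + μ • p.1, x0 + μ • p.2) = μ ^ (-(2 * α)) * rk α p := by
        unfold rk
        simp only [add_sub_add_left_eq_sub]
        rw [← smul_sub, norm_smul, norm_of_nonneg hμ.le, mul_rpow hμ.le (norm_nonneg _)]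
      simp only [this]
      have e2 : μ ^ (2 * (n:ℝ)) = μ ^ ((n:ℝ) - α) * μ ^ ((n:ℝ) - α) * μ ^ (2 * α) := by
        rw [← rpow_add hμ, ← rpow_add hμ]; congr 1; ring
      have e3 : μ ^ (2 * α) * μ ^ (-(2 * α)) = 1 := by rw [← rpow_add hμ]; simp
      rw [e2]
      calc _ = μ ^ ((n:ℝ) - α) * μ ^ ((n:ℝ) - α) * (F (x0 + μ • p.1) * F (x0 + μ • p.2) * rk α p) * 1 := by ring
        _ = _ := by rw [← e3]; ring
    simp only [e]
    rw [integral_const_mul, integral_affine2 hμ x0 (fun p => F p.1 * F p.2 * rk α p), ← mul_assoc, mul_inv_cancel₀ (by positivity), one_mul]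
  · intro j
    simp only [epow]
    set g : Euc n → ℝ := fun x => F x ^ q * stw (μ⁻¹ • (x - x0)) j with hg
    have e : ∀ z, μ ^ (n:ℝ) * F (x0 + μ • z) ^ q * stw z j = μ ^ (n:ℝ) * g (x0 + μ • z) := by
      intro z
      rw [hg]; simp only
      rw [add_sub_cancel_left, smul_smul, inv_mul_cancel₀ hμ.ne', one_smul, mul_assoc]
    simp only [e]
    rw [integral_const_mul, integral_affine hμ x0 g]
    suffices ∫ x, g x = 0 by rw [this]; simp
    have hs : ∀ x : Euc n, 0 < μ ^ 2 + ‖x - x0‖ ^ 2 := fun x => by positivity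
    have er : ∀ x : Euc n, srho (μ⁻¹ • (x - x0)) = 2 * (μ ^ 2 / (μ ^ 2 + ‖x - x0‖ ^ 2)) := by
      intro x
      unfold srho
      rw [norm_smul, norm_of_nonneg (by positivity), mul_pow]
      have := hs x
      field_simp
    have hi1 : Integrable (fun x => F x ^ q * (μ ^ 2 / (μ ^ 2 + ‖x - x0‖ ^ 2))) := by
      by_contra hh
      rw [integral_undef hh] at hc2
      norm_num at hc2
    rcases Fin.eq_zero_or_eq_succ j with rfl | ⟨i, rfl⟩
    · have e0 : ∀ x, g x = F x ^ q - 2 * (F x ^ q * (μ ^ 2 / (μ ^ 2 + ‖x - x0‖ ^ 2))) := by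
        intro x
        rw [hg]; simp only [stw, Fin.cons_zero, er]; ring
      simp only [e0]
      rw [integral_sub hint (hi1.const_mul 2), integral_const_mul, hone, hc2]; norm_num
    · have e0 : ∀ x, g x = 2 * μ * (F x ^ q * (inner ℝ (x - x0) (EuclideanSpace.single i (1:ℝ))
          / (μ ^ 2 + ‖x - x0‖ ^ 2))) := by
        intro x
        have hii : inner ℝ (x - x0) (EuclideanSpace.single i (1:ℝ)) = (x - x0) i := by
          rw [EuclideanSpace.inner_single_right]; simp
        rw [hg]; simp only [stw, Fin.cons_succ, er, hii]
        have := hs x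
        simp only [PiLp.smul_apply, smul_eq_mul]
        field_simp
      simp only [e0]
      rw [integral_const_mul, hc1, mul_zero]

/-- The sharp HLS constant. -/
def S0 (n : ℕ) (α : ℝ) : ℝ := Cc n (n - α) * Cc n n ^ (2 * α / n - 1)

lemma S0_eq {n : ℕ} {α : ℝ} (hα : 0 < α) (hn : 2 * α < n) :
    2 ^ ((n:ℝ) - 2 * α) * Cc n (n - α) / (2 ^ (n:ℝ) * Cc n n) * ((2 ^ (n:ℝ) * Cc n n) ^ (α / n)) ^ 2 = S0 n α := by
  obtain ⟨h0, hq1, hq2, hqm, hn1⟩ := qfacts hα hn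
  have hnr : (1:ℝ) ≤ n := by exact_mod_cast hn1
  have hC2 := Cc_pos (n := n) (r := n) (by linarith)
  unfold S0
  rw [← rpow_natCast, ← rpow_mul (by positivity), mul_rpow (by positivity) hC2.le, ← rpow_mul (by norm_num),
    rpow_sub hC2, rpow_one, rpow_sub (by norm_num)]
  rw [show (n:ℝ) * (α / n * ((2:ℕ):ℝ)) = 2 * α by push_cast; field_simp,
    show α / n * ((2:ℕ):ℝ) = 2 * α / n by push_cast; ring]
  field_simp

lemma S0_pos {n : ℕ} {α : ℝ} (hα : 0 < α) (hn : 2 * α < n) : 0 < S0 n α := by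
  obtain ⟨h0, hq1, hq2, hqm, hn1⟩ := qfacts hα hn
  have hC1 := Cc_pos (n := n) (r := n - α) (by linarith)
  have hC2 := Cc_pos (n := n) (r := n) (by linarith)
  unfold S0; positivity

lemma Adm_bdd {n : ℕ} {α : ℝ} (hα : 0 < α) (hn : 2 * α < n) :
    ∃ C : ℝ, ∀ F : Euc n → ℝ, Adm α F → II α F ≤ C := by
  obtain ⟨h0, hq1, hq2, hqm, hn1⟩ := qfacts hα hn
  set q := (n : ℝ) / (n - α) with hq
  obtain ⟨C, hC, H⟩ := hls_nonsharp (volume : Measure (Euc n)) (by simpa using hn1)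
    (lam := 2 * α) (q := q) (by linarith) (by simpa using hn)
    (by simp only [finrank_euclideanSpace_fin]; rw [hq, ← mul_sub, mul_div_mul_left _ _ two_ne_zero])
  refine ⟨C, fun F hF => ?_⟩
  have h1 := H F hF.meas hF.nonneg (by
    rw [← ofReal_integral_eq_lintegral_ofReal hF.int (Eventually.of_forall fun x => rpow_nonneg (hF.nonneg x) _),
      hF.one]; simp)
  have hm : Measurable (fun p : Euc n × Euc n => F p.1 * F p.2 * rk α p) := by
    have := measurable_rk (n := n) α
    have := hF.meas
    fun_prop
  have hp : ∀ p : Euc n × Euc n, 0 ≤ F p.1 * F p.2 * rk α p := fun p =>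
    mul_nonneg (mul_nonneg (hF.nonneg _) (hF.nonneg _)) (rk_nonneg _ _)
  unfold II
  rw [integral_eq_lintegral_of_nonneg_ae (Eventually.of_forall hp) hm.aestronglyMeasurable,
    Measure.volume_eq_prod, lintegral_prod _ hm.ennreal_ofReal.aemeasurable]
  exact ENNReal.toReal_le_of_le_ofReal hC h1

lemma small_delta {a b c d : ℝ} (h : ∀ δ : ℝ, 0 < δ → δ ≤ 1 / 2 → a ≤ b + c * δ + d * δ ^ 3) : a ≤ b := by
  have t : Tendsto (fun δ : ℝ => b + c * δ + d * δ ^ 3) (𝓝[>] 0) (𝓝 b) := by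
    have : ContinuousAt (fun δ : ℝ => b + c * δ + d * δ ^ 3) 0 := by fun_prop
    have h2 := this.tendsto
    simp only [mul_zero, add_zero] at h2
    norm_num at h2
    exact h2.mono_left nhdsWithin_le_nhds
  refine ge_of_tendsto t ?_
  filter_upwards [Ioc_mem_nhdsGT (show (0:ℝ) < 1 / 2 by norm_num)] with δ hδ
  exact h δ hδ.1 hδ.2

theorem hls_sharp_one {n : ℕ} {α : ℝ} (hα : 0 < α) (hn : 2 * α < n) :
    ∀ F : Euc n → ℝ, Adm α F → II α F ≤ S0 n α := by
  obtain ⟨h0, hq1, hq2, hqm, hn1⟩ := qfacts hα hn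
  have hC1 := Cc_pos (n := n) (r := n - α) (by linarith)
  have hC2 := Cc_pos (n := n) (r := n) (by linarith)
  obtain ⟨M, hM⟩ := Adm_bdd hα hn
  obtain ⟨C, hC, H⟩ := stereo_ineq hα hn
  intro F hF
  set T : Set ℝ := {t | ∃ F : Euc n → ℝ, Adm α F ∧ II α F = t} with hT
  have hTb : BddAbove T := ⟨M, by rintro t ⟨G, hG, rfl⟩; exact hM G hG⟩
  have hTn : T.Nonempty := ⟨_, F, hF, rfl⟩
  set S := sSup T with hS
  have hSub : ∀ G : Euc n → ℝ, Adm α G → II α G ≤ S := fun G hG => le_csSup hTb ⟨G, hG, rfl⟩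
  refine (hSub F hF).trans ?_
  set q := (n : ℝ) / (n - α) with hq
  refine small_delta (c := C * ((n - α) * ((n + 1) + 8 * (n + 1) * S))) (d := 1 + C * ((n - α) * (q - 1)))
    fun δ hδ hδ2 => ?_
  obtain ⟨t, ⟨G, hG, rfl⟩, hlt⟩ := exists_lt_of_lt_csSup hTn (show S - δ ^ 3 < sSup T by
    have : 0 < δ ^ 3 := by positivity
    linarith)
  obtain ⟨μ, x0, hμ, hA, hI, hc⟩ := exists_centered hα hn hG
  set G' := fun z => μ ^ ((n:ℝ) - α) * G (x0 + μ • z) with hG'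
  have hv := variation hα hn hSub hA hc (ε := δ ^ 3) (by rw [hI]; exact hlt.le) hδ hδ2
  obtain ⟨hh1, hh2, -⟩ := holder_sph hα hn hA
  have hs := H G' hA.meas hA.nonneg (by simpa only [abs_of_nonneg (hA.nonneg _)] using hA.int) hh1
  have h3 : (∫ x, G' x * srho x ^ α) ^ 2 ≤ ((2 ^ (n:ℝ) * Cc n n) ^ (α / n)) ^ 2 := by
    have : 0 ≤ ∫ x, G' x * srho x ^ α := integral_nonneg fun x => mul_nonneg (hA.nonneg x)
      (rpow_nonneg (srho_pos x).le _)
    gcongr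
  have h4 : II α G' ≤ S0 n α + C * QQ α G' := by
    rw [← S0_eq hα hn]
    refine hs.trans ?_
    gcongr
  have h5 := mul_le_mul_of_nonneg_left hv hC
  rw [← hq, show ((n:ℝ) + 1) * δ ^ 3 / δ ^ 2 = (n + 1) * δ by field_simp] at h5
  rw [hI] at h4
  linarith

theorem hls_sharp_eq {n : ℕ} {α : ℝ} (hα : 0 < α) (hn : 2 * α < n) {F : Euc n → ℝ} (hF : Adm α F)
    (hE : S0 n α ≤ II α F) : ∃ (μ : ℝ) (x0 : Euc n) (c : ℝ), 0 < μ ∧ 0 < c ∧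
      ∀ᵐ x, F x = c * (μ ^ 2 + ‖x - x0‖ ^ 2) ^ (-((n:ℝ) - α)) := by
  obtain ⟨h0, hq1, hq2, hqm, hn1⟩ := qfacts hα hn
  have hC1 := Cc_pos (n := n) (r := n - α) (by linarith)
  have hC2 := Cc_pos (n := n) (r := n) (by linarith)
  obtain ⟨C, hC, H⟩ := stereo_ineq hα hn
  obtain ⟨μ, x0, hμ, hA, hI, hc⟩ := exists_centered hα hn hF
  set G' := fun z => μ ^ ((n:ℝ) - α) * F (x0 + μ • z) with hG'
  have hQ : QQ α G' ≤ 0 := by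
    refine small_delta (c := (n - α) * (8 * (n + 1) * S0 n α)) (d := 0) fun δ hδ hδ2 => ?_
    have hv := variation hα hn (hls_sharp_one hα hn) hA hc (ε := 0) (by rw [hI]; linarith) hδ hδ2
    simp only [mul_zero, zero_div, zero_add] at hv
    linarith
  obtain ⟨hh1, hh2, hh3⟩ := holder_sph hα hn hA
  have hs := H G' hA.meas hA.nonneg (by simpa only [abs_of_nonneg (hA.nonneg _)] using hA.int) hh1
  set B' := 2 ^ (n:ℝ) * Cc n n with hB'
  have hB : 0 < B' := by positivity
  have h0' : 0 ≤ ∫ x, G' x * srho x ^ α := integral_nonneg fun x => mul_nonneg (hA.nonneg x)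
      (rpow_nonneg (srho_pos x).le _)
  have h4 : 2 ^ ((n:ℝ) - 2 * α) * Cc n (n - α) / B' * (B' ^ (α / n)) ^ 2 ≤
      2 ^ ((n:ℝ) - 2 * α) * Cc n (n - α) / B' * (∫ x, G' x * srho x ^ α) ^ 2 := by
    rw [hB', S0_eq hα hn, ← hB']
    have : C * QQ α G' ≤ 0 := mul_nonpos_of_nonneg_of_nonpos hC hQ
    rw [hI] at hs
    linarith
  have h5 := le_of_mul_le_mul_left h4 (by positivity)
  have h6 : B' ^ (α / n) ≤ ∫ x, G' x * srho x ^ α := le_of_sq_le_sq h5 h0'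
  have h7 := hh3 h6
  -- transport back
  have h8 : ∀ᵐ x : Euc n, G' (μ⁻¹ • (x - x0)) ^ ((n:ℝ) / (n - α)) = srho (μ⁻¹ • (x - x0)) ^ (n:ℝ) / B' := by
    have q1 : Measure.QuasiMeasurePreserving (fun x : Euc n => x - x0) volume volume :=
      (measurePreserving_sub_right volume x0).quasiMeasurePreserving
    have q2 : Measure.QuasiMeasurePreserving (fun x : Euc n => μ⁻¹ • x) volume volume := by
      refine ⟨by fun_prop, ?_⟩
      rw [Measure.map_addHaar_smul _ (inv_ne_zero hμ.ne')]
      exact Measure.smul_absolutelyContinuous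
    exact (q2.comp q1).ae h7
  refine ⟨μ, x0, (μ ^ ((n:ℝ) - α))⁻¹ * ((2 * μ ^ 2) ^ (n:ℝ) / B') ^ (((n:ℝ) - α) / n), hμ, by positivity, ?_⟩
  filter_upwards [h8] with x hx
  rw [hG'] at hx
  simp only at hx
  have hxx : x0 + μ • μ⁻¹ • (x - x0) = x := by
    rw [smul_smul, mul_inv_cancel₀ hμ.ne', one_smul]; abel
  rw [hxx] at hx
  have hs : 0 < μ ^ 2 + ‖x - x0‖ ^ 2 := by positivity
  have er : srho (μ⁻¹ • (x - x0)) = 2 * μ ^ 2 * (μ ^ 2 + ‖x - x0‖ ^ 2)⁻¹ := by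
    unfold srho
    rw [norm_smul, norm_of_nonneg (by positivity), mul_pow]
    field_simp
  have hnr : (0:ℝ) < n := by positivity
  have hx2 := congrArg (fun t => t ^ (((n:ℝ) - α) / n)) hx
  have hnn : 0 ≤ μ ^ ((n:ℝ) - α) * F x := mul_nonneg (by positivity) (hF.nonneg x)
  rw [← rpow_mul hnn, show (n:ℝ) / (n - α) * ((n - α) / n) = 1 by field_simp, rpow_one, er,
    mul_rpow (by positivity) (by positivity), mul_div_right_comm, mul_rpow (by positivity) (by positivity),
    ← rpow_mul (by positivity), show (n:ℝ) * (((n:ℝ) - α) / n) = n - α by field_simp, inv_rpow hs.le,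
    ← rpow_neg hs.le] at hx2
  rw [mul_assoc, ← hx2]
  field_simp

theorem hls_sharp {n : ℕ} {α : ℝ} (hα : 0 < α) (hn : 2 * α < n) {F : Euc n → ℝ} (hF : Measurable F)
    (hF0 : ∀ x, 0 ≤ F x) (hFq : Integrable (fun x => F x ^ ((n : ℝ) / (n - α)))) :
    II α F ≤ S0 n α * (∫ x, F x ^ ((n : ℝ) / (n - α))) ^ (2 / ((n : ℝ) / (n - α))) :=
  II_hom hα hn (hls_sharp_one hα hn) hF hF0 hFq

/-! ### Directional derivatives and Laplacians -/

section dirder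
variable {E : Type*} [NormedAddCommGroup E] [NormedSpace ℝ E]

def Dv (v : E) (f : E → ℝ) : E → ℝ := fun p => fderiv ℝ f p v

def Lop {ι : Type*} [Fintype ι] (e : ι → E) (f : E → ℝ) : E → ℝ := fun p => ∑ a, Dv (e a) (Dv (e a) f) p

def Tm {ι : Type*} [Fintype ι] (m : ℕ) (e : Option ι → E) (a : Option ι) (f : E → ℝ) : E → ℝ :=
  if Odd m then (if a = none then (Lop e)^[(m + 1) / 2] f else fun _ => 0)
  else Dv (e a) ((Lop e)^[m / 2] f)

lemma Dv_contDiff {v : E} {f : E → ℝ} (hf : ContDiff ℝ (⊤ : ℕ∞) f) : ContDiff ℝ (⊤ : ℕ∞) (Dv v f) := by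
  have h := (contDiff_infty_iff_fderiv.1 hf).2
  exact h.clm_apply contDiff_const

lemma Lop_contDiff {ι : Type*} [Fintype ι] {e : ι → E} {f : E → ℝ} (hf : ContDiff ℝ (⊤ : ℕ∞) f) :
    ContDiff ℝ (⊤ : ℕ∞) (Lop e f) := by
  unfold Lop
  exact ContDiff.sum fun a _ => Dv_contDiff (Dv_contDiff hf)

lemma Lop_iter_contDiff {ι : Type*} [Fintype ι] {e : ι → E} {f : E → ℝ} (hf : ContDiff ℝ (⊤ : ℕ∞) f) (k : ℕ) :
    ContDiff ℝ (⊤ : ℕ∞) ((Lop e)^[k] f) := by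
  induction k with
  | zero => exact hf
  | succ k ih => rw [Function.iterate_succ_apply']; exact Lop_contDiff ih

lemma Tm_contDiff {ι : Type*} [Fintype ι] {e : Option ι → E} {f : E → ℝ} (hf : ContDiff ℝ (⊤ : ℕ∞) f) (m : ℕ)
    (a : Option ι) : ContDiff ℝ (⊤ : ℕ∞) (Tm m e a f) := by
  unfold Tm
  split_ifs
  · exact Lop_iter_contDiff hf _
  · exact contDiff_const
  · exact Dv_contDiff (Lop_iter_contDiff hf _)

lemma norm_iter_Dv {v : E} (hv : ‖v‖ ≤ 1) {f : E → ℝ} (hf : ContDiff ℝ (⊤ : ℕ∞) f) (k : ℕ) (p : E) :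
    ‖iteratedFDeriv ℝ k (Dv v f) p‖ ≤ ‖iteratedFDeriv ℝ (k + 1) f p‖ := by
  have h := (contDiff_infty_iff_fderiv.1 hf).2
  have e : Dv v f = (ContinuousLinearMap.apply ℝ ℝ v) ∘ (fderiv ℝ f) := by
    ext p; rfl
  rw [e]
  have h1 := (ContinuousLinearMap.apply ℝ ℝ v).norm_iteratedFDeriv_comp_left (f := fderiv ℝ f) (x := p)
    (n := k) (N := (⊤ : ℕ∞)) h.contDiffAt (by exact_mod_cast le_top)
  rw [norm_iteratedFDeriv_fderiv] at h1
  refine h1.trans ?_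
  have h2 : ‖ContinuousLinearMap.apply ℝ ℝ v‖ ≤ 1 := by
    refine ContinuousLinearMap.opNorm_le_bound _ zero_le_one fun g => ?_
    simp only [ContinuousLinearMap.apply_apply, one_mul]
    exact (g.le_opNorm v).trans (mul_le_of_le_one_right (norm_nonneg _) hv)
  exact mul_le_of_le_one_left (norm_nonneg _) h2

lemma norm_iter_Lop {ι : Type*} [Fintype ι] {e : ι → E} (he : ∀ a, ‖e a‖ ≤ 1) {f : E → ℝ}
    (hf : ContDiff ℝ (⊤ : ℕ∞) f) (k : ℕ) (p : E) :
    ‖iteratedFDeriv ℝ k (Lop e f) p‖ ≤ Fintype.card ι * ‖iteratedFDeriv ℝ (k + 2) f p‖ := by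
  unfold Lop
  have h1 : iteratedFDeriv ℝ k (fun p => ∑ a, Dv (e a) (Dv (e a) f) p) p
      = ∑ a, iteratedFDeriv ℝ k (Dv (e a) (Dv (e a) f)) p := by
    have := iteratedFDeriv_sum (𝕜 := ℝ) (f := fun a => Dv (e a) (Dv (e a) f)) (u := Finset.univ) (i := k) (fun a _ =>
      ((Dv_contDiff (Dv_contDiff hf)).of_le (by exact_mod_cast le_top)))
    rw [this]
    simp
  rw [h1]
  refine (norm_sum_le _ _).trans ?_
  calc _ ≤ ∑ a : ι, ‖iteratedFDeriv ℝ (k + 2) f p‖ := Finset.sum_le_sum fun a _ =>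
        (norm_iter_Dv (he a) (Dv_contDiff hf) k p).trans (norm_iter_Dv (he a) hf (k + 1) p)
    _ = _ := by simp

lemma norm_iter_LopIter {ι : Type*} [Fintype ι] {e : ι → E} (he : ∀ a, ‖e a‖ ≤ 1) {f : E → ℝ}
    (hf : ContDiff ℝ (⊤ : ℕ∞) f) (j k : ℕ) (p : E) :
    ‖iteratedFDeriv ℝ k ((Lop e)^[j] f) p‖ ≤ (Fintype.card ι : ℝ) ^ j * ‖iteratedFDeriv ℝ (k + 2 * j) f p‖ := by
  induction j generalizing k with
  | zero => simp
  | succ j ih =>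
    rw [Function.iterate_succ_apply']
    refine (norm_iter_Lop he (Lop_iter_contDiff hf j) k p).trans ?_
    rw [pow_succ', mul_assoc]
    gcongr
    have := ih (k + 2)
    rw [show k + 2 * (j + 1) = k + 2 + 2 * j by ring]
    exact this

lemma abs_LopIter {ι : Type*} [Fintype ι] {e : ι → E} (he : ∀ a, ‖e a‖ ≤ 1) {f : E → ℝ}
    (hf : ContDiff ℝ (⊤ : ℕ∞) f) (j : ℕ) (p : E) :
    |(Lop e)^[j] f p| ≤ (Fintype.card ι : ℝ) ^ j * ‖iteratedFDeriv ℝ (2 * j) f p‖ := by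
  have := norm_iter_LopIter he hf j 0 p
  rwa [norm_iteratedFDeriv_zero, zero_add] at this

lemma abs_Dv_LopIter {ι : Type*} [Fintype ι] {e : ι → E} (he : ∀ a, ‖e a‖ ≤ 1) {f : E → ℝ}
    (hf : ContDiff ℝ (⊤ : ℕ∞) f) (j : ℕ) (a : ι) (p : E) :
    |Dv (e a) ((Lop e)^[j] f) p| ≤ (Fintype.card ι : ℝ) ^ j * ‖iteratedFDeriv ℝ (2 * j + 1) f p‖ := by
  have h := norm_iter_Dv (he a) (Lop_iter_contDiff (e := e) hf j) 0 p
  rw [norm_iteratedFDeriv_zero, zero_add] at h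
  have := norm_iter_LopIter he hf j 1 p
  rw [add_comm 1] at this
  exact h.trans this

lemma abs_DDv_LopIter {ι : Type*} [Fintype ι] {e : ι → E} (he : ∀ a, ‖e a‖ ≤ 1) {f : E → ℝ}
    (hf : ContDiff ℝ (⊤ : ℕ∞) f) (j : ℕ) (a : ι) (p : E) :
    |Dv (e a) (Dv (e a) ((Lop e)^[j] f)) p| ≤ (Fintype.card ι : ℝ) ^ j * ‖iteratedFDeriv ℝ (2 * j + 2) f p‖ := by
  have h := norm_iter_Dv (he a) (Dv_contDiff (v := e a) (Lop_iter_contDiff (e := e) hf j)) 0 p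
  rw [norm_iteratedFDeriv_zero, zero_add] at h
  have h2 := norm_iter_Dv (he a) (Lop_iter_contDiff (e := e) hf j) 1 p
  have := norm_iter_LopIter he hf j 2 p
  rw [add_comm 2] at this
  exact h.trans (h2.trans this)

end dirder

/-- coordinate directions in `ℝⁿ × ℝ` -/
def dX (n : ℕ) : Option (Fin n) → Euc n × ℝ
  | none => (0, 1)
  | some i => (EuclideanSpace.single i 1, 0)

lemma dX_norm {n : ℕ} (a : Option (Fin n)) : ‖dX n a‖ ≤ 1 := by
  cases a <;> simp [dX, Prod.norm_def]

lemma hasDerivAt_slice {n : ℕ} {u : Euc n × ℝ → ℝ} (hu : ContDiff ℝ (⊤ : ℕ∞) u) (x : Euc n) (y : ℝ) :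
    HasDerivAt (fun t => u (x, t)) (Dv (dX n none) u (x, y)) y := by
  have h1 : HasFDerivAt u (fderiv ℝ u (x, y)) (x, y) := (hu.differentiable (by simp) _).hasFDerivAt
  have h2 : HasDerivAt (fun t : ℝ => (x, t)) ((0 : Euc n), (1 : ℝ)) y := (hasDerivAt_const y x).prodMk (hasDerivAt_id y)
  exact h1.comp_hasDerivAt y h2

lemma fderiv_slice {n : ℕ} {u : Euc n × ℝ → ℝ} (hu : ContDiff ℝ (⊤ : ℕ∞) u) (x : Euc n) (y : ℝ) (v : Euc n) :
    fderiv ℝ (fun x' => u (x', y)) x v = Dv (v, (0:ℝ)) u (x, y) := by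
  have h1 : HasFDerivAt u (fderiv ℝ u (x, y)) (x, y) := (hu.differentiable (by simp) _).hasFDerivAt
  have h2 : HasFDerivAt (fun x' : Euc n => (x', y)) ((ContinuousLinearMap.id ℝ (Euc n)).prod 0) x :=
    (hasFDerivAt_id x).prodMk (hasFDerivAt_const y x)
  have h3 := h1.comp x h2
  have h4 := h3.fderiv
  have e : (u ∘ fun x' : Euc n => (x', y)) = fun x' => u (x', y) := rfl
  rw [e] at h4
  rw [h4]
  simp [Dv]

lemma lapH_eq {n : ℕ} {U : Euc n → ℝ → ℝ} (hu : ContDiff ℝ (⊤ : ℕ∞) (Function.uncurry U)) (x : Euc n) (y : ℝ) :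
    lapH U x y = Lop (dX n) (Function.uncurry U) (x, y) := by
  unfold lapH lapX lap Lop
  rw [Fintype.sum_option, add_comm]
  congr 1
  · have e1 : deriv (fun t => U x t) = fun t => Dv (dX n none) (Function.uncurry U) (x, t) := by
      ext t; exact (hasDerivAt_slice hu x t).deriv
    rw [iteratedDeriv_succ, iteratedDeriv_one, e1]
    exact (hasDerivAt_slice (Dv_contDiff hu) x y).deriv
  · refine Finset.sum_congr rfl fun i _ => ?_
    rw [iteratedFDeriv_two_apply]
    have hs : ContDiff ℝ (⊤ : ℕ∞) (fun x' => U x' y) :=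
      hu.comp (contDiff_id.prodMk contDiff_const)
    have e1 : (fun x' => fderiv ℝ (fun x' => U x' y) x' (EuclideanSpace.single i 1))
        = fun x' => Dv (dX n (some i)) (Function.uncurry U) (x', y) := by
      ext x'; exact fderiv_slice hu x' y _
    have hd : DifferentiableAt ℝ (fderiv ℝ (fun x' => U x' y)) x :=
      ((contDiff_infty_iff_fderiv.1 hs).2.differentiable (by simp)) x
    have e2 : fderiv ℝ (fderiv ℝ (fun x' => U x' y)) x (EuclideanSpace.single i 1) (EuclideanSpace.single i 1)
        = fderiv ℝ (fun x' => fderiv ℝ (fun x' => U x' y) x' (EuclideanSpace.single i 1)) x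
            (EuclideanSpace.single i 1) := by
      rw [fderiv_clm_apply hd (differentiableAt_const _)]
      simp
    rw [e2, e1]
    exact fderiv_slice (Dv_contDiff hu) x y _

lemma lapHIter_eq {n : ℕ} {U : Euc n → ℝ → ℝ} (hu : ContDiff ℝ (⊤ : ℕ∞) (Function.uncurry U)) (k : ℕ) :
    Function.uncurry (lapHIter k U) = (Lop (dX n))^[k] (Function.uncurry U) := by
  induction k with
  | zero => rfl
  | succ k ih =>
    unfold lapHIter at ih ⊢
    rw [Function.iterate_succ_apply', Function.iterate_succ_apply', ← ih]
    ext ⟨x, y⟩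
    exact lapH_eq (by rw [ih]; exact Lop_iter_contDiff hu k) x y

lemma lapHIter_apply {n : ℕ} {U : Euc n → ℝ → ℝ} (hu : ContDiff ℝ (⊤ : ℕ∞) (Function.uncurry U)) (k : ℕ)
    (x : Euc n) (y : ℝ) : lapHIter k U x y = (Lop (dX n))^[k] (Function.uncurry U) (x, y) := by
  rw [← lapHIter_eq hu]; rfl

lemma deriv_lapHIter {n : ℕ} {U : Euc n → ℝ → ℝ} (hu : ContDiff ℝ (⊤ : ℕ∞) (Function.uncurry U)) (k : ℕ)
    (x : Euc n) (y : ℝ) : deriv (fun t => lapHIter k U x t) y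
      = Dv (dX n none) ((Lop (dX n))^[k] (Function.uncurry U)) (x, y) := by
  simp only [lapHIter_apply hu]
  exact (hasDerivAt_slice (Lop_iter_contDiff hu k) x y).deriv

lemma gradPowH_eq {n : ℕ} {U : Euc n → ℝ → ℝ} (hu : ContDiff ℝ (⊤ : ℕ∞) (Function.uncurry U)) (m : ℕ)
    (x : Euc n) (y : ℝ) : gradPowH m U x y = ∑ a, Tm m (dX n) a (Function.uncurry U) (x, y) ^ 2 := by
  unfold gradPowH
  rw [Fintype.sum_option]
  unfold Tm
  by_cases h : Odd m
  · simp [lapHIter_apply hu, h]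
  · simp only [h, if_false]
    rw [deriv_lapHIter hu, add_comm]
    congr 1
    rw [EuclideanSpace.norm_sq_eq]
    refine Finset.sum_congr rfl fun i _ => ?_
    have hs : ContDiff ℝ (⊤ : ℕ∞) (fun x' => lapHIter (m / 2) U x' y) := by
      simp only [lapHIter_apply hu]
      exact (Lop_iter_contDiff hu _).comp (contDiff_id.prodMk contDiff_const)
    have e1 : gradient (fun x' => lapHIter (m / 2) U x' y) x i
        = fderiv ℝ (fun x' => lapHIter (m / 2) U x' y) x (EuclideanSpace.single i 1) := by
      have := inner_gradient_left (𝕜 := ℝ) (f := (fun x' => lapHIter (m / 2) U x' y)) (x := x) (y := EuclideanSpace.single i 1)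
      rw [← this]
      rw [EuclideanSpace.inner_single_right]; simp
    rw [e1, Real.norm_eq_abs, sq_abs]
    simp only [lapHIter_apply hu]
    rw [fderiv_slice (Lop_iter_contDiff hu _)]
    rfl

/-! ### Divergence lemma and Green identities on the half space -/

lemma half_restrict (n : ℕ) : (volume : Measure (Euc n × ℝ)).restrict (upperHS n)
    = (volume : Measure (Euc n)).prod ((volume : Measure ℝ).restrict (Set.Ioi 0)) := by
  have e : upperHS n = (Set.univ : Set (Euc n)) ×ˢ Set.Ioi (0:ℝ) := by
    ext p; simp [upperHS]
  rw [e, Measure.volume_eq_prod, ← Measure.prod_restrict, Measure.restrict_univ]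

lemma measurableSet_half (n : ℕ) : MeasurableSet (upperHS n) :=
  measurableSet_lt measurable_const measurable_snd

/-- almost all coordinate sections are integrable -/
def SecInt {n : ℕ} (F : Euc n × ℝ → ℝ) : Prop :=
  (∀ᵐ y ∂((volume : Measure ℝ).restrict (Set.Ioi 0)), Integrable (fun x => F (x, y))) ∧
  (∀ᵐ x : Euc n, IntegrableOn (fun y => F (x, y)) (Set.Ioi 0))

lemma SecInt.of_integrable {n : ℕ} {F : Euc n × ℝ → ℝ} (h : IntegrableOn F (upperHS n)) : SecInt F := by
  unfold IntegrableOn at h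
  rw [half_restrict] at h
  exact ⟨h.prod_left_ae, h.prod_right_ae⟩

lemma SecInt.mono {n : ℕ} {F G : Euc n × ℝ → ℝ} (h : SecInt F) (hG : Continuous G) (C : ℝ)
    (hb : ∀ p, |G p| ≤ C * |F p|) : SecInt G := by
  refine ⟨?_, ?_⟩
  · filter_upwards [h.1] with y hy
    refine Integrable.mono' (hy.abs.const_mul C) (by fun_prop) ?_
    exact ae_of_all _ fun x => hb (x, y)
  · filter_upwards [h.2] with x hx
    refine Integrable.mono' (hx.abs.const_mul C) (Continuous.aestronglyMeasurable (by fun_prop)) ?_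
    exact ae_of_all _ fun y => hb (x, y)

lemma integral_dir_zero {n : ℕ} {g : Euc n → ℝ} (hg : Differentiable ℝ g) (hi : Integrable g) (v : Euc n)
    (hi' : Integrable (fun x => fderiv ℝ g x v)) : ∫ x, fderiv ℝ g x v = 0 := by
  have h := integral_mul_fderiv_eq_neg_fderiv_mul_of_integrable (𝕜 := ℝ) (μ := (volume : Measure (Euc n)))
    (f := fun _ => (1:ℝ)) (g := g) (v := v) (by simp) (by simpa using hi') (by simpa using hi)
    (fun x _ => differentiableAt_const _) (fun x _ => (hg x))
  simpa using h

lemma div_half {n : ℕ} {F : Euc n × ℝ → ℝ} (hF : ContDiff ℝ (⊤ : ℕ∞) F) (a : Option (Fin n))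
    (hD : IntegrableOn (Dv (dX n a) F) (upperHS n)) (hs : SecInt F)
    (hb : a = none → ∀ x, F (x, 0) = 0) : ∫ p in upperHS n, Dv (dX n a) F p = 0 := by
  unfold IntegrableOn at hD
  rw [half_restrict] at hD ⊢
  cases a with
  | none =>
    rw [integral_prod _ hD]
    rw [integral_eq_zero_of_ae]
    filter_upwards [hs.2, hD.prod_right_ae] with x hx hx'
    have h1 : ∀ y ∈ Set.Ioi (0:ℝ), HasDerivAt (fun t => F (x, t)) (Dv (dX n none) F (x, y)) y :=
      fun y _ => hasDerivAt_slice hF x y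
    have ht := tendsto_zero_of_hasDerivAt_of_integrableOn_Ioi h1 hx' hx
    have := integral_Ioi_of_hasDerivAt_of_tendsto' (a := (0:ℝ)) (f := fun t => F (x, t))
      (fun y _ => hasDerivAt_slice hF x y) hx' ht
    simp only [hb rfl x, sub_zero] at this
    exact this
  | some i =>
    rw [integral_prod_symm _ hD]
    rw [integral_eq_zero_of_ae]
    filter_upwards [hs.1, hD.prod_left_ae] with y hy hy'
    have e : ∀ x, Dv (dX n (some i)) F (x, y) = fderiv ℝ (fun x' => F (x', y)) x (EuclideanSpace.single i 1) :=
      fun x => (fderiv_slice hF x y _).symm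
    simp only [e] at hy' ⊢
    have hs : ContDiff ℝ (⊤ : ℕ∞) (fun x' => F (x', y)) := hF.comp (contDiff_id.prodMk contDiff_const)
    exact integral_dir_zero (hs.differentiable (by simp)) hy _ hy'

lemma Dv_mul {E : Type*} [NormedAddCommGroup E] [NormedSpace ℝ E] {f g : E → ℝ} (hf : ContDiff ℝ (⊤ : ℕ∞) f)
    (hg : ContDiff ℝ (⊤ : ℕ∞) g) (v : E) (p : E) :
    Dv v (fun p => f p * g p) p = Dv v f p * g p + f p * Dv v g p := by
  have h := ((hf.differentiable (by simp) p).hasFDerivAt.mul (hg.differentiable (by simp) p).hasFDerivAt).fderiv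
  unfold Dv
  have e : (fun p => f p * g p) = f * g := rfl
  rw [e, h]
  simp; ring

/-- first Green identity in one direction -/
lemma green_one {n : ℕ} {f g : Euc n × ℝ → ℝ} (hf : ContDiff ℝ (⊤ : ℕ∞) f) (hg : ContDiff ℝ (⊤ : ℕ∞) g)
    (a : Option (Fin n))
    (h1 : IntegrableOn (fun p => Dv (dX n a) f p * Dv (dX n a) g p) (upperHS n))
    (h2 : IntegrableOn (fun p => f p * Dv (dX n a) (Dv (dX n a) g) p) (upperHS n))
    (hs : SecInt (fun p => f p * Dv (dX n a) g p))
    (hb : a = none → ∀ x, Dv (dX n none) g (x, 0) = 0) :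
    ∫ p in upperHS n, Dv (dX n a) f p * Dv (dX n a) g p
      = - ∫ p in upperHS n, f p * Dv (dX n a) (Dv (dX n a) g) p := by
  have hg' := Dv_contDiff (v := dX n a) hg
  have e : Dv (dX n a) (fun p => f p * Dv (dX n a) g p)
      = fun p => Dv (dX n a) f p * Dv (dX n a) g p + f p * Dv (dX n a) (Dv (dX n a) g) p := by
    ext p; exact Dv_mul hf hg' _ p
  have h := div_half (F := fun p => f p * Dv (dX n a) g p) (hf.mul hg') a (by rw [e]; exact h1.add h2) hs
    (by rintro rfl x; rw [hb rfl x, mul_zero])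
  rw [e, integral_add h1 h2] at h
  linarith

def wt {n : ℕ} (b : ℝ) (p : Euc n × ℝ) : ℝ := (1 + ‖p‖) ^ (-b)

lemma wt_pos {n : ℕ} (b : ℝ) (p : Euc n × ℝ) : 0 < wt b p := by
  unfold wt; positivity

lemma wt_cont {n : ℕ} (b : ℝ) : Continuous (wt (n := n) b) := by
  unfold wt
  exact Continuous.rpow_const (by fun_prop) fun p => Or.inl (by positivity)

lemma wt_mul {n : ℕ} (b c : ℝ) (p : Euc n × ℝ) : wt b p * wt c p = wt (b + c) p := by
  unfold wt
  rw [← Real.rpow_add (by positivity)]; ring_nf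

structure Good (n m : ℕ) (u : Euc n × ℝ → ℝ) : Prop where
  sm : ContDiff ℝ (⊤ : ℕ∞) u
  bd : ∀ k ≤ (m - 1) / 2, ∀ x, Dv (dX n none) ((Lop (dX n))^[k] u) (x, 0) = 0
  int : ∀ k ≤ m + 1, IntegrableOn (fun p => ‖iteratedFDeriv ℝ k u p‖ * wt ((n:ℝ) + 1 - k) p) (upperHS n)
  sec : ∀ k ≤ m, SecInt (fun p => ‖iteratedFDeriv ℝ k u p‖ * wt ((n:ℝ) - k) p)
  l2 : IntegrableOn (fun p => ‖iteratedFDeriv ℝ (m + 1) u p‖ ^ 2) (upperHS n)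

structure Nice (n m : ℕ) (v : Euc n × ℝ → ℝ) : Prop where
  sm : ContDiff ℝ (⊤ : ℕ∞) v
  bd : ∀ k, ∀ x, Dv (dX n none) ((Lop (dX n))^[k] v) (x, 0) = 0
  bound : ∀ k : ℕ, ∃ C, ∀ p, ‖iteratedFDeriv ℝ k v p‖ ≤ C * wt ((n:ℝ) - 2 * m - 1 + k) p

section chain
variable {n m : ℕ} {u v : Euc n × ℝ → ℝ}

lemma Good.int_mul (hu : Good n m u) (hv : Nice n m v) {k l : ℕ} (hk : k ≤ m + 1) (hl : k + l = 2 * m + 2)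
    {f g : Euc n × ℝ → ℝ} (hf : Continuous f) (hg : Continuous g) {A B : ℝ}
    (hfb : ∀ p, |f p| ≤ A * ‖iteratedFDeriv ℝ k u p‖)
    (hgb : ∀ p, |g p| ≤ B * ‖iteratedFDeriv ℝ l v p‖) (hB : 0 ≤ B) :
    IntegrableOn (fun p => f p * g p) (upperHS n) := by
  obtain ⟨C, hC⟩ := hv.bound l
  refine Integrable.mono' ((hu.int k hk).const_mul (A * B * C)) (hf.mul hg).aestronglyMeasurable ?_
  refine ae_of_all _ fun p => ?_
  rw [Real.norm_eq_abs, abs_mul]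
  have e : ((n:ℝ) - 2 * m - 1 + l) = (n:ℝ) + 1 - k := by
    have : (k:ℝ) + l = 2 * m + 2 := by exact_mod_cast hl
    linarith
  have h1 := hC p
  rw [e] at h1
  calc _ ≤ (A * ‖iteratedFDeriv ℝ k u p‖) * (B * (C * wt ((n:ℝ) + 1 - k) p)) := by
        gcongr
        · exact (abs_nonneg _).trans (hfb p)
        · exact hfb p
        · exact (hgb p).trans (by gcongr)
    _ = _ := by ring

lemma Good.sec_mul (hu : Good n m u) (hv : Nice n m v) {k l : ℕ} (hk : k ≤ m) (hl : k + l = 2 * m + 1)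
    {f g : Euc n × ℝ → ℝ} (hf : Continuous f) (hg : Continuous g) {A B : ℝ}
    (hfb : ∀ p, |f p| ≤ A * ‖iteratedFDeriv ℝ k u p‖)
    (hgb : ∀ p, |g p| ≤ B * ‖iteratedFDeriv ℝ l v p‖) (hB : 0 ≤ B) :
    SecInt (fun p => f p * g p) := by
  obtain ⟨C, hC⟩ := hv.bound l
  refine (hu.sec k hk).mono (hf.mul hg) (A * B * C) fun p => ?_
  rw [abs_mul, abs_of_nonneg (mul_nonneg (norm_nonneg _) (wt_pos _ _).le)]
  have e : ((n:ℝ) - 2 * m - 1 + l) = (n:ℝ) - k := by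
    have : (k:ℝ) + l = 2 * m + 1 := by exact_mod_cast hl
    linarith
  have h1 := hC p
  rw [e] at h1
  calc _ ≤ (A * ‖iteratedFDeriv ℝ k u p‖) * (B * (C * wt ((n:ℝ) - k) p)) := by
        gcongr
        · exact (abs_nonneg _).trans (hfb p)
        · exact hfb p
        · exact (hgb p).trans (by gcongr)
    _ = _ := by ring

lemma SecInt.swap {F G : Euc n × ℝ → ℝ} (h : SecInt (fun p => F p * G p)) : SecInt (fun p => G p * F p) := by
  simpa only [mul_comm] using h

/-- moving one Laplacian -/
lemma green_move (hu : Good n m u) (hv : Nice n m v) {j k : ℕ} (hj : 2 * j + 2 ≤ m + 1) (hjk : j + k = m) :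
    ∫ p in upperHS n, (Lop (dX n))^[j+1] u p * (Lop (dX n))^[k] v p
      = ∫ p in upperHS n, (Lop (dX n))^[j] u p * (Lop (dX n))^[k+1] v p := by
  have hf := Lop_iter_contDiff (e := dX n) hu.sm j
  have hg := Lop_iter_contDiff (e := dX n) hv.sm k
  have B0 : ∀ i : ℕ, (0:ℝ) ≤ (Fintype.card (Option (Fin n)) : ℝ) ^ i := fun i => by positivity
  have i1 : ∀ a, IntegrableOn (fun p => Dv (dX n a) (Dv (dX n a) ((Lop (dX n))^[j] u)) p * (Lop (dX n))^[k] v p)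
      (upperHS n) := fun a => hu.int_mul hv (k := 2 * j + 2) (l := 2 * k) hj (by omega)
    (Dv_contDiff (Dv_contDiff hf)).continuous hg.continuous
      (abs_DDv_LopIter dX_norm hu.sm j a) (abs_LopIter dX_norm hv.sm k) (B0 k)
  have i2 : ∀ a, IntegrableOn (fun p => (Lop (dX n))^[j] u p * Dv (dX n a) (Dv (dX n a) ((Lop (dX n))^[k] v)) p)
      (upperHS n) := fun a => hu.int_mul hv (k := 2 * j) (l := 2 * k + 2) (by omega) (by omega)
    hf.continuous (Dv_contDiff (Dv_contDiff hg)).continuous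
      (abs_LopIter dX_norm hu.sm j) (abs_DDv_LopIter dX_norm hv.sm k a) (B0 k)
  have i3 : ∀ a, IntegrableOn (fun p => Dv (dX n a) ((Lop (dX n))^[j] u) p * Dv (dX n a) ((Lop (dX n))^[k] v) p)
      (upperHS n) := fun a => hu.int_mul hv (k := 2 * j + 1) (l := 2 * k + 1) (by omega) (by omega)
    (Dv_contDiff hf).continuous (Dv_contDiff hg).continuous
      (abs_Dv_LopIter dX_norm hu.sm j a) (abs_Dv_LopIter dX_norm hv.sm k a) (B0 k)
  have s1 : ∀ a, SecInt (fun p => Dv (dX n a) ((Lop (dX n))^[j] u) p * (Lop (dX n))^[k] v p) := fun a =>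
    hu.sec_mul hv (k := 2 * j + 1) (l := 2 * k) (by omega) (by omega)
    (Dv_contDiff hf).continuous hg.continuous
      (abs_Dv_LopIter dX_norm hu.sm j a) (abs_LopIter dX_norm hv.sm k) (B0 k)
  have s2 : ∀ a, SecInt (fun p => (Lop (dX n))^[j] u p * Dv (dX n a) ((Lop (dX n))^[k] v) p) := fun a =>
    hu.sec_mul hv (k := 2 * j) (l := 2 * k + 1) (by omega) (by omega)
    hf.continuous (Dv_contDiff hg).continuous
      (abs_LopIter dX_norm hu.sm j) (abs_Dv_LopIter dX_norm hv.sm k a) (B0 k)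
  have key : ∀ a, ∫ p in upperHS n, Dv (dX n a) (Dv (dX n a) ((Lop (dX n))^[j] u)) p * (Lop (dX n))^[k] v p
      = ∫ p in upperHS n, (Lop (dX n))^[j] u p * Dv (dX n a) (Dv (dX n a) ((Lop (dX n))^[k] v)) p := by
    intro a
    have g1 := green_one hf hg a (i3 a) (i2 a) (s2 a) (fun _ => hv.bd k)
    have g2 := green_one hg hf a (by simpa only [mul_comm] using i3 a) (by simpa only [mul_comm] using i1 a)
      (s1 a).swap (fun _ => hu.bd j (by omega))
    have c1 : ∫ p in upperHS n, Dv (dX n a) ((Lop (dX n))^[k] v) p * Dv (dX n a) ((Lop (dX n))^[j] u) p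
      = ∫ p in upperHS n, Dv (dX n a) ((Lop (dX n))^[j] u) p * Dv (dX n a) ((Lop (dX n))^[k] v) p := by
      simp only [mul_comm]
    have c2 : ∫ p in upperHS n, (Lop (dX n))^[k] v p * Dv (dX n a) (Dv (dX n a) ((Lop (dX n))^[j] u)) p
      = ∫ p in upperHS n, Dv (dX n a) (Dv (dX n a) ((Lop (dX n))^[j] u)) p * (Lop (dX n))^[k] v p := by
      simp only [mul_comm]
    linarith
  rw [Function.iterate_succ_apply', Function.iterate_succ_apply']
  unfold Lop at *
  simp only [Finset.sum_mul, Finset.mul_sum]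
  rw [integral_finsetSum _ fun a _ => i1 a, integral_finsetSum _ fun a _ => i2 a]
  exact Finset.sum_congr rfl fun a _ => key a

lemma green_moves (hu : Good n m u) (hv : Nice n m v) (j : ℕ) (hj : 2 * j ≤ m + 1) :
    ∫ p in upperHS n, (Lop (dX n))^[j] u p * (Lop (dX n))^[m + 1 - j] v p
      = ∫ p in upperHS n, u p * (Lop (dX n))^[m + 1] v p := by
  induction j with
  | zero => simp
  | succ j ih =>
    rw [← ih (by omega)]
    have := green_move hu hv (j := j) (k := m - j) (by omega) (by omega)
    rw [show m + 1 - (j + 1) = m - j by omega, show m + 1 - j = m - j + 1 by omega]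
    exact this

lemma green_chain (hu : Good n m u) (hv : Nice n m v) :
    ∫ p in upperHS n, ∑ a, Tm m (dX n) a u p * Tm m (dX n) a v p
      = (-1) ^ (m + 1) * ∫ p in upperHS n, u p * (Lop (dX n))^[m + 1] v p := by
  by_cases h : Odd m
  · have he : (-1 : ℝ) ^ (m + 1) = 1 := by
      rw [Even.neg_one_pow]; exact h.add_odd odd_one
    rw [he, one_mul, ← green_moves hu hv ((m + 1) / 2) (by omega)]
    have : m + 1 - (m + 1) / 2 = (m + 1) / 2 := by
      obtain ⟨r, rfl⟩ := h; omega
    rw [this]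
    simp only [Tm, h, if_true, Fintype.sum_option]
    simp
  · have h' := Nat.not_odd_iff_even.1 h
    have he : (-1 : ℝ) ^ (m + 1) = -1 := by
      rw [Odd.neg_one_pow]; exact h'.add_odd odd_one
    rw [he, ← green_moves hu hv (m / 2) (by omega)]
    have e : m + 1 - m / 2 = m / 2 + 1 := by
      obtain ⟨r, rfl⟩ := h'; omega
    have e2 : 2 * (m / 2) = m := by
      obtain ⟨r, rfl⟩ := h'; omega
    rw [e]
    simp only [Tm, h, if_false]
    have hf := Lop_iter_contDiff (e := dX n) hu.sm (m / 2)
    have hg := Lop_iter_contDiff (e := dX n) hv.sm (m / 2)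
    have B0 : ∀ i : ℕ, (0:ℝ) ≤ (Fintype.card (Option (Fin n)) : ℝ) ^ i := fun i => by positivity
    have i2 : ∀ a, IntegrableOn (fun p => (Lop (dX n))^[m/2] u p * Dv (dX n a) (Dv (dX n a) ((Lop (dX n))^[m/2] v)) p)
        (upperHS n) := fun a => hu.int_mul hv (k := 2 * (m/2)) (l := 2 * (m/2) + 2) (by omega) (by omega)
      hf.continuous (Dv_contDiff (Dv_contDiff hg)).continuous
        (abs_LopIter dX_norm hu.sm _) (abs_DDv_LopIter dX_norm hv.sm _ a) (B0 _)
    have i3 : ∀ a, IntegrableOn (fun p => Dv (dX n a) ((Lop (dX n))^[m/2] u) p * Dv (dX n a) ((Lop (dX n))^[m/2] v) p)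
        (upperHS n) := fun a => hu.int_mul hv (k := 2 * (m/2) + 1) (l := 2 * (m/2) + 1) (by omega) (by omega)
      (Dv_contDiff hf).continuous (Dv_contDiff hg).continuous
        (abs_Dv_LopIter dX_norm hu.sm _ a) (abs_Dv_LopIter dX_norm hv.sm _ a) (B0 _)
    have s2 : ∀ a, SecInt (fun p => (Lop (dX n))^[m/2] u p * Dv (dX n a) ((Lop (dX n))^[m/2] v) p) := fun a =>
      hu.sec_mul hv (k := 2 * (m/2)) (l := 2 * (m/2) + 1) (by omega) (by omega)
      hf.continuous (Dv_contDiff hg).continuous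
        (abs_LopIter dX_norm hu.sm _) (abs_Dv_LopIter dX_norm hv.sm _ a) (B0 _)
    rw [Function.iterate_succ_apply']
    rw [integral_finsetSum _ fun a _ => i3 a]
    have : ∀ p, (Lop (dX n))^[m/2] u p * Lop (dX n) ((Lop (dX n))^[m/2] v) p
      = ∑ a, (Lop (dX n))^[m/2] u p * Dv (dX n a) (Dv (dX n a) ((Lop (dX n))^[m/2] v)) p := by
      intro p
      rw [← Finset.mul_sum]; rfl
    simp only [this]
    rw [integral_finsetSum _ fun a _ => i2 a, neg_one_mul, ← Finset.sum_neg_distrib]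
    exact Finset.sum_congr rfl fun a _ => green_one hf hg a (i3 a) (i2 a) (s2 a) (fun _ => hv.bd _)

end chain

lemma finrank_X (n : ℕ) : (Module.finrank ℝ (Euc n × ℝ) : ℝ) = n + 1 := by
  rw [Module.finrank_prod]; simp

instance haarX (n : ℕ) : (volume : Measure (Euc n × ℝ)).IsAddHaarMeasure := by
  rw [Measure.volume_eq_prod]; infer_instance

lemma wt_integrable {n : ℕ} {b : ℝ} (hb : (n:ℝ) + 1 < b) : Integrable (wt (n := n) b) := by
  unfold wt
  exact integrable_one_add_norm (by rw [finrank_X]; exact hb)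

lemma wt_sec {n : ℕ} {b : ℝ} (hb : (n:ℝ) < b) (hb1 : 1 < b) : SecInt (wt (n := n) b) := by
  refine ⟨ae_of_all _ fun y => ?_, ae_of_all _ fun x => ?_⟩
  · refine Integrable.mono' (integrable_one_add_norm (μ := (volume : Measure (Euc n))) (r := b) (by simpa using hb))
      (Continuous.aestronglyMeasurable (by have := wt_cont (n := n) b; fun_prop)) (ae_of_all _ fun x => ?_)
    rw [Real.norm_of_nonneg (wt_pos _ _).le]
    unfold wt
    refine Real.rpow_le_rpow_of_nonpos (by positivity) ?_ (by linarith)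
    have := norm_fst_le (x, y)
    simp only at this
    linarith
  · refine Integrable.integrableOn ?_
    refine Integrable.mono' (integrable_one_add_norm (μ := (volume : Measure ℝ)) (r := b) (by simpa using hb1))
      (Continuous.aestronglyMeasurable (by have := wt_cont (n := n) b; fun_prop)) (ae_of_all _ fun y => ?_)
    rw [Real.norm_of_nonneg (wt_pos _ _).le]
    unfold wt
    refine Real.rpow_le_rpow_of_nonpos (by positivity) ?_ (by linarith)
    have := norm_snd_le (x, y)
    simp only at this
    linarith

lemma wt_sq {n : ℕ} (b : ℝ) (p : Euc n × ℝ) : wt b p ^ 2 = wt (2 * b) p := by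
  rw [sq, wt_mul]; ring_nf

lemma iter_cont {n : ℕ} {u : Euc n × ℝ → ℝ} (hu : ContDiff ℝ (⊤ : ℕ∞) u) (k : ℕ) :
    Continuous (fun p => ‖iteratedFDeriv ℝ k u p‖) :=
  (hu.continuous_iteratedFDeriv (by exact_mod_cast le_top)).norm

lemma good_of_sob {n m : ℕ} (hmn : 2 * m + 1 < n) {u : Euc n × ℝ → ℝ} (hu : ContDiff ℝ (⊤ : ℕ∞) u)
    (hs : ∀ k ≤ m + 1, IntegrableOn (fun p => ‖iteratedFDeriv ℝ k u p‖ ^ 2) (upperHS n))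
    (hb : ∀ k ≤ (m - 1) / 2, ∀ x, Dv (dX n none) ((Lop (dX n))^[k] u) (x, 0) = 0) : Good n m u := by
  have hmn' : 2 * (m:ℝ) + 2 ≤ n := by exact_mod_cast hmn
  have key : ∀ k ≤ m + 1, ∀ b : ℝ, (n:ℝ) + 1 < 2 * b →
      IntegrableOn (fun p => ‖iteratedFDeriv ℝ k u p‖ * wt b p) (upperHS n) := by
    intro k hk b hb
    have h2 : IntegrableOn (fun p => wt (n := n) b p ^ 2) (upperHS n) := by
      simp only [wt_sq]
      exact (wt_integrable hb).integrableOn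
    refine Integrable.mono' ((hs k hk).add h2) ((iter_cont hu k).mul (wt_cont b)).aestronglyMeasurable
      (ae_of_all _ fun p => ?_)
    rw [Real.norm_of_nonneg (mul_nonneg (norm_nonneg _) (wt_pos _ _).le)]
    simp only [Pi.add_apply]
    nlinarith [sq_nonneg (‖iteratedFDeriv ℝ k u p‖ - wt b p), sq_nonneg (‖iteratedFDeriv ℝ k u p‖), sq_nonneg (wt b p)]
  refine ⟨hu, hb, fun k hk => key k hk _ ?_, fun k hk => SecInt.of_integrable (key k (by omega) _ ?_), hs _ le_rfl⟩
  · have : (k:ℝ) ≤ m + 1 := by exact_mod_cast hk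
    linarith
  · have : (k:ℝ) ≤ m := by exact_mod_cast hk
    linarith

lemma Nice.good {n m : ℕ} (hmn : 2 * m + 1 < n) {u : Euc n × ℝ → ℝ} (h : Nice n m u) : Good n m u := by
  have hmn' : 2 * (m:ℝ) + 2 ≤ n := by exact_mod_cast hmn
  have hm0 : (0:ℝ) ≤ m := Nat.cast_nonneg _
  refine ⟨h.sm, fun k _ => h.bd k, fun k hk => ?_, fun k hk => ?_, ?_⟩
  · obtain ⟨C, hC⟩ := h.bound k
    refine (Integrable.mono' ((wt_integrable (n := n) (b := (n:ℝ) - 2 * m - 1 + k + (n + 1 - k)) (by linarith)).const_mul C)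
      ((iter_cont h.sm k).mul (wt_cont _)).aestronglyMeasurable (ae_of_all _ fun p => ?_)).integrableOn
    show ‖‖iteratedFDeriv ℝ k u p‖ * wt ((n:ℝ) + 1 - k) p‖ ≤ _
    rw [Real.norm_of_nonneg (mul_nonneg (norm_nonneg _) (wt_pos _ _).le), ← wt_mul, ← mul_assoc]
    have := wt_pos ((n:ℝ) + 1 - k) p
    gcongr
    exact hC p
  · obtain ⟨C, hC⟩ := h.bound k
    refine (wt_sec (n := n) (b := (n:ℝ) - 2 * m - 1 + k + (n - k)) (by linarith) (by linarith)).mono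
      ((iter_cont h.sm k).mul (wt_cont _)) C fun p => ?_
    rw [abs_of_nonneg (mul_nonneg (norm_nonneg _) (wt_pos _ _).le), abs_of_nonneg (wt_pos _ _).le, ← wt_mul, ← mul_assoc]
    have := wt_pos ((n:ℝ) - k) p
    gcongr
    exact hC p
  · obtain ⟨C, hC⟩ := h.bound (m + 1)
    refine (Integrable.mono' ((wt_integrable (n := n) (b := 2 * ((n:ℝ) - 2 * m - 1 + (m + 1 : ℕ))) (by push_cast; linarith)).const_mul (C ^ 2))
      ((iter_cont h.sm (m + 1)).pow 2).aestronglyMeasurable (ae_of_all _ fun p => ?_)).integrableOn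
    show ‖‖iteratedFDeriv ℝ (m + 1) u p‖ ^ 2‖ ≤ _
    rw [Real.norm_of_nonneg (by positivity), ← wt_sq, ← mul_pow]
    gcongr
    exact hC p

/-- reflection in the last variable -/
def rfl2 {n : ℕ} (p : Euc n × ℝ) : Euc n × ℝ := (p.1, -p.2)

/-- parity in the last variable -/
def Par {n : ℕ} (s : ℝ) (v : Euc n × ℝ → ℝ) : Prop := ∀ p, v (rfl2 p) = s * v p

def rflL (n : ℕ) : (Euc n × ℝ) →L[ℝ] (Euc n × ℝ) :=
  (ContinuousLinearMap.fst ℝ (Euc n) ℝ).prod (-(ContinuousLinearMap.snd ℝ (Euc n) ℝ))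

lemma rflL_apply {n : ℕ} (p : Euc n × ℝ) : rflL n p = rfl2 p := rfl

lemma par_Dv {n : ℕ} {s : ℝ} {v : Euc n × ℝ → ℝ} (hv : ContDiff ℝ (⊤ : ℕ∞) v) (h : Par s v) (w p : Euc n × ℝ) :
    Dv (rfl2 w) v (rfl2 p) = s * Dv w v p := by
  have h1 : v ∘ (rflL n) = fun p => s * v p := by ext p; exact h p
  have hd : DifferentiableAt ℝ v (rflL n p) := hv.differentiable (by simp) _
  have h2 := (hd.hasFDerivAt.comp p (rflL n).hasFDerivAt).fderiv
  rw [h1] at h2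
  have h3 := ((hv.differentiable (by simp) p).hasFDerivAt.const_mul s).fderiv
  rw [h3] at h2
  have := congrArg (fun l => l w) h2
  simp only [ContinuousLinearMap.comp_apply, smul_apply, smul_eq_mul] at this
  exact this.symm

lemma par_Dv_none {n : ℕ} {s : ℝ} {v : Euc n × ℝ → ℝ} (hv : ContDiff ℝ (⊤ : ℕ∞) v) (h : Par s v) :
    Par (-s) (Dv (dX n none) v) := by
  intro p
  have h1 := par_Dv hv h (dX n none) p
  have e : rfl2 (dX n none) = - dX n none := by simp [rfl2, dX]
  rw [e] at h1
  unfold Dv at *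
  rw [map_neg] at h1
  linarith

lemma par_Dv_some {n : ℕ} {s : ℝ} {v : Euc n × ℝ → ℝ} (hv : ContDiff ℝ (⊤ : ℕ∞) v) (h : Par s v) (i : Fin n) :
    Par s (Dv (dX n (some i)) v) := by
  intro p
  have h1 := par_Dv hv h (dX n (some i)) p
  have e : rfl2 (dX n (some i)) = dX n (some i) := by simp [rfl2, dX]
  rwa [e] at h1

lemma par_Lop {n : ℕ} {v : Euc n × ℝ → ℝ} (hv : ContDiff ℝ (⊤ : ℕ∞) v) (h : Par 1 v) :
    Par 1 (Lop (dX n) v) := by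
  intro p
  unfold Lop
  rw [one_mul]
  refine Finset.sum_congr rfl fun a _ => ?_
  cases a with
  | none =>
    have := par_Dv_none (Dv_contDiff hv) (par_Dv_none hv h) p
    rw [this]; ring
  | some i =>
    have := par_Dv_some (Dv_contDiff hv) (par_Dv_some hv h i) i p
    rw [this]; ring

lemma par_Lop_iter {n : ℕ} {v : Euc n × ℝ → ℝ} (hv : ContDiff ℝ (⊤ : ℕ∞) v) (h : Par 1 v) (k : ℕ) :
    Par 1 ((Lop (dX n))^[k] v) := by
  induction k with
  | zero => exact h
  | succ k ih => rw [Function.iterate_succ_apply']; exact par_Lop (Lop_iter_contDiff hv k) ih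

lemma par_bd {n : ℕ} {v : Euc n × ℝ → ℝ} (hv : ContDiff ℝ (⊤ : ℕ∞) v) (h : Par 1 v) (k : ℕ) (x : Euc n) :
    Dv (dX n none) ((Lop (dX n))^[k] v) (x, 0) = 0 := by
  have h1 := par_Dv_none (Lop_iter_contDiff hv k) (par_Lop_iter hv h k) (x, 0)
  have e : rfl2 ((x, 0) : Euc n × ℝ) = (x, 0) := by simp [rfl2]
  rw [e] at h1
  linarith

/-! ### Homogeneous symbols on `ℝ × (ℝⁿ × ℝ)` -/

abbrev YY (n : ℕ) := ℝ × (Euc n × ℝ)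

structure Symb {n : ℕ} {F : Type} [NormedAddCommGroup F] [NormedSpace ℝ F] (d : ℝ) (f : YY n → F) : Prop where
  sm : ∀ y, y ≠ 0 → ContDiffAt ℝ (⊤ : ℕ∞) f y
  hom : ∀ c : ℝ, 0 < c → ∀ y, y ≠ 0 → f (c • y) = c ^ d • f y

section symb
variable {n : ℕ} {F G : Type} [NormedAddCommGroup F] [NormedSpace ℝ F] [NormedAddCommGroup G] [NormedSpace ℝ G]
variable {d : ℝ} {f g : YY n → F}

lemma Symb.bound (h : Symb d f) : ∃ C : ℝ, 0 ≤ C ∧ ∀ y, y ≠ 0 → ‖f y‖ ≤ C * ‖y‖ ^ d := by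
  have hc : ContinuousOn f (Metric.sphere (0 : YY n) 1) := fun y hy =>
    (h.sm y (by intro h0; simp [h0] at hy)).continuousAt.continuousWithinAt
  obtain ⟨C, hC⟩ := (isCompact_sphere (0 : YY n) 1).exists_bound_of_continuousOn hc
  refine ⟨max C 0, le_max_right _ _, fun y hy => ?_⟩
  have hn : 0 < ‖y‖ := norm_pos_iff.2 hy
  set z := ‖y‖⁻¹ • y with hz
  have hz1 : ‖z‖ = 1 := by rw [hz, norm_smul, norm_inv, norm_norm, inv_mul_cancel₀ hn.ne']
  have hz0 : z ≠ 0 := by intro h0; simp [h0] at hz1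
  have e : y = ‖y‖ • z := by rw [hz, smul_smul, mul_inv_cancel₀ hn.ne', one_smul]
  have := h.hom ‖y‖ hn z hz0
  rw [← e] at this
  rw [this, norm_smul, Real.norm_of_nonneg (by positivity), mul_comm]
  gcongr
  exact (hC z (by simp [hz1])).trans (le_max_left _ _)

lemma Symb.diff (h : Symb d f) {y : YY n} (hy : y ≠ 0) : DifferentiableAt ℝ f y :=
  (h.sm y hy).differentiableAt (by simp)

lemma Symb.fderiv (h : Symb d f) : Symb (d - 1) (fderiv ℝ f) := by
  refine ⟨fun y hy => (h.sm y hy).fderiv_right (m := (⊤ : ℕ∞)) (by exact_mod_cast le_top), fun c hc y hy => ?_⟩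
  have hcy : c • y ≠ 0 := smul_ne_zero hc.ne' hy
  have h1 : (fun z => f (c • z)) =ᶠ[𝓝 y] fun z => c ^ d • f z := by
    filter_upwards [isOpen_ne.mem_nhds hy] with z hz
    exact h.hom c hc z hz
  have h2 := h1.fderiv_eq (𝕜 := ℝ)
  rw [fderiv_fun_const_smul (h.diff hy)] at h2
  have h3 : _root_.fderiv ℝ (fun z => f (c • z)) y = c • _root_.fderiv ℝ f (c • y) := by
    have := ((h.diff hcy).hasFDerivAt.comp y ((ContinuousLinearMap.id ℝ (YY n)).hasFDerivAt.const_smul c)).fderiv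
    refine Eq.trans this ?_
    ext v <;> simp
  rw [h3] at h2
  have h4 : _root_.fderiv ℝ f (c • y) = c⁻¹ • (c • _root_.fderiv ℝ f (c • y)) := by
    rw [smul_smul, inv_mul_cancel₀ hc.ne', one_smul]
  rw [h4, h2, smul_smul, Real.rpow_sub hc, Real.rpow_one, div_eq_inv_mul]

lemma Symb.clm (h : Symb d f) (L : F →L[ℝ] G) : Symb d (fun y => L (f y)) := by
  refine ⟨fun y hy => L.contDiff.contDiffAt.comp y (h.sm y hy), fun c hc y hy => ?_⟩
  rw [h.hom c hc y hy, map_smul]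

lemma Symb.sum {ι : Type*} {s : Finset ι} {f : ι → YY n → F} (h : ∀ i ∈ s, Symb d (f i)) :
    Symb d (fun y => ∑ i ∈ s, f i y) := by
  refine ⟨fun y hy => ContDiffAt.sum fun i hi => (h i hi).sm y hy, fun c hc y hy => ?_⟩
  rw [Finset.smul_sum]
  exact Finset.sum_congr rfl fun i hi => (h i hi).hom c hc y hy

lemma Symb.zero : Symb (n := n) d (fun _ => (0 : F)) := ⟨fun y _ => contDiffAt_const, fun c _ y _ => by simp⟩

lemma Symb.Dv {f : YY n → ℝ} (h : Symb d f) (v : YY n) : Symb (d - 1) (Dv v f) :=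
  h.fderiv.clm (ContinuousLinearMap.apply ℝ ℝ v)

lemma Symb.Lop {ι : Type*} [Fintype ι] {f : YY n → ℝ} (h : Symb d f) (e : ι → YY n) : Symb (d - 2) (Lop e f) := by
  have := Symb.sum (s := Finset.univ) (fun a _ => (h.Dv (e a)).Dv (e a))
  rwa [show d - 1 - 1 = d - 2 by ring] at this

lemma Symb.Lop_iter {ι : Type*} [Fintype ι] {f : YY n → ℝ} (h : Symb d f) (e : ι → YY n) (k : ℕ) :
    Symb (d - 2 * k) ((_root_.Lop e)^[k] f) := by
  induction k with
  | zero => simpa using h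
  | succ k ih =>
    rw [Function.iterate_succ_apply']
    have := ih.Lop e
    rwa [show d - 2 * ((k + 1 : ℕ) : ℝ) = d - 2 * k - 2 by push_cast; ring]

lemma Symb.Tm {ι : Type*} [Fintype ι] {f : YY n → ℝ} (h : Symb d f) (m : ℕ) (e : Option ι → YY n) (a : Option ι) :
    Symb (d - (m + 1)) (Tm m e a f) := by
  unfold _root_.Tm
  split_ifs with h1 h2
  · have := h.Lop_iter e ((m + 1) / 2)
    have e2 : (2:ℝ) * (((m + 1) / 2 : ℕ) : ℝ) = m + 1 := by
      have : 2 * ((m + 1) / 2) = m + 1 := by obtain ⟨r, rfl⟩ := h1; omega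
      exact_mod_cast this
    rwa [e2] at this
  · exact Symb.zero
  · have := (h.Lop_iter e (m / 2)).Dv (e a)
    have e2 : (2:ℝ) * ((m / 2 : ℕ) : ℝ) = m := by
      have : 2 * (m / 2) = m := by obtain ⟨r, rfl⟩ := Nat.not_odd_iff_even.1 h1; omega
      exact_mod_cast this
    rw [e2] at this
    rwa [show d - m - 1 = d - (m + 1) by ring] at this

/-- slices of symbols -/
def sl (f : YY n → F) (η : ℝ) (ζ : Euc n × ℝ) (p : Euc n × ℝ) : F := f (η, p - ζ)

lemma sl_ne {η : ℝ} {ζ p : Euc n × ℝ} (h : η ≠ 0 ∨ p ≠ ζ) : ((η, p - ζ) : YY n) ≠ 0 := by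
  intro h0
  rw [Prod.ext_iff] at h0
  simp [sub_eq_zero] at h0
  tauto

lemma hasFDerivAt_sl (h : Symb d f) {η : ℝ} {ζ p : Euc n × ℝ} (hp : η ≠ 0 ∨ p ≠ ζ) :
    HasFDerivAt (sl f η ζ) ((fderiv ℝ f (η, p - ζ)).comp (ContinuousLinearMap.inr ℝ ℝ (Euc n × ℝ))) p := by
  have h1 := (h.diff (sl_ne hp)).hasFDerivAt
  have h2 : HasFDerivAt (fun p : Euc n × ℝ => ((η, p - ζ) : YY n)) (ContinuousLinearMap.inr ℝ ℝ (Euc n × ℝ)) p := by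
    have := (hasFDerivAt_const (𝕜 := ℝ) η p).prodMk ((hasFDerivAt_id (𝕜 := ℝ) p).sub_const ζ)
    exact this
  exact h1.comp p h2

lemma sl_contDiff (h : Symb d f) {η : ℝ} (hη : η ≠ 0) (ζ : Euc n × ℝ) : ContDiff ℝ (⊤ : ℕ∞) (sl f η ζ) := by
  rw [contDiff_iff_contDiffAt]
  intro p
  exact ContDiffAt.comp p (h.sm _ (sl_ne (Or.inl hη))) (contDiffAt_const.prodMk (contDiffAt_id.sub contDiffAt_const))

/-- lifted directions -/
def dY (n : ℕ) (a : Option (Fin n)) : YY n := (0, dX n a)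

lemma Dv_sl {f : YY n → ℝ} (h : Symb d f) {η : ℝ} {ζ p : Euc n × ℝ} (hp : η ≠ 0 ∨ p ≠ ζ) (v : Euc n × ℝ) :
    Dv v (sl f η ζ) p = sl (Dv ((0, v) : YY n) f) η ζ p := by
  unfold Dv
  rw [(hasFDerivAt_sl h hp).fderiv]
  rfl

lemma Dv_sl_fun {f : YY n → ℝ} (h : Symb d f) {η : ℝ} (hη : η ≠ 0) (ζ : Euc n × ℝ) (v : Euc n × ℝ) :
    Dv v (sl f η ζ) = sl (Dv ((0, v) : YY n) f) η ζ := by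
  ext p; exact Dv_sl h (Or.inl hη) v

lemma Lop_sl {f : YY n → ℝ} (h : Symb d f) {η : ℝ} (hη : η ≠ 0) (ζ : Euc n × ℝ) :
    Lop (dX n) (sl f η ζ) = sl (Lop (dY n) f) η ζ := by
  ext p
  unfold Lop
  rw [sl]
  refine Finset.sum_congr rfl fun a _ => ?_
  rw [Dv_sl_fun h hη, Dv_sl_fun (h.Dv _) hη]; rfl

lemma Lop_iter_sl {f : YY n → ℝ} (h : Symb d f) {η : ℝ} (hη : η ≠ 0) (ζ : Euc n × ℝ) (k : ℕ) :
    (Lop (dX n))^[k] (sl f η ζ) = sl ((Lop (dY n))^[k] f) η ζ := by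
  induction k with
  | zero => rfl
  | succ k ih => rw [Function.iterate_succ_apply', Function.iterate_succ_apply', ih, Lop_sl (h.Lop_iter _ k) hη]

lemma Tm_sl {f : YY n → ℝ} (h : Symb d f) {η : ℝ} (hη : η ≠ 0) (ζ : Euc n × ℝ) (m : ℕ) (a : Option (Fin n)) :
    Tm m (dX n) a (sl f η ζ) = sl (Tm m (dY n) a f) η ζ := by
  unfold Tm
  split_ifs
  · exact Lop_iter_sl h hη ζ _
  · rfl
  · rw [Lop_iter_sl h hη, Dv_sl_fun (h.Lop_iter _ _) hη]; rfl

end symb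

lemma sl_iter_bound {n : ℕ} (k : ℕ) : ∀ {F : Type} [NormedAddCommGroup F] [NormedSpace ℝ F] {d : ℝ} {f : YY n → F}
    (_ : Symb d f), ∃ C : ℝ, 0 ≤ C ∧ ∀ η : ℝ, η ≠ 0 → ∀ ζ p : Euc n × ℝ,
      ‖iteratedFDeriv ℝ k (sl f η ζ) p‖ ≤ C * ‖((η, p - ζ) : YY n)‖ ^ (d - k) := by
  induction k with
  | zero =>
    intro F _ _ d f h
    obtain ⟨C, hC0, hC⟩ := h.bound
    refine ⟨C, hC0, fun η hη ζ p => ?_⟩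
    rw [norm_iteratedFDeriv_zero, Nat.cast_zero, sub_zero]
    exact hC _ (sl_ne (Or.inl hη))
  | succ k ih =>
    intro F _ _ d f h
    have h1 : Symb (d - 1) (fun y => (fderiv ℝ f y).comp (ContinuousLinearMap.inr ℝ ℝ (Euc n × ℝ))) :=
      h.fderiv.clm ((ContinuousLinearMap.compL ℝ (Euc n × ℝ) (YY n) F).flip (ContinuousLinearMap.inr ℝ ℝ (Euc n × ℝ)))
    obtain ⟨C, hC0, hC⟩ := ih h1
    refine ⟨C, hC0, fun η hη ζ p => ?_⟩
    have e : fderiv ℝ (sl f η ζ) = sl (fun y => (fderiv ℝ f y).comp (ContinuousLinearMap.inr ℝ ℝ (Euc n × ℝ))) η ζ := by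
      ext1 p
      exact (hasFDerivAt_sl h (Or.inl hη)).fderiv
    rw [← norm_iteratedFDeriv_fderiv, e]
    have := hC η hη ζ p
    rwa [show d - ((k + 1 : ℕ) : ℝ) = d - 1 - k by push_cast; ring]

lemma YY_norm_lower {n : ℕ} {η : ℝ} (hη : η ≠ 0) (ζ : Euc n × ℝ) :
    ∃ c : ℝ, 0 < c ∧ ∀ p : Euc n × ℝ, c * (1 + ‖p‖) ≤ ‖((η, p - ζ) : YY n)‖ := by
  have hη' : 0 < |η| := abs_pos.2 hη
  refine ⟨((1 + ‖ζ‖) / |η| + 1)⁻¹, by positivity, fun p => ?_⟩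
  rw [inv_mul_le_iff₀ (by positivity)]
  have h1 : |η| ≤ ‖((η, p - ζ) : YY n)‖ := norm_fst_le ((η, p - ζ) : YY n)
  have h2 : ‖p - ζ‖ ≤ ‖((η, p - ζ) : YY n)‖ := norm_snd_le ((η, p - ζ) : YY n)
  have h3 : ‖p‖ ≤ ‖p - ζ‖ + ‖ζ‖ := by simpa using norm_add_le (p - ζ) ζ
  have h4 : 1 + ‖ζ‖ ≤ (1 + ‖ζ‖) / |η| * ‖((η, p - ζ) : YY n)‖ := by
    rw [div_mul_eq_mul_div, le_div_iff₀ hη']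
    gcongr
  linarith

lemma sl_wt_bound {n : ℕ} {d : ℝ} {f : YY n → ℝ} (h : Symb d f) {η : ℝ} (hη : η ≠ 0) (ζ : Euc n × ℝ) (k : ℕ)
    (hd : d - k ≤ 0) :
    ∃ C : ℝ, ∀ p, ‖iteratedFDeriv ℝ k (sl f η ζ) p‖ ≤ C * wt (-d + k) p := by
  obtain ⟨C, hC0, hC⟩ := sl_iter_bound k h
  obtain ⟨c, hc, hcp⟩ := YY_norm_lower hη ζ
  refine ⟨C * c ^ (d - k), fun p => (hC η hη ζ p).trans ?_⟩
  rw [mul_assoc]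
  refine mul_le_mul_of_nonneg_left ?_ hC0
  unfold wt
  rw [show -(-d + (k:ℝ)) = d - k by ring, ← Real.mul_rpow hc.le (by positivity)]
  exact Real.rpow_le_rpow_of_nonpos (by positivity) (hcp p) hd

/-! the fundamental kernel -/

def kq {n : ℕ} (y : YY n) : ℝ := y.1 ^ 2 + (‖y.2.1‖ ^ 2 + y.2.2 ^ 2)

def kk {n : ℕ} (a : ℝ) (y : YY n) : ℝ := kq y ^ (-a)

lemma kq_contDiff {n : ℕ} : ContDiff ℝ (⊤ : ℕ∞) (kq (n := n)) := by
  unfold kq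
  have := contDiff_norm_sq ℝ (E := Euc n) (n := (⊤ : ℕ∞))
  have h2 : ContDiff ℝ (⊤ : ℕ∞) (fun y : YY n => ‖y.2.1‖ ^ 2) := this.comp (contDiff_fst.comp contDiff_snd)
  fun_prop

lemma kq_nonneg {n : ℕ} (y : YY n) : 0 ≤ kq y := by unfold kq; positivity

lemma norm_sq_le_kq {n : ℕ} (y : YY n) : ‖y‖ ^ 2 ≤ kq y := by
  unfold kq
  rw [Prod.norm_def, Prod.norm_def]
  have h1 := sq_nonneg y.1
  have h2 := sq_nonneg ‖y.2.1‖
  have h3 := sq_nonneg y.2.2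
  rcases max_choice ‖y.1‖ (max ‖y.2.1‖ ‖y.2.2‖) with h | h
  · rw [h, Real.norm_eq_abs, sq_abs]; linarith
  · rw [h]
    rcases max_choice ‖y.2.1‖ ‖y.2.2‖ with h | h
    · rw [h]; linarith
    · rw [h, Real.norm_eq_abs, sq_abs]; linarith

lemma kq_pos {n : ℕ} {y : YY n} (hy : y ≠ 0) : 0 < kq y :=
  lt_of_lt_of_le (by have := norm_pos_iff.2 hy; positivity) (norm_sq_le_kq y)

lemma kq_smul {n : ℕ} (c : ℝ) (y : YY n) : kq (c • y) = c ^ 2 * kq y := by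
  unfold kq
  simp only [Prod.smul_fst, Prod.smul_snd, norm_smul, smul_eq_mul, mul_pow, Real.norm_eq_abs, sq_abs]
  ring

lemma kk_symb {n : ℕ} (a : ℝ) : Symb (n := n) (-(2 * a)) (kk a) := by
  refine ⟨fun y hy => ContDiffAt.rpow_const_of_ne kq_contDiff.contDiffAt (kq_pos hy).ne', fun c hc y hy => ?_⟩
  unfold kk
  rw [kq_smul, Real.mul_rpow (by positivity) (kq_nonneg y), smul_eq_mul]
  congr 1
  rw [← Real.rpow_natCast, ← Real.rpow_mul hc.le]
  congr 1; push_cast; ring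

/-! ### Explicit iterated Laplacian of the kernel -/
section expl
variable {n : ℕ}

def Sm (f : YY n → ℝ) : Prop := ∀ y, y ≠ 0 → ContDiffAt ℝ (⊤ : ℕ∞) f y

lemma Sm.diff {f : YY n → ℝ} (h : Sm f) {y : YY n} (hy : y ≠ 0) : DifferentiableAt ℝ f y :=
  (h y hy).differentiableAt (by simp)

lemma Sm.Dv {f : YY n → ℝ} (h : Sm f) (v : YY n) : Sm (Dv v f) := fun y hy =>
  ((ContinuousLinearMap.apply ℝ ℝ v).contDiff.contDiffAt).comp y
    ((h y hy).fderiv_right (m := (⊤ : ℕ∞)) (by exact_mod_cast le_top))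

def EqOff (f g : YY n → ℝ) : Prop := ∀ y, y ≠ 0 → f y = g y

lemma EqOff.Dv {f g : YY n → ℝ} (h : EqOff f g) (v : YY n) : EqOff (Dv v f) (Dv v g) := by
  intro y hy
  have : f =ᶠ[𝓝 y] g := by
    filter_upwards [isOpen_ne.mem_nhds hy] with z hz
    exact h z hz
  unfold _root_.Dv
  rw [this.fderiv_eq]

lemma EqOff.Lop {ι : Type*} [Fintype ι] {f g : YY n → ℝ} (h : EqOff f g) (e : ι → YY n) :
    EqOff (Lop e f) (Lop e g) := by
  intro y hy
  unfold _root_.Lop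
  exact Finset.sum_congr rfl fun a _ => (h.Dv _).Dv _ y hy

lemma Dv_lin {s : Finset ℕ} {c : ℕ → ℝ} {f : ℕ → YY n → ℝ} (hf : ∀ l, Sm (f l)) (v : YY n) :
    EqOff (Dv v (fun y => ∑ l ∈ s, c l * f l y)) (fun y => ∑ l ∈ s, c l * Dv v (f l) y) := by
  intro y hy
  have := (HasFDerivAt.fun_sum (u := s) fun l _ => ((hf l).diff hy).hasFDerivAt.const_mul (c l)).fderiv
  unfold Dv
  rw [this]
  simp

lemma Lop_lin {ι : Type*} [Fintype ι] {e : ι → YY n} {s : Finset ℕ} {c : ℕ → ℝ} {f : ℕ → YY n → ℝ} (hf : ∀ l, Sm (f l)) :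
    EqOff (Lop e (fun y => ∑ l ∈ s, c l * f l y)) (fun y => ∑ l ∈ s, c l * Lop e (f l) y) := by
  intro y hy
  unfold Lop
  simp only [Finset.mul_sum]
  rw [Finset.sum_comm]
  refine Finset.sum_congr rfl fun a _ => ?_
  rw [(Dv_lin hf (e a)).Dv (e a) y hy, Dv_lin (fun l => (hf l).Dv (e a)) (e a) y hy]

lemma Dv_of_line {f : YY n → ℝ} {y v : YY n} {d : ℝ} (hf : DifferentiableAt ℝ f y)
    (h : HasDerivAt (fun t : ℝ => f (y + t • v)) d 0) : Dv v f y = d := by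
  have h1 := hf.hasFDerivAt.hasLineDerivAt v
  exact HasDerivAt.unique h1 h

def co (a : Option (Fin n)) (y : YY n) : ℝ := match a with
  | none => y.2.2
  | some i => y.2.1 i

lemma kq_line (a : Option (Fin n)) (y : YY n) (t : ℝ) :
    kq (y + t • dY n a) = kq y + 2 * t * co a y + t ^ 2 := by
  cases a with
  | none => simp [kq, dY, dX, co]; ring
  | some i =>
    simp only [kq, dY, dX, co, Prod.smul_mk, Prod.fst_add, Prod.snd_add, smul_zero, add_zero]
    rw [norm_add_sq_real, inner_smul_right, EuclideanSpace.inner_single_right, norm_smul]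
    simp
    ring

lemma co_line (a : Option (Fin n)) (y : YY n) (t : ℝ) : co a (y + t • dY n a) = co a y + t := by
  cases a <;> simp [dY, dX, co]

lemma fst_line (a : Option (Fin n)) (y : YY n) (t : ℝ) : (y + t • dY n a).1 = y.1 := by simp [dY]

lemma co_sq_sum (y : YY n) : ∑ a, co a y ^ 2 = kq y - y.1 ^ 2 := by
  rw [Fintype.sum_option]
  simp only [co, kq, EuclideanSpace.norm_sq_eq, Real.norm_eq_abs, sq_abs]; ring

def JJ (l : ℕ) (b : ℝ) (y : YY n) : ℝ := y.1 ^ (2 * l) * kq y ^ (-b)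

lemma JJ_sm (l : ℕ) (b : ℝ) : Sm (n := n) (JJ l b) := fun _ hy =>
  (contDiffAt_fst.pow _).mul (ContDiffAt.rpow_const_of_ne kq_contDiff.contDiffAt (kq_pos hy).ne')

lemma co_contDiff (a : Option (Fin n)) : ContDiff ℝ (⊤ : ℕ∞) (co (n := n) a) := by
  cases a with
  | none => exact contDiff_snd.comp contDiff_snd
  | some i =>
    have : (co (n := n) (some i)) = fun y => (EuclideanSpace.proj (𝕜 := ℝ) i) y.2.1 := rfl
    rw [this]
    fun_prop

lemma JJ_line (l : ℕ) (b : ℝ) (a : Option (Fin n)) {y : YY n} (hy : y ≠ 0) :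
    HasDerivAt (fun t : ℝ => JJ l b (y + t • dY n a)) (-(2 * b) * co a y * JJ l (b + 1) y) 0 := by
  unfold JJ
  simp only [fst_line, kq_line]
  have h0 : HasDerivAt (fun t : ℝ => kq y + 2 * t * co a y + t ^ 2) (2 * co a y) 0 := by
    have h1 := ((((hasDerivAt_id (0:ℝ)).const_mul 2).mul_const (co a y)).const_add (kq y)).add ((hasDerivAt_id (0:ℝ)).pow 2)
    refine h1.congr_deriv ?_
    simp
  have h2 := (h0.rpow_const (p := -b) (Or.inl (by simpa using (kq_pos hy).ne'))).const_mul (y.1 ^ (2 * l))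
  refine h2.congr_deriv ?_
  simp only [mul_zero, zero_mul, add_zero, ne_eq, OfNat.ofNat_ne_zero, not_false_eq_true, zero_pow]
  rw [show -(b + 1) = -b - 1 by ring]; ring

lemma Dv_JJ (l : ℕ) (b : ℝ) (a : Option (Fin n)) :
    EqOff (Dv (dY n a) (JJ l b)) (fun y => -(2 * b) * (co a y * JJ l (b + 1) y)) := by
  intro y hy
  have := Dv_of_line ((JJ_sm l b).diff hy) (JJ_line l b a hy)
  rw [this]; ring

lemma DvDv_JJ (l : ℕ) (b : ℝ) (a : Option (Fin n)) :
    EqOff (Dv (dY n a) (Dv (dY n a) (JJ l b)))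
      (fun y => -(2 * b) * (JJ l (b + 1) y - 2 * (b + 1) * co a y ^ 2 * JJ l (b + 2) y)) := by
  intro y hy
  rw [(Dv_JJ l b a).Dv _ y hy]
  refine Dv_of_line ?_ ?_
  · exact (((co_contDiff a).contDiffAt.differentiableAt (by simp)).mul ((JJ_sm l (b+1)).diff hy)).const_mul _
  · have h0 : HasDerivAt (fun t : ℝ => co a (y + t • dY n a)) 1 0 := by
      simp only [co_line]
      simpa using (hasDerivAt_id (0:ℝ)).const_add (co a y)
    have h := (h0.mul (JJ_line l (b+1) a hy)).const_mul (-(2*b))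
    refine h.congr_deriv ?_
    simp only [zero_smul, add_zero]
    rw [show b + 1 + 1 = b + 2 by ring]; ring

lemma Lop_JJ (l : ℕ) (b : ℝ) : EqOff (Lop (dY n) (JJ l b))
    (fun y => 2 * b * (2 * b + 2 - (n + 1)) * JJ l (b + 1) y - 4 * b * (b + 1) * JJ (l + 1) (b + 2) y) := by
  intro y hy
  unfold Lop
  rw [Finset.sum_congr rfl fun a _ => DvDv_JJ l b a y hy, ← Finset.mul_sum, Finset.sum_sub_distrib,
    ← Finset.sum_mul, ← Finset.mul_sum, co_sq_sum]
  have e1 : kq y * JJ l (b + 2) y = JJ l (b + 1) y := by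
    unfold JJ
    rw [show -(b + 1) = -(b + 2) + 1 by ring, Real.rpow_add_one (kq_pos hy).ne']; ring
  have e2 : y.1 ^ 2 * JJ l (b + 2) y = JJ (l + 1) (b + 2) y := by
    unfold JJ
    rw [show 2 * (l + 1) = 2 * l + 2 by ring, pow_add]; ring
  simp only [Finset.sum_const, Finset.card_univ, Fintype.card_option, Fintype.card_fin, nsmul_eq_mul]
  push_cast
  linear_combination (4 * b * (b + 1)) * e1 - (4 * b * (b + 1)) * e2

/-- coefficients -/
def cc (a : ℝ) (m : ℕ) : ℕ → ℕ → ℝ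
  | 0, l => if l = 0 then 1 else 0
  | i + 1, 0 => -4 * (a + i) * (m - i) * cc a m i 0
  | i + 1, l + 1 => -4 * (a + i + (l + 1)) * (m - i - (l + 1)) * cc a m i (l + 1)
      - 4 * (a + i + l) * (a + i + l + 1) * cc a m i l

def poch (a : ℝ) (k : ℕ) : ℝ := ∏ t ∈ Finset.range k, (a + t)

lemma poch_succ (a : ℝ) (k : ℕ) : poch a (k + 1) = poch a k * (a + k) := Finset.prod_range_succ _ _

lemma cc_eq (a : ℝ) (m : ℕ) : ∀ i l, cc a m i l
    = (-4) ^ i * poch a (i + l) * (i.choose l) * ∏ t ∈ Finset.range (i - l), ((m:ℝ) - l - t) := by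
  intro i
  induction i with
  | zero =>
    intro l
    cases l with
    | zero => simp [cc, poch]
    | succ l => simp [cc]
  | succ i ih =>
    intro l
    cases l with
    | zero =>
      rw [cc, ih]
      simp only [add_zero, Nat.sub_zero, Nat.choose_zero_right]
      rw [poch_succ, Finset.prod_range_succ, pow_succ]
      push_cast; ring
    | succ l =>
      rw [cc, ih, ih]
      have p1 : poch a (i + (l + 1)) = poch a (i + l) * (a + i + l) := by
        rw [← add_assoc, poch_succ]; push_cast; ring
      have p2 : poch a (i + 1 + (l + 1)) = poch a (i + l) * (a + i + l) * (a + i + l + 1) := by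
        rw [show i + 1 + (l + 1) = (i + l + 1) + 1 by ring, poch_succ, poch_succ]; push_cast; ring
      rw [p1, p2, Nat.choose_succ_succ, Nat.add_sub_add_right, pow_succ]
      rcases lt_trichotomy i l with h | h | h
      · rw [Nat.choose_eq_zero_of_lt h, Nat.choose_eq_zero_of_lt (by omega : i < l + 1)]; simp
      · subst h
        simp; ring
      · obtain ⟨r, rfl⟩ := Nat.exists_eq_add_of_lt h
        have q1 : l + r + 1 - (l + 1) = r := by omega
        have q2 : l + r + 1 - l = r + 1 := by omega
        rw [q1, q2, Finset.prod_range_succ' (fun t : ℕ => (m:ℝ) - l - t) r,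
          Finset.prod_range_succ (fun t : ℕ => (m:ℝ) - ((l+1:ℕ):ℝ) - t) r]
        have q3 : ∏ k ∈ Finset.range r, ((m:ℝ) - l - ((k + 1 : ℕ) : ℝ)) = ∏ k ∈ Finset.range r, ((m:ℝ) - ((l+1:ℕ):ℝ) - k) := by
          refine Finset.prod_congr rfl fun k _ => ?_
          push_cast; ring
        rw [q3]
        set P := ∏ k ∈ Finset.range r, ((m:ℝ) - ((l+1:ℕ):ℝ) - k)
        have hch := Nat.choose_succ_right_eq (l + r + 1) l
        rw [q2] at hch
        have hch' : ((l + r + 1).choose (l + 1) : ℝ) * (l + 1) = (l + r + 1).choose l * (r + 1) := by exact_mod_cast hch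
        push_cast
        linear_combination (-4) ^ (l + r + 1) * 4 * poch a (l + r + 1 + l) * (a + (l + r + 1) + l) * (a + (l + r + 1) + l + 1) * P * hch'

lemma Lop_iter_kk {a : ℝ} {m : ℕ} (ha : 2 * a = (n:ℝ) - 2 * m - 1) (i : ℕ) :
    EqOff ((Lop (dY n))^[i] (kk a)) (fun y => ∑ l ∈ Finset.range (i + 1), cc a m i l * JJ l (a + i + l) y) := by
  induction i with
  | zero => intro y hy; simp [cc, JJ, kk]
  | succ i ih =>
    intro y hy
    rw [Function.iterate_succ_apply', ih.Lop (dY n) y hy, Lop_lin (fun l => JJ_sm l (a + i + l)) y hy]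
    have h1 : ∀ l : ℕ, Lop (dY n) (JJ l (a + i + l)) y
        = -4 * (a + i + l) * (m - i - l) * JJ l (a + (i + 1) + l) y
          - 4 * (a + i + l) * (a + i + l + 1) * JJ (l + 1) (a + (i + 1) + (l + 1)) y := by
      intro l
      rw [Lop_JJ l _ y hy, show a + i + l + 1 = a + ((i:ℝ) + 1) + l by ring,
        show a + i + l + 2 = a + ((i:ℝ) + 1) + (l + 1) by ring]
      have : 2 * (a + i + l) + 2 - ((n:ℝ) + 1) = -2 * (m - i - l) := by linarith
      rw [this]; ring
    have h3 : ∀ l : ℕ, cc a m i l * Lop (dY n) (JJ l (a + i + l)) y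
        = cc a m i l * (-4 * (a + i + l) * (m - i - l) * JJ l (a + (i + 1) + l) y)
          - cc a m i l * (4 * (a + i + l) * (a + i + l + 1) * JJ (l + 1) (a + (i + 1) + (l + 1)) y) := by
      intro l; rw [h1, mul_sub]
    simp only [h3, Finset.sum_sub_distrib]
    rw [Finset.sum_range_succ' _ (i + 1)]
    have hc : cc a m i (i + 1) = 0 := by rw [cc_eq]; simp
    have h2 : ∀ k ∈ Finset.range (i + 1), cc a m (i + 1) (k + 1) * JJ (k + 1) (a + ((i + 1 : ℕ) : ℝ) + ((k + 1 : ℕ) : ℝ)) y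
      = cc a m i (k + 1) * (-4 * (a + i + (k + 1 : ℕ)) * (m - i - (k + 1 : ℕ)) * JJ (k + 1) (a + (i + 1) + (k + 1 : ℕ)) y)
        - cc a m i k * (4 * (a + i + k) * (a + i + k + 1) * JJ (k + 1) (a + (i + 1) + (k + 1)) y) := by
      intro k _
      rw [cc]; push_cast; ring
    rw [Finset.sum_congr rfl h2, Finset.sum_sub_distrib,
      Finset.sum_range_succ (fun k => cc a m i (k + 1) * (-4 * (a + i + (k + 1 : ℕ)) * (m - i - (k + 1 : ℕ)) * JJ (k + 1) (a + (i + 1) + (k + 1 : ℕ)) y)), hc,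
      Finset.sum_range_succ' (fun l => cc a m i l * (-4 * (a + i + l) * (m - i - l) * JJ l (a + (i + 1) + l) y)), cc]
    push_cast
    simp only [add_zero, sub_zero]
    ring

lemma Lop_top_kk {a : ℝ} {m : ℕ} (ha : 2 * a = (n:ℝ) - 2 * m - 1) :
    EqOff ((Lop (dY n))^[m + 1] (kk a))
      (fun y => (-4) ^ (m + 1) * poch a (2 * m + 2) * JJ (m + 1) (a + 2 * m + 2) y) := by
  intro y hy
  rw [Lop_iter_kk ha (m + 1) y hy]
  show ∑ l ∈ Finset.range (m + 1 + 1), cc a m (m + 1) l * JJ l (a + ↑(m + 1) + ↑l) y = _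
  rw [Finset.sum_range_succ, Finset.sum_eq_zero]
  · rw [cc_eq]
    simp only [Nat.choose_self, Nat.sub_self, Finset.range_zero, Finset.prod_empty]
    rw [show m + 1 + (m + 1) = 2 * m + 2 by ring, show a + ((m + 1 : ℕ) : ℝ) + ((m + 1 : ℕ) : ℝ) = a + 2 * m + 2 by push_cast; ring]
    simp
  · intro l hl
    rw [Finset.mem_range] at hl
    rw [cc_eq, Finset.prod_eq_zero (i := m - l) (Finset.mem_range.2 (by omega))]
    · simp
    · rw [Nat.cast_sub (by omega)]; ring

end expl

/-! ### Approximate identity on `ℝⁿ × ℝ` -/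
section approx
variable {n : ℕ}

def nX (p : Euc n × ℝ) : ℝ := ‖p.1‖ ^ 2 + p.2 ^ 2

lemma nX_meas : Measurable (nX (n := n)) := by unfold nX; fun_prop

lemma nX_nonneg (p : Euc n × ℝ) : 0 ≤ nX p := by unfold nX; positivity

lemma norm_sq_le_nX (p : Euc n × ℝ) : ‖p‖ ^ 2 ≤ nX p := by
  have := norm_sq_le_kq ((0, p) : YY n)
  have e : ‖((0, p) : YY n)‖ = ‖p‖ := by simp [Prod.norm_def]
  rw [e] at this
  simpa [kq, nX] using this

lemma lint_gauss_X {t : ℝ} (ht : 0 < t) :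
    ∫⁻ p : Euc n × ℝ, ENNReal.ofReal (rexp (-(t * nX p))) = ENNReal.ofReal ((π / t) ^ (((n : ℝ) + 1) / 2)) := by
  have h1 : ∫⁻ y : ℝ, ENNReal.ofReal (rexp (-(t * y ^ 2))) = ENNReal.ofReal ((π / t) ^ ((1:ℝ) / 2)) := by
    have h := integral_gaussian t
    rw [Real.sqrt_eq_rpow] at h
    rw [← h, ofReal_integral_eq_lintegral_ofReal (integrable_exp_neg_mul_sq ht) (Eventually.of_forall fun v => (exp_pos _).le)]
    simp [neg_mul]
  have h2 : ∀ p : Euc n × ℝ, ENNReal.ofReal (rexp (-(t * nX p)))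
      = ENNReal.ofReal (rexp (-(t * ‖p.1‖ ^ 2))) * ENNReal.ofReal (rexp (-(t * p.2 ^ 2))) := by
    intro p
    rw [← ENNReal.ofReal_mul (exp_pos _).le, ← Real.exp_add]
    unfold nX; ring_nf
  simp only [h2]
  rw [Measure.volume_eq_prod, lintegral_prod_mul (f := fun x : Euc n => ENNReal.ofReal (rexp (-(t * ‖x‖ ^ 2))))
    (g := fun y : ℝ => ENNReal.ofReal (rexp (-(t * y ^ 2))))
    (Measurable.aemeasurable (by fun_prop)) (Measurable.aemeasurable (by fun_prop)),
    lint_gauss_euc n ht, h1, ← ENNReal.ofReal_mul (by positivity), ← Real.rpow_add (by positivity)]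
  congr 2; ring

/-- the profile -/
def prof (b : ℝ) (p : Euc n × ℝ) : ℝ := (1 + nX p) ^ (-b)

lemma prof_nonneg (b : ℝ) (p : Euc n × ℝ) : 0 ≤ prof b p := by
  have := nX_nonneg p
  unfold prof; positivity

lemma prof_meas (b : ℝ) : Measurable (prof (n := n) b) := by
  unfold prof
  have := nX_meas (n := n)
  fun_prop

lemma prof_int {b : ℝ} (hb : ((n:ℝ) + 1) / 2 < b) : Integrable (prof (n := n) b) ∧
    ∫ p, prof (n := n) b p = π ^ (((n:ℝ) + 1) / 2) * Gamma (b - ((n:ℝ) + 1) / 2) / Gamma b := by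
  have h := lint_of_gauss (volume : Measure (Euc n × ℝ)) nX nX_meas nX_nonneg (k := ((n:ℝ) + 1) / 2) (r := b)
    (by positivity) (fun t ht => lint_gauss_X ht) hb
  have hn0 : (0:ℝ) ≤ n := Nat.cast_nonneg _
  have hpos : 0 ≤ π ^ (((n:ℝ) + 1) / 2) * Gamma (b - ((n:ℝ) + 1) / 2) / Gamma b := by
    have h1 := Gamma_pos_of_pos (show 0 < b - ((n:ℝ) + 1) / 2 by linarith)
    have h2 := Gamma_pos_of_pos (show 0 < b by linarith)
    positivity
  have hI : Integrable (prof (n := n) b) := by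
    refine ⟨(prof_meas b).aestronglyMeasurable, ?_⟩
    rw [hasFiniteIntegral_iff_ofReal (ae_of_all _ (prof_nonneg b))]
    unfold prof
    rw [h]; exact ENNReal.ofReal_lt_top
  refine ⟨hI, ?_⟩
  rw [integral_eq_lintegral_of_nonneg_ae (ae_of_all _ (prof_nonneg b)) hI.1]
  unfold prof
  rw [h, ENNReal.toReal_ofReal hpos]

lemma JJ_scale (l : ℕ) (b : ℝ) (hb : 2 * b = 2 * l + (n + 1)) {η : ℝ} (hη : 0 < η) (p : Euc n × ℝ) :
    JJ l b ((η, p) : YY n) = (η⁻¹) ^ (n + 1) * prof b (η⁻¹ • p) := by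
  have e : kq ((η, p) : YY n) = η ^ 2 * (1 + nX (η⁻¹ • p)) := by
    unfold kq nX
    simp only [Prod.smul_fst, Prod.smul_snd, norm_smul, smul_eq_mul, norm_inv, Real.norm_eq_abs, abs_of_pos hη]
    field_simp
  have h0 := nX_nonneg (η⁻¹ • p)
  unfold JJ prof
  rw [e, Real.mul_rpow (by positivity) (by positivity), ← mul_assoc]
  congr 1
  simp only
  rw [← Real.rpow_natCast, ← Real.rpow_natCast, ← Real.rpow_natCast, ← Real.rpow_mul hη.le, Real.inv_rpow hη.le,
    ← Real.rpow_add hη, ← Real.rpow_neg hη.le]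
  congr 1; push_cast; linarith

lemma prof_decay {b : ℝ} (hb : (n:ℝ) + 1 < 2 * b) : 
    Tendsto (fun p : Euc n × ℝ => ‖p‖ ^ Module.finrank ℝ (Euc n × ℝ) * prof b p) (Bornology.cobounded (Euc n × ℝ)) (𝓝 0) := by
  have hfr : Module.finrank ℝ (Euc n × ℝ) = n + 1 := by rw [Module.finrank_prod]; simp
  rw [hfr]
  have h1 : Tendsto (fun p : Euc n × ℝ => ‖p‖ ^ (-(2 * b - (n + 1)))) (Bornology.cobounded (Euc n × ℝ)) (𝓝 0) :=
    (tendsto_rpow_neg_atTop (by linarith)).comp tendsto_norm_cobounded_atTop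
  refine squeeze_zero' (Eventually.of_forall fun p => mul_nonneg (by positivity) (prof_nonneg b p)) ?_ h1
  filter_upwards [tendsto_norm_cobounded_atTop.eventually (eventually_gt_atTop 0)] with p hp
  have hn0 : (0:ℝ) ≤ n := Nat.cast_nonneg _
  have : prof b p ≤ (‖p‖ ^ 2) ^ (-b) := by
    unfold prof
    refine Real.rpow_le_rpow_of_nonpos (by positivity) ?_ (by linarith)
    linarith [norm_sq_le_nX p]
  calc _ ≤ ‖p‖ ^ (n + 1) * (‖p‖ ^ 2) ^ (-b) := by gcongr
    _ = _ := by
      rw [← Real.rpow_natCast, ← Real.rpow_natCast, ← Real.rpow_mul hp.le, ← Real.rpow_add hp]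
      congr 1; push_cast; ring

lemma JJ_far (l : ℕ) {b : ℝ} (hb : (n:ℝ) + 1 ≤ 2 * b) (η : ℝ) {p : Euc n × ℝ} (hp : 1 ≤ ‖p‖) :
    |JJ l b ((η, p) : YY n)| ≤ η ^ (2 * l) * (2 ^ ((n:ℝ) + 1) * wt ((n:ℝ) + 1) p) := by
  have hn0 : (0:ℝ) ≤ n := Nat.cast_nonneg _
  unfold JJ
  rw [abs_of_nonneg (mul_nonneg (Even.pow_nonneg (even_two_mul l) _) (Real.rpow_nonneg (kq_nonneg _) _))]
  simp only
  refine mul_le_mul_of_nonneg_left ?_ (Even.pow_nonneg (even_two_mul l) _)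
  have h1 : ‖p‖ ^ 2 ≤ kq ((η, p) : YY n) := by
    have := norm_sq_le_nX p
    unfold kq; unfold nX at this
    have := sq_nonneg η
    simp only
    linarith
  have hp0 : 0 < ‖p‖ := by linarith
  calc kq ((η, p) : YY n) ^ (-b) ≤ (‖p‖ ^ 2) ^ (-b) := Real.rpow_le_rpow_of_nonpos (by positivity) h1 (by linarith)
    _ = ‖p‖ ^ (-(2 * b)) := by
      rw [← Real.rpow_natCast, ← Real.rpow_mul hp0.le]; congr 1; push_cast; ring
    _ ≤ ‖p‖ ^ (-((n:ℝ) + 1)) := Real.rpow_le_rpow_of_exponent_le hp (by linarith)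
    _ ≤ ((1 + ‖p‖) / 2) ^ (-((n:ℝ) + 1)) :=
      Real.rpow_le_rpow_of_nonpos (by positivity) (by linarith) (by linarith)
    _ = _ := by
      unfold wt
      rw [div_eq_mul_inv, Real.mul_rpow (by positivity) (by positivity), Real.inv_rpow (by norm_num), ← Real.rpow_neg (by norm_num), neg_neg]
      ring

lemma JJ_cont (l : ℕ) (b : ℝ) {η : ℝ} (hη : η ≠ 0) : Continuous (fun p : Euc n × ℝ => JJ l b ((η, p) : YY n)) := by
  rw [continuous_iff_continuousAt]
  intro p
  have := (JJ_sm (n := n) l b (η, p) (by simpa using sl_ne (ζ := 0) (p := p) (Or.inl hη))).continuousAt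
  exact ContinuousAt.comp (f := fun p : Euc n × ℝ => ((η, p) : YY n)) this (by fun_prop)

lemma approx_id {l : ℕ} (hl : 1 ≤ l) {b : ℝ} (hb : 2 * b = 2 * l + (n + 1)) {g : Euc n × ℝ → ℝ} (hg : Continuous g)
    (hgi : Integrable (fun p => g p * wt ((n:ℝ) + 1) p)) :
    (∀ η : ℝ, 0 < η → Integrable (fun p => g p * JJ l b ((η, p) : YY n))) ∧
    Tendsto (fun η : ℝ => ∫ p, g p * JJ l b ((η, p) : YY n)) (𝓝[>] 0)
      (𝓝 (g 0 * ∫ p, prof (n := n) b p)) := by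
  have hl' : (1:ℝ) ≤ l := by exact_mod_cast hl
  have hn0 : (0:ℝ) ≤ n := Nat.cast_nonneg _
  set B : Set (Euc n × ℝ) := Metric.ball 0 1 with hB
  have hBm : MeasurableSet B := Metric.isOpen_ball.measurableSet
  obtain ⟨hPi, hPv⟩ := prof_int (n := n) (b := b) (by linarith)
  set P := ∫ p, prof (n := n) b p with hP
  have hP0 : 0 < P := by
    rw [hPv]
    have h1 := Gamma_pos_of_pos (show 0 < b - ((n:ℝ) + 1) / 2 by linarith)
    have h2 := Gamma_pos_of_pos (show 0 < b by linarith)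
    positivity
  have near : IntegrableOn g B := 
    (hg.continuousOn.integrableOn_compact (isCompact_closedBall (0 : Euc n × ℝ) 1)).mono_set Metric.ball_subset_closedBall
  have far_b : ∀ η : ℝ, ∀ p ∈ Bᶜ, ‖g p * JJ l b ((η, p) : YY n)‖ ≤ η ^ (2 * l) * (2 ^ ((n:ℝ) + 1) * |g p * wt ((n:ℝ) + 1) p|) := by
    intro η p hp
    have hp1 : 1 ≤ ‖p‖ := by simpa [hB] using hp
    rw [Real.norm_eq_abs, abs_mul, abs_mul (g p), abs_of_pos (wt_pos _ _)]
    calc _ ≤ |g p| * (η ^ (2 * l) * (2 ^ ((n:ℝ) + 1) * wt ((n:ℝ) + 1) p)) :=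
          mul_le_mul_of_nonneg_left (JJ_far l (by linarith) η hp1) (abs_nonneg _)
      _ = _ := by ring
  have far_i : ∀ η : ℝ, 0 < η → IntegrableOn (fun p => g p * JJ l b ((η, p) : YY n)) Bᶜ := by
    intro η hη
    refine Integrable.mono' (((hgi.abs.const_mul (2 ^ ((n:ℝ) + 1))).const_mul (η ^ (2 * l))).integrableOn)
      (hg.mul (JJ_cont l b hη.ne')).aestronglyMeasurable ?_
    exact (ae_restrict_iff' hBm.compl).2 (ae_of_all _ fun p hp => far_b η p hp)
  have near_i : ∀ η : ℝ, 0 < η → IntegrableOn (fun p => g p * JJ l b ((η, p) : YY n)) B := fun η hη =>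
    ((hg.mul (JJ_cont l b hη.ne')).continuousOn.integrableOn_compact (isCompact_closedBall (0 : Euc n × ℝ) 1)).mono_set
      Metric.ball_subset_closedBall
  have all_i : ∀ η : ℝ, 0 < η → Integrable (fun p => g p * JJ l b ((η, p) : YY n)) := by
    intro η hη
    have := (near_i η hη).union (far_i η hη)
    rwa [Set.union_compl_self, integrableOn_univ] at this
  refine ⟨all_i, ?_⟩
  have hsplit : ∀ η : ℝ, 0 < η → ∫ p, g p * JJ l b ((η, p) : YY n)
      = (∫ p in B, g p * JJ l b ((η, p) : YY n)) + ∫ p in Bᶜ, g p * JJ l b ((η, p) : YY n) := fun η hη =>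
    (integral_add_compl hBm (all_i η hη)).symm
  have t2 : Tendsto (fun η : ℝ => ∫ p in Bᶜ, g p * JJ l b ((η, p) : YY n)) (𝓝[>] 0) (𝓝 0) := by
    have hb2 : ∀ η : ℝ, ‖∫ p in Bᶜ, g p * JJ l b ((η, p) : YY n)‖
        ≤ η ^ (2 * l) * ∫ p in Bᶜ, (2 ^ ((n:ℝ) + 1) * |g p * wt ((n:ℝ) + 1) p|) := by
      intro η
      rw [← integral_const_mul]
      refine norm_integral_le_of_norm_le (((hgi.abs.const_mul (2 ^ ((n:ℝ) + 1))).const_mul (η ^ (2 * l))).integrableOn) ?_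
      exact (ae_restrict_iff' hBm.compl).2 (ae_of_all _ fun p hp => far_b η p hp)
    refine squeeze_zero_norm hb2 ?_
    have : Tendsto (fun η : ℝ => η ^ (2 * l) * ∫ p in Bᶜ, (2 ^ ((n:ℝ) + 1) * |g p * wt ((n:ℝ) + 1) p|)) (𝓝 0)
        (𝓝 (0 ^ (2 * l) * ∫ p in Bᶜ, (2 ^ ((n:ℝ) + 1) * |g p * wt ((n:ℝ) + 1) p|))) :=
      Continuous.tendsto (by fun_prop) 0
    rw [zero_pow (by omega), zero_mul] at this
    exact this.mono_left nhdsWithin_le_nhds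
  have t1 : Tendsto (fun η : ℝ => ∫ p in B, g p * JJ l b ((η, p) : YY n)) (𝓝[>] 0) (𝓝 (g 0 * P)) := by
    have hph : ∀ p : Euc n × ℝ, 0 ≤ (fun p : Euc n × ℝ => P⁻¹ * prof b p) p :=
      fun p => mul_nonneg (inv_nonneg.2 hP0.le) (prof_nonneg b p)
    have hk := tendsto_integral_comp_smul_smul_of_integrable (μ := (volume : Measure (Euc n × ℝ)))
      hph
      (by rw [integral_const_mul, ← hP, inv_mul_cancel₀ hP0.ne'])
      (by
        have := (prof_decay (n := n) (b := b) (by linarith)).const_mul P⁻¹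
        rw [mul_zero] at this
        refine this.congr fun p => by ring)
      (g := B.indicator g) ((integrable_indicator_iff hBm).2 near)
      (by
        refine hg.continuousAt.congr ?_
        filter_upwards [Metric.ball_mem_nhds (0 : Euc n × ℝ) one_pos] with p hp
        rw [Set.indicator_of_mem hp])
    have h3 := (hk.comp tendsto_inv_nhdsGT_zero).mul_const P
    rw [Set.indicator_of_mem (by simp [hB])] at h3
    refine h3.congr' ?_
    filter_upwards [self_mem_nhdsWithin] with η hη
    have hη' : (0:ℝ) < η := hη
    simp only [Function.comp_apply]
    rw [← integral_mul_const, ← integral_indicator hBm]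
    congr 1; ext p
    have hfr : Module.finrank ℝ (Euc n × ℝ) = n + 1 := by rw [Module.finrank_prod]; simp
    by_cases hp : p ∈ B
    · rw [Set.indicator_of_mem hp, Set.indicator_of_mem hp, JJ_scale l b hb hη', hfr, smul_eq_mul]
      field_simp
    · rw [Set.indicator_of_notMem hp, Set.indicator_of_notMem hp]; simp
  have := t1.add t2
  rw [add_zero] at this
  refine this.congr' ?_
  filter_upwards [self_mem_nhdsWithin] with η hη
  exact (hsplit η hη).symm

end approx

section addit
variable {E : Type*} [NormedAddCommGroup E] [NormedSpace ℝ E] {ι : Type*} [Fintype ι]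

lemma Dv_add' {f g : E → ℝ} (hf : ContDiff ℝ (⊤ : ℕ∞) f) (hg : ContDiff ℝ (⊤ : ℕ∞) g) (v : E) :
    Dv v (fun p => f p + g p) = fun p => Dv v f p + Dv v g p := by
  ext p
  unfold Dv
  rw [fderiv_fun_add (hf.differentiable (by simp) p) (hg.differentiable (by simp) p)]
  rfl

lemma Lop_add' {e : ι → E} {f g : E → ℝ} (hf : ContDiff ℝ (⊤ : ℕ∞) f) (hg : ContDiff ℝ (⊤ : ℕ∞) g) :
    Lop e (fun p => f p + g p) = fun p => Lop e f p + Lop e g p := by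
  ext p
  unfold Lop
  rw [← Finset.sum_add_distrib]
  refine Finset.sum_congr rfl fun a _ => ?_
  rw [Dv_add' hf hg, Dv_add' (Dv_contDiff hf) (Dv_contDiff hg)]

lemma Lop_iter_add' {e : ι → E} {f g : E → ℝ} (hf : ContDiff ℝ (⊤ : ℕ∞) f) (hg : ContDiff ℝ (⊤ : ℕ∞) g) (k : ℕ) :
    (Lop e)^[k] (fun p => f p + g p) = fun p => (Lop e)^[k] f p + (Lop e)^[k] g p := by
  induction k with
  | zero => rfl
  | succ k ih =>
    rw [Function.iterate_succ_apply', ih, Lop_add' (Lop_iter_contDiff hf k) (Lop_iter_contDiff hg k)]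
    simp only [Function.iterate_succ_apply']

lemma Tm_add' {e : Option ι → E} {f g : E → ℝ} (hf : ContDiff ℝ (⊤ : ℕ∞) f) (hg : ContDiff ℝ (⊤ : ℕ∞) g) (m : ℕ)
    (a : Option ι) : Tm m e a (fun p => f p + g p) = fun p => Tm m e a f p + Tm m e a g p := by
  unfold Tm
  split_ifs
  · exact Lop_iter_add' hf hg _
  · simp
  · rw [Lop_iter_add' hf hg, Dv_add' (Lop_iter_contDiff hf _) (Lop_iter_contDiff hg _)]
end addit

section refl
variable {n : ℕ}

lemma rfl2_rfl2 (p : Euc n × ℝ) : rfl2 (rfl2 p) = p := by simp [rfl2]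

lemma rfl2_sub (p q : Euc n × ℝ) : rfl2 (p - q) = rfl2 p - rfl2 q := by
  simp only [rfl2, Prod.fst_sub, Prod.snd_sub, Prod.mk_sub_mk]; congr 1; ring

lemma rfl2_mp : MeasurePreserving (rfl2 (n := n)) volume volume :=
  (MeasurePreserving.id volume).prod (Measure.measurePreserving_neg volume)

lemma rfl2_emb : MeasurableEmbedding (rfl2 (n := n)) := by
  refine MeasurableEmbedding.of_measurable_inverse (g := rfl2) rfl2_mp.measurable ?_ rfl2_mp.measurable rfl2_rfl2
  have : Set.range (rfl2 (n := n)) = Set.univ := Set.range_eq_univ.2 fun p => ⟨rfl2 p, rfl2_rfl2 p⟩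
  rw [this]; exact MeasurableSet.univ

lemma half_compl (n : ℕ) : ((upperHS n)ᶜ : Set (Euc n × ℝ)) =ᵐ[volume] rfl2 ⁻¹' (upperHS n) := by
  have h0 : volume {p : Euc n × ℝ | p.2 = 0} = 0 := by
    have : {p : Euc n × ℝ | p.2 = 0} = Set.univ ×ˢ {0} := by ext p; simp
    rw [this, Measure.volume_eq_prod, Measure.prod_prod]; simp
  have : ∀ᵐ p : Euc n × ℝ, p.2 ≠ 0 := by
    rw [ae_iff]; simpa using h0
  filter_upwards [this] with p hp
  apply propext
  show ¬ (0 < p.2) ↔ 0 < -p.2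
  constructor
  · intro h; have := lt_of_le_of_ne (not_lt.1 h) hp; linarith
  · intro h; linarith

lemma even_int {F : Euc n × ℝ → ℝ} (hF : IntegrableOn F (upperHS n)) (he : ∀ p, F (rfl2 p) = F p) : Integrable F := by
  rw [← integrableOn_univ, ← Set.union_compl_self (upperHS n)]
  refine hF.union ?_
  rw [IntegrableOn, Measure.restrict_congr_set (half_compl n)]
  have := (rfl2_mp.integrableOn_comp_preimage (rfl2_emb (n := n)) (f := F) (s := upperHS n)).2 hF
  exact this.congr (ae_of_all _ he)

lemma int_refl {F : Euc n × ℝ → ℝ} (hF : Integrable F) :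
    ∫ p, F p = (∫ p in upperHS n, F p) + ∫ p in upperHS n, F (rfl2 p) := by
  rw [← integral_add_compl (measurableSet_half n) hF]
  congr 1
  rw [Measure.restrict_congr_set (half_compl n),
    ← rfl2_mp.setIntegral_preimage_emb (rfl2_emb (n := n)) (fun p => F (rfl2 p)) (upperHS n)]
  simp only [rfl2_rfl2]

def evn (u : Euc n × ℝ → ℝ) (p : Euc n × ℝ) : ℝ := u (p.1, |p.2|)

lemma evn_rfl (u : Euc n × ℝ → ℝ) (p : Euc n × ℝ) : evn u (rfl2 p) = evn u p := by simp [evn, rfl2]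

lemma evn_of {u : Euc n × ℝ → ℝ} {p : Euc n × ℝ} (hp : 0 ≤ p.2) : evn u p = u p := by simp [evn, abs_of_nonneg hp]

lemma rfl2_norm (p : Euc n × ℝ) : ‖rfl2 p‖ = ‖p‖ := by simp [rfl2, Prod.norm_def]

lemma wt_rfl (b : ℝ) (p : Euc n × ℝ) : wt b (rfl2 p) = wt b p := by simp [wt, rfl2_norm]

lemma wt_shift {b : ℝ} (hb : 0 ≤ b) (p z : Euc n × ℝ) : wt b p ≤ (1 + ‖z‖) ^ b * wt b (p + z) := by
  unfold wt
  have h1 : 1 + ‖p + z‖ ≤ (1 + ‖z‖) * (1 + ‖p‖) := by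
    nlinarith [norm_add_le p z, norm_nonneg p, norm_nonneg z, mul_nonneg (norm_nonneg p) (norm_nonneg z)]
  rw [Real.rpow_neg (by positivity), Real.rpow_neg (by positivity), ← div_eq_mul_inv, inv_eq_one_div,
    div_le_div_iff₀ (by positivity) (by positivity), one_mul, ← Real.mul_rpow (by positivity) (by positivity)]
  exact Real.rpow_le_rpow (by positivity) h1 hb

lemma evn_int {u : Euc n × ℝ → ℝ} (hu : Continuous u) (h : IntegrableOn (fun p => u p * wt ((n:ℝ) + 1) p) (upperHS n))
    (z : Euc n × ℝ) : Integrable (fun p => evn u (p + z) * wt ((n:ℝ) + 1) p) := by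
  have hc : Continuous (evn u) := by unfold evn; fun_prop
  have h1 : Integrable (fun p => evn u p * wt ((n:ℝ) + 1) p) := by
    refine even_int (h.congr_fun (fun p hp => ?_) (measurableSet_half n)) fun p => by rw [evn_rfl, wt_rfl]
    show u p * _ = evn u p * _
    rw [evn_of (le_of_lt hp)]
  have h2 := (h1.comp_add_right z).norm.const_mul ((1 + ‖z‖) ^ ((n:ℝ) + 1))
  refine h2.mono' (Continuous.aestronglyMeasurable ?_) (ae_of_all _ fun p => ?_)
  · exact (hc.comp (by fun_prop)).mul (wt_cont _)
  · have := wt_shift (b := (n:ℝ) + 1) (by positivity) p z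
    rw [norm_mul, norm_mul, Real.norm_of_nonneg (wt_pos _ p).le, Real.norm_of_nonneg (wt_pos _ (p + z)).le]
    calc _ ≤ ‖evn u (p + z)‖ * _ := mul_le_mul_of_nonneg_left this (norm_nonneg _)
      _ = _ := by ring

lemma JJ_rfl (l : ℕ) (b η : ℝ) (p : Euc n × ℝ) : JJ l b ((η, rfl2 p) : YY n) = JJ l b (η, p) := by
  simp [JJ, kq, rfl2]

lemma kk_rfl (a η : ℝ) (p : Euc n × ℝ) : kk a ((η, rfl2 p) : YY n) = kk a (η, p) := by
  simp [kk, kq, rfl2]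
end refl

section repr
variable {n m : ℕ} {u : Euc n × ℝ → ℝ}

def NN (a η : ℝ) (ζ p : Euc n × ℝ) : ℝ := sl (kk a) η ζ p + sl (kk a) η (rfl2 ζ) p

lemma nice_of_par {v : Euc n × ℝ → ℝ} (hv : ContDiff ℝ (⊤ : ℕ∞) v) (h : Par 1 v)
    (hb : ∀ k : ℕ, ∃ C, ∀ p, ‖iteratedFDeriv ℝ k v p‖ ≤ C * wt ((n:ℝ) - 2 * m - 1 + k) p) : Nice n m v :=
  ⟨hv, fun k x => par_bd hv h k x, hb⟩

lemma sl_nice_bound {a : ℝ} (ha : 2 * a = (n:ℝ) - 2 * m - 1) (ha0 : 0 < a) {η : ℝ} (hη : η ≠ 0) (ζ : Euc n × ℝ) (k : ℕ) :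
    ∃ C, ∀ p, ‖iteratedFDeriv ℝ k (sl (kk (n := n) a) η ζ) p‖ ≤ C * wt ((n:ℝ) - 2 * m - 1 + k) p := by
  obtain ⟨C, hC⟩ := sl_wt_bound (kk_symb (n := n) a) hη ζ k (by have : (0:ℝ) ≤ k := Nat.cast_nonneg _; linarith)
  refine ⟨C, fun p => ?_⟩
  rw [show (n:ℝ) - 2 * m - 1 + k = -(-(2 * a)) + k by linarith]
  exact hC p

lemma NN_nice {a : ℝ} (ha : 2 * a = (n:ℝ) - 2 * m - 1) (ha0 : 0 < a) {η : ℝ} (hη : η ≠ 0) (ζ : Euc n × ℝ) :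
    Nice n m (NN a η ζ) := by
  have h1 := sl_contDiff (kk_symb (n := n) a) hη ζ
  have h2 := sl_contDiff (kk_symb (n := n) a) hη (rfl2 ζ)
  refine nice_of_par (h1.add h2) ?_ fun k => ?_
  · intro p
    rw [one_mul]
    show kk a (η, rfl2 p - ζ) + kk a (η, rfl2 p - rfl2 ζ) = kk a (η, p - ζ) + kk a (η, p - rfl2 ζ)
    rw [← rfl2_sub, kk_rfl, ← kk_rfl a η (rfl2 p - ζ), rfl2_sub, rfl2_rfl2, add_comm]
  · obtain ⟨C1, hC1⟩ := sl_nice_bound ha ha0 hη ζ k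
    obtain ⟨C2, hC2⟩ := sl_nice_bound ha ha0 hη (rfl2 ζ) k
    refine ⟨C1 + C2, fun p => ?_⟩
    have : iteratedFDeriv ℝ k (NN a η ζ) p = iteratedFDeriv ℝ k (sl (kk (n := n) a) η ζ) p
        + iteratedFDeriv ℝ k (sl (kk (n := n) a) η (rfl2 ζ)) p :=
      iteratedFDeriv_add_apply (h1.of_le (by exact_mod_cast le_top)).contDiffAt (h2.of_le (by exact_mod_cast le_top)).contDiffAt
    rw [this, add_mul]
    exact (norm_add_le _ _).trans (add_le_add (hC1 p) (hC2 p))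

lemma K_nice {a : ℝ} (ha : 2 * a = (n:ℝ) - 2 * m - 1) (ha0 : 0 < a) {η : ℝ} (hη : η ≠ 0) (ξ : Euc n) :
    Nice n m (sl (kk (n := n) a) η (ξ, 0)) := by
  refine nice_of_par (sl_contDiff (kk_symb (n := n) a) hη _) ?_ fun k => sl_nice_bound ha ha0 hη _ k
  intro p
  rw [one_mul]
  show kk a (η, rfl2 p - (ξ, 0)) = kk a (η, p - (ξ, 0))
  rw [← kk_rfl, rfl2_sub, rfl2_rfl2]
  simp [rfl2]

/-- the constant `2κ` -/
def kap2 (n m : ℕ) (a : ℝ) : ℝ := 4 ^ (m + 1) * poch a (2 * m + 2) * ∫ p, prof (n := n) (a + 2 * m + 2) p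

lemma rhs_lim {a : ℝ} (ha : 2 * a = (n:ℝ) - 2 * m - 1) (ha0 : 0 < a) (hu : Good n m u) {ζ : Euc n × ℝ} (hζ : 0 ≤ ζ.2) :
    Tendsto (fun η : ℝ => (-1) ^ (m + 1) * ∫ p in upperHS n, u p * (Lop (dX n))^[m+1] (NN a η ζ) p)
      (𝓝[>] 0) (𝓝 (kap2 n m a * u ζ)) := by
  have hc : Continuous u := hu.sm.continuous
  have hce : Continuous (evn u) := by unfold evn; fun_prop
  have hi0 : IntegrableOn (fun p => u p * wt ((n:ℝ) + 1) p) (upperHS n) := by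
    have := hu.int 0 (by omega)
    refine this.mono' ((hc.mul (wt_cont _)).aestronglyMeasurable) (ae_of_all _ fun p => ?_)
    simp only [norm_iteratedFDeriv_zero, Nat.cast_zero, sub_zero]
    show ‖u p * wt ((n:ℝ) + 1) p‖ ≤ _
    rw [norm_mul, Real.norm_of_nonneg (wt_pos _ p).le]
  obtain ⟨A1, A2⟩ := approx_id (n := n) (l := m + 1) (by omega) (b := a + 2 * m + 2)
    (by push_cast; linarith) (g := fun p => evn u (p + ζ)) (hce.comp (by fun_prop)) (evn_int hc hi0 ζ)
  have A3 := A2.const_mul (4 ^ (m + 1) * poch a (2 * m + 2))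
  have e1 : (4 ^ (m + 1) * poch a (2 * m + 2)) * (evn u (0 + ζ) * ∫ p, prof (n := n) (a + 2 * m + 2) p)
      = kap2 n m a * u ζ := by
    rw [zero_add, evn_of hζ]; unfold kap2; ring
  rw [e1] at A3
  refine A3.congr' ?_
  filter_upwards [self_mem_nhdsWithin] with η hη
  have hη' : (0:ℝ) < η := hη
  have hη0 := hη'.ne'
  have e2 : ∀ p, (Lop (dX n))^[m+1] (NN a η ζ) p = (-4) ^ (m + 1) * poch a (2 * m + 2) *
      (JJ (m + 1) (a + 2 * m + 2) ((η, p - ζ) : YY n) + JJ (m + 1) (a + 2 * m + 2) ((η, p - rfl2 ζ) : YY n)) := by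
    intro p
    have h1 := sl_contDiff (kk_symb (n := n) a) hη0 ζ
    have h2 := sl_contDiff (kk_symb (n := n) a) hη0 (rfl2 ζ)
    have h3 : (Lop (dX n))^[m+1] (NN a η ζ) = _ := Lop_iter_add' h1 h2 (m + 1)
    rw [h3, Lop_iter_sl (kk_symb (n := n) a) hη0, Lop_iter_sl (kk_symb (n := n) a) hη0]
    simp only [sl]
    rw [Lop_top_kk ha _ (sl_ne (Or.inl hη0)), Lop_top_kk ha _ (sl_ne (Or.inl hη0))]
    ring
  have e3 : ∫ p, evn u (p + ζ) * JJ (m + 1) (a + 2 * m + 2) ((η, p) : YY n)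
      = ∫ p in upperHS n, u p * (JJ (m + 1) (a + 2 * m + 2) ((η, p - ζ) : YY n) + JJ (m + 1) (a + 2 * m + 2) ((η, p - rfl2 ζ) : YY n)) := by
    have hF : Integrable (fun p => evn u p * JJ (m + 1) (a + 2 * m + 2) ((η, p - ζ) : YY n)) := by
      have := (A1 η hη').comp_sub_right ζ
      simpa using this
    have t1 : ∫ p, evn u (p + ζ) * JJ (m + 1) (a + 2 * m + 2) ((η, p) : YY n)
        = ∫ p, evn u p * JJ (m + 1) (a + 2 * m + 2) ((η, p - ζ) : YY n) := by
      have := integral_add_right_eq_self (μ := (volume : Measure (Euc n × ℝ)))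
        (fun p => evn u p * JJ (m + 1) (a + 2 * m + 2) ((η, p - ζ) : YY n)) ζ
      simpa using this
    have hF2 : Integrable (fun p => evn u (rfl2 p) * JJ (m + 1) (a + 2 * m + 2) ((η, rfl2 p - ζ) : YY n)) :=
      rfl2_mp.integrable_comp_of_integrable hF
    rw [t1, int_refl hF, ← integral_add hF.integrableOn hF2.integrableOn]
    refine setIntegral_congr_fun (measurableSet_half n) fun p hp => ?_
    show evn u p * _ + evn u (rfl2 p) * _ = _
    have e4 : rfl2 p - ζ = rfl2 (p - rfl2 ζ) := by rw [rfl2_sub, rfl2_rfl2]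
    rw [evn_rfl, evn_of (le_of_lt hp), e4, JJ_rfl]; ring
  simp only [e2]
  rw [e3, ← integral_const_mul, ← integral_const_mul]
  congr 1; ext p
  rw [show (-4 : ℝ) = (-1) * 4 by norm_num, mul_pow]
  have : ((-1:ℝ) ^ (m + 1)) * (-1) ^ (m + 1) = 1 := by rw [← mul_pow]; norm_num
  linear_combination (-(4 ^ (m + 1) * poch a (2 * m + 2) * (u p * (JJ (m + 1) (a + 2 * m + 2) ((η, p - ζ) : YY n) + JJ (m + 1) (a + 2 * m + 2) ((η, p - rfl2 ζ) : YY n))))) * this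
end repr

section ker
variable {n m : ℕ} {u : Euc n × ℝ → ℝ}

lemma finX1 (n : ℕ) : 1 ≤ Module.finrank ℝ (Euc n × ℝ) := by
  have := finrank_X n
  have h : (1:ℝ) ≤ (Module.finrank ℝ (Euc n × ℝ) : ℝ) := by
    rw [this]; have : (0:ℝ) ≤ n := Nat.cast_nonneg _; linarith
  exact_mod_cast h

lemma near_shift {s : ℝ} (hs : s < (n:ℝ) + 1) : ∃ c : ℝ, 0 ≤ c ∧ ∀ (ζ : Euc n × ℝ) (R : ℝ), 0 < R →
    ∫⁻ p in Metric.ball ζ R, ENNReal.ofReal (‖p - ζ‖ ^ (-s)) ≤ ENNReal.ofReal (c * R ^ ((n:ℝ) + 1 - s)) := by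
  obtain ⟨c, hc, h⟩ := radial_near (volume : Measure (Euc n × ℝ)) (finX1 n) (s := s) (by rw [finrank_X]; exact hs)
  refine ⟨c, hc, fun ζ R hR => ?_⟩
  have h2 := h R hR
  rw [finrank_X] at h2
  refine le_trans (le_of_eq ?_) h2
  rw [← lintegral_indicator measurableSet_ball, ← lintegral_indicator measurableSet_ball,
    ← lintegral_sub_right_eq_self ((Metric.ball (0 : Euc n × ℝ) R).indicator (fun z => ENNReal.ofReal (‖z‖ ^ (-s)))) ζ]
  congr 1; ext p
  by_cases hp : p ∈ Metric.ball ζ R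
  · rw [Set.indicator_of_mem hp, Set.indicator_of_mem]
    rw [mem_ball_zero_iff]; rwa [mem_ball_iff_norm] at hp
  · rw [Set.indicator_of_notMem hp, Set.indicator_of_notMem]
    rw [mem_ball_zero_iff]; rwa [mem_ball_iff_norm] at hp

lemma far_shift {s : ℝ} (hs : (n:ℝ) + 1 < s) : ∃ c : ℝ, 0 ≤ c ∧ ∀ (ζ : Euc n × ℝ) (R : ℝ), 0 < R →
    ∫⁻ p in (Metric.ball ζ R)ᶜ, ENNReal.ofReal (‖p - ζ‖ ^ (-s)) ≤ ENNReal.ofReal (c * R ^ ((n:ℝ) + 1 - s)) := by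
  obtain ⟨c, hc, h⟩ := radial_far (volume : Measure (Euc n × ℝ)) (s := s) (by rw [finrank_X]; exact hs)
  refine ⟨c, hc, fun ζ R hR => ?_⟩
  have h2 := h R hR
  rw [finrank_X] at h2
  refine le_trans (le_of_eq ?_) h2
  rw [← lintegral_indicator measurableSet_ball.compl, ← lintegral_indicator measurableSet_ball.compl,
    ← lintegral_sub_right_eq_self ((Metric.ball (0 : Euc n × ℝ) R)ᶜ.indicator (fun z => ENNReal.ofReal (‖z‖ ^ (-s)))) ζ]
  congr 1; ext p
  by_cases hp : p ∈ Metric.ball ζ R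
  · rw [Set.indicator_of_notMem (by simpa using hp), Set.indicator_of_notMem]
    rw [mem_ball_iff_norm] at hp
    simpa using hp
  · rw [Set.indicator_of_mem hp, Set.indicator_of_mem]
    rw [mem_ball_iff_norm] at hp
    simpa using hp

/-- the singular weight -/
def rw' (s : ℝ) (ζ p : Euc n × ℝ) : ℝ := ‖p - ζ‖ ^ (-s)

lemma rw'_nonneg (s : ℝ) (ζ p : Euc n × ℝ) : 0 ≤ rw' s ζ p := by unfold rw'; positivity

lemma rw'_meas (s : ℝ) (ζ : Euc n × ℝ) : Measurable (rw' s ζ) := by unfold rw'; fun_prop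

lemma rw'_near {s : ℝ} (hs : s < (n:ℝ) + 1) (ζ : Euc n × ℝ) : IntegrableOn (rw' s ζ) (Metric.ball ζ 1) := by
  obtain ⟨c, hc, h⟩ := near_shift (n := n) hs
  refine ⟨(rw'_meas s ζ).aestronglyMeasurable, ?_⟩
  rw [hasFiniteIntegral_iff_ofReal (ae_of_all _ fun p => rw'_nonneg s ζ p)]
  exact lt_of_le_of_lt (h ζ 1 one_pos) ENNReal.ofReal_lt_top

lemma rw'_far {s : ℝ} (hs : (n:ℝ) + 1 < s) (ζ : Euc n × ℝ) : IntegrableOn (rw' s ζ) (Metric.ball ζ 1)ᶜ := by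
  obtain ⟨c, hc, h⟩ := far_shift (n := n) hs
  refine ⟨(rw'_meas s ζ).aestronglyMeasurable, ?_⟩
  rw [hasFiniteIntegral_iff_ofReal (ae_of_all _ fun p => rw'_nonneg s ζ p)]
  exact lt_of_le_of_lt (h ζ 1 one_pos) ENNReal.ofReal_lt_top

lemma rw'_sq (s : ℝ) (ζ p : Euc n × ℝ) : rw' s ζ p * rw' s ζ p = rw' (2 * s) ζ p := by
  unfold rw'
  rw [← sq, ← Real.rpow_natCast, ← Real.rpow_mul (norm_nonneg _)]; congr 1; push_cast; ring

lemma cont_rw_int {s : ℝ} (h1 : s < (n:ℝ) + 1) (h2 : (n:ℝ) + 1 < 2 * s) {F : Euc n × ℝ → ℝ} (hF : Continuous F)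
    (hFi : IntegrableOn (fun p => F p ^ 2) (upperHS n)) (ζ : Euc n × ℝ) :
    IntegrableOn (fun p => |F p| * rw' s ζ p) (upperHS n) := by
  obtain ⟨M, hM⟩ := (isCompact_closedBall ζ 1).exists_bound_of_continuousOn hF.continuousOn
  have i1 : Integrable (fun p => (Metric.ball ζ 1).indicator (fun p => M * rw' s ζ p) p) :=
    (integrable_indicator_iff measurableSet_ball).2 ((rw'_near h1 ζ).const_mul M)
  have i2 : Integrable (fun p => (Metric.ball ζ 1)ᶜ.indicator (fun p => rw' (2 * s) ζ p) p) :=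
    (integrable_indicator_iff measurableSet_ball.compl).2 (rw'_far h2 ζ)
  refine ((hFi.add i1.integrableOn).add i2.integrableOn).mono' ?_ (ae_of_all _ fun p => ?_)
  · exact (hF.abs.measurable.mul (rw'_meas s ζ)).aestronglyMeasurable
  · show ‖|F p| * rw' s ζ p‖ ≤ F p ^ 2 + (Metric.ball ζ 1).indicator (fun p => M * rw' s ζ p) p +
      (Metric.ball ζ 1)ᶜ.indicator (fun p => rw' (2 * s) ζ p) p
    have hr := rw'_nonneg s ζ p
    rw [Real.norm_of_nonneg (by positivity)]
    by_cases hp : p ∈ Metric.ball ζ 1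
    · rw [Set.indicator_of_mem hp, Set.indicator_of_notMem (by simpa using hp)]
      have := hM p (Metric.ball_subset_closedBall hp)
      rw [Real.norm_eq_abs] at this
      nlinarith [mul_le_mul_of_nonneg_right this hr, sq_nonneg (F p)]
    · rw [Set.indicator_of_notMem hp, Set.indicator_of_mem hp, ← rw'_sq]
      nlinarith [sq_abs (F p), abs_nonneg (F p), sq_nonneg (|F p| - rw' s ζ p)]

lemma tonelli_bound {s : ℝ} (h1 : s < (n:ℝ) + 1) (h2 : (n:ℝ) + 1 < 2 * s) :
    ∃ C : ℝ, 0 ≤ C ∧ ∀ ζ ζ' : Euc n × ℝ, ζ ≠ ζ' →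
      ∫⁻ p, ENNReal.ofReal (rw' s ζ p * rw' s ζ' p) ≤ ENNReal.ofReal (C * ‖ζ - ζ'‖ ^ ((n:ℝ) + 1 - 2 * s)) := by
  obtain ⟨c1, hc1, near⟩ := near_shift (n := n) h1
  obtain ⟨c2, hc2, far⟩ := far_shift (n := n) h2
  have hs0 : 0 < s := by have : (0:ℝ) ≤ n := Nat.cast_nonneg _; linarith
  refine ⟨2 * (c1 + c2) * (1/2) ^ ((n:ℝ) + 1 - 2 * s), by positivity, fun ζ ζ' hne => ?_⟩
  set D := ‖ζ - ζ'‖ with hD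
  have hD0 : 0 < D := norm_pos_iff.2 (sub_ne_zero.2 hne)
  set R := D / 2 with hR
  have hR0 : 0 < R := by positivity
  have key : ∀ (ζ ζ' p : Euc n × ℝ), ‖ζ - ζ'‖ = D → p ∈ Metric.ball ζ R → rw' s ζ' p ≤ R ^ (-s) := by
    intro ζ ζ' p hd hp
    rw [mem_ball_iff_norm] at hp
    have : R ≤ ‖p - ζ'‖ := by
      have h3 : ‖ζ - ζ'‖ ≤ ‖p - ζ'‖ + ‖p - ζ‖ := by
        have := norm_sub_le (p - ζ') (p - ζ)
        simpa using this
      rw [hd] at h3; rw [hR] at hp ⊢; linarith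
    exact Real.rpow_le_rpow_of_nonpos hR0 this (by linarith)
  have pt : ∀ p, ENNReal.ofReal (rw' s ζ p * rw' s ζ' p) ≤
      ((Metric.ball ζ R).indicator (fun p => ENNReal.ofReal (R ^ (-s)) * ENNReal.ofReal (rw' s ζ p)) p +
       (Metric.ball ζ' R).indicator (fun p => ENNReal.ofReal (R ^ (-s)) * ENNReal.ofReal (rw' s ζ' p)) p) +
      ((Metric.ball ζ R)ᶜ.indicator (fun p => ENNReal.ofReal (rw' (2 * s) ζ p)) p +
       (Metric.ball ζ' R)ᶜ.indicator (fun p => ENNReal.ofReal (rw' (2 * s) ζ' p)) p) := by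
    intro p
    have a1 := rw'_nonneg s ζ p
    have a2 := rw'_nonneg s ζ' p
    by_cases hp : p ∈ Metric.ball ζ R
    · refine le_trans ?_ (le_trans le_self_add le_self_add)
      rw [Set.indicator_of_mem hp, ← ENNReal.ofReal_mul (by positivity)]
      refine ENNReal.ofReal_le_ofReal ?_
      have := key ζ ζ' p rfl hp
      nlinarith
    · by_cases hp' : p ∈ Metric.ball ζ' R
      · refine le_trans ?_ (le_trans le_add_self le_self_add)
        rw [Set.indicator_of_mem hp', ← ENNReal.ofReal_mul (by positivity)]
        refine ENNReal.ofReal_le_ofReal ?_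
        have := key ζ' ζ p (by rw [norm_sub_rev]) hp'
        nlinarith
      · refine le_trans ?_ le_add_self
        rw [Set.indicator_of_mem (by simpa using hp), Set.indicator_of_mem (by simpa using hp'),
          ← ENNReal.ofReal_add (rw'_nonneg _ _ _) (rw'_nonneg _ _ _), ← rw'_sq, ← rw'_sq]
        refine ENNReal.ofReal_le_ofReal ?_
        nlinarith [sq_nonneg (rw' s ζ p - rw' s ζ' p)]
  refine (lintegral_mono pt).trans ?_
  have mb : ∀ ζ : Euc n × ℝ, Measurable ((Metric.ball ζ R).indicator (fun p => ENNReal.ofReal (R ^ (-s)) * ENNReal.ofReal (rw' s ζ p))) :=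
    fun ζ => Measurable.indicator ((rw'_meas s ζ).ennreal_ofReal.const_mul _) measurableSet_ball
  have mc : ∀ ζ : Euc n × ℝ, Measurable ((Metric.ball ζ R)ᶜ.indicator (fun p => ENNReal.ofReal (rw' (2 * s) ζ p))) :=
    fun ζ => Measurable.indicator ((rw'_meas _ ζ).ennreal_ofReal) measurableSet_ball.compl
  rw [lintegral_add_left (Measurable.fun_add (mb ζ) (mb ζ')), lintegral_add_left (mb ζ), lintegral_add_left (mc ζ)]
  have b1 : ∀ ζ : Euc n × ℝ, ∫⁻ p, (Metric.ball ζ R).indicator (fun p => ENNReal.ofReal (R ^ (-s)) * ENNReal.ofReal (rw' s ζ p)) p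
      ≤ ENNReal.ofReal (c1 * R ^ ((n:ℝ) + 1 - 2 * s)) := by
    intro ζ
    rw [lintegral_indicator measurableSet_ball, lintegral_const_mul _ (rw'_meas s ζ).ennreal_ofReal]
    refine (mul_le_mul_right (near ζ R hR0) _).trans ?_
    rw [← ENNReal.ofReal_mul (by positivity)]
    refine ENNReal.ofReal_le_ofReal (le_of_eq ?_)
    rw [show (n:ℝ) + 1 - 2 * s = -s + ((n:ℝ) + 1 - s) by ring, Real.rpow_add hR0]; ring
  have b2 : ∀ ζ : Euc n × ℝ, ∫⁻ p, (Metric.ball ζ R)ᶜ.indicator (fun p => ENNReal.ofReal (rw' (2 * s) ζ p)) p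
      ≤ ENNReal.ofReal (c2 * R ^ ((n:ℝ) + 1 - 2 * s)) := by
    intro ζ
    rw [lintegral_indicator measurableSet_ball.compl]
    exact far ζ R hR0
  refine (add_le_add (add_le_add (b1 ζ) (b1 ζ')) (add_le_add (b2 ζ) (b2 ζ'))).trans ?_
  rw [← ENNReal.ofReal_add (by positivity) (by positivity), ← ENNReal.ofReal_add (by positivity) (by positivity),
    ← ENNReal.ofReal_add (by positivity) (by positivity)]
  refine ENNReal.ofReal_le_ofReal (le_of_eq ?_)
  rw [show R = (1/2) * D by rw [hR]; ring, Real.mul_rpow (by norm_num) hD0.le]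
  ring

lemma prod_int {s : ℝ} (h1 : s < (n:ℝ) + 1) (h2 : (n:ℝ) + 1 < 2 * s) {ζ ζ' : Euc n × ℝ} (h : ζ ≠ ζ') :
    Integrable (fun p => rw' s ζ p * rw' s ζ' p) := by
  obtain ⟨C, _, hC⟩ := tonelli_bound (n := n) h1 h2
  refine ⟨((rw'_meas s ζ).mul (rw'_meas s ζ')).aestronglyMeasurable, ?_⟩
  rw [hasFiniteIntegral_iff_ofReal (ae_of_all _ fun p => mul_nonneg (rw'_nonneg s ζ p) (rw'_nonneg s ζ' p))]
  exact lt_of_le_of_lt (hC ζ ζ' h) ENNReal.ofReal_lt_top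

lemma Symb.meas {d : ℝ} {f : YY n → ℝ} (h : Symb d f) : Measurable f :=
  measurable_of_continuousOn_compl_singleton 0 fun y hy => ((h.sm y hy).continuousAt).continuousWithinAt

lemma Symb.sl_bound {d : ℝ} {f : YY n → ℝ} (h : Symb d f) (hd : d ≤ 0) : ∃ C : ℝ, 0 ≤ C ∧ ∀ η ζ p, p ≠ ζ →
    |sl f η ζ p| ≤ C * rw' (-d) ζ p := by
  obtain ⟨C, hC0, hC⟩ := h.bound
  refine ⟨C, hC0, fun η ζ p hp => (hC _ (sl_ne (Or.inr hp))).trans ?_⟩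
  refine mul_le_mul_of_nonneg_left ?_ hC0
  unfold rw'
  rw [neg_neg]
  refine Real.rpow_le_rpow_of_nonpos (norm_pos_iff.2 (sub_ne_zero.2 hp)) ?_ hd
  exact le_max_right _ _

lemma Symb.sl_tendsto {d : ℝ} {f : YY n → ℝ} (h : Symb d f) {ζ p : Euc n × ℝ} (hp : p ≠ ζ) :
    Tendsto (fun η => sl f η ζ p) (𝓝[>] 0) (𝓝 (sl f 0 ζ p)) := by
  have h1 : ContinuousAt f (0, p - ζ) := (h.sm _ (sl_ne (Or.inr hp))).continuousAt
  have h2 : ContinuousAt (fun η : ℝ => ((η, p - ζ) : YY n)) 0 := by fun_prop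
  have h3 : ContinuousAt (f ∘ fun η : ℝ => ((η, p - ζ) : YY n)) 0 := ContinuousAt.comp h1 h2
  exact h3.tendsto.mono_left nhdsWithin_le_nhds

def tt (al : ℝ) (m : ℕ) (a : Option (Fin n)) : YY n → ℝ := Tm m (dY n) a (kk al)

/-- kernel `τ_a(ζ, p)` -/
def ta (al : ℝ) (m : ℕ) (a : Option (Fin n)) (ζ p : Euc n × ℝ) : ℝ := sl (tt al m a) 0 ζ p

lemma tt_symb {al : ℝ} (ha : 2 * al = (n:ℝ) - 2 * m - 1) (a : Option (Fin n)) : Symb (-((n:ℝ) - m)) (tt al m a) := by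
  have := (kk_symb (n := n) al).Tm m (dY n) a
  rwa [show -(2 * al) - ((m:ℝ) + 1) = -((n:ℝ) - m) by linarith] at this

lemma tt_bound {al : ℝ} (ha : 2 * al = (n:ℝ) - 2 * m - 1) (ha0 : 0 < al) : ∃ C : ℝ, 0 ≤ C ∧
    ∀ a η ζ p, p ≠ ζ → |sl (tt (n := n) al m a) η ζ p| ≤ C * rw' ((n:ℝ) - m) ζ p := by
  have hm : (0:ℝ) ≤ m := Nat.cast_nonneg _
  have h : ∀ a, ∃ C : ℝ, 0 ≤ C ∧ ∀ η ζ p, p ≠ ζ → |sl (tt (n := n) al m a) η ζ p| ≤ C * rw' ((n:ℝ) - m) ζ p := by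
    intro a
    have := (tt_symb ha a).sl_bound (by linarith)
    rwa [neg_neg] at this
  choose C hC0 hC using h
  refine ⟨∑ a, C a, Finset.sum_nonneg fun a _ => hC0 a, fun a η ζ p hp => (hC a η ζ p hp).trans ?_⟩
  exact mul_le_mul_of_nonneg_right (Finset.single_le_sum (fun a _ => hC0 a) (Finset.mem_univ a)) (rw'_nonneg _ _ _)

lemma ta_meas {al : ℝ} (ha : 2 * al = (n:ℝ) - 2 * m - 1) (a : Option (Fin n)) :
    Measurable (fun q : (Euc n × ℝ) × (Euc n × ℝ) => ta al m a q.1 q.2) := by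
  unfold ta sl
  exact (tt_symb ha a).meas.comp (by fun_prop)

lemma sl_meas {al : ℝ} (ha : 2 * al = (n:ℝ) - 2 * m - 1) (a : Option (Fin n)) (η : ℝ) (ζ : Euc n × ℝ) :
    Measurable (sl (tt (n := n) al m a) η ζ) := by
  unfold sl
  exact (tt_symb ha a).meas.comp (by fun_prop)

lemma Tm_l2 (hu : Good n m u) (a : Option (Fin n)) : IntegrableOn (fun p => Tm m (dX n) a u p ^ 2) (upperHS n) := by
  have hc := (Tm_contDiff (e := dX n) hu.sm m a).continuous
  have hb : ∃ C : ℝ, ∀ p, |Tm m (dX n) a u p| ≤ C * ‖iteratedFDeriv ℝ (m + 1) u p‖ := by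
    unfold Tm
    split_ifs with h1 h2
    · refine ⟨(Fintype.card (Option (Fin n)) : ℝ) ^ ((m + 1) / 2), fun p => (abs_LopIter (dX_norm (n := n)) hu.sm ((m + 1) / 2) p).trans_eq ?_⟩
      obtain ⟨k, hk⟩ := h1
      rw [show 2 * ((m + 1) / 2) = m + 1 by omega]
    · exact ⟨0, fun p => by simp⟩
    · refine ⟨(Fintype.card (Option (Fin n)) : ℝ) ^ (m / 2), fun p => (abs_Dv_LopIter (dX_norm (n := n)) hu.sm (m / 2) a p).trans_eq ?_⟩
      obtain ⟨k, hk⟩ := Nat.not_odd_iff_even.1 h1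
      rw [show 2 * (m / 2) + 1 = m + 1 by omega]
  obtain ⟨C, hC⟩ := hb
  refine (hu.l2.const_mul (C ^ 2)).mono' (hc.pow 2).aestronglyMeasurable (ae_of_all _ fun p => ?_)
  rw [Real.norm_of_nonneg (sq_nonneg _), ← mul_pow, ← sq_abs]
  exact pow_le_pow_left₀ (abs_nonneg _) (hC p) 2

lemma Tm_rw_int {al : ℝ} (ha : 2 * al = (n:ℝ) - 2 * m - 1) (ha0 : 0 < al) (hu : Good n m u) (a : Option (Fin n)) (ζ : Euc n × ℝ) :
    IntegrableOn (fun p => |Tm m (dX n) a u p| * rw' ((n:ℝ) - m) ζ p) (upperHS n) := by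
  have hm : (0:ℝ) ≤ m := Nat.cast_nonneg _
  exact cont_rw_int (by linarith) (by linarith) (Tm_contDiff (e := dX n) hu.sm m a).continuous (Tm_l2 hu a) ζ

lemma ae_ne (ζ : Euc n × ℝ) (S : Set (Euc n × ℝ)) : ∀ᵐ p ∂(volume.restrict S), p ≠ ζ := by
  have : ∀ᵐ p : Euc n × ℝ, p ≠ ζ := by
    have hd := finX1 n
    have : Nontrivial (Euc n × ℝ) := Module.nontrivial_of_finrank_pos (R := ℝ) (by omega)
    rw [ae_iff]; simp
  exact ae_restrict_of_ae this

/-- representation formula R1 -/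
lemma R1 {al : ℝ} (ha : 2 * al = (n:ℝ) - 2 * m - 1) (ha0 : 0 < al) (hu : Good n m u) {ζ : Euc n × ℝ} (hζ : 0 ≤ ζ.2) :
    kap2 n m al * u ζ = ∫ p in upperHS n, ∑ a, Tm m (dX n) a u p * (ta al m a ζ p + ta al m a (rfl2 ζ) p) := by
  obtain ⟨C, hC0, hC⟩ := tt_bound (n := n) (m := m) ha ha0
  refine tendsto_nhds_unique (rhs_lim ha ha0 hu hζ) ?_
  have e : ∀ η : ℝ, 0 < η → (-1) ^ (m + 1) * ∫ p in upperHS n, u p * (Lop (dX n))^[m+1] (NN al η ζ) p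
      = ∫ p in upperHS n, ∑ a, Tm m (dX n) a u p * (sl (tt al m a) η ζ p + sl (tt al m a) η (rfl2 ζ) p) := by
    intro η hη
    rw [← green_chain hu (NN_nice ha ha0 hη.ne' ζ)]
    congr 1; ext p
    refine Finset.sum_congr rfl fun a _ => ?_
    have h3 : Tm m (dX n) a (NN al η ζ) = _ := Tm_add' (sl_contDiff (kk_symb (n := n) al) hη.ne' ζ)
      (sl_contDiff (kk_symb (n := n) al) hη.ne' (rfl2 ζ)) m a
    rw [h3, Tm_sl (kk_symb (n := n) al) hη.ne', Tm_sl (kk_symb (n := n) al) hη.ne']; rfl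
  have hbi : Integrable (fun p => ∑ a, (C * (|Tm m (dX n) a u p| * rw' ((n:ℝ) - m) ζ p) +
      C * (|Tm m (dX n) a u p| * rw' ((n:ℝ) - m) (rfl2 ζ) p))) (volume.restrict (upperHS n)) :=
    integrable_finsetSum _ fun a _ => ((Tm_rw_int ha ha0 hu a ζ).const_mul C).add ((Tm_rw_int ha ha0 hu a (rfl2 ζ)).const_mul C)
  refine (tendsto_integral_filter_of_dominated_convergence
    (F := fun (η : ℝ) p => ∑ a, Tm m (dX n) a u p * (sl (tt al m a) η ζ p + sl (tt al m a) η (rfl2 ζ) p)) _ ?_ ?_ hbi ?_).congr' ?_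
  · refine Eventually.of_forall fun η => Measurable.aestronglyMeasurable ?_
    refine Finset.measurable_fun_sum _ fun a _ => ?_
    exact (Tm_contDiff (e := dX n) hu.sm m a).continuous.measurable.mul ((sl_meas ha a η ζ).add (sl_meas ha a η (rfl2 ζ)))
  · refine Eventually.of_forall fun η => ?_
    filter_upwards [ae_ne ζ (upperHS n), ae_ne (rfl2 ζ) (upperHS n)] with p h1 h2
    refine (norm_sum_le _ _).trans (Finset.sum_le_sum fun a _ => ?_)
    rw [norm_mul, Real.norm_eq_abs, Real.norm_eq_abs]
    have := (abs_add_le (sl (tt al m a) η ζ p) (sl (tt al m a) η (rfl2 ζ) p)).trans (add_le_add (hC a η ζ p h1) (hC a η (rfl2 ζ) p h2))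
    calc _ ≤ |Tm m (dX n) a u p| * _ := mul_le_mul_of_nonneg_left this (abs_nonneg _)
      _ = _ := by ring
  · filter_upwards [ae_ne ζ (upperHS n), ae_ne (rfl2 ζ) (upperHS n)] with p h1 h2
    refine tendsto_finsetSum _ fun a _ => ?_
    exact (((tt_symb ha a).sl_tendsto h1).add ((tt_symb ha a).sl_tendsto h2)).const_mul _
  · filter_upwards [self_mem_nhdsWithin] with η hη
    exact (e η hη).symm

/-- representation formula R2 -/
lemma R2 {al : ℝ} (hmn : 2 * m + 1 < n) (ha : 2 * al = (n:ℝ) - 2 * m - 1) (ha0 : 0 < al) {ζ : Euc n × ℝ} (hζ : 0 ≤ ζ.2)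
    {ξ : Euc n} (hne : ζ ≠ (ξ, 0)) :
    kap2 n m al * kk al ((0, ζ - (ξ, 0)) : YY n)
      = ∫ p in upperHS n, ∑ a, ta al m a (ξ, 0) p * (ta al m a ζ p + ta al m a (rfl2 ζ) p) := by
  have hm : (0:ℝ) ≤ m := Nat.cast_nonneg _
  obtain ⟨C, hC0, hC⟩ := tt_bound (n := n) (m := m) ha ha0
  have hne2 : (ξ, 0) ≠ rfl2 ζ := by
    intro h; apply hne
    rw [← rfl2_rfl2 ζ, ← h]; simp [rfl2]
  have h1 : Tendsto (fun η => kap2 n m al * sl (kk al) η (ξ, 0) ζ) (𝓝[>] 0)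
      (𝓝 (kap2 n m al * kk al ((0, ζ - (ξ, 0)) : YY n))) :=
    ((kk_symb (n := n) al).sl_tendsto hne).const_mul _
  refine tendsto_nhds_unique h1 ?_
  have hbi : Integrable (fun p => ∑ a : Option (Fin n), (C ^ 2 * (rw' ((n:ℝ) - m) (ξ, 0) p * rw' ((n:ℝ) - m) ζ p) +
      C ^ 2 * (rw' ((n:ℝ) - m) (ξ, 0) p * rw' ((n:ℝ) - m) (rfl2 ζ) p))) (volume.restrict (upperHS n)) :=
    integrable_finsetSum _ fun a _ => (((prod_int (by linarith) (by linarith) hne.symm).const_mul _).add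
      ((prod_int (by linarith) (by linarith) hne2).const_mul _)).integrableOn
  refine (tendsto_integral_filter_of_dominated_convergence
    (F := fun (η : ℝ) p => ∑ a, sl (tt al m a) η (ξ, 0) p * (ta al m a ζ p + ta al m a (rfl2 ζ) p)) _ ?_ ?_ hbi ?_).congr' ?_
  · refine Eventually.of_forall fun η => Measurable.aestronglyMeasurable ?_
    refine Finset.measurable_fun_sum _ fun a _ => ?_
    exact (sl_meas ha a η (ξ, 0)).mul ((sl_meas ha a 0 ζ).add (sl_meas ha a 0 (rfl2 ζ)))
  · refine Eventually.of_forall fun η => ?_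
    filter_upwards [ae_ne ζ (upperHS n), ae_ne (rfl2 ζ) (upperHS n), ae_ne (ξ, 0) (upperHS n)] with p h1 h2 h3
    refine (norm_sum_le _ _).trans (Finset.sum_le_sum fun a _ => ?_)
    rw [norm_mul, Real.norm_eq_abs, Real.norm_eq_abs]
    have := (abs_add_le (ta al m a ζ p) (ta al m a (rfl2 ζ) p)).trans (add_le_add (hC a 0 ζ p h1) (hC a 0 (rfl2 ζ) p h2))
    calc _ ≤ (C * rw' ((n:ℝ) - m) (ξ, 0) p) * _ := mul_le_mul (hC a η (ξ, 0) p h3) this (abs_nonneg _)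
              (mul_nonneg hC0 (rw'_nonneg _ _ _))
      _ = _ := by ring
  · filter_upwards [ae_ne (ξ, 0) (upperHS n)] with p h1
    refine tendsto_finsetSum _ fun a _ => ?_
    exact ((tt_symb ha a).sl_tendsto h1).mul_const _
  · filter_upwards [self_mem_nhdsWithin] with η hη
    have hη' : (0:ℝ) < η := hη
    rw [R1 ha ha0 ((K_nice ha ha0 hη'.ne' ξ).good hmn) hζ]
    congr 1; ext p
    refine Finset.sum_congr rfl fun a _ => ?_
    rw [Tm_sl (kk_symb (n := n) al) hη'.ne']; rfl
end ker

section pot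
variable {n m : ℕ} {al : ℝ} {g : Euc n → ℝ} {u : Euc n × ℝ → ℝ}

lemma prod_int_of_bound {X Y : Type*} [MeasurableSpace X] [MeasurableSpace Y] {μ : Measure X} {ν : Measure Y}
    [SFinite μ] [SFinite ν] {Ψ : X × Y → ℝ} (hΨ : Measurable Ψ) {B : X → ENNReal}
    (hb : ∀ᵐ p ∂μ, ∫⁻ z, ‖Ψ (p, z)‖ₑ ∂ν ≤ B p) (hB : ∫⁻ p, B p ∂μ < ⊤) : Integrable Ψ (μ.prod ν) := by
  refine ⟨hΨ.aestronglyMeasurable, ?_⟩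
  rw [HasFiniteIntegral, lintegral_prod _ hΨ.enorm.aemeasurable]
  exact lt_of_le_of_lt (lintegral_mono_ae hb) hB

/-- boundary majorant -/
def WW (n m : ℕ) (g : Euc n → ℝ) (p : Euc n × ℝ) : ENNReal :=
  ∫⁻ ξ, ENNReal.ofReal (|g ξ| * rw' ((n:ℝ) - m) (ξ, 0) p)

lemma rwj_meas (s : ℝ) (hg : Measurable g) :
    Measurable (fun q : (Euc n × ℝ) × Euc n => |g q.2| * rw' s (q.2, 0) q.1) := by
  unfold rw'; fun_prop

lemma WW_meas (hg : Measurable g) : Measurable (WW n m g) :=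
  Measurable.lintegral_prod_right' (f := fun q : (Euc n × ℝ) × Euc n => ENNReal.ofReal (|g q.2| * rw' ((n:ℝ) - m) (q.2, 0) q.1))
    (rwj_meas _ hg).ennreal_ofReal

lemma WW_sq (ha : 2 * al = (n:ℝ) - 2 * m - 1) (ha0 : 0 < al) (hg : Measurable g)
    (hgq : Integrable (fun x => |g x| ^ ((n : ℝ) / (n - al)))) :
    ∫⁻ p in upperHS n, WW n m g p ^ 2 < ⊤ := by
  have hm : (0:ℝ) ≤ m := Nat.cast_nonneg _
  have hn2 : 2 * al < n := by linarith
  obtain ⟨-, -, -, -, hn1⟩ := qfacts ha0 hn2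
  obtain ⟨C, hC0, hC⟩ := tonelli_bound (n := n) (s := (n:ℝ) - m) (by linarith) (by linarith)
  have hgm : ∀ p : Euc n × ℝ, Measurable (fun ξ => ENNReal.ofReal (|g ξ| * rw' ((n:ℝ) - m) (ξ, 0) p)) := by
    intro p
    exact ((rwj_meas _ hg).comp (measurable_const.prodMk measurable_id)).ennreal_ofReal
  have e1 : ∀ p, WW n m g p ^ 2 = ∫⁻ z : Euc n × Euc n, ENNReal.ofReal (|g z.1| * rw' ((n:ℝ) - m) (z.1, 0) p) *
      ENNReal.ofReal (|g z.2| * rw' ((n:ℝ) - m) (z.2, 0) p) := by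
    intro p
    rw [Measure.volume_eq_prod, lintegral_prod_mul (hgm p).aemeasurable (hgm p).aemeasurable, sq]; rfl
  simp only [e1]
  rw [lintegral_lintegral_swap]
  swap
  · refine Measurable.aemeasurable ?_
    unfold rw'; fun_prop
  have hII := (II_integrable ha0 hn2 (F := fun x => |g x|) (by fun_prop) (by simpa using hgq)).const_mul C
  have hfin : ∫⁻ z : Euc n × Euc n, ENNReal.ofReal (C * (|g z.1| * |g z.2| * rk al z)) < ⊤ := by
    have := hII.2
    rwa [hasFiniteIntegral_iff_ofReal (ae_of_all _ fun z => mul_nonneg hC0 (mul_nonneg (by positivity) (rk_nonneg _ _)))] at this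
  refine lt_of_le_of_lt (lintegral_mono_ae ?_) hfin
  filter_upwards [ae_ne_prod hn1] with z hz
  have hne : ((z.1, 0) : Euc n × ℝ) ≠ (z.2, 0) := fun h => hz (congrArg Prod.fst h)
  have e2 : ∀ p : Euc n × ℝ, ENNReal.ofReal (|g z.1| * rw' ((n:ℝ) - m) (z.1, 0) p) * ENNReal.ofReal (|g z.2| * rw' ((n:ℝ) - m) (z.2, 0) p)
      = ENNReal.ofReal (|g z.1| * |g z.2|) * ENNReal.ofReal (rw' ((n:ℝ) - m) (z.1, 0) p * rw' ((n:ℝ) - m) (z.2, 0) p) := by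
    intro p
    rw [← ENNReal.ofReal_mul (mul_nonneg (abs_nonneg _) (rw'_nonneg _ _ _)), ← ENNReal.ofReal_mul (by positivity)]
    congr 1; ring
  simp only [e2]
  rw [lintegral_const_mul _ (Measurable.fun_mul (rw'_meas _ _) (rw'_meas _ _)).ennreal_ofReal]
  refine (mul_le_mul_right ((setLIntegral_le_lintegral _ _).trans (hC _ _ hne)) _).trans ?_
  rw [← ENNReal.ofReal_mul (by positivity)]
  refine ENNReal.ofReal_le_ofReal (le_of_eq ?_)
  have : ‖((z.1, 0) : Euc n × ℝ) - (z.2, 0)‖ = ‖z.1 - z.2‖ := by simp [Prod.norm_def]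
  rw [this]
  unfold rk
  rw [show (n:ℝ) + 1 - 2 * ((n:ℝ) - m) = -(2 * al) by linarith]
  ring

/-- potential -/
def GG (al : ℝ) (m : ℕ) (g : Euc n → ℝ) (a : Option (Fin n)) (p : Euc n × ℝ) : ℝ := ∫ ξ, g ξ * ta al m a (ξ, 0) p

lemma half_ne {p : Euc n × ℝ} (hp : p ∈ upperHS n) (ξ : Euc n) : p ≠ (ξ, 0) := by
  intro h
  have h2 : 0 < p.2 := hp
  rw [h] at h2; exact lt_irrefl _ h2

lemma gta_meas (ha : 2 * al = (n:ℝ) - 2 * m - 1) (hg : Measurable g) (a : Option (Fin n)) :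
    Measurable (fun q : (Euc n × ℝ) × Euc n => g q.2 * ta al m a (q.2, 0) q.1) := by
  have h1 := ta_meas (n := n) (m := m) ha a
  have h2 : Measurable (fun q : (Euc n × ℝ) × Euc n => ta al m a (q.2, 0) q.1) :=
    h1.comp (g := fun q : (Euc n × ℝ) × (Euc n × ℝ) => ta al m a q.1 q.2)
      (f := fun q : (Euc n × ℝ) × Euc n => (((q.2, 0), q.1) : (Euc n × ℝ) × (Euc n × ℝ))) (by fun_prop)
  fun_prop

lemma GG_sm (ha : 2 * al = (n:ℝ) - 2 * m - 1) (hg : Measurable g) (a : Option (Fin n)) :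
    StronglyMeasurable (GG al m g a) :=
  StronglyMeasurable.integral_prod_right' (f := fun q : (Euc n × ℝ) × Euc n => g q.2 * ta al m a (q.2, 0) q.1)
    (gta_meas ha hg a).stronglyMeasurable

lemma gta_enorm (ha : 2 * al = (n:ℝ) - 2 * m - 1) (ha0 : 0 < al) : ∃ C : ℝ, 0 ≤ C ∧ ∀ (g : Euc n → ℝ) (a : Option (Fin n)),
    ∀ p ∈ upperHS n, ∀ ξ, ‖g ξ * ta al m a (ξ, 0) p‖ₑ ≤ ENNReal.ofReal C * ENNReal.ofReal (|g ξ| * rw' ((n:ℝ) - m) (ξ, 0) p) := by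
  obtain ⟨C, hC0, hC⟩ := tt_bound (n := n) (m := m) ha ha0
  refine ⟨C, hC0, fun g a p hp ξ => ?_⟩
  rw [Real.enorm_eq_ofReal_abs, ← ENNReal.ofReal_mul hC0]
  refine ENNReal.ofReal_le_ofReal ?_
  rw [abs_mul]
  have := mul_le_mul_of_nonneg_left (hC a 0 (ξ, 0) p (half_ne hp ξ)) (abs_nonneg (g ξ))
  calc _ ≤ _ := this
    _ = _ := by ring

lemma GG_le (ha : 2 * al = (n:ℝ) - 2 * m - 1) (ha0 : 0 < al) : ∃ C : ℝ, 0 ≤ C ∧ ∀ (g : Euc n → ℝ) (a : Option (Fin n)),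
    Measurable g → ∀ p ∈ upperHS n, ∫⁻ ξ, ‖g ξ * ta al m a (ξ, 0) p‖ₑ ≤ ENNReal.ofReal C * WW n m g p := by
  obtain ⟨C, hC0, hC⟩ := gta_enorm (n := n) (m := m) ha ha0
  refine ⟨C, hC0, fun g a hg p hp => ?_⟩
  refine (lintegral_mono (hC g a p hp)).trans ?_
  rw [lintegral_const_mul]
  · rfl
  · exact ((rwj_meas _ hg).comp (measurable_const.prodMk measurable_id)).ennreal_ofReal

lemma GG_l2 (ha : 2 * al = (n:ℝ) - 2 * m - 1) (ha0 : 0 < al) (hg : Measurable g)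
    (hgq : Integrable (fun x => |g x| ^ ((n : ℝ) / (n - al)))) (a : Option (Fin n)) :
    IntegrableOn (fun p => GG al m g a p ^ 2) (upperHS n) := by
  obtain ⟨C, hC0, hC⟩ := GG_le (n := n) (m := m) ha ha0
  refine ⟨((GG_sm ha hg a).pow 2).aestronglyMeasurable, ?_⟩
  rw [HasFiniteIntegral]
  have : ∫⁻ p in upperHS n, ENNReal.ofReal C ^ 2 * WW n m g p ^ 2 < ⊤ := by
    rw [lintegral_const_mul _ ((WW_meas hg).pow_const 2)]
    exact ENNReal.mul_lt_top (by simp) (WW_sq ha ha0 hg hgq)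
  refine lt_of_le_of_lt (setLIntegral_mono' (measurableSet_half n) fun p hp => ?_) this
  rw [enorm_pow, ← mul_pow]
  gcongr
  exact (enorm_integral_le_lintegral_enorm _).trans (hC g a hg p hp)

lemma swap_int (ha : 2 * al = (n:ℝ) - 2 * m - 1) (ha0 : 0 < al) (hg : Measurable g)
    (hgq : Integrable (fun x => |g x| ^ ((n : ℝ) / (n - al)))) (a : Option (Fin n)) {F : Euc n × ℝ → ℝ}
    (hF : Measurable F) (hFi : IntegrableOn (fun p => F p ^ 2) (upperHS n)) :
    Integrable (fun q : (Euc n × ℝ) × Euc n => F q.1 * (g q.2 * ta al m a (q.2, 0) q.1))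
      ((volume.restrict (upperHS n)).prod volume) := by
  obtain ⟨C, hC0, hC⟩ := GG_le (n := n) (m := m) ha ha0
  have hm := gta_meas (n := n) (m := m) ha hg a
  refine prod_int_of_bound (B := fun p => ‖F p ^ 2‖ₑ + ENNReal.ofReal C ^ 2 * WW n m g p ^ 2)
    ((hF.comp measurable_fst).mul hm) ?_ ?_
  · refine (ae_restrict_iff' (measurableSet_half n)).2 (ae_of_all _ fun p hp => ?_)
    simp only [enorm_mul]
    rw [lintegral_const_mul]
    swap
    · have := (hm.comp (measurable_const (a := p) |>.prodMk measurable_id)).enorm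
      simpa [enorm_mul] using this
    have h1 := hC g a hg p hp
    simp only [enorm_mul] at h1
    rw [enorm_pow, ← mul_pow]
    refine (mul_le_mul_right h1 _).trans ?_
    generalize ‖F p‖ₑ = A
    generalize ENNReal.ofReal C * WW n m g p = B
    rcases le_total A B with h | h
    · exact (mul_le_mul_left h B).trans (by rw [sq B]; exact le_add_self)
    · exact (mul_le_mul_right h A).trans (by rw [sq A]; exact le_self_add)
  · rw [lintegral_add_left (hF.pow_const 2).enorm, lintegral_const_mul _ ((WW_meas hg).pow_const 2)]
    exact ENNReal.add_lt_top.2 ⟨hFi.2, ENNReal.mul_lt_top (by simp) (WW_sq ha ha0 hg hgq)⟩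

lemma swap_eq (ha : 2 * al = (n:ℝ) - 2 * m - 1) (ha0 : 0 < al) (hg : Measurable g)
    (hgq : Integrable (fun x => |g x| ^ ((n : ℝ) / (n - al)))) (a : Option (Fin n)) {F : Euc n × ℝ → ℝ}
    (hF : Measurable F) (hFi : IntegrableOn (fun p => F p ^ 2) (upperHS n)) :
    Integrable (fun ξ => g ξ * ∫ p in upperHS n, F p * ta al m a (ξ, 0) p) ∧
    ∫ p in upperHS n, F p * GG al m g a p = ∫ ξ, g ξ * ∫ p in upperHS n, F p * ta al m a (ξ, 0) p := by
  have h := swap_int ha ha0 hg hgq a hF hFi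
  have e : ∀ ξ, ∫ p in upperHS n, F p * (g ξ * ta al m a (ξ, 0) p) = g ξ * ∫ p in upperHS n, F p * ta al m a (ξ, 0) p := by
    intro ξ
    rw [← integral_const_mul]; congr 1; ext p; ring
  constructor
  · have := h.swap.integral_prod_left
    refine this.congr (ae_of_all _ fun ξ => ?_)
    exact e ξ
  · have h2 := integral_integral_swap (f := fun p ξ => F p * (g ξ * ta al m a (ξ, 0) p)) h
    simp only [e] at h2
    rw [← h2]
    congr 1; ext p
    rw [integral_const_mul]; rfl

/-- cross term -/
lemma cross_term (ha : 2 * al = (n:ℝ) - 2 * m - 1) (ha0 : 0 < al) (hg : Measurable g)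
    (hgq : Integrable (fun x => |g x| ^ ((n : ℝ) / (n - al)))) (hu : Good n m u) :
    ∑ a, ∫ p in upperHS n, Tm m (dX n) a u p * GG al m g a p = kap2 n m al / 2 * ∫ ξ, g ξ * u (ξ, 0) := by
  have hs := fun a => swap_eq ha ha0 hg hgq a (Tm_contDiff (e := dX n) hu.sm m a).continuous.measurable (Tm_l2 hu a)
  simp only [fun a => (hs a).2]
  rw [← integral_finsetSum _ fun a _ => (hs a).1, ← integral_const_mul]
  congr 1; ext ξ
  rw [← Finset.mul_sum]
  obtain ⟨C, hC0, hC⟩ := tt_bound (n := n) (m := m) ha ha0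
  have hi : ∀ a, IntegrableOn (fun p => Tm m (dX n) a u p * ta al m a (ξ, 0) p) (upperHS n) := by
    intro a
    refine ((Tm_rw_int ha ha0 hu a (ξ, 0)).const_mul C).mono' ?_ ?_
    · exact ((Tm_contDiff (e := dX n) hu.sm m a).continuous.measurable.mul (sl_meas ha a 0 (ξ, 0))).aestronglyMeasurable
    · refine (ae_restrict_iff' (measurableSet_half n)).2 (ae_of_all _ fun p hp => ?_)
      show ‖Tm m (dX n) a u p * ta al m a (ξ, 0) p‖ ≤ _
      rw [norm_mul, Real.norm_eq_abs, Real.norm_eq_abs]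
      calc _ ≤ |Tm m (dX n) a u p| * _ := mul_le_mul_of_nonneg_left (hC a 0 (ξ, 0) p (half_ne hp ξ)) (abs_nonneg _)
        _ = _ := by ring
  rw [← integral_finsetSum _ fun a _ => hi a]
  have h1 := R1 ha ha0 hu (ζ := (ξ, 0)) le_rfl
  have e : rfl2 ((ξ, 0) : Euc n × ℝ) = (ξ, 0) := by simp [rfl2]
  rw [e] at h1
  have h2 : ∫ p in upperHS n, ∑ a, Tm m (dX n) a u p * (ta al m a (ξ, 0) p + ta al m a (ξ, 0) p)
      = 2 * ∫ p in upperHS n, ∑ a, Tm m (dX n) a u p * ta al m a (ξ, 0) p := by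
    rw [← integral_const_mul]; congr 1; ext p
    rw [Finset.mul_sum]; refine Finset.sum_congr rfl fun a _ => by ring
  rw [h2] at h1
  linear_combination (-(g ξ) / 2) * h1

/-- quadratic term -/
lemma quad_term (hmn : 2 * m + 1 < n) (ha : 2 * al = (n:ℝ) - 2 * m - 1) (ha0 : 0 < al) (hg : Measurable g)
    (hgq : Integrable (fun x => |g x| ^ ((n : ℝ) / (n - al)))) :
    ∑ a, ∫ p in upperHS n, GG al m g a p ^ 2 = kap2 n m al / 2 * II al g := by
  have hm0 : (0:ℝ) ≤ m := Nat.cast_nonneg _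
  have hn1 : 1 ≤ n := by omega
  obtain ⟨C, hC0, hC⟩ := GG_le (n := n) (m := m) ha ha0
  obtain ⟨C', hC0', hC'⟩ := tt_bound (n := n) (m := m) ha ha0
  have hΦ : ∀ a, Integrable (fun q : (Euc n × ℝ) × (Euc n × Euc n) =>
      (g q.2.1 * ta al m a (q.2.1, 0) q.1) * (g q.2.2 * ta al m a (q.2.2, 0) q.1))
      ((volume.restrict (upperHS n)).prod volume) := by
    intro a
    have hm := gta_meas (n := n) (m := m) ha hg a
    have hm1 : Measurable (fun q : (Euc n × ℝ) × (Euc n × Euc n) => g q.2.1 * ta al m a (q.2.1, 0) q.1) :=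
      hm.comp (g := fun q : (Euc n × ℝ) × Euc n => g q.2 * ta al m a (q.2, 0) q.1)
        (f := fun q : (Euc n × ℝ) × (Euc n × Euc n) => (q.1, q.2.1)) (by fun_prop)
    have hm2 : Measurable (fun q : (Euc n × ℝ) × (Euc n × Euc n) => g q.2.2 * ta al m a (q.2.2, 0) q.1) :=
      hm.comp (g := fun q : (Euc n × ℝ) × Euc n => g q.2 * ta al m a (q.2, 0) q.1)
        (f := fun q : (Euc n × ℝ) × (Euc n × Euc n) => (q.1, q.2.2)) (by fun_prop)
    refine prod_int_of_bound (B := fun p => ENNReal.ofReal C ^ 2 * WW n m g p ^ 2) (hm1.mul hm2) ?_ ?_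
    · refine (ae_restrict_iff' (measurableSet_half n)).2 (ae_of_all _ fun p hp => ?_)
      have hmp : Measurable (fun ξ => ‖g ξ * ta al m a (ξ, 0) p‖ₑ) :=
        (hm.comp (measurable_const (a := p) |>.prodMk measurable_id)).enorm
      have e1 : ∫⁻ z : Euc n × Euc n, ‖(g z.1 * ta al m a (z.1, 0) p) * (g z.2 * ta al m a (z.2, 0) p)‖ₑ
          = (∫⁻ ξ, ‖g ξ * ta al m a (ξ, 0) p‖ₑ) * ∫⁻ ξ, ‖g ξ * ta al m a (ξ, 0) p‖ₑ := by
        rw [← lintegral_prod_mul hmp.aemeasurable hmp.aemeasurable, ← Measure.volume_eq_prod]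
        congr 1; ext z; rw [enorm_mul]
      refine (le_of_eq e1).trans ?_
      rw [← mul_pow, sq]
      exact mul_le_mul' (hC g a hg p hp) (hC g a hg p hp)
    · rw [lintegral_const_mul _ ((WW_meas hg).pow_const 2)]
      exact ENNReal.mul_lt_top (by simp) (WW_sq ha ha0 hg hgq)
  have e2 : ∀ a, ∫ p in upperHS n, GG al m g a p ^ 2 = ∫ z : Euc n × Euc n, ∫ p in upperHS n,
      (g z.1 * ta al m a (z.1, 0) p) * (g z.2 * ta al m a (z.2, 0) p) := by
    intro a
    rw [← integral_integral_swap (f := fun p (z : Euc n × Euc n) => (g z.1 * ta al m a (z.1, 0) p) * (g z.2 * ta al m a (z.2, 0) p)) (hΦ a)]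
    congr 1; ext p
    rw [Measure.volume_eq_prod, integral_prod_mul (fun ξ => g ξ * ta al m a (ξ, 0) p) (fun ξ => g ξ * ta al m a (ξ, 0) p), sq]; rfl
  simp only [e2]
  have hi2 : ∀ a ∈ Finset.univ, Integrable (fun z : Euc n × Euc n => ∫ p in upperHS n,
      (g z.1 * ta al m a (z.1, 0) p) * (g z.2 * ta al m a (z.2, 0) p)) := fun a _ => (hΦ a).swap.integral_prod_left
  rw [← integral_finsetSum _ hi2]
  unfold II
  rw [← integral_const_mul]
  refine integral_congr_ae ?_
  filter_upwards [ae_ne_prod hn1] with z hz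
  have hne : ((z.2, 0) : Euc n × ℝ) ≠ (z.1, 0) := fun h => hz (congrArg Prod.fst h).symm
  have hi3 : ∀ a ∈ Finset.univ, IntegrableOn (fun p => ta al m a (z.1, 0) p * ta al m a (z.2, 0) p) (upperHS n) := by
    intro a _
    refine ((prod_int (s := (n:ℝ) - m) (by linarith) (by linarith) hne.symm).integrableOn.const_mul (C' ^ 2)).mono' ?_ ?_
    · exact ((sl_meas ha a 0 (z.1, 0)).mul (sl_meas ha a 0 (z.2, 0))).aestronglyMeasurable
    · refine (ae_restrict_iff' (measurableSet_half n)).2 (ae_of_all _ fun p hp => ?_)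
      show ‖ta al m a (z.1, 0) p * ta al m a (z.2, 0) p‖ ≤ _
      rw [norm_mul, Real.norm_eq_abs, Real.norm_eq_abs]
      calc _ ≤ _ := mul_le_mul (hC' a 0 (z.1, 0) p (half_ne hp _)) (hC' a 0 (z.2, 0) p (half_ne hp _)) (abs_nonneg _)
              (mul_nonneg hC0' (rw'_nonneg _ _ _))
        _ = _ := by ring
  have e3 : ∀ a, ∫ p in upperHS n, (g z.1 * ta al m a (z.1, 0) p) * (g z.2 * ta al m a (z.2, 0) p)
      = g z.1 * g z.2 * ∫ p in upperHS n, ta al m a (z.1, 0) p * ta al m a (z.2, 0) p := by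
    intro a
    rw [← integral_const_mul]; congr 1; ext p; ring
  simp only [e3]
  rw [← Finset.mul_sum, ← integral_finsetSum _ hi3]
  have h1 := R2 hmn ha ha0 (ζ := (z.2, 0)) le_rfl (ξ := z.1) hne
  have e : rfl2 ((z.2, 0) : Euc n × ℝ) = (z.2, 0) := by simp [rfl2]
  rw [e] at h1
  have h2 : ∫ p in upperHS n, ∑ a, ta al m a (z.1, 0) p * (ta al m a (z.2, 0) p + ta al m a (z.2, 0) p)
      = 2 * ∫ p in upperHS n, ∑ a, ta al m a (z.1, 0) p * ta al m a (z.2, 0) p := by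
    rw [← integral_const_mul]; congr 1; ext p
    rw [Finset.mul_sum]; refine Finset.sum_congr rfl fun a _ => by ring
  rw [h2] at h1
  have h3 : kk al ((0, ((z.2, 0) : Euc n × ℝ) - (z.1, 0)) : YY n) = rk al z := by
    unfold kk kq rk
    simp only [Prod.mk_sub_mk, sub_self]
    rw [norm_sub_rev, zero_pow two_ne_zero, zero_add, add_zero, ← Real.rpow_natCast, ← Real.rpow_mul (norm_nonneg _)]
    congr 1; push_cast; ring
  rw [h3] at h1
  linear_combination (-(g z.1 * g z.2) / 2) * h1

/-- completing the square -/
lemma square_id (hmn : 2 * m + 1 < n) (ha : 2 * al = (n:ℝ) - 2 * m - 1) (ha0 : 0 < al) (hg : Measurable g)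
    (hgq : Integrable (fun x => |g x| ^ ((n : ℝ) / (n - al)))) (hu : Good n m u) :
    (∀ a, IntegrableOn (fun p => (Tm m (dX n) a u p - GG al m g a p) ^ 2) (upperHS n)) ∧
    ∑ a, ∫ p in upperHS n, (Tm m (dX n) a u p - GG al m g a p) ^ 2
      = (∫ p in upperHS n, ∑ a, Tm m (dX n) a u p ^ 2) - kap2 n m al * (∫ ξ, g ξ * u (ξ, 0)) + kap2 n m al / 2 * II al g := by
  have i1 := fun a => Tm_l2 hu a
  have i2 := fun a => GG_l2 ha ha0 hg hgq a
  have i3 : ∀ a, IntegrableOn (fun p => Tm m (dX n) a u p * GG al m g a p) (upperHS n) := by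
    intro a
    refine ((i1 a).add (i2 a)).mono' ?_ (ae_of_all _ fun p => ?_)
    · exact ((Tm_contDiff (e := dX n) hu.sm m a).continuous.measurable.mul (GG_sm ha hg a).measurable).aestronglyMeasurable
    · show ‖Tm m (dX n) a u p * GG al m g a p‖ ≤ Tm m (dX n) a u p ^ 2 + GG al m g a p ^ 2
      rw [Real.norm_eq_abs, abs_le]
      constructor <;> nlinarith [sq_nonneg (Tm m (dX n) a u p + GG al m g a p), sq_nonneg (Tm m (dX n) a u p - GG al m g a p)]
  have e : ∀ a p, (Tm m (dX n) a u p - GG al m g a p) ^ 2 = Tm m (dX n) a u p ^ 2 + (-2) * (Tm m (dX n) a u p * GG al m g a p) + GG al m g a p ^ 2 := by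
    intro a p; ring
  simp only [e]
  have i4 : ∀ a, IntegrableOn (fun p => Tm m (dX n) a u p ^ 2 + (-2) * (Tm m (dX n) a u p * GG al m g a p)) (upperHS n) :=
    fun a => (i1 a).add ((i3 a).const_mul _)
  refine ⟨fun a => (i4 a).add (i2 a), ?_⟩
  have e2 : ∀ a, ∫ p in upperHS n, (Tm m (dX n) a u p ^ 2 + (-2) * (Tm m (dX n) a u p * GG al m g a p) + GG al m g a p ^ 2)
      = (∫ p in upperHS n, Tm m (dX n) a u p ^ 2) + (-2) * (∫ p in upperHS n, Tm m (dX n) a u p * GG al m g a p)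
        + ∫ p in upperHS n, GG al m g a p ^ 2 := by
    intro a
    rw [integral_add (i4 a) (i2 a), integral_add (i1 a) ((i3 a).const_mul _), integral_const_mul]
  simp only [e2]
  rw [Finset.sum_add_distrib, Finset.sum_add_distrib, ← Finset.mul_sum, cross_term ha ha0 hg hgq hu, quad_term hmn ha ha0 hg hgq,
    integral_finsetSum _ fun a _ => i1 a]
  ring
end pot

section ineq
variable {n m : ℕ} {al : ℝ} {f : Euc n → ℝ} {u : Euc n × ℝ → ℝ}

lemma poch_pos {a : ℝ} (ha : 0 < a) (k : ℕ) : poch a k = Gamma (a + k) / Gamma a := by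
  induction k with
  | zero => simp [poch, (Gamma_pos_of_pos ha).ne']
  | succ k ih =>
    rw [poch_succ, ih]
    push_cast
    rw [← add_assoc, Real.Gamma_add_one (by positivity)]
    ring

lemma kap2_eq (ha : 2 * al = (n:ℝ) - 2 * m - 1) (ha0 : 0 < al) :
    kap2 n m al = 4 ^ (m + 1) * π ^ (((n:ℝ) + 1) / 2) * Gamma ((m:ℝ) + 1) / Gamma al := by
  unfold kap2
  have h1 : al + ((2 * m + 2 : ℕ) : ℝ) = al + 2 * m + 2 := by push_cast; ring
  have hg := (Gamma_pos_of_pos (show 0 < al + 2 * m + 2 by positivity)).ne'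
  rw [poch_pos ha0, h1, (prof_int (n := n) (b := al + 2 * m + 2) (by linarith)).2,
    show al + 2 * m + 2 - ((n:ℝ) + 1) / 2 = m + 1 by linarith]
  field_simp

lemma kap2_pos (ha : 2 * al = (n:ℝ) - 2 * m - 1) (ha0 : 0 < al) : 0 < kap2 n m al := by
  rw [kap2_eq ha ha0]
  have := Gamma_pos_of_pos ha0
  have := Gamma_pos_of_pos (show (0:ℝ) < m + 1 by positivity)
  positivity

/-- dual function -/
def hd (al : ℝ) (f : Euc n → ℝ) (x : Euc n) : ℝ := |f x| ^ ((n:ℝ) / al - 2) * f x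

lemma pfacts (ha0 : 0 < al) (hn : 2 * al < n) : 2 < (n:ℝ) / al ∧ ((n:ℝ) / al - 1) * ((n:ℝ) / (n - al)) = n / al := by
  refine ⟨by rw [lt_div_iff₀ ha0]; exact hn, ?_⟩
  have : (n:ℝ) - al ≠ 0 := by linarith
  field_simp

lemma hd_abs (ha0 : 0 < al) (hn : 2 * al < n) (x : Euc n) : |hd al f x| = |f x| ^ ((n:ℝ) / al - 1) := by
  obtain ⟨h1, -⟩ := pfacts ha0 hn
  unfold hd
  rw [abs_mul, abs_of_nonneg (by positivity)]
  rcases (abs_nonneg (f x)).eq_or_lt with h | h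
  · rw [← h, mul_zero, Real.zero_rpow (by linarith)]
  · rw [← Real.rpow_add_one h.ne']; congr 1; ring

lemma hd_pow (ha0 : 0 < al) (hn : 2 * al < n) (x : Euc n) : |hd al f x| ^ ((n:ℝ) / (n - al)) = |f x| ^ ((n:ℝ) / al) := by
  rw [hd_abs ha0 hn, ← Real.rpow_mul (abs_nonneg _), (pfacts ha0 hn).2]

lemma hd_mul (ha0 : 0 < al) (hn : 2 * al < n) (x : Euc n) : hd al f x * f x = |f x| ^ ((n:ℝ) / al) := by
  obtain ⟨h1, -⟩ := pfacts ha0 hn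
  unfold hd
  rw [mul_assoc, ← abs_mul_abs_self (f x)]
  rcases (abs_nonneg (f x)).eq_or_lt with h | h
  · rw [← h, mul_zero, mul_zero, Real.zero_rpow (by linarith)]
  · rw [← sq, ← Real.rpow_natCast, ← Real.rpow_add h]; congr 1; push_cast; ring

lemma hd_cont (ha0 : 0 < al) (hn : 2 * al < n) (hf : Continuous f) : Continuous (hd al f) := by
  obtain ⟨h1, -⟩ := pfacts ha0 hn
  unfold hd
  exact (hf.abs.rpow_const fun x => Or.inr (by linarith)).mul hf

lemma II_le_abs (ha0 : 0 < al) (hn : 2 * al < n) {g : Euc n → ℝ} (hg : Measurable g)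
    (hgq : Integrable (fun x => |g x| ^ ((n : ℝ) / (n - al)))) : II al g ≤ II al (fun x => |g x|) := by
  unfold II
  refine integral_mono (II_integrable ha0 hn hg hgq) (II_integrable ha0 hn (F := fun x => |g x|) (by fun_prop) (by simpa using hgq)) ?_
  intro p
  refine mul_le_mul_of_nonneg_right ?_ (rk_nonneg _ _)
  rw [← abs_mul]; exact le_abs_self _

lemma hls_abs (ha0 : 0 < al) (hn : 2 * al < n) {g : Euc n → ℝ} (hg : Measurable g)
    (hgq : Integrable (fun x => |g x| ^ ((n : ℝ) / (n - al)))) :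
    II al (fun x => |g x|) ≤ S0 n al * (∫ x, |g x| ^ ((n : ℝ) / (n - al))) ^ (2 / ((n : ℝ) / (n - al))) :=
  hls_sharp ha0 hn (F := fun x => |g x|) (by fun_prop) (fun x => abs_nonneg _) hgq

/-- the deficit identity -/
lemma deficit (hmn : 2 * m + 1 < n) (ha : 2 * al = (n:ℝ) - 2 * m - 1) (ha0 : 0 < al) (hu : Good n m u)
    {h : Euc n → ℝ} (hh : Measurable h) (hhq : Integrable (fun x => |h x| ^ ((n : ℝ) / (n - al)))) {N t : ℝ}
    (hN0 : 0 < N) (hN : ∫ x, |h x| ^ ((n : ℝ) / (n - al)) = N) (hN2 : ∫ x, h x * u (x, 0) = N)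
    (ht : t = N ^ (2 * al / n - 1) / S0 n al) :
    (∀ a, IntegrableOn (fun p => (Tm m (dX n) a u p - GG al m (fun x => t * h x) a p) ^ 2) (upperHS n)) ∧
    (∑ a, ∫ p in upperHS n, (Tm m (dX n) a u p - GG al m (fun x => t * h x) a p) ^ 2) +
      kap2 n m al / 2 * t ^ 2 * (S0 n al * N ^ (2 / ((n : ℝ) / (n - al))) - II al h)
      = (∫ p in upperHS n, ∑ a, Tm m (dX n) a u p ^ 2) - kap2 n m al / 2 / S0 n al * N ^ (2 * al / n) := by
  have hm : (0:ℝ) ≤ m := Nat.cast_nonneg _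
  have hn : 2 * al < n := by linarith
  have hS := S0_pos ha0 hn
  have hn0 : (0:ℝ) < n := by linarith
  have hna : (n:ℝ) - al ≠ 0 := by linarith
  obtain ⟨q1, q2⟩ := square_id (g := fun x => t * h x) hmn ha ha0 (by fun_prop) (by
    simp only [abs_mul, Real.mul_rpow (abs_nonneg _) (abs_nonneg _)]
    exact hhq.const_mul _) hu
  refine ⟨q1, ?_⟩
  rw [q2, II_smul]
  simp only [mul_assoc]
  rw [integral_const_mul, hN2]
  have e1 : t * N = N ^ (2 * al / n) / S0 n al := by
    rw [ht, div_mul_eq_mul_div, ← Real.rpow_add_one hN0.ne']; congr 2; ring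
  have e2 : t ^ 2 * N ^ (2 / ((n : ℝ) / (n - al))) = N ^ (2 * al / n) / S0 n al ^ 2 := by
    rw [ht, div_pow, ← Real.rpow_natCast, ← Real.rpow_mul hN0.le, div_mul_eq_mul_div, ← Real.rpow_add hN0]
    congr 2; push_cast; field_simp; ring
  have e3 : t ^ 2 * (S0 n al * N ^ (2 / ((n : ℝ) / (n - al)))) = N ^ (2 * al / n) / S0 n al := by
    rw [mul_left_comm, e2]; field_simp
  rw [e1, mul_sub, e3]
  field_simp
  ring

/-- energy -/
def EE (n m : ℕ) (u : Euc n × ℝ → ℝ) : ℝ := ∫ p in upperHS n, ∑ a, Tm m (dX n) a u p ^ 2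

lemma ineq_h (hmn : 2 * m + 1 < n) (ha : 2 * al = (n:ℝ) - 2 * m - 1) (ha0 : 0 < al) (hu : Good n m u)
    {h : Euc n → ℝ} (hh : Measurable h) (hhq : Integrable (fun x => |h x| ^ ((n : ℝ) / (n - al)))) {N : ℝ}
    (hN0 : 0 < N) (hN : ∫ x, |h x| ^ ((n : ℝ) / (n - al)) = N) (hN2 : ∫ x, h x * u (x, 0) = N) :
    kap2 n m al / 2 / S0 n al * N ^ (2 * al / n) ≤ EE n m u := by
  have hm : (0:ℝ) ≤ m := Nat.cast_nonneg _
  have hn : 2 * al < n := by linarith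
  have d := (deficit hmn ha ha0 hu hh hhq hN0 hN hN2 rfl).2
  have h1 := II_le_abs ha0 hn hh hhq
  have h2 := hls_abs ha0 hn hh hhq
  rw [hN] at h2
  have hk := kap2_pos ha ha0
  have h3 : 0 ≤ kap2 n m al / 2 * (N ^ (2 * al / n - 1) / S0 n al) ^ 2 * (S0 n al * N ^ (2 / ((n : ℝ) / (n - al))) - II al h) :=
    mul_nonneg (by positivity) (by linarith)
  have h4 : 0 ≤ ∑ a, ∫ p in upperHS n, (Tm m (dX n) a u p - GG al m (fun x => (N ^ (2 * al / n - 1) / S0 n al) * h x) a p) ^ 2 :=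
    Finset.sum_nonneg fun a _ => integral_nonneg fun p => sq_nonneg _
  unfold EE
  linarith

lemma EE_nonneg : 0 ≤ EE n m u := integral_nonneg fun p => Finset.sum_nonneg fun a _ => sq_nonneg _

lemma trace_cont (hu : Good n m u) : Continuous fun x : Euc n => u (x, 0) :=
  hu.sm.continuous.comp (by fun_prop)

/-- inequality on balls -/
lemma ineq_ball (hmn : 2 * m + 1 < n) (ha : 2 * al = (n:ℝ) - 2 * m - 1) (ha0 : 0 < al) (hu : Good n m u) (r : ℝ) :
    IntegrableOn (fun x : Euc n => |u (x, 0)| ^ ((n:ℝ) / al)) (Metric.ball 0 r) ∧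
    kap2 n m al / 2 / S0 n al * (∫ x in Metric.ball (0 : Euc n) r, |u (x, 0)| ^ ((n:ℝ) / al)) ^ (2 * al / n) ≤ EE n m u := by
  have hm : (0:ℝ) ≤ m := Nat.cast_nonneg _
  have hn : 2 * al < n := by linarith
  have hn0 : (0:ℝ) < n := by linarith
  have hcf := trace_cont hu
  have hc : Continuous (fun x : Euc n => |u (x, 0)| ^ ((n:ℝ) / al)) :=
    hcf.abs.rpow_const fun x => Or.inr (by positivity)
  have hi : IntegrableOn (fun x : Euc n => |u (x, 0)| ^ ((n:ℝ) / al)) (Metric.ball 0 r) :=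
    (hc.continuousOn.integrableOn_compact (isCompact_closedBall (0 : Euc n) r)).mono_set Metric.ball_subset_closedBall
  refine ⟨hi, ?_⟩
  set N := ∫ x in Metric.ball (0 : Euc n) r, |u (x, 0)| ^ ((n:ℝ) / al) with hNd
  have hN : 0 ≤ N := integral_nonneg fun x => by positivity
  rcases hN.eq_or_lt with h | h
  · rw [← h, Real.zero_rpow (by positivity), mul_zero]; exact EE_nonneg
  set hb : Euc n → ℝ := (Metric.ball (0 : Euc n) r).indicator (hd al fun x => u (x, 0)) with hbd
  have mb : MeasurableSet (Metric.ball (0 : Euc n) r) := Metric.isOpen_ball.measurableSet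
  have hq0 : (n:ℝ) / (n - al) ≠ 0 := by
    have := (qfacts ha0 hn).2.1; linarith
  have e1 : (fun x => |hb x| ^ ((n : ℝ) / (n - al))) = (Metric.ball (0 : Euc n) r).indicator (fun x => |u (x, 0)| ^ ((n:ℝ) / al)) := by
    ext x
    by_cases hx : x ∈ Metric.ball (0 : Euc n) r
    · rw [hbd, Set.indicator_of_mem hx, Set.indicator_of_mem hx, hd_pow ha0 hn]
    · rw [hbd, Set.indicator_of_notMem hx, Set.indicator_of_notMem hx, abs_zero, Real.zero_rpow hq0]
  have e2 : (fun x => hb x * u (x, 0)) = (Metric.ball (0 : Euc n) r).indicator (fun x => |u (x, 0)| ^ ((n:ℝ) / al)) := by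
    ext x
    by_cases hx : x ∈ Metric.ball (0 : Euc n) r
    · rw [hbd, Set.indicator_of_mem hx, Set.indicator_of_mem hx, hd_mul (f := fun x => u (x, 0)) ha0 hn]
    · rw [hbd, Set.indicator_of_notMem hx, Set.indicator_of_notMem hx, zero_mul]
  refine ineq_h hmn ha ha0 hu (h := hb) ((hd_cont ha0 hn hcf).measurable.indicator mb) ?_ h ?_ ?_
  · rw [e1]; exact hi.integrable_indicator mb
  · rw [e1, integral_indicator mb]
  · rw [e2, integral_indicator mb]

/-- the sharp inequality, with integrability of the trace -/
lemma ineq_main (hmn : 2 * m + 1 < n) (ha : 2 * al = (n:ℝ) - 2 * m - 1) (ha0 : 0 < al) (hu : Good n m u) :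
    Integrable (fun x : Euc n => |u (x, 0)| ^ ((n:ℝ) / al)) ∧
    kap2 n m al / 2 / S0 n al * (∫ x : Euc n, |u (x, 0)| ^ ((n:ℝ) / al)) ^ (2 * al / n) ≤ EE n m u := by
  have hm : (0:ℝ) ≤ m := Nat.cast_nonneg _
  have hn : 2 * al < n := by linarith
  have hn0 : (0:ℝ) < n := by linarith
  have hS := S0_pos ha0 hn
  have hk := kap2_pos ha ha0
  have key := fun k : ℕ => ineq_ball hmn ha ha0 hu (k : ℝ)
  have cov : AECover (volume : Measure (Euc n)) atTop (fun k : ℕ => Metric.ball (0 : Euc n) (k:ℝ)) :=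
    aecover_ball tendsto_natCast_atTop_atTop
  set c := kap2 n m al / 2 / S0 n al with hc
  have hc0 : 0 < c := by positivity
  have hexp : (0:ℝ) < 2 * al / n := by positivity
  have bd : ∀ k : ℕ, ∫ x in Metric.ball (0 : Euc n) (k:ℝ), |u (x, 0)| ^ ((n:ℝ) / al) ≤ (EE n m u / c) ^ ((2 * al / n)⁻¹) := by
    intro k
    have h0 : 0 ≤ ∫ x in Metric.ball (0 : Euc n) (k:ℝ), |u (x, 0)| ^ ((n:ℝ) / al) := integral_nonneg fun x => by positivity
    rw [← Real.rpow_rpow_inv h0 hexp.ne']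
    refine Real.rpow_le_rpow (by positivity) ?_ (by positivity)
    rw [le_div_iff₀ hc0, mul_comm]; exact (key k).2
  have hint : Integrable (fun x : Euc n => |u (x, 0)| ^ ((n:ℝ) / al)) :=
    cov.integrable_of_integral_bounded_of_nonneg_ae _ (fun k => (key k).1)
      (ae_of_all _ fun x => by positivity) (Eventually.of_forall bd)
  refine ⟨hint, ?_⟩
  have lim := cov.integral_tendsto_of_countably_generated hint
  exact le_of_tendsto (((Real.continuousAt_rpow_const _ _ (Or.inr hexp.le)).tendsto.comp lim).const_mul c)
    (Eventually.of_forall fun k => (key k).2)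
end ineq

section reprS
variable {n m : ℕ} {al : ℝ} {g : Euc n → ℝ} {u : Euc n × ℝ → ℝ}

lemma pair_bd (ha : 2 * al = (n:ℝ) - 2 * m - 1) (ha0 : 0 < al) {ζ : Euc n × ℝ} (hζ : ζ.2 ≠ 0) :
    ∃ B : ℝ, 0 ≤ B ∧ ∀ a ξ, ∫⁻ p in upperHS n, ‖ta al m a (ξ, 0) p * ta al m a ζ p‖ₑ ≤ ENNReal.ofReal B := by
  have hm0 : (0:ℝ) ≤ m := Nat.cast_nonneg _
  obtain ⟨C, hC0, hC⟩ := tt_bound (n := n) (m := m) ha ha0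
  obtain ⟨D, hD0, hD⟩ := tonelli_bound (n := n) (s := (n:ℝ) - m) (by linarith) (by linarith)
  have hz : 0 < |ζ.2| := abs_pos.2 hζ
  refine ⟨C ^ 2 * (D * |ζ.2| ^ (-(2 * al))), by positivity, fun a ξ => ?_⟩
  have hne : ((ξ, 0) : Euc n × ℝ) ≠ ζ := fun h => hζ (by rw [← h])
  have h1 : ∫⁻ p in upperHS n, ‖ta al m a (ξ, 0) p * ta al m a ζ p‖ₑ
      ≤ ∫⁻ p in upperHS n, ENNReal.ofReal (C ^ 2) * ENNReal.ofReal (rw' ((n:ℝ) - m) (ξ, 0) p * rw' ((n:ℝ) - m) ζ p) := by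
    refine lintegral_mono_ae ?_
    filter_upwards [ae_ne ((ξ, 0) : Euc n × ℝ) (upperHS n), ae_ne ζ (upperHS n)] with p h1 h2
    rw [Real.enorm_eq_ofReal_abs, ← ENNReal.ofReal_mul (by positivity)]
    refine ENNReal.ofReal_le_ofReal ?_
    rw [abs_mul]
    calc _ ≤ _ := mul_le_mul (hC a 0 (ξ, 0) p h1) (hC a 0 ζ p h2) (abs_nonneg _) (mul_nonneg hC0 (rw'_nonneg _ _ _))
      _ = _ := by ring
  refine h1.trans ?_
  rw [lintegral_const_mul _ (Measurable.fun_mul (rw'_meas _ _) (rw'_meas _ _)).ennreal_ofReal, ENNReal.ofReal_mul (by positivity)]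
  refine mul_le_mul_right ((setLIntegral_le_lintegral _ _).trans ((hD _ _ hne).trans ?_)) _
  refine ENNReal.ofReal_le_ofReal (mul_le_mul_of_nonneg_left ?_ hD0)
  rw [show (n:ℝ) + 1 - 2 * ((n:ℝ) - m) = -(2 * al) by linarith]
  refine Real.rpow_le_rpow_of_nonpos hz ?_ (by linarith)
  have := norm_snd_le (((ξ, 0) : Euc n × ℝ) - ζ)
  simpa using this

lemma swap2 (ha : 2 * al = (n:ℝ) - 2 * m - 1) (ha0 : 0 < al) (hg : Measurable g) (hgi : Integrable g)
    {ζ : Euc n × ℝ} (hζ : ζ.2 ≠ 0) (a : Option (Fin n)) :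
    Integrable (fun ξ => g ξ * ∫ p in upperHS n, ta al m a (ξ, 0) p * ta al m a ζ p) ∧
    IntegrableOn (fun p => GG al m g a p * ta al m a ζ p) (upperHS n) ∧
    ∫ p in upperHS n, GG al m g a p * ta al m a ζ p = ∫ ξ, g ξ * ∫ p in upperHS n, ta al m a (ξ, 0) p * ta al m a ζ p := by
  obtain ⟨B, hB0, hB⟩ := pair_bd (m := m) ha ha0 hζ
  have hm := gta_meas (n := n) (m := m) ha hg a
  have hm1 : Measurable (fun q : Euc n × (Euc n × ℝ) => (g q.1 * ta al m a (q.1, 0) q.2) * ta al m a ζ q.2) := by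
    refine Measurable.fun_mul (hm.comp (g := fun q : (Euc n × ℝ) × Euc n => g q.2 * ta al m a (q.2, 0) q.1)
        (f := fun q : Euc n × (Euc n × ℝ) => (q.2, q.1)) (by fun_prop)) ?_
    exact (sl_meas ha a 0 ζ).comp measurable_snd
  have hI : Integrable (fun q : Euc n × (Euc n × ℝ) => (g q.1 * ta al m a (q.1, 0) q.2) * ta al m a ζ q.2)
      (volume.prod (volume.restrict (upperHS n))) := by
    refine prod_int_of_bound (B := fun ξ => ‖g ξ‖ₑ * ENNReal.ofReal B) hm1 (ae_of_all _ fun ξ => ?_) ?_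
    · simp only [mul_assoc, enorm_mul (g ξ)]
      have hmm : Measurable (fun p => ‖ta al m a (ξ, 0) p * ta al m a ζ p‖ₑ) :=
        (Measurable.fun_mul (sl_meas ha a 0 (ξ, 0)) (sl_meas ha a 0 ζ)).enorm
      rw [lintegral_const_mul _ hmm]
      exact mul_le_mul_right (hB a ξ) _
    · rw [lintegral_mul_const _ hg.enorm]
      exact ENNReal.mul_lt_top hgi.2 ENNReal.ofReal_lt_top
  have e1 : (fun ξ => ∫ p in upperHS n, (g ξ * ta al m a (ξ, 0) p) * ta al m a ζ p)
      = fun ξ => g ξ * ∫ p in upperHS n, ta al m a (ξ, 0) p * ta al m a ζ p := by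
    ext ξ; rw [← integral_const_mul]; congr 1; ext p; ring
  have e2 : (fun p => ∫ ξ, (g ξ * ta al m a (ξ, 0) p) * ta al m a ζ p) = fun p => GG al m g a p * ta al m a ζ p := by
    ext p; rw [integral_mul_const]; rfl
  have i1 := hI.integral_prod_left
  have i2 := hI.integral_prod_right
  have i3 := integral_integral_swap (f := fun ξ p => (g ξ * ta al m a (ξ, 0) p) * ta al m a ζ p) hI
  simp only at i1 i2
  rw [e1] at i1
  rw [e2] at i2
  rw [e1, e2] at i3
  exact ⟨i1, i2, i3.symm⟩

lemma pair_int (ha : 2 * al = (n:ℝ) - 2 * m - 1) (ha0 : 0 < al) {ζ : Euc n × ℝ} (hζ : ζ.2 ≠ 0) (a : Option (Fin n)) (ξ : Euc n) :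
    IntegrableOn (fun p => ta al m a (ξ, 0) p * ta al m a ζ p) (upperHS n) := by
  obtain ⟨B, hB0, hB⟩ := pair_bd (m := m) ha ha0 hζ
  exact ⟨(Measurable.fun_mul (sl_meas ha a 0 (ξ, 0)) (sl_meas ha a 0 ζ)).aestronglyMeasurable,
    lt_of_le_of_lt (hB a ξ) ENNReal.ofReal_lt_top⟩

lemma u_repr (hmn : 2 * m + 1 < n) (ha : 2 * al = (n:ℝ) - 2 * m - 1) (ha0 : 0 < al) (hg : Measurable g) (hgi : Integrable g)
    (hu : Good n m u) (hT : ∀ a, ∀ᵐ p ∂(volume.restrict (upperHS n)), Tm m (dX n) a u p = GG al m g a p)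
    {ζ : Euc n × ℝ} (hζ : 0 < ζ.2) : u ζ = ∫ ξ, g ξ * kk al ((0, ζ - (ξ, 0)) : YY n) := by
  have h1 : ζ.2 ≠ 0 := hζ.ne'
  have h2 : (rfl2 ζ).2 ≠ 0 := by simpa [rfl2] using h1
  have hk := kap2_pos ha ha0
  have r1 := R1 ha ha0 hu hζ.le
  have e1 : ∫ p in upperHS n, ∑ a, Tm m (dX n) a u p * (ta al m a ζ p + ta al m a (rfl2 ζ) p)
      = ∫ p in upperHS n, ∑ a, (GG al m g a p * ta al m a ζ p + GG al m g a p * ta al m a (rfl2 ζ) p) := by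
    refine integral_congr_ae ?_
    filter_upwards [ae_all_iff.2 hT] with p hp
    refine Finset.sum_congr rfl fun a _ => ?_
    rw [hp a]; ring
  have s1 := fun a => swap2 (m := m) ha ha0 hg hgi h1 a
  have s2 := fun a => swap2 (m := m) ha ha0 hg hgi h2 a
  have hi1 : ∀ a ∈ Finset.univ, IntegrableOn (fun p => GG al m g a p * ta al m a ζ p + GG al m g a p * ta al m a (rfl2 ζ) p) (upperHS n) :=
    fun a _ => (s1 a).2.1.add (s2 a).2.1
  rw [e1, integral_finsetSum _ hi1] at r1
  have e2 : ∀ a, ∫ p in upperHS n, (GG al m g a p * ta al m a ζ p + GG al m g a p * ta al m a (rfl2 ζ) p)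
      = ∫ ξ, (g ξ * (∫ p in upperHS n, ta al m a (ξ, 0) p * ta al m a ζ p) + g ξ * ∫ p in upperHS n, ta al m a (ξ, 0) p * ta al m a (rfl2 ζ) p) := by
    intro a
    rw [integral_add (s1 a).2.1 (s2 a).2.1, integral_add (s1 a).1 (s2 a).1, (s1 a).2.2, (s2 a).2.2]
  simp only [e2] at r1
  have hi2 : ∀ a ∈ Finset.univ, Integrable (fun ξ => g ξ * (∫ p in upperHS n, ta al m a (ξ, 0) p * ta al m a ζ p) + g ξ * ∫ p in upperHS n, ta al m a (ξ, 0) p * ta al m a (rfl2 ζ) p) :=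
    fun a _ => (s1 a).1.add (s2 a).1
  rw [← integral_finsetSum _ hi2] at r1
  have e3 : ∀ ξ, (∑ a, (g ξ * (∫ p in upperHS n, ta al m a (ξ, 0) p * ta al m a ζ p) + g ξ * ∫ p in upperHS n, ta al m a (ξ, 0) p * ta al m a (rfl2 ζ) p))
      = kap2 n m al * (g ξ * kk al ((0, ζ - (ξ, 0)) : YY n)) := by
    intro ξ
    have r2 := R2 hmn ha ha0 hζ.le (ξ := ξ) (fun h => h1 (by rw [h]))
    have i : ∀ a ∈ Finset.univ, IntegrableOn (fun p => ta al m a (ξ, 0) p * (ta al m a ζ p + ta al m a (rfl2 ζ) p)) (upperHS n) := by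
      intro a _
      simp only [mul_add]
      exact (pair_int ha ha0 h1 a ξ).add (pair_int ha ha0 h2 a ξ)
    rw [integral_finsetSum _ i] at r2
    rw [mul_left_comm, r2, Finset.mul_sum]
    refine Finset.sum_congr rfl fun a _ => ?_
    rw [← mul_add, ← integral_add (pair_int ha ha0 h1 a ξ) (pair_int ha ha0 h2 a ξ)]
    congr 2; ext p; ring
  simp only [e3] at r1
  rw [integral_const_mul] at r1
  exact mul_left_cancel₀ hk.ne' r1
end reprS

section fwd
variable {n m : ℕ} {al : ℝ} {g : Euc n → ℝ} {u : Euc n × ℝ → ℝ}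

/-- bubbles -/
def bub (μ : ℝ) (x0 : Euc n) (r : ℝ) (ξ : Euc n) : ℝ := (μ ^ 2 + ‖ξ - x0‖ ^ 2) ^ (-r)

lemma bub_pos {μ : ℝ} (hμ : 0 < μ) (x0 : Euc n) (r : ℝ) (ξ : Euc n) : 0 < bub μ x0 r ξ := by
  unfold bub; positivity

lemma bub_cont {μ : ℝ} (hμ : 0 < μ) (x0 : Euc n) (r : ℝ) : Continuous (bub μ x0 r) := by
  unfold bub
  refine Continuous.rpow_const (by fun_prop) fun x => Or.inl ?_
  positivity

lemma bub_scale {μ : ℝ} (hμ : 0 < μ) (x0 : Euc n) (r : ℝ) (z : Euc n) :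
    bub μ x0 r (x0 + μ • z) = μ ^ (-(2 * r)) * (1 + ‖z‖ ^ 2) ^ (-r) := by
  unfold bub
  rw [add_sub_cancel_left, norm_smul, Real.norm_of_nonneg hμ.le,
    show μ ^ 2 + (μ * ‖z‖) ^ 2 = μ ^ 2 * (1 + ‖z‖ ^ 2) by ring, Real.mul_rpow (by positivity) (by positivity),
    ← Real.rpow_natCast μ 2, ← Real.rpow_mul hμ.le]
  congr 2; push_cast; ring

lemma bub_int {μ : ℝ} (hμ : 0 < μ) (x0 : Euc n) {r : ℝ} (hr : (n:ℝ) / 2 < r) :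
    Integrable (bub μ x0 r) ∧ ∫ ξ, bub μ x0 r ξ = μ ^ ((n:ℝ) - 2 * r) * Cc n r := by
  constructor
  · have h := (integrable_affine (inv_pos.2 hμ) (-(μ⁻¹ • x0)) (integrable_bubble n hr)).const_mul (μ ^ (-(2 * r)))
    refine h.congr (ae_of_all _ fun x => ?_)
    have := bub_scale hμ x0 r (-(μ⁻¹ • x0) + μ⁻¹ • x)
    rw [show x0 + μ • (-(μ⁻¹ • x0) + μ⁻¹ • x) = x by
      rw [smul_add, smul_neg, smul_smul, smul_smul, mul_inv_cancel₀ hμ.ne', one_smul, one_smul]; abel] at this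
    exact this.symm
  · have h := integral_affine hμ x0 (bub μ x0 r)
    simp only [bub_scale hμ] at h
    rw [integral_const_mul, integral_bubble n hr, eq_inv_mul_iff_mul_eq₀ (by positivity)] at h
    rw [← h, ← mul_assoc, ← Real.rpow_add hμ]; congr 2

lemma sq_zero_ae {X : Type*} [MeasurableSpace X] {ν : Measure X} {ι : Type*} [Fintype ι] {F : ι → X → ℝ}
    (hi : ∀ a, Integrable (fun p => F a p ^ 2) ν) (h : ∑ a, ∫ p, F a p ^ 2 ∂ν = 0) : ∀ a, ∀ᵐ p ∂ν, F a p = 0 := by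
  intro a
  have h1 := (Finset.sum_eq_zero_iff_of_nonneg (fun a _ => integral_nonneg fun p => sq_nonneg (F a p))).1 h a (Finset.mem_univ _)
  have h2 := (integral_eq_zero_iff_of_nonneg (fun p => sq_nonneg (F a p)) (hi a)).1 h1
  filter_upwards [h2] with p hp
  simpa using hp

lemma fwd (hmn : 2 * m + 1 < n) (ha : 2 * al = (n:ℝ) - 2 * m - 1) (ha0 : 0 < al) (hu : Good n m u)
    (hE : kap2 n m al / 2 / S0 n al * (∫ x : Euc n, |u (x, 0)| ^ ((n:ℝ) / al)) ^ (2 * al / n) = EE n m u) :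
    ∃ (μ : ℝ) (c : ℝ) (x0 : Euc n), 0 < μ ∧ ∀ ζ : Euc n × ℝ, 0 < ζ.2 →
      u ζ = ∫ ξ, (c * bub μ x0 (n - al) ξ) * kk al ((0, ζ - (ξ, 0)) : YY n) := by
  have hm0 : (0:ℝ) ≤ m := Nat.cast_nonneg _
  have hn : 2 * al < n := by linarith
  have hn0 : (0:ℝ) < n := by linarith
  have hS := S0_pos ha0 hn
  have hk := kap2_pos ha ha0
  obtain ⟨hq0, hq1, -, -, hn1⟩ := qfacts ha0 hn
  obtain ⟨hint, -⟩ := ineq_main hmn ha ha0 hu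
  set f : Euc n → ℝ := fun x => u (x, 0) with hf
  have hcf : Continuous f := trace_cont hu
  set N := ∫ x : Euc n, |f x| ^ ((n:ℝ) / al) with hNd
  have hN : 0 ≤ N := integral_nonneg fun x => by positivity
  have hTi : ∀ a, IntegrableOn (fun p => Tm m (dX n) a u p ^ 2) (upperHS n) := fun a => Tm_l2 hu a
  rcases hN.eq_or_lt with h | h
  · have hE0 : EE n m u = 0 := by
      rw [← hE]
      change kap2 n m al / 2 / S0 n al * N ^ (2 * al / n) = 0
      rw [← h, Real.zero_rpow (by positivity), mul_zero]
    unfold EE at hE0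
    rw [integral_finsetSum _ fun a _ => hTi a] at hE0
    have hT := sq_zero_ae hTi hE0
    refine ⟨1, 0, 0, one_pos, fun ζ hζ => ?_⟩
    rw [u_repr (g := fun _ => 0) hmn ha ha0 measurable_const (integrable_zero _ _ _) hu ?_ hζ]
    · simp
    · intro a
      filter_upwards [hT a] with p hp
      rw [hp]; simp [GG]
  · have hh := hd_cont ha0 hn hcf
    have hhq : Integrable (fun x => |hd al f x| ^ ((n : ℝ) / (n - al))) := by
      simp only [hd_pow ha0 hn]; exact hint
    have hN1 : ∫ x, |hd al f x| ^ ((n : ℝ) / (n - al)) = N := by simp only [hd_pow ha0 hn, hNd]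
    have hN2 : ∫ x, hd al f x * u (x, 0) = N := by
      have : ∀ x, hd al f x * u (x, 0) = |f x| ^ ((n:ℝ) / al) := fun x => hd_mul ha0 hn x
      simp only [this, hNd]
    set t := N ^ (2 * al / n - 1) / S0 n al with ht
    have ht0 : 0 < t := by positivity
    obtain ⟨d1, d2⟩ := deficit hmn ha ha0 hu hh.measurable hhq h hN1 hN2 ht
    have h1 := II_le_abs ha0 hn hh.measurable hhq
    have h2 := hls_abs ha0 hn hh.measurable hhq
    rw [hN1] at h2
    set Q := N ^ (2 / ((n : ℝ) / (n - al))) with hQ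
    have h3 : 0 ≤ kap2 n m al / 2 * t ^ 2 * (S0 n al * Q - II al (hd al f)) :=
      mul_nonneg (by positivity) (by linarith)
    have h4 : 0 ≤ ∑ a, ∫ p in upperHS n, (Tm m (dX n) a u p - GG al m (fun x => t * hd al f x) a p) ^ 2 :=
      Finset.sum_nonneg fun a _ => integral_nonneg fun p => sq_nonneg _
    have h5 : kap2 n m al / 2 / S0 n al * N ^ (2 * al / n) = ∫ p in upperHS n, ∑ a, Tm m (dX n) a u p ^ 2 := hE
    have h6 : ∑ a, ∫ p in upperHS n, (Tm m (dX n) a u p - GG al m (fun x => t * hd al f x) a p) ^ 2 = 0 := by linarith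
    have h7 : kap2 n m al / 2 * t ^ 2 * (S0 n al * Q - II al (hd al f)) = 0 := by linarith
    have h8 : S0 n al * Q - II al (hd al f) = 0 := by
      rcases mul_eq_zero.1 h7 with h | h
      · exact absurd h (by positivity)
      · exact h
    have hT : ∀ a, ∀ᵐ p ∂(volume.restrict (upperHS n)), Tm m (dX n) a u p = GG al m (fun x => t * hd al f x) a p := by
      intro a
      filter_upwards [sq_zero_ae d1 h6 a] with p hp
      linarith
    set q := (n:ℝ) / (n - al) with hq
    have hqp : 0 < q := by linarith
    set s := N ^ (-(1 / q)) with hs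
    have hs0 : 0 < s := by positivity
    have hsq : s ^ q = N⁻¹ := by
      rw [hs, ← Real.rpow_mul h.le, show -(1 / q) * q = -1 by field_simp, Real.rpow_neg_one]
    have hsQ : s ^ 2 * Q = 1 := by
      rw [hs, hQ, ← Real.rpow_natCast, ← Real.rpow_mul h.le, ← Real.rpow_add h,
        show -(1 / q) * ((2:ℕ):ℝ) + 2 / q = 0 by push_cast; ring, Real.rpow_zero]
    have hpw : ∀ x, (s * |hd al f x|) ^ q = N⁻¹ * |hd al f x| ^ q := by
      intro x; rw [Real.mul_rpow hs0.le (abs_nonneg _), hsq]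
    have hA : Adm al (fun x => s * |hd al f x|) := by
      refine ⟨by have := hh.measurable; fun_prop, fun x => by positivity, ?_, ?_⟩
      · show Integrable (fun x => (s * |hd al f x|) ^ q)
        simp only [hpw]; exact hhq.const_mul _
      · show ∫ x, (s * |hd al f x|) ^ q = 1
        simp only [hpw]
        rw [integral_const_mul, hN1, inv_mul_cancel₀ h.ne']
    obtain ⟨μ, x0, c, hμ, hc, hb⟩ := hls_sharp_eq ha0 hn hA (by
      rw [II_smul]
      have : S0 n al * (s ^ 2 * Q) ≤ s ^ 2 * II al (fun x => |hd al f x|) := by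
        rw [mul_left_comm]
        exact mul_le_mul_of_nonneg_left (by linarith) (by positivity)
      rwa [hsQ, mul_one] at this)
    have hb' : (fun x => s * |hd al f x|) = fun x => c * bub μ x0 (n - al) x :=
      (Continuous.ae_eq_iff_eq volume (by fun_prop) ((bub_cont hμ x0 _).const_mul c)).1 hb
    have hb2 : ∀ x, |hd al f x| = c / s * bub μ x0 (n - al) x := by
      intro x
      have := congrFun hb' x
      field_simp; linarith
    have hsign := (isPreconnected_univ (α := Euc n)).eq_or_eq_neg_of_sq_eq (f := hd al f)
      (g := fun x => c / s * bub μ x0 (n - al) x) hh.continuousOn ((bub_cont hμ x0 _).const_mul _).continuousOn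
      (by intro x _
          show hd al f x ^ 2 = (c / s * bub μ x0 (n - al) x) ^ 2
          rw [← hb2, sq_abs]) (by intro x _; have := bub_pos hμ x0 (n - al) x; positivity)
    have hsg : ∃ c', ∀ x, t * hd al f x = c' * bub μ x0 (n - al) x := by
      rcases hsign with h | h
      · refine ⟨t * (c / s), fun x => ?_⟩
        rw [h (Set.mem_univ x), mul_assoc]
      · refine ⟨-(t * (c / s)), fun x => ?_⟩
        rw [h (Set.mem_univ x)]; simp only [Pi.neg_apply]; ring
    obtain ⟨c', hc'⟩ := hsg
    simp only [hc'] at hT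
    refine ⟨μ, c', x0, hμ, fun ζ hζ => ?_⟩
    refine u_repr hmn ha ha0 ((bub_cont hμ x0 _).const_mul c').measurable
      ((bub_int hμ x0 (by linarith)).1.const_mul c') hu hT hζ
end fwd

section exch
variable {n m : ℕ} {al : ℝ}

lemma inv_dist (c d w : Euc n) {μ R ρ : ℝ} (hρ : 0 < ρ) (hR : R ^ 2 = ρ * (‖d‖ ^ 2 + μ ^ 2)) (hw : w ≠ 0) :
    μ ^ 2 + ‖(R / ‖w‖) ^ 2 • w + d‖ ^ 2 = (R / ‖w‖) ^ 2 * ρ⁻¹ * ((ρ * μ) ^ 2 + ‖w + ρ • d‖ ^ 2) ∧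
    (ρ * μ) ^ 2 + ‖(R / ‖w‖) ^ 2 • w + ρ • d‖ ^ 2 = (R / ‖w‖) ^ 2 * ρ * (μ ^ 2 + ‖w + d‖ ^ 2) := by
  have hw0 : ‖w‖ ≠ 0 := norm_ne_zero_iff.2 hw
  have hs : (R / ‖w‖) ^ 2 * ‖w‖ ^ 2 = R ^ 2 := by field_simp
  set s := (R / ‖w‖) ^ 2 with hsd
  have hs0 : 0 ≤ s := sq_nonneg _
  simp only [norm_add_sq_real, norm_smul, Real.norm_of_nonneg hs0, Real.norm_of_nonneg hρ.le, inner_smul_left, inner_smul_right,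
    RCLike.conj_to_real]
  constructor
  · field_simp
    linear_combination (ρ * s - 1) * hR + (ρ * s - 1) * hs
  · linear_combination (s - ρ) * hR + (s - ρ) * hs

lemma exch_lint (hn : 1 ≤ n) {μ y : ℝ} (hμ : 0 < μ) (hy : 0 < y) (x0 x : Euc n) :
    ∫⁻ ξ, ENNReal.ofReal (bub μ x0 (n - al) ξ * bub y x al ξ)
      = ENNReal.ofReal ((y / μ) ^ ((n:ℝ) - 2 * al)) * ∫⁻ ξ, ENNReal.ofReal (bub y x (n - al) ξ * bub μ x0 al ξ) := by
  have : Nonempty (Fin n) := ⟨⟨0, hn⟩⟩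
  obtain ⟨ρ, hρd⟩ : ∃ ρ, ρ = y / μ := ⟨_, rfl⟩
  have hρ : 0 < ρ := by rw [hρd]; positivity
  have hyρ : y = ρ * μ := by rw [hρd]; field_simp
  rw [← hρd]
  by_cases h1 : ρ = 1
  · have hy1 : y = μ := by rw [hyρ, h1, one_mul]
    rw [h1, Real.one_rpow, ENNReal.ofReal_one, one_mul,
      ← lintegral_sub_left_eq_self (μ := volume) (fun ξ => ENNReal.ofReal (bub μ x0 (n - al) ξ * bub y x al ξ)) (x0 + x)]
    congr 1; ext ξ
    have e1 : x0 + x - ξ - x0 = -(ξ - x) := by abel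
    have e2 : x0 + x - ξ - x = -(ξ - x0) := by abel
    unfold bub
    rw [e1, e2, norm_neg, norm_neg, hy1]
  have h1' : 1 - ρ ≠ 0 := sub_ne_zero.2 (Ne.symm h1)
  obtain ⟨d, hd⟩ : ∃ d : Euc n, d = (1 - ρ)⁻¹ • (x - x0) := ⟨_, rfl⟩
  have hdx : x0 + d - x = ρ • d := by
    have : (1 - ρ) • d = x - x0 := by rw [hd, smul_smul, mul_inv_cancel₀ h1', one_smul]
    rw [sub_smul, one_smul] at this
    have h2 : d = x - x0 + ρ • d := by rw [← this]; abel
    calc x0 + d - x = x0 + (x - x0 + ρ • d) - x := by rw [← h2]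
      _ = ρ • d := by abel
  obtain ⟨R, hRd⟩ : ∃ R, R = Real.sqrt (ρ * (‖d‖ ^ 2 + μ ^ 2)) := ⟨_, rfl⟩
  have hR0 : 0 < R := by rw [hRd]; exact Real.sqrt_pos.2 (by positivity)
  have hR : R ^ 2 = ρ * (‖d‖ ^ 2 + μ ^ 2) := by rw [hRd, Real.sq_sqrt (by positivity)]
  rw [lint_inversion n (x0 + d) hn hR0 (fun ξ => ENNReal.ofReal (bub μ x0 (n - al) ξ * bub y x al ξ)),
    ← lintegral_const_mul _ (by unfold bub; fun_prop)]
  refine lintegral_congr_ae ?_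
  have hae : ∀ᵐ z : Euc n, z ≠ x0 + d := by rw [ae_iff]; simp
  filter_upwards [hae] with z hz
  obtain ⟨w, hwd⟩ : ∃ w, w = z - (x0 + d) := ⟨_, rfl⟩
  have hw : w ≠ 0 := by rw [hwd]; exact sub_ne_zero.2 hz
  have hwn : 0 < ‖w‖ := norm_pos_iff.2 hw
  obtain ⟨k1, k2⟩ := inv_dist d d w (μ := μ) hρ hR hw
  have f1 : EuclideanGeometry.inversion (x0 + d) R z - x0 = (R / ‖w‖) ^ 2 • w + d := by
    unfold EuclideanGeometry.inversion
    rw [dist_eq_norm, vsub_eq_sub, vadd_eq_add, ← hwd]; abel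
  have f2 : EuclideanGeometry.inversion (x0 + d) R z - x = (R / ‖w‖) ^ 2 • w + ρ • d := by
    unfold EuclideanGeometry.inversion
    rw [dist_eq_norm, vsub_eq_sub, vadd_eq_add, ← hwd, ← hdx]; abel
  have f3 : z - x = w + ρ • d := by rw [hwd, ← hdx]; abel
  have f4 : z - x0 = w + d := by rw [hwd]; abel
  rw [← ENNReal.ofReal_mul (by positivity), ← ENNReal.ofReal_mul (by positivity)]
  congr 1
  unfold bub
  rw [f1, f2, f3, f4, hyρ, k1, k2, ← hwd]
  have hA : 0 < μ ^ 2 + ‖w + d‖ ^ 2 := by positivity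
  have hB : 0 < (ρ * μ) ^ 2 + ‖w + ρ • d‖ ^ 2 := by positivity
  have hs : 0 < R / ‖w‖ := by positivity
  rw [Real.mul_rpow (by positivity) hB.le, Real.mul_rpow (by positivity) hA.le,
    Real.mul_rpow (by positivity) (by positivity), Real.mul_rpow (by positivity) (by positivity),
    Real.inv_rpow hρ.le, ← Real.rpow_neg hρ.le, neg_neg, ← Real.rpow_natCast (R / ‖w‖) 2, ← Real.rpow_natCast (R / ‖w‖) (2 * n),
    ← Real.rpow_mul hs.le, ← Real.rpow_mul hs.le]
  set s := R / ‖w‖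
  have g1 : s ^ (((2 * n : ℕ) : ℝ)) * s ^ (((2 : ℕ) : ℝ) * (-((n:ℝ) - al))) * s ^ (((2 : ℕ) : ℝ) * (-al)) = 1 := by
    rw [← Real.rpow_add hs, ← Real.rpow_add hs]
    rw [show ((2 * n : ℕ) : ℝ) + ((2 : ℕ) : ℝ) * (-((n:ℝ) - al)) + ((2 : ℕ) : ℝ) * (-al) = 0 by push_cast; ring, Real.rpow_zero]
  have g2 : ρ ^ ((n:ℝ) - 2 * al) = ρ ^ ((n:ℝ) - al) * ρ ^ (-al) := by
    rw [← Real.rpow_add hρ]; congr 1; ring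
  rw [g2]
  linear_combination (ρ ^ ((n:ℝ) - al) * ρ ^ (-al) * ((ρ * μ) ^ 2 + ‖w + ρ • d‖ ^ 2) ^ (-((n:ℝ) - al)) * (μ ^ 2 + ‖w + d‖ ^ 2) ^ (-al)) * g1

lemma bub_mul_int (ha0 : 0 < al) (hn : 2 * al < n) {μ y : ℝ} (hμ : 0 < μ) (hy : 0 < y) (x0 x : Euc n) :
    Integrable (fun ξ => bub μ x0 (n - al) ξ * bub y x al ξ) := by
  refine ((bub_int hμ x0 (r := n - al) (by linarith)).1.mul_const ((y ^ 2) ^ (-al))).mono'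
    ((bub_cont hμ x0 _).mul (bub_cont hy x _)).aestronglyMeasurable (ae_of_all _ fun ξ => ?_)
  show ‖bub μ x0 (n - al) ξ * bub y x al ξ‖ ≤ _
  have h1 := bub_pos hμ x0 (n - al) ξ
  have h2 := bub_pos hy x al ξ
  rw [Real.norm_of_nonneg (by positivity)]
  refine mul_le_mul_of_nonneg_left ?_ h1.le
  unfold bub
  exact Real.rpow_le_rpow_of_nonpos (by positivity) (by nlinarith [sq_nonneg ‖ξ - x‖]) (by linarith)

lemma exch_int (ha0 : 0 < al) (hn : 2 * al < n) {μ y : ℝ} (hμ : 0 < μ) (hy : 0 < y) (x0 x : Euc n) :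
    ∫ ξ, bub μ x0 (n - al) ξ * bub y x al ξ
      = (y / μ) ^ ((n:ℝ) - 2 * al) * ∫ ξ, bub y x (n - al) ξ * bub μ x0 al ξ := by
  obtain ⟨-, -, -, -, hn1⟩ := qfacts ha0 hn
  have i1 := bub_mul_int ha0 hn hμ hy x0 x
  have i2 := bub_mul_int ha0 hn hy hμ x x0
  have p1 : ∀ ξ, 0 ≤ bub μ x0 (n - al) ξ * bub y x al ξ := fun ξ =>
    (mul_pos (bub_pos hμ x0 _ ξ) (bub_pos hy x _ ξ)).le
  have p2 : ∀ ξ, 0 ≤ bub y x (n - al) ξ * bub μ x0 al ξ := fun ξ =>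
    (mul_pos (bub_pos hy x _ ξ) (bub_pos hμ x0 _ ξ)).le
  rw [integral_eq_lintegral_of_nonneg_ae (ae_of_all _ p1) i1.1, integral_eq_lintegral_of_nonneg_ae (ae_of_all _ p2) i2.1,
    exch_lint hn1 hμ hy, ENNReal.toReal_mul, ENNReal.toReal_ofReal (by positivity)]

/-- the Poisson-type form in the statement agrees with the potential of a bubble -/
lemma kk_bub (x ξ : Euc n) (y : ℝ) : kk al ((0, (x, y) - ((ξ, 0) : Euc n × ℝ)) : YY n) = bub y x al ξ := by
  unfold kk kq bub
  simp only [Prod.mk_sub_mk, sub_zero]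
  rw [norm_sub_rev, zero_pow two_ne_zero, zero_add, add_comm]

lemma poisson_form (ha : 2 * al = (n:ℝ) - 2 * m - 1) (ha0 : 0 < al) {μ y : ℝ} (hμ : 0 < μ) (hy : 0 < y) (x0 x : Euc n) :
    ∫ ξ : Euc n, y ^ (1 + 2 * m) * (‖x - ξ‖ ^ 2 + y ^ 2) ^ (-(((n : ℝ) + 1) / 2 + m)) *
              (μ ^ 2 + ‖ξ - x0‖ ^ 2) ^ (-(((n : ℝ) - 2 * m - 1) / 2))
      = μ ^ ((n:ℝ) - 2 * al) * ∫ ξ, bub μ x0 (n - al) ξ * kk al ((0, (x, y) - ((ξ, 0) : Euc n × ℝ)) : YY n) := by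
  have hm0 : (0:ℝ) ≤ m := Nat.cast_nonneg _
  have hn : 2 * al < n := by linarith
  simp only [kk_bub]
  rw [exch_int ha0 hn hμ hy, ← mul_assoc, ← Real.mul_rpow hμ.le (by positivity), mul_div_cancel₀ _ hμ.ne', ← integral_const_mul]
  congr 1; ext ξ
  rw [mul_assoc]
  congr 1
  · rw [← Real.rpow_natCast]; congr 1; push_cast; linarith
  · unfold bub
    rw [norm_sub_rev x ξ, add_comm (‖ξ - x‖ ^ 2)]
    congr 2 <;> linarith
end exch

section bwd
variable {n m : ℕ} {al : ℝ} {g : Euc n → ℝ} {u : Euc n × ℝ → ℝ}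

lemma half_dist {p : Euc n × ℝ} {δ : ℝ} (hp : δ ≤ p.2) (ξ : Euc n) : δ ≤ ‖p - (ξ, 0)‖ := by
  have := norm_snd_le (p - ((ξ, 0) : Euc n × ℝ))
  simp only [Prod.snd_sub, sub_zero] at this
  exact hp.trans ((le_abs_self _).trans this)

lemma Symb.half_bound {d : ℝ} {f : YY n → ℝ} (h : Symb d f) (hd : d ≤ 0) {δ : ℝ} (hδ : 0 < δ) :
    ∃ C : ℝ, 0 ≤ C ∧ ∀ p : Euc n × ℝ, δ ≤ p.2 → ∀ ξ, |sl f 0 (ξ, 0) p| ≤ C := by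
  obtain ⟨C, hC0, hC⟩ := h.sl_bound hd
  refine ⟨C * δ ^ d, by positivity, fun p hp ξ => ?_⟩
  have hp0 : p ∈ upperHS n := lt_of_lt_of_le hδ hp
  refine (hC 0 (ξ, 0) p (half_ne hp0 ξ)).trans (mul_le_mul_of_nonneg_left ?_ hC0)
  unfold rw'
  rw [neg_neg]
  exact Real.rpow_le_rpow_of_nonpos hδ (half_dist hp ξ) hd

lemma Symb.sl_meas2 {d : ℝ} {f : YY n → ℝ} (h : Symb d f) (p : Euc n × ℝ) : Measurable (fun ξ : Euc n => sl f 0 (ξ, 0) p) := by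
  unfold sl
  exact h.meas.comp (by fun_prop)

lemma Symb.half_int {d : ℝ} {f : YY n → ℝ} (h : Symb d f) (hd : d ≤ 0) (hg : Integrable g) {p : Euc n × ℝ} (hp : p ∈ upperHS n) :
    Integrable (fun ξ => g ξ * sl f 0 (ξ, 0) p) := by
  obtain ⟨C, hC0, hC⟩ := h.half_bound hd (show (0:ℝ) < p.2 from hp)
  exact hg.mul_bdd (c := C) (h.sl_meas2 p).aestronglyMeasurable (ae_of_all _ fun ξ => hC p le_rfl ξ)

lemma Dv_pot {d : ℝ} {f : YY n → ℝ} (h : Symb d f) (hd : d ≤ 0) (hgm : Measurable g) (hg : Integrable g)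
    {w : Euc n × ℝ → ℝ} (hw : ContDiff ℝ (⊤ : ℕ∞) w) (hwe : ∀ p ∈ upperHS n, w p = ∫ ξ, g ξ * sl f 0 (ξ, 0) p)
    (v : Euc n × ℝ) : ∀ p ∈ upperHS n, Dv v w p = ∫ ξ, g ξ * sl (Dv ((0, v) : YY n) f) 0 (ξ, 0) p := by
  intro p hp
  have hp0 : 0 < p.2 := hp
  have hl : ∀ t : ℝ, HasDerivAt (fun t : ℝ => p + t • v) v t := by
    intro t
    have := ((hasDerivAt_id t).smul_const v).const_add p
    simpa using this
  have hcont : Continuous fun t : ℝ => (p + t • v).2 := by fun_prop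
  obtain ⟨C, hC0, hC⟩ := (h.Dv ((0, v) : YY n)).half_bound (by linarith) (show 0 < p.2 / 2 by linarith)
  set s : Set ℝ := {t | p.2 / 2 < (p + t • v).2} with hs
  have hsn : s ∈ 𝓝 (0:ℝ) := by
    refine (isOpen_lt continuous_const hcont).mem_nhds ?_
    simp only [Set.mem_setOf_eq, zero_smul, add_zero]; linarith
  have hsh : ∀ t ∈ s, p + t • v ∈ upperHS n := by
    intro t ht
    have h1 : p.2 / 2 < (p + t • v).2 := ht
    show 0 < (p + t • v).2
    linarith
  have key := (hasDerivAt_integral_of_dominated_loc_of_deriv_le (𝕜 := ℝ) (μ := (volume : Measure (Euc n))) (x₀ := 0) (s := s)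
    (F := fun (t : ℝ) ξ => g ξ * sl f 0 (ξ, 0) (p + t • v))
    (F' := fun (t : ℝ) ξ => g ξ * sl (Dv ((0, v) : YY n) f) 0 (ξ, 0) (p + t • v)) (bound := fun ξ => |g ξ| * C) hsn
    (Eventually.of_forall fun t => (hgm.mul (h.sl_meas2 _)).aestronglyMeasurable)
    (by have := h.half_int hd hg hp; simpa using this)
    (hgm.mul ((h.Dv ((0, v) : YY n)).sl_meas2 _)).aestronglyMeasurable
    (ae_of_all _ fun ξ t ht => by
      rw [norm_mul, Real.norm_eq_abs, Real.norm_eq_abs]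
      exact mul_le_mul_of_nonneg_left (hC _ (le_of_lt ht) ξ) (abs_nonneg _))
    (hg.abs.mul_const C)
    (ae_of_all _ fun ξ t ht => by
      have h1 := (hasFDerivAt_sl h (η := 0) (ζ := (ξ, 0)) (Or.inr (half_ne (hsh t ht) ξ))).comp_hasDerivAt t (hl t)
      refine (h1.const_mul (g ξ)).congr_deriv ?_
      simp [sl, Dv])).2
  have h2 : HasDerivAt (fun t : ℝ => w (p + t • v)) (Dv v w p) 0 := by
    have hwd : HasFDerivAt w (fderiv ℝ w (p + (0:ℝ) • v)) (p + (0:ℝ) • v) :=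
      (hw.differentiable (by simp) _).hasFDerivAt
    have := hwd.comp_hasDerivAt (0:ℝ) (hl 0)
    refine this.congr_deriv ?_
    simp [Dv]
  have h3 : (fun t : ℝ => w (p + t • v)) =ᶠ[𝓝 0] fun t => ∫ ξ, g ξ * sl f 0 (ξ, 0) (p + t • v) := by
    filter_upwards [hsn] with t ht
    exact hwe _ (hsh t ht)
  have h4 := (key.congr_of_eventuallyEq h3).unique h2
  rw [← h4]
  simp

lemma Lop_pot {d : ℝ} {f : YY n → ℝ} (h : Symb d f) (hd : d ≤ 0) (hgm : Measurable g) (hg : Integrable g)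
    {w : Euc n × ℝ → ℝ} (hw : ContDiff ℝ (⊤ : ℕ∞) w) (hwe : ∀ p ∈ upperHS n, w p = ∫ ξ, g ξ * sl f 0 (ξ, 0) p) (k : ℕ) :
    ∀ p ∈ upperHS n, (Lop (dX n))^[k] w p = ∫ ξ, g ξ * sl ((Lop (dY n))^[k] f) 0 (ξ, 0) p := by
  induction k with
  | zero => exact hwe
  | succ k ih =>
    intro p hp
    rw [Function.iterate_succ_apply', Function.iterate_succ_apply']
    have hk : (0:ℝ) ≤ k := Nat.cast_nonneg _
    have h0 := h.Lop_iter (dY n) k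
    have hs := Lop_iter_contDiff (e := dX n) hw k
    have h1 : ∀ a, Dv (dX n a) (Dv (dX n a) ((Lop (dX n))^[k] w)) p
        = ∫ ξ, g ξ * sl (Dv (dY n a) (Dv (dY n a) ((Lop (dY n))^[k] f))) 0 (ξ, 0) p := fun a =>
      Dv_pot (h0.Dv _) (by linarith) hgm hg (Dv_contDiff hs) (Dv_pot h0 (by linarith) hgm hg hs ih (dX n a)) (dX n a) p hp
    have hi : ∀ a ∈ Finset.univ, Integrable (fun ξ => g ξ * sl (Dv (dY n a) (Dv (dY n a) ((Lop (dY n))^[k] f))) 0 (ξ, 0) p) :=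
      fun a _ => ((h0.Dv (dY n a)).Dv (dY n a)).half_int (by linarith) hg hp
    unfold Lop
    unfold Lop at h1 hi
    simp only [h1]
    rw [← integral_finsetSum _ hi]
    congr 1; ext ξ
    rw [← Finset.mul_sum]; rfl

lemma Tm_pot (ha0 : 0 < al) (hgm : Measurable g) (hg : Integrable g) {w : Euc n × ℝ → ℝ} (hw : ContDiff ℝ (⊤ : ℕ∞) w)
    (hwe : ∀ p ∈ upperHS n, w p = ∫ ξ, g ξ * kk al ((0, p - (ξ, 0)) : YY n)) (a : Option (Fin n)) :
    ∀ p ∈ upperHS n, Tm m (dX n) a w p = GG al m g a p := by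
  have hs := kk_symb (n := n) al
  have h1 := Lop_pot hs (by linarith) hgm hg hw hwe
  intro p hp
  unfold GG ta tt Tm
  split_ifs with h2 h3
  · exact h1 _ p hp
  · simp [sl]
  · have hk : (0:ℝ) ≤ (m / 2 : ℕ) := Nat.cast_nonneg _
    exact Dv_pot (hs.Lop_iter (dY n) (m / 2)) (by linarith) hgm hg (Lop_iter_contDiff (e := dX n) hw _) (h1 _) (dX n a) p hp

/-- boundary trace of the potential of a bubble -/
lemma trace_lim (ha0 : 0 < al) (hn : 2 * al < n) {μ c : ℝ} {x0 : Euc n} (hμ : 0 < μ) (hw : Continuous u)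
    (hwe : ∀ ζ : Euc n × ℝ, 0 < ζ.2 → u ζ = ∫ ξ, (c * bub μ x0 (n - al) ξ) * kk al ((0, ζ - (ξ, 0)) : YY n)) (x : Euc n) :
    u (x, 0) = c * (μ ^ (-((n:ℝ) - 2 * al)) * Cc n (n - al) * bub μ x0 al x) := by
  have h1 : Tendsto (fun y : ℝ => u (x, y)) (𝓝[>] 0) (𝓝 (u (x, 0))) := by
    have : Continuous fun y : ℝ => u (x, y) := hw.comp (by fun_prop)
    exact (this.tendsto 0).mono_left nhdsWithin_le_nhds
  have e1 : ∀ y : ℝ, 0 < y → u (x, y) = c * (μ ^ (-((n:ℝ) - 2 * al)) * ∫ z : Euc n, (1 + ‖z‖ ^ 2) ^ (-((n:ℝ) - al)) * bub μ x0 al (x + y • z)) := by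
    intro y hy
    rw [hwe (x, y) hy]
    simp only [mul_assoc, kk_bub]
    rw [integral_const_mul, exch_int ha0 hn hμ hy]
    congr 1
    have h2 := integral_affine hy x (fun ξ => bub y x (n - al) ξ * bub μ x0 al ξ)
    rw [eq_inv_mul_iff_mul_eq₀ (by positivity)] at h2
    rw [← h2]
    simp only [bub_scale hy, mul_assoc]
    rw [integral_const_mul, Real.div_rpow hy.le hμ.le, Real.rpow_neg hμ.le, ← mul_assoc (y ^ (n:ℝ)), ← mul_assoc (_ / _), ← Real.rpow_add hy,
      div_mul_eq_mul_div, ← Real.rpow_add hy, show (n:ℝ) - 2 * al + ((n:ℝ) + -(2 * ((n:ℝ) - al))) = 0 by ring, Real.rpow_zero, one_div]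
  have hb : ∀ y, bub μ x0 al y ≤ (μ ^ 2) ^ (-al) := by
    intro y
    unfold bub
    exact Real.rpow_le_rpow_of_nonpos (by positivity) (by nlinarith [sq_nonneg ‖y - x0‖]) (by linarith)
  have h3 : Tendsto (fun y : ℝ => ∫ z : Euc n, (1 + ‖z‖ ^ 2) ^ (-((n:ℝ) - al)) * bub μ x0 al (x + y • z)) (𝓝[>] 0)
      (𝓝 (∫ z : Euc n, (1 + ‖z‖ ^ 2) ^ (-((n:ℝ) - al)) * bub μ x0 al x)) := by
    refine tendsto_integral_filter_of_dominated_convergence (fun z => (1 + ‖z‖ ^ 2) ^ (-((n:ℝ) - al)) * (μ ^ 2) ^ (-al)) ?_ ?_ ?_ ?_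
    · refine Eventually.of_forall fun y => Measurable.aestronglyMeasurable ?_
      have := (bub_cont hμ x0 al).measurable
      fun_prop
    · refine Eventually.of_forall fun y => ae_of_all _ fun z => ?_
      have := bub_pos hμ x0 al (x + y • z)
      rw [Real.norm_of_nonneg (by positivity)]
      exact mul_le_mul_of_nonneg_left (hb _) (by positivity)
    · exact (integrable_bubble n (by linarith)).mul_const _
    · refine ae_of_all _ fun z => ?_
      have hc : Continuous fun y : ℝ => (1 + ‖z‖ ^ 2) ^ (-((n:ℝ) - al)) * bub μ x0 al (x + y • z) :=
        continuous_const.mul ((bub_cont hμ x0 al).comp (by fun_prop))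
      have := (hc.tendsto 0).mono_left (nhdsWithin_le_nhds (s := Set.Ioi 0))
      simpa using this
  rw [integral_mul_const, integral_bubble n (by linarith)] at h3
  have h4 : Tendsto (fun y : ℝ => u (x, y)) (𝓝[>] 0) (𝓝 (c * (μ ^ (-((n:ℝ) - 2 * al)) * (Cc n (n - al) * bub μ x0 al x)))) := by
    refine ((h3.const_mul _).const_mul c).congr' ?_
    filter_upwards [self_mem_nhdsWithin] with y hy
    exact (e1 y hy).symm
  rw [tendsto_nhds_unique h1 h4]; ring

lemma bwd (hmn : 2 * m + 1 < n) (ha : 2 * al = (n:ℝ) - 2 * m - 1) (ha0 : 0 < al) (hu : Good n m u)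
    {μ c : ℝ} {x0 : Euc n} (hμ : 0 < μ)
    (hwe : ∀ ζ : Euc n × ℝ, 0 < ζ.2 → u ζ = ∫ ξ, (c * bub μ x0 (n - al) ξ) * kk al ((0, ζ - (ξ, 0)) : YY n)) :
    kap2 n m al / 2 / S0 n al * (∫ x : Euc n, |u (x, 0)| ^ ((n:ℝ) / al)) ^ (2 * al / n) = EE n m u := by
  have hm0 : (0:ℝ) ≤ m := Nat.cast_nonneg _
  have hn : 2 * al < n := by linarith
  have hn0 : (0:ℝ) < n := by linarith
  have hS := S0_pos ha0 hn
  have hna : (0:ℝ) < n - al := by linarith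
  have hbi := bub_int (n := n) hμ x0 (r := n - al) (by linarith)
  have hbn := bub_int (n := n) hμ x0 (r := n) (by linarith)
  have hgm : Measurable (fun ξ => c * bub μ x0 (n - al) ξ) := ((bub_cont hμ x0 _).const_mul c).measurable
  have hT := fun a => Tm_pot (m := m) ha0 hgm (hbi.1.const_mul c) hu.sm hwe a
  have hbp : ∀ r s ξ, bub μ x0 r ξ ^ s = bub μ x0 (r * s) ξ := by
    intro r s ξ
    unfold bub
    rw [← Real.rpow_mul (by positivity), neg_mul]
  have hgq : Integrable (fun x => |c * bub μ x0 (n - al) x| ^ ((n : ℝ) / (n - al))) := by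
    simp only [abs_mul, abs_of_pos (bub_pos hμ x0 _ _)]
    simp only [Real.mul_rpow (abs_nonneg c) (bub_pos hμ x0 _ _).le, hbp]
    rw [mul_div_cancel₀ _ hna.ne']
    exact hbn.1.const_mul _
  have ct := cross_term ha ha0 hgm hgq hu
  have hEE : EE n m u = kap2 n m al / 2 * ∫ ξ, (c * bub μ x0 (n - al) ξ) * u (ξ, 0) := by
    rw [← ct]
    unfold EE
    rw [integral_finsetSum _ fun a _ => Tm_l2 hu a]
    refine Finset.sum_congr rfl fun a _ => setIntegral_congr_fun (measurableSet_half n) fun p hp => ?_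
    show Tm m (dX n) a u p ^ 2 = _
    rw [← hT a p hp, sq]
  have htr := trace_lim ha0 hn hμ hu.sm.continuous hwe
  set C := Cc n (n - al) with hC
  have hC0 : 0 < C := Cc_pos (by linarith)
  set M := ∫ ξ, bub μ x0 n ξ with hM
  have hD0 : 0 < Cc n n := Cc_pos (by linarith)
  have hM0 : 0 < M := by rw [hbn.2]; positivity
  set k := μ ^ (-((n:ℝ) - 2 * al)) * C with hk
  have hk0 : 0 < k := by positivity
  have e1 : ∫ ξ, (c * bub μ x0 (n - al) ξ) * u (ξ, 0) = c ^ 2 * k * M := by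
    rw [hM, ← integral_const_mul]
    congr 1; ext ξ
    have : bub μ x0 n ξ = bub μ x0 (n - al) ξ * bub μ x0 al ξ := by
      unfold bub
      rw [← Real.rpow_add (by positivity)]; congr 1; ring
    rw [htr, this]; ring
  have e2 : (∫ x : Euc n, |u (x, 0)| ^ ((n:ℝ) / al)) ^ (2 * al / n) = (c * k) ^ 2 * M ^ (2 * al / n) := by
    have : ∀ x, |u (x, 0)| ^ ((n:ℝ) / al) = |c * k| ^ ((n:ℝ) / al) * bub μ x0 n x := by
      intro x
      rw [htr, ← mul_assoc, abs_mul, abs_of_pos (bub_pos hμ x0 _ _), Real.mul_rpow (abs_nonneg _) (bub_pos hμ x0 _ _).le, hbp,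
        mul_div_cancel₀ _ ha0.ne']
    simp only [this]
    rw [integral_const_mul, ← hM, Real.mul_rpow (by positivity) hM0.le, ← Real.rpow_mul (abs_nonneg _),
      show (n:ℝ) / al * (2 * al / n) = ((2:ℕ):ℝ) by push_cast; field_simp, Real.rpow_natCast, sq_abs]
  have e3 : k * M ^ (2 * al / n) = S0 n al * M := by
    have h1 : M ^ (2 * al / n) = M ^ (2 * al / n - 1) * M := by
      rw [← Real.rpow_add_one hM0.ne']; congr 1; ring
    have h2 : M ^ (2 * al / n - 1) = μ ^ ((n:ℝ) - 2 * al) * Cc n n ^ (2 * al / n - 1) := by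
      rw [hbn.2, Real.mul_rpow (by positivity) hD0.le, ← Real.rpow_mul hμ.le]
      congr 2; field_simp; ring
    have h3 : μ ^ (-((n:ℝ) - 2 * al)) * μ ^ ((n:ℝ) - 2 * al) = 1 := by
      rw [← Real.rpow_add hμ]; simp
    rw [h1, h2, hk]
    unfold S0
    rw [← hC]
    linear_combination (C * Cc n n ^ (2 * al / n - 1) * M) * h3
  have e4 : (c * k) ^ 2 * M ^ (2 * al / n) = c ^ 2 * k * (S0 n al * M) := by rw [← e3]; ring
  rw [hEE, e1, e2, e4]
  field_simp
end bwd

section consts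
lemma omegaN_eq {n : ℕ} (hn : 1 ≤ n) : omegaN n = 2 ^ (n:ℝ) * Cc n n := by
  have hn0 : (0:ℝ) < n := by exact_mod_cast hn
  have h := Real.Gamma_mul_Gamma_add_half ((n:ℝ) / 2)
  have g1 : 0 < Gamma ((n:ℝ) / 2) := Real.Gamma_pos_of_pos (by positivity)
  have g2 : 0 < Gamma (((n:ℝ) + 1) / 2) := Real.Gamma_pos_of_pos (by positivity)
  have g3 : 0 < Gamma (n:ℝ) := Real.Gamma_pos_of_pos hn0
  rw [show (n:ℝ) / 2 + 1 / 2 = ((n:ℝ) + 1) / 2 by ring, show 2 * ((n:ℝ) / 2) = n by ring,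
    Real.rpow_sub two_pos, Real.rpow_one] at h
  unfold omegaN Cc
  rw [show (n:ℝ) - n / 2 = n / 2 by ring,
    show π ^ (((n:ℝ) + 1) / 2) = π ^ ((n:ℝ) / 2) * √π by
      rw [Real.sqrt_eq_rpow, ← Real.rpow_add Real.pi_pos]; congr 1; ring]
  have h2 : (0:ℝ) < 2 ^ (n:ℝ) := by positivity
  have hp : (0:ℝ) < π ^ ((n:ℝ) / 2) := by positivity
  generalize Gamma ((n:ℝ) / 2) = G1 at *
  generalize Gamma (((n:ℝ) + 1) / 2) = G2 at *
  generalize Gamma (n:ℝ) = G3 at *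
  generalize (2:ℝ) ^ (n:ℝ) = T at *
  field_simp at h ⊢
  linear_combination -h

lemma const_eq {n m : ℕ} {al : ℝ} (hmn : 2 * m + 1 < n) (ha : 2 * al = (n:ℝ) - 2 * m - 1) (ha0 : 0 < al) :
    (Gamma ((m : ℝ) + 1) * Gamma (1 / 2) / Gamma ((m : ℝ) + 1 / 2)) *
        (Gamma (((n : ℝ) + 2 * m + 1) / 2) / Gamma (((n : ℝ) - 2 * m - 1) / 2)) *
        omegaN n ^ ((2 * (m : ℝ) + 1) / n) = kap2 n m al / 2 / S0 n al := by
  have hn0 : (0:ℝ) < n := by exact_mod_cast (by omega : 0 < n)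
  have hD : 0 < Cc n n := Cc_pos (by linarith)
  rw [kap2_eq ha ha0, omegaN_eq (by omega), Real.mul_rpow (by positivity) hD.le, ← Real.rpow_mul two_pos.le,
    show (n:ℝ) * ((2 * (m:ℝ) + 1) / n) = ((2 * m + 1 : ℕ) : ℝ) by push_cast; field_simp, Real.rpow_natCast,
    Real.Gamma_one_half_eq]
  unfold S0
  rw [show 2 * al / n - 1 = -((2 * (m:ℝ) + 1) / n) by rw [ha]; field_simp; ring, Real.rpow_neg hD.le]
  have hE : 0 < Cc n n ^ ((2 * (m:ℝ) + 1) / n) := by positivity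
  generalize Cc n n ^ ((2 * (m:ℝ) + 1) / n) = E at *
  unfold Cc
  rw [show (n:ℝ) - al - n / 2 = (m:ℝ) + 1 / 2 by linarith, show (n:ℝ) - al = ((n : ℝ) + 2 * m + 1) / 2 by linarith,
    show ((n : ℝ) - 2 * m - 1) / 2 = al by linarith,
    show π ^ (((n:ℝ) + 1) / 2) = π ^ ((n:ℝ) / 2) * √π by
      rw [Real.sqrt_eq_rpow, ← Real.rpow_add Real.pi_pos]; congr 1; ring]
  have g1 : 0 < Gamma ((m:ℝ) + 1 / 2) := Real.Gamma_pos_of_pos (by positivity)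
  have g2 : 0 < Gamma (((n : ℝ) + 2 * m + 1) / 2) := Real.Gamma_pos_of_pos (by positivity)
  have g3 : 0 < Gamma al := Real.Gamma_pos_of_pos ha0
  have hp : (0:ℝ) < π ^ ((n:ℝ) / 2) := by positivity
  have h4 : (4:ℝ) ^ (m + 1) = 2 * 2 ^ (2 * m + 1) := by
    rw [show (4:ℝ) = 2 ^ 2 by norm_num, ← pow_mul]; ring
  rw [h4]
  generalize Gamma ((m:ℝ) + 1 / 2) = G1 at *
  generalize Gamma (((n : ℝ) + 2 * m + 1) / 2) = G2 at *
  generalize Gamma al = G3 at *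
  generalize Gamma ((m:ℝ) + 1) = G4 at *
  generalize (2:ℝ) ^ (2 * m + 1) = T at *
  field_simp
end consts

theorem sharp_sobolev_trace_halfspace
    (n m : ℕ) (hm : 1 ≤ m) (hmn : 2 * m + 1 < n)
    (U : Euc n → ℝ → ℝ)
    (hUsm : ContDiff ℝ (⊤ : ℕ∞) (Function.uncurry U))
    (hUsob : ∀ k ≤ m + 1, IntegrableOn
      (fun p : Euc n × ℝ => ‖iteratedFDeriv ℝ k (Function.uncurry U) p‖ ^ 2) (upperHS n) volume)
    (hbc1 : ∀ k ≤ m / 2, ∀ x : Euc n,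
      lapHIter k U x 0 = (Gamma ((m : ℝ) + 1) * Gamma ((m : ℝ) + 1 / 2 - k) /
          (Gamma ((m : ℝ) - k + 1) * Gamma ((m : ℝ) + 1 / 2))) *
        lapIter k (fun x' => U x' 0) x)
    (hbc2 : ∀ k ≤ (m - 1) / 2, ∀ x : Euc n,
      deriv (fun y => lapHIter k U x y) 0 = 0) :
    (Gamma ((m : ℝ) + 1) * Gamma (1 / 2) / Gamma ((m : ℝ) + 1 / 2)) *
        (Gamma (((n : ℝ) + 2 * m + 1) / 2) / Gamma (((n : ℝ) - 2 * m - 1) / 2)) *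
        omegaN n ^ ((2 * (m : ℝ) + 1) / n) *
        (∫ x : Euc n, |U x 0| ^ (2 * (n : ℝ) / ((n : ℝ) - 2 * m - 1))) ^
          (((n : ℝ) - 2 * m - 1) / n) ≤
      ∫ p in upperHS n, gradPowH m U p.1 p.2 ∧
    ((Gamma ((m : ℝ) + 1) * Gamma (1 / 2) / Gamma ((m : ℝ) + 1 / 2)) *
        (Gamma (((n : ℝ) + 2 * m + 1) / 2) / Gamma (((n : ℝ) - 2 * m - 1) / 2)) *
        omegaN n ^ ((2 * (m : ℝ) + 1) / n) *
        (∫ x : Euc n, |U x 0| ^ (2 * (n : ℝ) / ((n : ℝ) - 2 * m - 1))) ^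
          (((n : ℝ) - 2 * m - 1) / n) =
      ∫ p in upperHS n, gradPowH m U p.1 p.2 ↔
      ∃ (lam : ℝ) (c : ℝ) (ξ₀ : Euc n), 0 < lam ∧
        ∀ (x : Euc n) (y : ℝ), 0 < y →
          U x y = c * ∫ ξ : Euc n,
            y ^ (1 + 2 * m) * (‖x - ξ‖ ^ 2 + y ^ 2) ^ (-(((n : ℝ) + 1) / 2 + m)) *
              (lam ^ 2 + ‖ξ - ξ₀‖ ^ 2) ^ (-(((n : ℝ) - 2 * m - 1) / 2))) := by
  have hmn' : 2 * (m:ℝ) + 1 < n := by exact_mod_cast hmn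
  set al : ℝ := ((n:ℝ) - 2 * m - 1) / 2 with hal
  have ha : 2 * al = (n:ℝ) - 2 * m - 1 := by rw [hal]; ring
  have ha0 : 0 < al := by linarith
  have hn0 : (0:ℝ) < n := by linarith [(Nat.cast_nonneg m : (0:ℝ) ≤ m)]
  have hu : Good n m (Function.uncurry U) := by
    refine good_of_sob hmn hUsm hUsob fun k hk x => ?_
    rw [← deriv_lapHIter hUsm k x 0]
    exact hbc2 k hk x
  have hG : ∫ p in upperHS n, gradPowH m U p.1 p.2 = EE n m (Function.uncurry U) := by
    unfold EE
    congr 1; ext p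
    exact gradPowH_eq hUsm m p.1 p.2
  have hC := const_eq hmn ha ha0
  rw [← hal] at hC
  have hp1 : 2 * (n:ℝ) / ((n:ℝ) - 2 * m - 1) = (n:ℝ) / al := by
    rw [← ha]; field_simp
  rw [hC, hG, hp1, ← ha]
  have hI := ineq_main hmn ha ha0 hu
  refine ⟨hI.2, ?_, ?_⟩
  · intro hE
    obtain ⟨μ, c, x0, hμ, h⟩ := fwd hmn ha ha0 hu hE
    refine ⟨μ, c * (μ ^ ((n:ℝ) - 2 * al))⁻¹, x0, hμ, fun x y hy => ?_⟩
    have h1 := h (x, y) hy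
    have h2 := poisson_form ha ha0 hμ hy x0 x
    rw [← hal] at h2
    rw [h2]
    have hpos : 0 < μ ^ ((n:ℝ) - 2 * al) := by positivity
    simp only [mul_assoc] at h1
    rw [integral_const_mul] at h1
    change U x y = _ at h1
    rw [h1]
    field_simp
  · rintro ⟨μ, c, x0, hμ, h⟩
    refine bwd hmn ha ha0 hu (c := c * μ ^ ((n:ℝ) - 2 * al)) (x0 := x0) hμ ?_
    rintro ⟨x, y⟩ hy
    have h1 := h x y hy
    have h2 := poisson_form ha ha0 hμ hy x0 x
    rw [← hal] at h2
    rw [h2] at h1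
    simp only [mul_assoc]
    rw [integral_const_mul, integral_const_mul]
    exact h1
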